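/- Let 0 < ε < 1/4, T ≥ 1 and s = σ+it. For a primitive Hecke character χ, define the multiset 𝒵_{r,t} = { ρ = β+iγ : L(ρ,χ)=0, |1+it−ρ| < r } of non-trivial zeros. Then, for 0 < r < ε, uniformly in the region 1 < σ ≤ 1+ε, |t| ≤ T: (i) −Re{(L′/L)(s,χ)} ≤ (1/4 + ε/π)·ℒ_χ + 4ε²·ℒ_χ′ + δ(χ)·Re{1/(s−1)} − Σ_{ρ ∈ 𝒵_{r,t}} Re{1/(s−ρ)} + O_ε(n_K); and (ii) −Re{(L′/L)(s,χ)} ≤ (1/4 + ε/π)·ℒ_χ + δ(χ)·Re{1/(s−1)} + O_ε(n_K); where ℒ_χ = log D_χ + n_K log(T+3) and ℒ_χ′ = log D_K + ℒ_χ. -/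

import Mathlib

open scoped BigOperators
open Complex NumberField Filter Topology

noncomputable section

namespace RTZ

/-- The degree `n_K = [K : ℚ]` of a number field. -/
def nK (K : Type*) [Field K] [NumberField K] : ℕ := Module.finrank ℚ K

/-- The absolute value `D_K` of the discriminant of `K`. -/
def DK (K : Type*) [Field K] [NumberField K] : ℕ := (NumberField.discr K).natAbs

/-- An algebraic integer is totally positive if it is positive under every real embedding. -/
def TotPos (K : Type*) [Field K] [NumberField K] (α : 𝓞 K) : Prop :=
  ∀ φ : K →+* ℝ, 0 < φ (algebraMap (𝓞 K) K α)

/-- A Hecke (narrow ray class) character modulo `𝔮`, regarded as a function on integral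
ideals extended by zero: it is completely multiplicative, vanishes on ideals not coprime
to `𝔮`, has modulus one on ideals coprime to `𝔮`, and is trivial on principal ideals
generated by totally positive elements `α ≡ 1 (mod 𝔮)`. -/
structure HeckeChar (K : Type*) [Field K] [NumberField K] (𝔮 : Ideal (𝓞 K)) where
  toFun : Ideal (𝓞 K) → ℂ
  map_mul' : ∀ 𝔞 𝔟 : Ideal (𝓞 K), toFun (𝔞 * 𝔟) = toFun 𝔞 * toFun 𝔟
  eq_zero' : ∀ 𝔞 : Ideal (𝓞 K), ¬ IsCoprime 𝔞 𝔮 → toFun 𝔞 = 0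
  norm_one' : ∀ 𝔞 : Ideal (𝓞 K), IsCoprime 𝔞 𝔮 → ‖toFun 𝔞‖ = 1
  ray_one' : ∀ α : 𝓞 K, TotPos K α → α - 1 ∈ 𝔮 → toFun (Ideal.span {α}) = 1

variable {K : Type*} [Field K] [NumberField K]

/-- The trivial (principal) Hecke character condition. -/
def IsTrivialChar {𝔮 : Ideal (𝓞 K)} (χ : HeckeChar K 𝔮) : Prop :=
  ∀ 𝔞, IsCoprime 𝔞 𝔮 → χ.toFun 𝔞 = 1

open scoped Classical in
/-- `δ(χ)`: the indicator of the trivial character. -/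
def delta {𝔮 : Ideal (𝓞 K)} (χ : HeckeChar K 𝔮) : ℝ :=
  if IsTrivialChar χ then 1 else 0

/-- `χ' (mod 𝔣)` induces `χ (mod 𝔮)`: `𝔣 ∣ 𝔮` and the two characters agree on ideals
coprime to `𝔮`. -/
def Induces {𝔣 𝔮 : Ideal (𝓞 K)} (χ' : HeckeChar K 𝔣) (χ : HeckeChar K 𝔮) : Prop :=
  𝔮 ≤ 𝔣 ∧ ∀ 𝔞, IsCoprime 𝔞 𝔮 → χ.toFun 𝔞 = χ'.toFun 𝔞

/-- `𝔣` is the conductor `𝔣_χ` of `χ`: `χ` is induced from a character mod `𝔣`, and `𝔣`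
divides every modulus from which `χ` is induced. -/
def IsConductor {𝔮 : Ideal (𝓞 K)} (χ : HeckeChar K 𝔮) (𝔣 : Ideal (𝓞 K)) : Prop :=
  (∃ χ' : HeckeChar K 𝔣, Induces χ' χ) ∧
    ∀ 𝔣' : Ideal (𝓞 K), (∃ χ' : HeckeChar K 𝔣', Induces χ' χ) → 𝔣' ≤ 𝔣

/-- A Hecke character is primitive if its conductor equals its modulus. -/
def IsPrimitiveChar {𝔮 : Ideal (𝓞 K)} (χ : HeckeChar K 𝔮) : Prop := IsConductor χ 𝔮

/-- Two integral ideals lie in the same narrow ray class mod `𝔮`: `(α)𝔞 = (β)𝔟` for some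
totally positive `α, β ≡ 1 (mod 𝔮)`. -/
def rayEquiv (𝔮 𝔞 𝔟 : Ideal (𝓞 K)) : Prop :=
  ∃ α β : 𝓞 K, TotPos K α ∧ TotPos K β ∧ α - 1 ∈ 𝔮 ∧ β - 1 ∈ 𝔮 ∧
    Ideal.span {α} * 𝔞 = Ideal.span {β} * 𝔟

/-- A congruence class group `H (mod 𝔮)`: a subgroup of `I(𝔮)` containing `P_𝔮`, described
by the set of integral ideals whose narrow ray class lies in the subgroup. -/
structure CongClassGroup (K : Type*) [Field K] [NumberField K] (𝔮 : Ideal (𝓞 K)) where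
  mem : Ideal (𝓞 K) → Prop
  coprime' : ∀ 𝔞, mem 𝔞 → IsCoprime 𝔞 𝔮
  princ_mem' : ∀ α : 𝓞 K, TotPos K α → α - 1 ∈ 𝔮 → mem (Ideal.span {α})
  mul_mem' : ∀ 𝔞 𝔟, mem 𝔞 → mem 𝔟 → mem (𝔞 * 𝔟)
  class_mem' : ∀ 𝔞 𝔟, IsCoprime 𝔟 𝔮 → rayEquiv 𝔮 𝔞 𝔟 → mem 𝔞 → mem 𝔟

/-- `χ(H) = 1`: the character is trivial on the congruence class group `H`. -/
def CharTrivOn {𝔮 : Ideal (𝓞 K)} (χ : HeckeChar K 𝔮) (H : CongClassGroup K 𝔮) : Prop :=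
  ∀ 𝔞, H.mem 𝔞 → χ.toFun 𝔞 = 1

/-- The coset of `H` in `I(𝔮)` determined by an integral ideal `𝔞₀`. -/
def coset {𝔮 : Ideal (𝓞 K)} (H : CongClassGroup K 𝔮) (𝔞₀ : Ideal (𝓞 K)) :
    Set (Ideal (𝓞 K)) :=
  {𝔞 | ∃ 𝔥, H.mem 𝔥 ∧ rayEquiv 𝔮 (𝔞₀ * 𝔥) 𝔞}

/-- `h_H = [I(𝔮) : H]`, the number of cosets of `H`. -/
def hH {𝔮 : Ideal (𝓞 K)} (H : CongClassGroup K 𝔮) : ℕ :=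
  Nat.card {C : Set (Ideal (𝓞 K)) // ∃ 𝔞₀, IsCoprime 𝔞₀ 𝔮 ∧ C = coset H 𝔞₀}

/-- `Q = Q_H = max { N𝔣_χ : χ (mod 𝔮), χ(H) = 1 }`. -/
def QH {𝔮 : Ideal (𝓞 K)} (H : CongClassGroup K 𝔮) : ℕ :=
  sSup {n | ∃ (χ : HeckeChar K 𝔮) (𝔣 : Ideal (𝓞 K)),
    CharTrivOn χ H ∧ IsConductor χ 𝔣 ∧ n = Ideal.absNorm 𝔣}

/-- `𝔣_H = lcm { 𝔣_χ : χ(H) = 1 }` (the lcm of ideals is their infimum). -/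
def fH {𝔮 : Ideal (𝓞 K)} (H : CongClassGroup K 𝔮) : Ideal (𝓞 K) :=
  sInf {𝔣 | ∃ χ : HeckeChar K 𝔮, CharTrivOn χ H ∧ IsConductor χ 𝔣}

/-- A congruence class group `H (mod 𝔮)` is primitive if `𝔮 = 𝔣_H`. -/
def IsPrimitiveCCG {𝔮 : Ideal (𝓞 K)} (H : CongClassGroup K 𝔮) : Prop := 𝔮 = fH H

/-- The Dirichlet series `Σ_𝔫 χ(𝔫) N𝔫^{-s}` of a Hecke character. -/
def LSer {𝔮 : Ideal (𝓞 K)} (χ : HeckeChar K 𝔮) (s : ℂ) : ℂ :=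
  ∑' 𝔞 : {I : Ideal (𝓞 K) // I ≠ ⊥}, χ.toFun 𝔞.1 * (Ideal.absNorm 𝔞.1 : ℂ) ^ (-s)

/-- `L` is "the" Hecke `L`-function of `χ`: analytic away from `s = 1` and given by the
Dirichlet series on `Re s > 1` (this determines `L` away from `s = 1`). -/
def IsLFun {𝔮 : Ideal (𝓞 K)} (χ : HeckeChar K 𝔮) (L : ℂ → ℂ) : Prop :=
  (∀ s : ℂ, s ≠ 1 → DifferentiableAt ℂ L s) ∧ ∀ s : ℂ, 1 < s.re → L s = LSer χ s

/-- The Dedekind zeta series of `K`. -/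
def zetaSer (K : Type*) [Field K] [NumberField K] (s : ℂ) : ℂ :=
  ∑' 𝔞 : {I : Ideal (𝓞 K) // I ≠ ⊥}, (Ideal.absNorm 𝔞.1 : ℂ) ^ (-s)

/-- `Z` is "the" Dedekind zeta function of `K`. -/
def IsZetaFun (K : Type*) [Field K] [NumberField K] (Z : ℂ → ℂ) : Prop :=
  (∀ s : ℂ, s ≠ 1 → DifferentiableAt ℂ Z s) ∧ ∀ s : ℂ, 1 < s.re → Z s = zetaSer K s

/-- `L` vanishes at `ρ` to order at least `m`. -/
def ZeroOrderAtLeast (L : ℂ → ℂ) (ρ : ℂ) (m : ℕ) : Prop :=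
  ∃ g : ℂ → ℂ, AnalyticAt ℂ g ρ ∧ ∀ᶠ z in nhds ρ, L z = (z - ρ) ^ m * g z

/-- `L` vanishes at `ρ` to order exactly `m`. -/
def ZeroOrderExact (L : ℂ → ℂ) (ρ : ℂ) (m : ℕ) : Prop :=
  ∃ g : ℂ → ℂ, AnalyticAt ℂ g ρ ∧ g ρ ≠ 0 ∧ ∀ᶠ z in nhds ρ, L z = (z - ρ) ^ m * g z

open scoped Classical in
/-- The von Mangoldt function `Λ_K` of the field `K`. -/
def ΛK (K : Type*) [Field K] [NumberField K] (𝔫 : Ideal (𝓞 K)) : ℝ :=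
  if h : ∃ (𝔭 : Ideal (𝓞 K)) (k : ℕ), 𝔭.IsPrime ∧ 𝔭 ≠ ⊥ ∧ 1 ≤ k ∧ 𝔫 = 𝔭 ^ k
  then Real.log (Ideal.absNorm h.choose) else 0

/-- The residue `κ_K` of `ζ_K` at `s = 1`, characterized as a limit of the real Dirichlet
series. -/
def IsResidue (K : Type*) [Field K] [NumberField K] (κ : ℝ) : Prop :=
  Filter.Tendsto (fun σ : ℝ => (σ - 1) *
      ∑' 𝔞 : {I : Ideal (𝓞 K) // I ≠ ⊥}, (Ideal.absNorm 𝔞.1 : ℝ) ^ (-σ))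
    (nhdsWithin 1 (Set.Ioi 1)) (nhds κ)

/-- `γ_K`, the Euler–Kronecker constant: `ζ_K(s) - κ_K/(s-1) → κ_K γ_K` as `s → 1⁺`. -/
def IsEulerKronecker (K : Type*) [Field K] [NumberField K] (κ γK : ℝ) : Prop :=
  Filter.Tendsto (fun σ : ℝ =>
      (∑' 𝔞 : {I : Ideal (𝓞 K) // I ≠ ⊥}, (Ideal.absNorm 𝔞.1 : ℝ) ^ (-σ)) - κ / (σ - 1))
    (nhdsWithin 1 (Set.Ioi 1)) (nhds (κ * γK))

/-- The standard parametrization of `ℤ^ι` inside `ℝ^ι`. -/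
theorem exists_intLattice_equiv (ι : Type*) [Fintype ι] :
    ∃ e : (ι → ℤ) ≃ Submodule.span ℤ (Set.range (Pi.basisFun ℝ ι)),
      ∀ k, ((e k : Submodule.span ℤ (Set.range (Pi.basisFun ℝ ι))) : ι → ℝ) =
        fun i => (k i : ℝ) := by
  classical
  let b := Pi.basisFun ℝ ι
  refine ⟨(b.restrictScalars ℤ).equivFun.symm.toEquiv, fun k => ?_⟩
  have h1 : (b.restrictScalars ℤ).equivFun.symm.toEquiv k =
      ∑ i, k i • (b.restrictScalars ℤ) i := by
    simp [Module.Basis.equivFun_symm_apply]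
  rw [h1]
  ext j
  simp [b, Pi.single_apply]

open MeasureTheory in
/-- An integral over `ℝ^ι` is the sum of the integrals over the integral translates of the unit
box. -/
theorem integral_eq_tsum_int_translate {ι : Type*} [Fintype ι] (g : (ι → ℝ) → ℂ)
    (hg : Integrable g) :
    ∫ x, g x = ∑' k : ι → ℤ, ∫ x in {x : ι → ℝ | ∀ i, x i ∈ Set.Ioc ((0 : ι → ℝ) i)
      ((0 : ι → ℝ) i + 1)}, g (x + fun i => (k i : ℝ)) := by
  let b := Pi.basisFun ℝ ι
  have hfd := ZSpan.isAddFundamentalDomain' b (volume : Measure (ι → ℝ))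
  obtain ⟨e, he⟩ := exists_intLattice_equiv ι
  have hbox : ({x : ι → ℝ | ∀ i, x i ∈ Set.Ioc ((0 : ι → ℝ) i) ((0 : ι → ℝ) i + 1)}
      : Set (ι → ℝ)) =ᵐ[volume] ZSpan.fundamentalDomain b := by
    have h1 : ({x : ι → ℝ | ∀ i, x i ∈ Set.Ioc ((0 : ι → ℝ) i) ((0 : ι → ℝ) i + 1)}
        : Set (ι → ℝ)) = Set.pi Set.univ fun i => Set.Ioc ((0 : ι → ℝ) i) ((1 : ι → ℝ) i) := by
      ext x; simp
    have h2 : ZSpan.fundamentalDomain b =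
        Set.pi Set.univ fun i => Set.Ico ((0 : ι → ℝ) i) ((1 : ι → ℝ) i) := by
      rw [ZSpan.fundamentalDomain_pi_basisFun]; rfl
    rw [h1, h2]
    exact (Measure.univ_pi_Ioc_ae_eq_Icc (μ := fun _ : ι => (volume : Measure ℝ))).trans
      (Measure.univ_pi_Ico_ae_eq_Icc (μ := fun _ : ι => (volume : Measure ℝ))).symm
  have : Countable (Submodule.span ℤ (Set.range b)).toAddSubgroup :=
    e.symm.injective.countable
  have h3 := hfd.integral_eq_tsum'' g hg
  rw [h3]
  refine (e.tsum_eq _).symm.trans ?_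
  refine tsum_congr fun k => ?_
  rw [setIntegral_congr_set hbox]
  refine integral_congr_ae (Eventually.of_forall fun x => ?_)
  change g ((e k : ι → ℝ) + x) = _
  rw [he k, add_comm]

theorem summable_one_add_norm_int (ι : Type*) [Fintype ι] :
    Summable fun k : ι → ℤ => ((1 + ‖fun i => (k i : ℝ)‖) ^ (Fintype.card ι + 1))⁻¹ := by
  classical
  let b := Pi.basisFun ℝ ι
  obtain ⟨e, he⟩ := exists_intLattice_equiv ι
  have hrank : Module.finrank ℤ (Submodule.span ℤ (Set.range b)) = Fintype.card ι :=
    Module.finrank_eq_card_basis (b.restrictScalars ℤ)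
  have h1 := ZLattice.summable_norm_pow_inv (L := Submodule.span ℤ (Set.range b))
    (Fintype.card ι + 1) (by rw [hrank]; omega)
  have h2 := e.summable_iff.mpr h1
  rw [← Finset.summable_compl_iff ({0} : Finset (ι → ℤ))] at h2 ⊢
  refine Summable.of_nonneg_of_le (fun k => by positivity) (fun k => ?_) h2
  have hk : (k : ι → ℤ) ≠ 0 := by simpa using! k.2
  have h4 : (e (k : ι → ℤ)) ≠ 0 := by
    intro h; apply hk
    have : e (0 : ι → ℤ) = 0 := by
      apply Subtype.ext; rw [he]; ext; simp
    exact e.injective (h.trans this.symm)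
  simp only [Function.comp_apply, inv_pow]
  have h5 : 0 < ‖e (k : ι → ℤ)‖ := norm_pos_iff.mpr h4
  have h6 : ‖e (k : ι → ℤ)‖ = ‖fun i => ((k : ι → ℤ) i : ℝ)‖ := by
    rw [← he]; rfl
  rw [← h6]
  gcongr
  linarith

open MeasureTheory in
/-- **Poisson summation** on `ℝ^ι`. -/
theorem poisson_pi {ι : Type*} [Fintype ι] (F : (ι → ℝ) → ℂ) (hc : Continuous F) (C : ℝ)
    (hC : ∀ y, ‖F y‖ * (1 + ‖y‖) ^ (Fintype.card ι + 1) ≤ C)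
    (hs : Summable fun m : ι → ℤ => ∫ y, F y * cexp (-(2 * Real.pi * I * ∑ i, (m i : ℂ) * (y i : ℂ)))) :
    Summable (fun k : ι → ℤ => F fun i => (k i : ℝ)) ∧
    ∑' k : ι → ℤ, F (fun i => (k i : ℝ)) =
      ∑' m : ι → ℤ, ∫ y, F y * cexp (-(2 * Real.pi * I * ∑ i, (m i : ℂ) * (y i : ℂ))) := by
  have hC0 : 0 ≤ C := le_trans (by positivity) (hC 0)
  set N := Fintype.card ι + 1 with hN
  have hb : ∀ (R : ℝ) (x : ι → ℝ), ‖x‖ ≤ R → ∀ k : ι → ℤ, ‖F (x + fun i => (k i : ℝ))‖ ≤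
      C * (1 + R) ^ N * ((1 + ‖fun i => (k i : ℝ)‖) ^ N)⁻¹ := by
    intro R x hx k
    have hR : 0 ≤ R := (norm_nonneg x).trans hx
    set v : ι → ℝ := fun i => (k i : ℝ) with hv
    have h1 := hC (x + v)
    have h2 : 1 + ‖v‖ ≤ (1 + R) * (1 + ‖x + v‖) := by
      have : ‖v‖ ≤ ‖x + v‖ + ‖x‖ := by
        calc ‖v‖ = ‖(x + v) - x‖ := by congr 1; abel
          _ ≤ _ := norm_sub_le _ _
      nlinarith [norm_nonneg (x + v), norm_nonneg x]
    have h3 : (1 + ‖v‖) ^ N ≤ (1 + R) ^ N * (1 + ‖x + v‖) ^ N := by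
      rw [← mul_pow]; gcongr
    rw [← div_eq_mul_inv, le_div_iff₀ (by positivity)]
    calc ‖F (x + v)‖ * (1 + ‖v‖) ^ N ≤ ‖F (x + v)‖ * ((1 + R) ^ N * (1 + ‖x + v‖) ^ N) := by gcongr
      _ = (1 + R) ^ N * (‖F (x + v)‖ * (1 + ‖x + v‖) ^ N) := by ring
      _ ≤ (1 + R) ^ N * C := by gcongr
      _ = _ := by ring
  have hsum : ∀ R : ℝ, Summable fun k : ι → ℤ =>
      C * (1 + R) ^ N * ((1 + ‖fun i => (k i : ℝ)‖) ^ N)⁻¹ :=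
    fun R => (summable_one_add_norm_int ι).mul_left _
  let P : (ι → ℝ) → ℂ := fun x => ∑' k : ι → ℤ, F (x + fun i => (k i : ℝ))
  have hPc : Continuous P := by
    rw [continuous_iff_continuousAt]
    intro x
    have h1 : ContinuousOn P (Metric.ball 0 (‖x‖ + 1)) := by
      refine continuousOn_tsum (fun k => ?_) (hsum (‖x‖ + 1)) fun k y hy => hb _ y ?_ k
      · exact (hc.comp (by fun_prop)).continuousOn
      · simpa using (Metric.mem_ball.mp hy).le
    exact h1.continuousAt (Metric.isOpen_ball.mem_nhds (by simp))
  have hPper : ∀ x (m : ι → ℤ), P (x + fun i => (m i : ℝ)) = P x := by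
    intro x m
    simp only [P]
    rw [← (Equiv.addLeft m).tsum_eq (fun k : ι → ℤ => F (x + fun i => (k i : ℝ)))]
    refine tsum_congr fun k => ?_
    congr 1
    ext i
    simp [add_assoc]
  let q : (ι → ℝ) → UnitAddTorus ι := fun x i => (x i : UnitAddCircle)
  have hq : IsOpenQuotientMap q :=
    IsOpenQuotientMap.piMap (f := fun _ : ι => ((↑) : ℝ → UnitAddCircle))
      fun _ => QuotientAddGroup.isOpenQuotientMap_mk
  have hPq : ∀ x y, q x = q y → P x = P y := by
    intro x y hxy
    have h1 : ∀ i, ∃ m : ℤ, y i = x i + m := by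
      intro i
      have h2 : ((x i : ℝ) : UnitAddCircle) = (y i : ℝ) := congrFun hxy i
      rw [eq_comm, QuotientAddGroup.eq] at h2
      obtain ⟨m, hm⟩ := AddSubgroup.mem_zmultiples_iff.mp h2
      refine ⟨-m, ?_⟩
      simp at hm
      push_cast; linarith
    choose m hm using h1
    rw [← hPper x m]
    congr 1
    ext i; simp [hm]
  let Q : C(UnitAddTorus ι, ℂ) := ⟨fun z => P (Function.surjInv hq.surjective z), by
    rw [hq.isQuotientMap.continuous_iff]
    convert hPc using 1
    ext x
    exact hPq _ _ (Function.surjInv_eq hq.surjective _)⟩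
  have hQ : ∀ x, Q (q x) = P x := fun x => hPq _ _ (Function.surjInv_eq hq.surjective _)
  have hmf : ∀ (m : ι → ℤ) (x : ι → ℝ), UnitAddTorus.mFourier (-m) (q x) =
      cexp (-(2 * Real.pi * I * ∑ i, (m i : ℂ) * (x i : ℂ))) := by
    intro m x
    simp only [UnitAddTorus.mFourier, ContinuousMap.coe_mk, q, fourier_coe_apply, Finset.mul_sum,
      ← Finset.sum_neg_distrib, Complex.exp_sum]
    refine Finset.prod_congr rfl fun i _ => ?_
    congr 1
    simp; ring
  have hFint : Integrable F := by
    have h1 := integrable_one_add_norm (E := ι → ℝ) (μ := volume) (r := (N : ℝ)) (by simp [hN])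
    refine (h1.const_mul C).mono' hc.aestronglyMeasurable (Eventually.of_forall fun x => ?_)
    rw [Real.rpow_neg (by positivity), Real.rpow_natCast, ← div_eq_mul_inv,
      le_div_iff₀ (by positivity)]
    exact hC x
  have hexpint : ∀ m : ι → ℤ, Integrable fun y =>
      F y * cexp (-(2 * Real.pi * I * ∑ i, (m i : ℂ) * (y i : ℂ))) := by
    intro m
    refine hFint.mono (by fun_prop) (Eventually.of_forall fun x => ?_)
    rw [norm_mul, ← hmf]
    have h2 := (UnitAddTorus.mFourier (-m)).norm_coe_le_norm (q x)
    rw [UnitAddTorus.mFourier_norm] at h2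
    nlinarith [norm_nonneg (F x)]
  have hcoef : ∀ m : ι → ℤ, UnitAddTorus.mFourierCoeff Q m =
      ∫ y, F y * cexp (-(2 * Real.pi * I * ∑ i, (m i : ℂ) * (y i : ℂ))) := by
    intro m
    rw [UnitAddTorus.mFourierCoeff_eq_integral _ m 0, integral_eq_tsum_int_translate _ (hexpint m)]
    set B : Set (ι → ℝ) := {x | ∀ i, x i ∈ Set.Ioc ((0 : ι → ℝ) i) ((0 : ι → ℝ) i + 1)} with hB
    have hBm : MeasurableSet B := MeasurableSet.univ_pi' fun i => measurableSet_Ioc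
    have hBn : ∀ x ∈ B, ‖x‖ ≤ 1 := by
      intro x hx
      rw [pi_norm_le_iff_of_nonneg zero_le_one]
      intro i
      have := hx i
      simp only [Pi.zero_apply, zero_add, Set.mem_Ioc] at this
      rw [Real.norm_eq_abs, abs_le]; constructor <;> linarith
    have hBfin : volume B < ⊤ := by
      refine (measure_mono (fun x hx => ?_)).trans_lt
        (measure_closedBall_lt_top (x := (0 : ι → ℝ)) (r := 1))
      simpa using hBn x hx
    have hshift : ∀ (k : ι → ℤ) (x : ι → ℝ),
        cexp (-(2 * Real.pi * I * ∑ i, (m i : ℂ) * ((x + fun i => (k i : ℝ)) i : ℝ))) =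
          cexp (-(2 * Real.pi * I * ∑ i, (m i : ℂ) * (x i : ℂ))) := by
      intro k x
      rw [← hmf, ← hmf]
      congr 1
      ext i
      simp [q]
    have hnorm1 : ∀ x : ι → ℝ, ‖cexp (-(2 * Real.pi * I * ∑ i, (m i : ℂ) * (x i : ℂ)))‖ ≤ 1 := by
      intro x
      rw [← hmf]
      exact ((UnitAddTorus.mFourier (-m)).norm_coe_le_norm _).trans_eq UnitAddTorus.mFourier_norm
    have h5 := hasSum_integral_of_summable_integral_norm (μ := volume.restrict B)
      (F := fun (k : ι → ℤ) x => F (x + fun i => (k i : ℝ)) *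
        cexp (-(2 * Real.pi * I * ∑ i, (m i : ℂ) * ((x + fun i => (k i : ℝ)) i : ℝ))))
      (fun k => ((hexpint m).comp_add_right fun i => (k i : ℝ)).integrableOn) ?_
    · rw [h5.tsum_eq]
      refine setIntegral_congr_fun hBm fun x hx => ?_
      change UnitAddTorus.mFourier (-m) (q x) • Q (q x) = _
      rw [hQ, hmf, smul_eq_mul]
      simp only [hshift, P]
      rw [tsum_mul_right, mul_comm]
    · refine Summable.of_nonneg_of_le (fun k => integral_nonneg fun x => norm_nonneg _)
        (fun k => ?_) ((hsum 1).mul_right (volume.real B))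
      refine (le_abs_self _).trans ?_
      rw [← Real.norm_eq_abs]
      refine norm_setIntegral_le_of_norm_le_const hBfin fun x hx => ?_
      rw [norm_norm, norm_mul, hshift]
      refine (mul_le_of_le_one_right (norm_nonneg _) (hnorm1 x)).trans (hb 1 x (hBn x hx) k)
  have h6 := UnitAddTorus.hasSum_mFourier_series_apply_of_summable (f := Q)
    (by rw [funext hcoef]; exact hs) (q 0)
  rw [hQ] at h6
  have hq0 : ∀ m : ι → ℤ, UnitAddTorus.mFourier m (q 0) = 1 := by
    intro m
    have := hmf (-m) 0
    simpa using this
  simp only [hcoef, hq0, smul_eq_mul, mul_one] at h6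
  have hP0 : P 0 = ∑' k : ι → ℤ, F (fun i => (k i : ℝ)) := by simp [P]
  refine ⟨?_, by rw [h6.tsum_eq, hP0]⟩
  refine Summable.of_norm_bounded (hsum 0) fun k => ?_
  simpa using hb 0 0 (by simp) k

/-- The Gaussian at a real place, multiplied by the coordinate when `b` is true. -/
def gre (b : Bool) (t : ℝ) : ℂ := (if b then (t : ℂ) else 1) * cexp (-(Real.pi : ℂ) * (t : ℂ) ^ 2)

/-- The Gaussian at a complex place. -/
def gco (z : ℂ) : ℂ := cexp (-(2 * Real.pi : ℂ) * (‖z‖ : ℂ) ^ 2)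

lemma integrable_gre (b : Bool) : MeasureTheory.Integrable (gre b) := by
  cases b
  · have := integrable_cexp_neg_mul_sq (b := (Real.pi : ℂ)) (by simpa using Real.pi_pos)
    refine this.congr (Filter.Eventually.of_forall fun t => ?_)
    simp [gre]
  · have := integrable_mul_cexp_neg_mul_sq (b := (Real.pi : ℂ)) (by simpa using Real.pi_pos)
    refine this.congr (Filter.Eventually.of_forall fun t => ?_)
    simp [gre]

lemma continuous_gre (b : Bool) : Continuous (gre b) := by
  cases b <;> · unfold gre; simp only [if_true, Bool.false_eq_true, if_false]; fun_prop

lemma continuous_gco : Continuous gco := by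
  unfold gco; fun_prop

lemma norm_gre_false (t : ℝ) : ‖gre false t‖ = Real.exp (-Real.pi * t ^ 2) := by
  simp only [gre, Bool.false_eq_true, if_false, one_mul]
  rw [show (-(Real.pi : ℂ) * (t : ℂ) ^ 2) = ((-Real.pi * t ^ 2 : ℝ) : ℂ) by push_cast; ring]
  rw [Complex.norm_exp_ofReal]

lemma norm_gre_le (b : Bool) (t : ℝ) : ‖gre b t‖ ≤ Real.exp (-t ^ 2) := by
  have h3 := Real.pi_gt_three
  cases b
  · rw [norm_gre_false]
    apply Real.exp_le_exp.2
    nlinarith [sq_nonneg t]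
  · have : gre true t = (t : ℂ) * gre false t := by simp [gre]
    rw [this, norm_mul, norm_gre_false, Complex.norm_real, Real.norm_eq_abs]
    have h1 : |t| ≤ Real.exp (t ^ 2) := by
      have := Real.add_one_le_exp (t ^ 2)
      rw [← sq_abs] at this
      rw [← sq_abs]
      nlinarith [sq_nonneg (|t| - 1), abs_nonneg t]
    calc |t| * Real.exp (-Real.pi * t ^ 2) ≤ Real.exp (t ^ 2) * Real.exp (-Real.pi * t ^ 2) := by
          gcongr
      _ = Real.exp (t ^ 2 + -Real.pi * t ^ 2) := (Real.exp_add _ _).symm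
      _ ≤ _ := Real.exp_le_exp.2 (by nlinarith [sq_nonneg t])

lemma norm_gco (z : ℂ) : ‖gco z‖ = Real.exp (-(2 * Real.pi) * ‖z‖ ^ 2) := by
  rw [gco, show (-(2 * Real.pi : ℂ) * (‖z‖ : ℂ) ^ 2) = ((-(2 * Real.pi) * ‖z‖ ^ 2 : ℝ) : ℂ) by
    push_cast; ring, Complex.norm_exp_ofReal]

lemma norm_gco_le (z : ℂ) : ‖gco z‖ ≤ Real.exp (-‖z‖ ^ 2) := by
  have h3 := Real.pi_gt_three
  rw [norm_gco]
  apply Real.exp_le_exp.2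
  nlinarith [sq_nonneg ‖z‖]

lemma integral_gre_false (ξ : ℝ) :
    ∫ t : ℝ, gre false t * cexp (-(2 * Real.pi * I * (ξ * t : ℂ))) = gre false ξ := by
  have h := fourierIntegral_gaussian (b := (Real.pi : ℂ)) (by simpa using Real.pi_pos)
    (-(2 * Real.pi * ξ : ℂ))
  have hpi : (Real.pi : ℂ) ≠ 0 := by exact_mod_cast Real.pi_ne_zero
  rw [div_self hpi, one_cpow, one_mul] at h
  simp only [gre, Bool.false_eq_true, if_false, one_mul]
  convert h using 1
  · congr 1; ext t
    rw [mul_comm]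
    congr 2; ring
  · congr 1; field_simp; ring

lemma integral_gre_true (ξ : ℝ) :
    ∫ t : ℝ, gre true t * cexp (-(2 * Real.pi * I * (ξ * t : ℂ))) = -I * gre true ξ := by
  have hpi : (Real.pi : ℂ) ≠ 0 := by exact_mod_cast Real.pi_ne_zero
  have hd : ∀ t : ℝ, HasDerivAt
      (fun t : ℝ => gre false t * cexp (-(2 * Real.pi * I * (ξ * t : ℂ))))
      (-(2 * Real.pi) * (gre true t * cexp (-(2 * Real.pi * I * (ξ * t : ℂ)))) +
        -(2 * Real.pi * I * ξ) * (gre false t * cexp (-(2 * Real.pi * I * (ξ * t : ℂ))))) t := by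
    intro t
    have h1 : HasDerivAt (fun t : ℝ => (t : ℂ)) 1 t := Complex.ofRealCLM.hasDerivAt
    have h2 := (((h1.pow 2).const_mul (-(Real.pi : ℂ))).cexp).mul
      ((((h1.const_mul (ξ : ℂ)).const_mul (2 * Real.pi * I : ℂ)).neg).cexp)
    simp only [gre, if_true, Bool.false_eq_true, if_false, one_mul]
    refine HasDerivAt.congr_deriv (f := fun t : ℝ => cexp (-(Real.pi : ℂ) * (t : ℂ) ^ 2) *
      cexp (-(2 * Real.pi * I * (ξ * t : ℂ)))) h2 ?_
    simp only [Pi.pow_apply, Pi.neg_apply]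
    push_cast
    ring
  have hintg : ∀ b : Bool, MeasureTheory.Integrable
      (fun t : ℝ => gre b t * cexp (-(2 * Real.pi * I * (ξ * t : ℂ)))) := by
    intro b
    refine (integrable_gre b).mono ?_ ?_
    · refine ((continuous_gre b).mul ?_).aestronglyMeasurable
      fun_prop
    · refine Filter.Eventually.of_forall fun t => ?_
      rw [norm_mul, Complex.norm_exp]
      simp
  have h0 := MeasureTheory.integral_eq_zero_of_hasDerivAt_of_integrable hd
    (((hintg true).const_mul _).add ((hintg false).const_mul _)) (hintg false)
  rw [MeasureTheory.integral_add ((hintg true).const_mul _) ((hintg false).const_mul _),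
    MeasureTheory.integral_const_mul, MeasureTheory.integral_const_mul, integral_gre_false] at h0
  have h5 : gre true ξ = ξ * gre false ξ := by simp [gre]
  rw [h5]
  have h6 : (-(2 * Real.pi : ℂ)) ≠ 0 := by simp [hpi]
  refine mul_left_cancel₀ h6 ?_
  linear_combination h0

lemma integral_gre (b : Bool) (ξ : ℝ) :
    ∫ t : ℝ, gre b t * cexp (-(2 * Real.pi * I * (ξ * t : ℂ))) =
      (if b then -I else 1) * gre b ξ := by
  cases b
  · simpa using integral_gre_false ξ
  · simpa using integral_gre_true ξ

lemma integral_gco (ξ : ℂ) :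
    ∫ z : ℂ, gco z * cexp (-(2 * Real.pi * I * ((2 * (ξ * z).re : ℝ) : ℂ))) = (1 / 2) * gco ξ := by
  have hpi : (Real.pi : ℂ) ≠ 0 := by exact_mod_cast Real.pi_ne_zero
  have h := GaussianFourier.integral_cexp_neg_mul_sq_norm_add (V := ℂ) (b := (2 * Real.pi : ℂ))
    (by simp [Real.pi_pos]) (-(4 * Real.pi * I : ℂ)) ((starRingEnd ℂ) ξ)
  simp only [Complex.finrank_real_complex] at h
  have e1 : (2 * Real.pi : ℂ) ≠ 0 := by simp [hpi]
  have e2 : ((Real.pi : ℂ) / (2 * Real.pi)) ^ (((2 : ℕ) : ℂ) / 2) = 1 / 2 := by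
    rw [show (((2 : ℕ) : ℂ) / 2) = 1 by norm_num, cpow_one]
    field_simp
  rw [e2] at h
  convert h using 1
  · congr 1; ext z
    rw [gco, ← Complex.exp_add]
    congr 1
    have : (inner ℝ ((starRingEnd ℂ) ξ) z : ℝ) = (ξ * z).re := by
      rw [Complex.inner]; simp [mul_comm]
    rw [this]; push_cast; ring
  · rw [gco]
    congr 2
    rw [Complex.norm_conj]
    have : (I : ℂ) ^ 2 = -1 := I_sq
    field_simp
    linear_combination (-4 * (‖ξ‖ : ℂ) ^ 2) * this

/-- Product functions on `ℝ^ι × ℂ^κ`. -/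
def pf {ι κ : Type*} [Fintype ι] [Fintype κ] (f : ι → ℝ → ℂ) (g : κ → ℂ → ℂ)
    (v : (ι → ℝ) × (κ → ℂ)) : ℂ :=
  (∏ w, f w (v.1 w)) * ∏ w, g w (v.2 w)

section Pf

variable {ι κ : Type*} [Fintype ι] [Fintype κ]

lemma integrable_pf {f : ι → ℝ → ℂ} {g : κ → ℂ → ℂ}
    (hf : ∀ w, MeasureTheory.Integrable (f w)) (hg : ∀ w, MeasureTheory.Integrable (g w)) :
    MeasureTheory.Integrable (pf f g) := by
  have h1 : MeasureTheory.Integrable (fun a : ι → ℝ => ∏ w, f w (a w)) :=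
    MeasureTheory.Integrable.fintype_prod hf
  have h2 : MeasureTheory.Integrable (fun a : κ → ℂ => ∏ w, g w (a w)) :=
    MeasureTheory.Integrable.fintype_prod hg
  exact h1.mul_prod h2

lemma integral_pf (f : ι → ℝ → ℂ) (g : κ → ℂ → ℂ) :
    ∫ v, pf f g v = (∏ w, ∫ t, f w t) * ∏ w, ∫ z, g w z := by
  rw [← MeasureTheory.integral_fintype_prod_volume_eq_prod,
    ← MeasureTheory.integral_fintype_prod_volume_eq_prod]
  exact MeasureTheory.integral_prod_mul (μ := MeasureTheory.volume) (ν := MeasureTheory.volume)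
    (fun a : ι → ℝ => ∏ w, f w (a w)) (fun b : κ → ℂ => ∏ w, g w (b w))

/-- The Gaussian test function with parity `p`. -/
def gfn (p : ι → Bool) : (ι → ℝ) × (κ → ℂ) → ℂ := pf (fun w => gre (p w)) (fun _ => gco)

/-- The trace form. -/
def trf (v : (ι → ℝ) × (κ → ℂ)) : ℝ := (∑ w, v.1 w) + ∑ w, 2 * (v.2 w).re

lemma continuous_gfn (p : ι → Bool) : Continuous (gfn p : (ι → ℝ) × (κ → ℂ) → ℂ) := by
  unfold gfn pf
  refine Continuous.mul (continuous_finsetProd _ fun w _ => (continuous_gre _).comp (by fun_prop))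
    (continuous_finsetProd _ fun w _ => continuous_gco.comp (by fun_prop))

lemma integral_gfn_mul (p : ι → Bool) (ξ : (ι → ℝ) × (κ → ℂ)) :
    ∫ v, gfn p v * cexp (-(2 * Real.pi * I * (trf (ξ * v) : ℂ))) =
      (∏ w, (if p w then -I else 1)) * (1 / 2) ^ Fintype.card κ * gfn p ξ := by
  have h := integral_pf
    (fun w (t : ℝ) => gre (p w) t * cexp (-(2 * Real.pi * I * (ξ.1 w * t : ℂ))))
    (fun w (z : ℂ) => gco z * cexp (-(2 * Real.pi * I * ((2 * (ξ.2 w * z).re : ℝ) : ℂ))))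
  simp_rw [integral_gre, integral_gco] at h
  rw [Finset.prod_mul_distrib, Finset.prod_mul_distrib, Finset.prod_const] at h
  have e : ∀ v, pf (fun w (t : ℝ) => gre (p w) t * cexp (-(2 * Real.pi * I * (ξ.1 w * t : ℂ))))
    (fun w (z : ℂ) => gco z * cexp (-(2 * Real.pi * I * ((2 * (ξ.2 w * z).re : ℝ) : ℂ)))) v =
    gfn p v * cexp (-(2 * Real.pi * I * (trf (ξ * v) : ℂ))) := by
    intro v
    simp only [pf, gfn, Finset.prod_mul_distrib, ← Complex.exp_sum]
    rw [show (-(2 * Real.pi * I * (trf (ξ * v) : ℂ))) =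
      (∑ w, -(2 * Real.pi * I * (ξ.1 w * v.1 w : ℂ))) +
      ∑ w, -(2 * Real.pi * I * ((2 * (ξ.2 w * v.2 w).re : ℝ) : ℂ)) by
        simp only [trf, Prod.fst_mul, Prod.snd_mul, Pi.mul_apply, Finset.sum_neg_distrib,
          ← Finset.mul_sum]
        push_cast [← Finset.mul_sum]
        ring, Complex.exp_add]
    ring
  simp_rw [e] at h
  rw [h]
  simp only [gfn, pf, Finset.card_univ]
  ring

lemma norm_gfn_le (p : ι → Bool) (v : (ι → ℝ) × (κ → ℂ)) :
    ‖gfn p v‖ ≤ Real.exp (-‖v‖ ^ 2) := by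
  have h1 : ‖gfn p v‖ ≤ Real.exp (-((∑ w, ‖v.1 w‖ ^ 2) + ∑ w, ‖v.2 w‖ ^ 2)) := by
    simp only [gfn, pf, norm_mul, norm_prod]
    rw [neg_add, Real.exp_add, ← Finset.sum_neg_distrib, ← Finset.sum_neg_distrib, Real.exp_sum,
      Real.exp_sum]
    gcongr with w _ w _
    · simpa using norm_gre_le (p w) (v.1 w)
    · exact norm_gco_le _
  refine h1.trans (Real.exp_le_exp.2 (neg_le_neg ?_))
  have h2 : 0 ≤ (∑ w, ‖v.1 w‖ ^ 2) := Finset.sum_nonneg fun _ _ => by positivity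
  have h3 : 0 ≤ (∑ w, ‖v.2 w‖ ^ 2) := Finset.sum_nonneg fun _ _ => by positivity
  have h4 : ‖v‖ ≤ √((∑ w, ‖v.1 w‖ ^ 2) + ∑ w, ‖v.2 w‖ ^ 2) := by
    rw [Prod.norm_def, sup_le_iff, pi_norm_le_iff_of_nonneg (Real.sqrt_nonneg _),
      pi_norm_le_iff_of_nonneg (Real.sqrt_nonneg _)]
    constructor
    · intro i
      refine Real.le_sqrt_of_sq_le ?_
      have := Finset.single_le_sum (f := fun w => ‖v.1 w‖ ^ 2) (fun _ _ => by positivity)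
        (Finset.mem_univ i)
      linarith
    · intro i
      refine Real.le_sqrt_of_sq_le ?_
      have := Finset.single_le_sum (f := fun w => ‖v.2 w‖ ^ 2) (fun _ _ => by positivity)
        (Finset.mem_univ i)
      linarith
  calc ‖v‖ ^ 2 ≤ √((∑ w, ‖v.1 w‖ ^ 2) + ∑ w, ‖v.2 w‖ ^ 2) ^ 2 := by gcongr
    _ = _ := Real.sq_sqrt (by positivity)

end Pf

section Mixed

open scoped Classical
open NumberField.InfinitePlace NumberField.mixedEmbedding

variable (K : Type*) [Field K] [NumberField K]

/-- A choice of parity at every real place. -/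
abbrev Par := {w : InfinitePlace K // w.IsReal} → Bool

variable {K}

/-- The trace form on the mixed space. -/
def mtr (v : mixedSpace K) : ℝ := trf v

lemma mtr_mixedEmbedding (x : K) : mtr (mixedEmbedding K x) = (Algebra.trace ℚ K x : ℝ) := by
  have h := trace_eq_sum_embeddings (K := ℚ) (L := K) ℂ (x := x)
  have h2 : (∑ σ : K →ₐ[ℚ] ℂ, σ x) = ∑ φ : K →+* ℂ, φ x :=
    Fintype.sum_equiv (RingHom.equivRatAlgHom (R := K) (S := ℂ)).symm _ _ (fun σ => rfl)
  rw [h2] at h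
  rw [← Finset.sum_fiberwise (s := Finset.univ) (g := fun φ : K →+* ℂ => InfinitePlace.mk φ)] at h
  have h3 : ∀ w : InfinitePlace K, (∑ φ : K →+* ℂ with InfinitePlace.mk φ = w, φ x) =
      if w.IsReal then w.embedding x else ((2 * (w.embedding x).re : ℝ) : ℂ) := by
    intro w
    split_ifs with hw
    · have : (Finset.univ.filter fun φ : K →+* ℂ => InfinitePlace.mk φ = w) = {w.embedding} := by
        ext φ
        simp only [Finset.mem_filter, Finset.mem_univ, true_and, Finset.mem_singleton]
        constructor
        · intro h
          subst h
          exact (embedding_mk_eq_of_isReal (isReal_mk_iff.1 hw) ).symm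
        · rintro rfl; exact mk_embedding w
      rw [this, Finset.sum_singleton]
    · have hne : w.embedding ≠ ComplexEmbedding.conjugate w.embedding := by
        intro h
        exact hw (isReal_iff.2 (ComplexEmbedding.isReal_iff.2 h.symm))
      have : (Finset.univ.filter fun φ : K →+* ℂ => InfinitePlace.mk φ = w) =
          {w.embedding, ComplexEmbedding.conjugate w.embedding} := by
        ext φ
        simp only [Finset.mem_filter, Finset.mem_univ, true_and, Finset.mem_singleton,
          Finset.mem_insert]
        conv_lhs => rw [← mk_embedding w, mk_eq_iff]
        constructor
        · rintro (h | h)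
          · exact Or.inl h
          · right; rw [← h]; ext; simp
        · rintro (h | h)
          · exact Or.inl h
          · right; rw [h]; ext; simp
      rw [this, Finset.sum_pair hne, ComplexEmbedding.conjugate_coe_eq, Complex.add_conj]
  simp_rw [h3] at h
  rw [Finset.sum_ite] at h
  have h4 : ((mtr (mixedEmbedding K x) : ℝ) : ℂ) = (Algebra.trace ℚ K x : ℂ) := by
    rw [show (Algebra.trace ℚ K x : ℂ) = algebraMap ℚ ℂ (Algebra.trace ℚ K x) from rfl, h]
    simp only [mtr, trf, mixedEmbedding_apply_isReal, mixedEmbedding_apply_isComplex]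
    push_cast
    congr 1
    · rw [← Finset.sum_subtype_eq_sum_filter]
      simp only [Finset.subtype_univ]
      refine Finset.sum_congr rfl fun w _ => ?_
      exact embedding_of_isReal_apply w.2 x
    · rw [← Finset.sum_subtype_eq_sum_filter]
      simp only [Finset.subtype_univ]
      refine Fintype.sum_equiv (Equiv.subtypeEquivRight fun w => not_isReal_iff_isComplex.symm) _ _
        fun w => rfl
  exact_mod_cast h4

end Mixed

section Basis

open MeasureTheory

variable {E ι : Type*} [NormedAddCommGroup E] [NormedSpace ℝ E] [MeasurableSpace E] [BorelSpace E]
  [Fintype ι]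

lemma map_equivFun_symm_volume (μ : Measure E) [μ.IsAddHaarMeasure] (b : Module.Basis ι ℝ E) :
    (volume : Measure (ι → ℝ)).map b.equivFun.symm =
      (μ (ZSpan.fundamentalDomain b))⁻¹ • μ := by
  classical
  have hfd : FiniteDimensional ℝ E := Module.Finite.of_basis b
  let e : (ι → ℝ) ≃L[ℝ] E := b.equivFun.symm.toContinuousLinearEquiv
  have he : ⇑b.equivFun.symm = ⇑e := rfl
  rw [he]
  have hH : (Measure.map e (volume : Measure (ι → ℝ))).IsAddHaarMeasure :=
    e.isAddHaarMeasure_map _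
  have hu := Measure.isAddLeftInvariant_eq_smul (Measure.map e (volume : Measure (ι → ℝ))) μ
  set c := Measure.addHaarScalarFactor (Measure.map e (volume : Measure (ι → ℝ))) μ
  have hF : MeasurableSet (ZSpan.fundamentalDomain b) := ZSpan.fundamentalDomain_measurableSet b
  have h1 : Measure.map e (volume : Measure (ι → ℝ)) (ZSpan.fundamentalDomain b) = 1 := by
    rw [Measure.map_apply e.continuous.measurable hF]
    have : e ⁻¹' (ZSpan.fundamentalDomain b) = Set.pi Set.univ fun _ => Set.Ico (0 : ℝ) 1 := by
      ext y
      simp only [Set.mem_preimage, ZSpan.mem_fundamentalDomain, Set.mem_pi, Set.mem_univ,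
        true_implies]
      refine forall_congr' fun i => ?_
      have : (b.repr (e y)) i = y i := by
        rw [← he, ← Module.Basis.equivFun_apply, LinearEquiv.apply_symm_apply]
      rw [this]
    rw [this, Real.volume_pi_Ico]
    simp
  rw [hu] at h1 ⊢
  have h2 : (c : ENNReal) * μ (ZSpan.fundamentalDomain b) = 1 := by
    rw [Measure.smul_apply, ENNReal.smul_def, smul_eq_mul] at h1
    exact h1
  have h3 : (c : ENNReal) = (μ (ZSpan.fundamentalDomain b))⁻¹ :=
    ENNReal.eq_inv_of_mul_eq_one_left h2
  rw [← h3]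
  rfl

lemma integral_comp_equivFun_symm (μ : Measure E) [μ.IsAddHaarMeasure] (b : Module.Basis ι ℝ E)
    (Φ : E → ℂ) :
    ∫ y : ι → ℝ, Φ (b.equivFun.symm y) =
      ((μ.real (ZSpan.fundamentalDomain b))⁻¹ : ℝ) * ∫ v, Φ v ∂μ := by
  have hfd : FiniteDimensional ℝ E := Module.Finite.of_basis b
  let e : (ι → ℝ) ≃L[ℝ] E := b.equivFun.symm.toContinuousLinearEquiv
  have he : ⇑b.equivFun.symm = ⇑e := rfl
  have h := map_equivFun_symm_volume μ b
  rw [he] at h ⊢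
  have h2 : ∫ y : ι → ℝ, Φ (e y) = ∫ v, Φ v ∂(volume.map e) :=
    (e.toHomeomorph.measurableEmbedding.integral_map (g := Φ)).symm
  rw [h2, h, integral_smul_measure, ENNReal.toReal_inv, Complex.real_smul]
  rfl

end Basis

section Scale

open MeasureTheory

variable {ι κ : Type*} [Fintype ι] [Fintype κ]

lemma isAddHaar_volume : (volume : Measure ((ι → ℝ) × (κ → ℂ))).IsAddHaarMeasure :=
  Measure.prod.instIsAddHaarMeasure _ _

/-- The norm form on `ℝ^ι × ℂ^κ`. -/
def nrm (x : (ι → ℝ) × (κ → ℂ)) : ℝ := (∏ w, |x.1 w|) * ∏ w, ‖x.2 w‖ ^ 2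

lemma nrm_mul (x y : (ι → ℝ) × (κ → ℂ)) : nrm (x * y) = nrm x * nrm y := by
  simp only [nrm, Prod.fst_mul, Prod.snd_mul, Pi.mul_apply, abs_mul, norm_mul, mul_pow,
    Finset.prod_mul_distrib]
  ring

lemma nrm_inv (x : (ι → ℝ) × (κ → ℂ)) : nrm x⁻¹ = (nrm x)⁻¹ := by
  simp only [nrm, Prod.fst_inv, Prod.snd_inv, Pi.inv_apply, abs_inv, norm_inv, inv_pow,
    Finset.prod_inv_distrib, mul_inv]

lemma nrm_nonneg (x : (ι → ℝ) × (κ → ℂ)) : 0 ≤ nrm x := by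
  unfold nrm; positivity

lemma nrm_ne_zero_iff (x : (ι → ℝ) × (κ → ℂ)) :
    nrm x ≠ 0 ↔ (∀ w, x.1 w ≠ 0) ∧ ∀ w, x.2 w ≠ 0 := by
  simp [nrm, Finset.prod_ne_zero_iff]

lemma continuous_nrm : Continuous (nrm : (ι → ℝ) × (κ → ℂ) → ℝ) := by
  unfold nrm
  fun_prop

lemma mul_inv_of_nrm {x : (ι → ℝ) × (κ → ℂ)} (hx : nrm x ≠ 0) : x * x⁻¹ = 1 := by
  rw [nrm_ne_zero_iff] at hx
  ext w
  · simp [hx.1 w]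
  · simp [hx.2 w]

lemma det_mulLeft (x : (ι → ℝ) × (κ → ℂ)) :
    |LinearMap.det (LinearMap.mulLeft ℝ x)| = nrm x := by
  have h : LinearMap.mulLeft ℝ x = LinearMap.prodMap
      (LinearMap.pi fun i => (LinearMap.mulLeft ℝ (x.1 i)).comp (LinearMap.proj i))
      (LinearMap.pi fun i => (LinearMap.mulLeft ℝ (x.2 i)).comp (LinearMap.proj i)) := by
    ext <;> simp
  rw [h, LinearMap.det_prodMap, LinearMap.det_pi, LinearMap.det_pi, abs_mul, nrm,
    Finset.abs_prod, Finset.abs_prod]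
  congr 1
  · refine Finset.prod_congr rfl fun i _ => ?_
    have : LinearMap.det (LinearMap.mulLeft ℝ (x.1 i)) = Algebra.norm ℝ (x.1 i) := rfl
    rw [this, Algebra.norm_self]
    rfl
  · refine Finset.prod_congr rfl fun i _ => ?_
    have : LinearMap.det (LinearMap.mulLeft ℝ (x.2 i)) = Algebra.norm ℝ (x.2 i) := rfl
    rw [this, Algebra.norm_complex_apply, Complex.normSq_eq_norm_sq, abs_of_nonneg (by positivity)]

lemma map_mul_volume {x : (ι → ℝ) × (κ → ℂ)} (hx : nrm x ≠ 0) :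
    (volume : Measure ((ι → ℝ) × (κ → ℂ))).map (fun v => x * v) =
      ENNReal.ofReal (nrm x)⁻¹ • volume := by
  have hh := isAddHaar_volume (ι := ι) (κ := κ)
  have hd : LinearMap.det (LinearMap.mulLeft ℝ x) ≠ 0 := by
    rw [← det_mulLeft] at hx
    simpa using hx
  have := Measure.map_linearMap_addHaar_eq_smul_addHaar
    (volume : Measure ((ι → ℝ) × (κ → ℂ))) hd
  rw [abs_inv, det_mulLeft] at this
  exact this

/-- Multiplication by an invertible vector as a homeomorphism. -/
def mulHomeo (x : (ι → ℝ) × (κ → ℂ)) (hx : nrm x ≠ 0) :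
    ((ι → ℝ) × (κ → ℂ)) ≃ₜ ((ι → ℝ) × (κ → ℂ)) where
  toFun v := x * v
  invFun v := x⁻¹ * v
  left_inv v := by
    simp only
    rw [← mul_assoc, mul_comm x⁻¹, mul_inv_of_nrm hx, one_mul]
  right_inv v := by
    simp only
    rw [← mul_assoc, mul_inv_of_nrm hx, one_mul]
  continuous_toFun := by fun_prop
  continuous_invFun := by fun_prop

lemma integral_comp_mul {x : (ι → ℝ) × (κ → ℂ)} (hx : nrm x ≠ 0)
    (Φ : (ι → ℝ) × (κ → ℂ) → ℂ) :
    ∫ v, Φ (x * v) = ((nrm x)⁻¹ : ℝ) * ∫ v, Φ v := by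
  have h2 : ∫ v, Φ (mulHomeo x hx v) = ∫ v, Φ v ∂(volume.map (mulHomeo x hx)) :=
    ((mulHomeo x hx).measurableEmbedding.integral_map (g := Φ)).symm
  have h3 := map_mul_volume hx
  change ∫ v, Φ (mulHomeo x hx v) = _
  rw [h2, show (mulHomeo x hx : _ → _) = fun v => x * v from rfl, h3, integral_smul_measure,
    ENNReal.toReal_ofReal (inv_nonneg.2 (nrm_nonneg x)), Complex.real_smul]

lemma lintegral_comp_mul {x : (ι → ℝ) × (κ → ℂ)} (hx : nrm x ≠ 0)
    (Φ : (ι → ℝ) × (κ → ℂ) → ENNReal) :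
    ∫⁻ v, Φ (x * v) = ENNReal.ofReal (nrm x)⁻¹ * ∫⁻ v, Φ v := by
  have h2 : ∫⁻ v, Φ (mulHomeo x hx v) = ∫⁻ v, Φ v ∂(volume.map (mulHomeo x hx)) :=
    ((mulHomeo x hx).measurableEmbedding.lintegral_map Φ).symm
  change ∫⁻ v, Φ (mulHomeo x hx v) = _
  rw [h2, show (mulHomeo x hx : _ → _) = fun v => x * v from rfl, map_mul_volume hx,
    lintegral_smul_measure, smul_eq_mul]

end Scale

section LatticePoisson

open MeasureTheory

variable {ι κ : Type*} [Fintype ι] [Fintype κ]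

lemma exists_exp_neg_sq_mul_pow_le (n : ℕ) :
    ∃ C : ℝ, 0 < C ∧ ∀ t : ℝ, 0 ≤ t → Real.exp (-t ^ 2) * (1 + t) ^ n ≤ C := by
  refine ⟨n.factorial * Real.exp 2, by positivity, fun t ht => ?_⟩
  have h1 := Real.pow_div_factorial_le_exp (1 + t) (by positivity) n
  rw [div_le_iff₀ (by positivity)] at h1
  calc Real.exp (-t ^ 2) * (1 + t) ^ n ≤ Real.exp (-t ^ 2) * (Real.exp (1 + t) * n.factorial) := by
        gcongr
    _ = n.factorial * Real.exp (-t ^ 2 + (1 + t)) := by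
        rw [Real.exp_add (-t ^ 2) (1 + t)]; ring
    _ ≤ _ := by
        gcongr
        nlinarith [sq_nonneg (t - 1 / 2)]

lemma exists_norm_gfn_mul_pow_le (p : ι → Bool) {A : ℝ} (hA : 0 < A) (n : ℕ) :
    ∃ C : ℝ, 0 < C ∧ ∀ (v : (ι → ℝ) × (κ → ℂ)) (t : ℝ), 0 ≤ t → 1 + t ≤ A * (1 + ‖v‖) →
      ‖gfn p v‖ * (1 + t) ^ n ≤ C := by
  obtain ⟨C, hC, h⟩ := exists_exp_neg_sq_mul_pow_le n
  refine ⟨C * A ^ n, by positivity, fun v t ht hv => ?_⟩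
  calc ‖gfn p v‖ * (1 + t) ^ n ≤ Real.exp (-‖v‖ ^ 2) * (A * (1 + ‖v‖)) ^ n := by
        gcongr
        exact norm_gfn_le p v
    _ = (Real.exp (-‖v‖ ^ 2) * (1 + ‖v‖) ^ n) * A ^ n := by rw [mul_pow]; ring
    _ ≤ _ := by
        gcongr
        exact h _ (norm_nonneg _)

lemma summable_gfn_of_norm_le {J : Type*} [Fintype J] (p : ι → Bool)
    (v : (J → ℤ) → (ι → ℝ) × (κ → ℂ)) {A : ℝ} (hA : 0 < A)
    (h : ∀ m, 1 + ‖fun i => (m i : ℝ)‖ ≤ A * (1 + ‖v m‖)) :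
    Summable fun m => gfn p (v m) := by
  obtain ⟨C, hC, hb⟩ := exists_norm_gfn_mul_pow_le (κ := κ) p hA (Fintype.card J + 1)
  refine Summable.of_norm_bounded ((summable_one_add_norm_int J).mul_left C) fun m => ?_
  have := hb (v m) _ (norm_nonneg _) (h m)
  rw [← div_eq_mul_inv, le_div_iff₀ (by positivity)]
  exact this

lemma trf_add (v w : (ι → ℝ) × (κ → ℂ)) : trf (v + w) = trf v + trf w := by
  simp only [trf, Prod.fst_add, Prod.snd_add, Pi.add_apply, Complex.add_re, mul_add,
    Finset.sum_add_distrib]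
  ring

lemma trf_smul (c : ℝ) (v : (ι → ℝ) × (κ → ℂ)) : trf (c • v) = c * trf v := by
  simp only [trf, Prod.smul_fst, Prod.smul_snd, Pi.smul_apply, smul_eq_mul, mul_add,
    Finset.mul_sum, Complex.smul_re]
  congr 1
  exact Finset.sum_congr rfl fun _ _ => by ring

/-- The trace form as a linear map. -/
def trL : (ι → ℝ) × (κ → ℂ) →ₗ[ℝ] ℝ where
  toFun := trf
  map_add' := trf_add
  map_smul' := trf_smul

lemma abs_trf_le (v : (ι → ℝ) × (κ → ℂ)) :
    |trf v| ≤ (Fintype.card ι + 2 * Fintype.card κ) * ‖v‖ := by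
  have h1 : ∀ i, |v.1 i| ≤ ‖v‖ := fun i =>
    (norm_le_pi_norm v.1 i).trans (norm_fst_le v)
  have h2 : ∀ i, |2 * (v.2 i).re| ≤ 2 * ‖v‖ := fun i => by
    rw [abs_mul, abs_two]
    have := (Complex.abs_re_le_norm (v.2 i)).trans ((norm_le_pi_norm v.2 i).trans (norm_snd_le v))
    linarith
  calc |trf v| ≤ (∑ i, |v.1 i|) + ∑ i, |2 * (v.2 i).re| := by
        refine (abs_add_le _ _).trans (add_le_add (Finset.abs_sum_le_sum_abs _ _)
          (Finset.abs_sum_le_sum_abs _ _))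
    _ ≤ (∑ _i : ι, ‖v‖) + ∑ _i : κ, 2 * ‖v‖ := by
        gcongr with i _ i _
        · exact h1 i
        · exact h2 i
    _ = _ := by simp; ring

variable {J : Type*} [Fintype J]

/-- The constant in the Fourier transform of the Gaussian test functions. -/
def gfc (κ : Type*) [Fintype κ] (p : ι → Bool) : ℂ :=
  (∏ w, (if p w then -I else 1)) * (1 / 2) ^ Fintype.card κ

lemma integral_gfn_lattice (b : Module.Basis J ℝ ((ι → ℝ) × (κ → ℂ))) (p : ι → Bool)
    {x : (ι → ℝ) × (κ → ℂ)} (hx : nrm x ≠ 0) (a ξ : (ι → ℝ) × (κ → ℂ)) (m : J → ℤ)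
    (hξ : ∀ i, trf (ξ * b i) = m i) :
    ∫ y : J → ℝ, gfn p (x * (a + b.equivFun.symm y)) *
        cexp (-(2 * Real.pi * I * ∑ i, (m i : ℂ) * (y i : ℂ))) =
      ((volume.real (ZSpan.fundamentalDomain b))⁻¹ : ℝ) * ((nrm x)⁻¹ : ℝ) *
        (gfc κ p * gfn p (ξ * x⁻¹)) * cexp (2 * Real.pi * I * (trf (ξ * a) : ℂ)) := by
  have hh := isAddHaar_volume (ι := ι) (κ := κ)
  have e1 : ∀ y : J → ℝ, (∑ i, (m i : ℂ) * (y i : ℂ)) = (trf (ξ * b.equivFun.symm y) : ℂ) := by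
    intro y
    have : trL (ξ * b.equivFun.symm y) = ∑ i, (m i : ℝ) * y i := by
      rw [Module.Basis.equivFun_symm_apply, Finset.mul_sum, map_sum]
      refine Finset.sum_congr rfl fun i _ => ?_
      rw [mul_smul_comm, map_smul, smul_eq_mul, mul_comm]
      congr 1
      exact hξ i
    change _ = ((trL (ξ * b.equivFun.symm y) : ℝ) : ℂ)
    rw [this]
    push_cast
    rfl
  simp_rw [e1]
  rw [integral_comp_equivFun_symm volume b (fun v => gfn p (x * (a + v)) *
    cexp (-(2 * Real.pi * I * (trf (ξ * v) : ℂ))))]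
  have e2 : ∫ v, gfn p (x * (a + v)) * cexp (-(2 * Real.pi * I * (trf (ξ * v) : ℂ))) =
      ∫ v, (gfn p (x * v) * cexp (-(2 * Real.pi * I * (trf (ξ * v) : ℂ)))) *
        cexp (2 * Real.pi * I * (trf (ξ * a) : ℂ)) := by
    refine Eq.trans ?_ (integral_add_left_eq_self (μ := volume) (fun v =>
      (gfn p (x * v) * cexp (-(2 * Real.pi * I * (trf (ξ * v) : ℂ)))) *
        cexp (2 * Real.pi * I * (trf (ξ * a) : ℂ))) a)
    refine integral_congr_ae (Eventually.of_forall fun v => ?_)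
    simp only
    rw [mul_assoc (gfn p (x * (a + v))), ← Complex.exp_add, mul_add ξ a v, trf_add]
    congr 2
    push_cast
    ring
  have e3 : ∀ v, gfn p (x * v) * cexp (-(2 * Real.pi * I * (trf (ξ * v) : ℂ))) =
      (fun u => gfn p u * cexp (-(2 * Real.pi * I * (trf ((ξ * x⁻¹) * u) : ℂ)))) (x * v) := by
    intro v
    have : ξ * x⁻¹ * (x * v) = ξ * v := by
      rw [show ξ * x⁻¹ * (x * v) = ξ * (x * x⁻¹) * v by ring, mul_inv_of_nrm hx, mul_one]
    simp only [this]
  rw [e2, integral_mul_const]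
  rw [funext e3, integral_comp_mul hx (fun u => gfn p u *
    cexp (-(2 * Real.pi * I * (trf (ξ * x⁻¹ * u) : ℂ)))), integral_gfn_mul, gfc]
  ring

theorem poisson_lattice (b : Module.Basis J ℝ ((ι → ℝ) × (κ → ℂ))) (p : ι → Bool)
    {x : (ι → ℝ) × (κ → ℂ)} (hx : nrm x ≠ 0) (a : (ι → ℝ) × (κ → ℂ))
    (ξ : (J → ℤ) → (ι → ℝ) × (κ → ℂ)) (hξ : ∀ m i, trf (ξ m * b i) = m i) :
    (Summable fun k : J → ℤ => gfn p (x * (a + ∑ i, (k i : ℝ) • b i))) ∧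
    (Summable fun m : J → ℤ => gfn p (ξ m * x⁻¹)) ∧
    ∑' k : J → ℤ, gfn p (x * (a + ∑ i, (k i : ℝ) • b i)) =
      gfc κ p * ((volume.real (ZSpan.fundamentalDomain b))⁻¹ : ℝ) * ((nrm x)⁻¹ : ℝ) *
      ∑' m, cexp (2 * Real.pi * I * (trf (ξ m * a) : ℂ)) * gfn p (ξ m * x⁻¹) := by
  have hsum : Summable fun m : J → ℤ => gfn p (ξ m * x⁻¹) := by
    set A : ℝ := 1 + ∑ i, (Fintype.card ι + 2 * Fintype.card κ) * (‖x‖ * ‖b i‖)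
    have hA : 1 ≤ A := le_add_of_nonneg_right (Finset.sum_nonneg fun _ _ => by positivity)
    refine summable_gfn_of_norm_le p _ (A := A) (by linarith) fun m => ?_
    have h1 : ‖fun i => (m i : ℝ)‖ ≤ (A - 1) * ‖ξ m * x⁻¹‖ := by
      rw [pi_norm_le_iff_of_nonneg (mul_nonneg (by linarith) (norm_nonneg _))]
      intro i
      rw [← hξ m i, Real.norm_eq_abs]
      have e : ξ m * b i = (ξ m * x⁻¹) * (x * b i) := by
        rw [show (ξ m * x⁻¹) * (x * b i) = ξ m * (x * x⁻¹) * b i by ring, mul_inv_of_nrm hx,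
          mul_one]
      have h2 : ‖ξ m * b i‖ ≤ ‖ξ m * x⁻¹‖ * (‖x‖ * ‖b i‖) := by
        rw [e]
        refine (norm_mul_le _ _).trans ?_
        gcongr
        exact norm_mul_le _ _
      calc |trf (ξ m * b i)| ≤ (Fintype.card ι + 2 * Fintype.card κ) * ‖ξ m * b i‖ := abs_trf_le _
        _ ≤ (Fintype.card ι + 2 * Fintype.card κ) * (‖ξ m * x⁻¹‖ * (‖x‖ * ‖b i‖)) := by gcongr
        _ = ((Fintype.card ι + 2 * Fintype.card κ) * (‖x‖ * ‖b i‖)) * ‖ξ m * x⁻¹‖ := by ring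
        _ ≤ _ := by
          gcongr
          have := Finset.single_le_sum
            (f := fun i => ((Fintype.card ι : ℝ) + 2 * Fintype.card κ) * (‖x‖ * ‖b i‖))
            (fun _ _ => by positivity) (Finset.mem_univ i)
          simpa [A] using this
    nlinarith [norm_nonneg (ξ m * x⁻¹)]
  set F : (J → ℝ) → ℂ := fun y => gfn p (x * (a + b.equivFun.symm y)) with hF
  have hFT : ∀ m : J → ℤ, ∫ y : J → ℝ, F y *
        cexp (-(2 * Real.pi * I * ∑ i, (m i : ℂ) * (y i : ℂ))) =
      (gfc κ p * ((volume.real (ZSpan.fundamentalDomain b))⁻¹ : ℝ) * ((nrm x)⁻¹ : ℝ)) *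
        (cexp (2 * Real.pi * I * (trf (ξ m * a) : ℂ)) * gfn p (ξ m * x⁻¹)) := by
    intro m
    rw [hF, integral_gfn_lattice b p hx a (ξ m) m (hξ m)]
    ring
  have hfd : FiniteDimensional ℝ ((ι → ℝ) × (κ → ℂ)) := Module.Finite.of_basis b
  have hcont : Continuous F := by
    have : Continuous b.equivFun.symm :=
      (b.equivFun.symm.toContinuousLinearEquiv (𝕜 := ℝ)).continuous
    exact (continuous_gfn p).comp (continuous_const.mul (continuous_const.add this))
  have hsum2 : Summable fun m : J → ℤ => cexp (2 * Real.pi * I * (trf (ξ m * a) : ℂ)) *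
      gfn p (ξ m * x⁻¹) := by
    refine Summable.of_norm_bounded hsum.norm fun m => ?_
    rw [norm_mul, Complex.norm_exp]
    simp
  have hdec : ∃ C : ℝ, ∀ y, ‖F y‖ * (1 + ‖y‖) ^ (Fintype.card J + 1) ≤ C := by
    let e : ((ι → ℝ) × (κ → ℂ)) ≃L[ℝ] (J → ℝ) := b.equivFun.toContinuousLinearEquiv
    set B := ‖(e : ((ι → ℝ) × (κ → ℂ)) →L[ℝ] (J → ℝ))‖
    have hB : 0 ≤ B := norm_nonneg _
    have hle : ∀ v, ‖b.equivFun v‖ ≤ B * ‖v‖ := fun v =>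
      (e : ((ι → ℝ) × (κ → ℂ)) →L[ℝ] (J → ℝ)).le_opNorm v
    obtain ⟨C, -, hC⟩ := exists_norm_gfn_mul_pow_le (κ := κ) p
      (A := 1 + B * (‖x⁻¹‖ + ‖a‖)) (by positivity) (Fintype.card J + 1)
    refine ⟨C, fun y => hC _ _ (norm_nonneg _) ?_⟩
    have h1 := hle (b.equivFun.symm y)
    rw [LinearEquiv.apply_symm_apply] at h1
    have h2 : b.equivFun.symm y = x⁻¹ * (x * (a + b.equivFun.symm y)) - a := by
      rw [← mul_assoc, mul_comm x⁻¹, mul_inv_of_nrm hx, one_mul, add_sub_cancel_left]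
    set u := x * (a + b.equivFun.symm y)
    have h3 : ‖b.equivFun.symm y‖ ≤ ‖x⁻¹‖ * ‖u‖ + ‖a‖ := by
      rw [h2]
      exact (norm_sub_le _ _).trans (by gcongr; exact norm_mul_le _ _)
    have h4 : ‖y‖ ≤ B * (‖x⁻¹‖ * ‖u‖ + ‖a‖) := h1.trans (by gcongr)
    have h5 : 0 ≤ B * ‖a‖ * ‖u‖ := by positivity
    have h6 : 0 ≤ B * ‖x⁻¹‖ := by positivity
    nlinarith [norm_nonneg u]
  obtain ⟨C, hC⟩ := hdec
  have hs : Summable fun m : J → ℤ => ∫ y : J → ℝ, F y *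
        cexp (-(2 * Real.pi * I * ∑ i, (m i : ℂ) * (y i : ℂ))) := by
    simp_rw [hFT]
    exact hsum2.mul_left _
  obtain ⟨h1, h2⟩ := poisson_pi F hcont C hC hs
  have e1 : ∀ k : J → ℤ, (F fun i => (k i : ℝ)) = gfn p (x * (a + ∑ i, (k i : ℝ) • b i)) := by
    intro k
    rw [hF]
    simp only [Module.Basis.equivFun_symm_apply]
  simp_rw [e1, hFT] at h1 h2
  rw [tsum_mul_left] at h2
  exact ⟨h1, hsum, h2⟩

end LatticePoisson

section Unfolding

open MeasureTheory

variable {ι κ : Type*} [Fintype ι] [Fintype κ]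

lemma ae_nrm_ne_zero : ∀ᵐ v : (ι → ℝ) × (κ → ℂ), nrm v ≠ 0 := by
  have h1 : ∀ w : ι, ∀ᵐ v : (ι → ℝ) × (κ → ℂ), v.1 w ≠ 0 := fun w =>
    Measure.quasiMeasurePreserving_fst.ae (Measure.ae_eval_ne _ w 0)
  have h2 : ∀ w : κ, ∀ᵐ v : (ι → ℝ) × (κ → ℂ), v.2 w ≠ 0 := fun w =>
    Measure.quasiMeasurePreserving_snd.ae (Measure.ae_eval_ne _ w 0)
  filter_upwards [eventually_countable_forall.2 h1, eventually_countable_forall.2 h2] with v a b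
  rw [nrm_ne_zero_iff]
  exact ⟨a, b⟩

lemma integrable_comp_mul {x : (ι → ℝ) × (κ → ℂ)} (hx : nrm x ≠ 0)
    {Φ : (ι → ℝ) × (κ → ℂ) → ℂ} (hΦ : Integrable Φ) : Integrable fun v => Φ (x * v) := by
  have h := (mulHomeo x hx).measurableEmbedding.integrable_map_iff (μ := volume) (g := Φ)
  refine h.1 ?_
  have e : volume.map (mulHomeo x hx) = volume.map (fun v => x * v) := rfl
  rw [e, map_mul_volume hx]
  exact hΦ.smul_measure ENNReal.ofReal_ne_top

/-- A fundamental weight for the action of a group `Γ` of norm-one elements. -/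
structure FundWeight (Γ : Type*) [Group Γ] (e : Γ →* (ι → ℝ) × (κ → ℂ))
    (R : (ι → ℝ) × (κ → ℂ) → ℝ) : Prop where
  nrm_one : ∀ u, nrm (e u) = 1
  meas : Measurable R
  nonneg : ∀ x, 0 ≤ R x
  le_one : ∀ x, R x ≤ 1
  sum_one : ∀ x, nrm x ≠ 0 → HasSum (fun u => R (e u * x)) 1
  scale : ∀ (c : ℝ) x, 0 < c → R (c • x) = R x
  fin : IntegrableOn R {x | nrm x ≤ 1}

variable {Γ : Type*} [Group Γ] {e : Γ →* (ι → ℝ) × (κ → ℂ)}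
  {R : (ι → ℝ) × (κ → ℂ) → ℝ}

namespace FundWeight

lemma integrable_mul (h : FundWeight Γ e R) (a : (ι → ℝ) × (κ → ℂ)) {Φ : (ι → ℝ) × (κ → ℂ) → ℂ}
    (hΦ : Integrable Φ) : Integrable fun x => (R (a * x) : ℂ) * Φ x := by
  refine hΦ.bdd_mul (c := 1) ?_ (Eventually.of_forall fun x => ?_)
  · exact (Complex.measurable_ofReal.comp
      (h.meas.comp (continuous_const.mul continuous_id).measurable)).aestronglyMeasurable
  · rw [Complex.norm_real, Real.norm_eq_abs, abs_of_nonneg (h.nonneg _)]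
    exact h.le_one _

lemma nrm_ne (h : FundWeight Γ e R) (u : Γ) : nrm (e u) ≠ 0 := by rw [h.nrm_one]; exact one_ne_zero

lemma unfold_eq (_h : FundWeight Γ e R) (u : Γ) (Φ : (ι → ℝ) × (κ → ℂ) → ℂ) :
    (fun x => (R x : ℂ) * Φ (e u * x)) =
      fun x => (fun y => (R (e u⁻¹ * y) : ℂ) * Φ y) (e u * x) := by
  ext x
  simp only [← mul_assoc, ← map_mul, inv_mul_cancel, map_one, one_mul]

lemma integrable_unfold (h : FundWeight Γ e R) (u : Γ) {Φ : (ι → ℝ) × (κ → ℂ) → ℂ}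
    (hΦ : Integrable Φ) : Integrable fun x => (R x : ℂ) * Φ (e u * x) := by
  rw [h.unfold_eq]
  exact integrable_comp_mul (h.nrm_ne u) (h.integrable_mul _ hΦ)

variable [Countable Γ]

lemma hasSum_unfold (h : FundWeight Γ e R) {Φ : (ι → ℝ) × (κ → ℂ) → ℂ} (hΦ : Integrable Φ) :
    HasSum (fun u => ∫ x, (R x : ℂ) * Φ (e u * x)) (∫ x, Φ x) := by
  have e1 : ∀ u, ∫ x, (R x : ℂ) * Φ (e u * x) = ∫ y, (R (e u⁻¹ * y) : ℂ) * Φ y := by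
    intro u
    rw [h.unfold_eq, integral_comp_mul (h.nrm_ne u) (fun y => (R (e u⁻¹ * y) : ℂ) * Φ y),
      h.nrm_one]
    simp
  simp_rw [e1]
  have hs : ∀ y, nrm y ≠ 0 → HasSum (fun u : Γ => R (e u⁻¹ * y)) 1 := fun y hy =>
    (Equiv.inv Γ).hasSum_iff.2 (h.sum_one y hy)
  refine hasSum_integral_of_dominated_convergence (fun u y => R (e u⁻¹ * y) * ‖Φ y‖)
    (fun u => (h.integrable_mul _ hΦ).aestronglyMeasurable)
    (fun u => Eventually.of_forall fun y => ?_) ?_ ?_ ?_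
  · rw [norm_mul, Complex.norm_real, Real.norm_eq_abs, abs_of_nonneg (h.nonneg _)]
  · filter_upwards [ae_nrm_ne_zero] with y hy
    exact (hs y hy).summable.mul_right _
  · refine hΦ.norm.congr ?_
    filter_upwards [ae_nrm_ne_zero] with y hy
    rw [((hs y hy).mul_right _).tsum_eq, one_mul]
  · filter_upwards [ae_nrm_ne_zero] with y hy
    have := (Complex.hasSum_ofReal.2 (hs y hy)).mul_right (Φ y)
    simpa using this

lemma hasSum_unfold_norm (h : FundWeight Γ e R) {Φ : (ι → ℝ) × (κ → ℂ) → ℂ} (hΦ : Integrable Φ) :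
    HasSum (fun u => ∫ x, ‖(R x : ℂ) * Φ (e u * x)‖) (∫ x, ‖Φ x‖) := by
  have h1 := h.hasSum_unfold (Φ := fun x => (‖Φ x‖ : ℂ)) hΦ.norm.ofReal
  rw [integral_complex_ofReal] at h1
  have e1 : ∀ u, ∫ x, (R x : ℂ) * ((‖Φ (e u * x)‖ : ℝ) : ℂ) =
      ((∫ x, ‖(R x : ℂ) * Φ (e u * x)‖ : ℝ) : ℂ) := by
    intro u
    rw [← integral_complex_ofReal]
    refine integral_congr_ae (Eventually.of_forall fun x => ?_)
    simp [abs_of_nonneg (h.nonneg x)]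
  simp_rw [e1] at h1
  exact Complex.hasSum_ofReal.1 h1

/-- Unfolding a sum over a `Γ`-set with orbit representatives indexed by `J`. -/
theorem unfold_sum (h : FundWeight Γ e R) {J : Type*} [Countable J]
    (Φ : J → (ι → ℝ) × (κ → ℂ) → ℂ) (hΦ : ∀ j, Integrable (Φ j))
    (hs : Summable fun j => ∫ x, ‖Φ j x‖) (φ : Γ ≃ Γ) :
    Integrable (fun x => ∑' i : Γ × J, (R x : ℂ) * Φ i.2 (e (φ i.1) * x)) ∧
    Integrable (fun x => ∑' i : Γ × J, ‖(R x : ℂ) * Φ i.2 (e (φ i.1) * x)‖) ∧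
    ∫ x, ∑' i : Γ × J, (R x : ℂ) * Φ i.2 (e (φ i.1) * x) = ∑' j, ∫ x, Φ j x := by
  set F : Γ × J → (ι → ℝ) × (κ → ℂ) → ℂ := fun i x => (R x : ℂ) * Φ i.2 (e (φ i.1) * x)
  have hF : ∀ i, Integrable (F i) := fun i => h.integrable_unfold _ (hΦ _)
  have hn : ∀ j, HasSum (fun u => ∫ x, ‖F (u, j) x‖) (∫ x, ‖Φ j x‖) := fun j =>
    φ.hasSum_iff.2 (h.hasSum_unfold_norm (hΦ j))
  have hc : ∀ j, HasSum (fun u => ∫ x, F (u, j) x) (∫ x, Φ j x) := fun j =>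
    φ.hasSum_iff.2 (h.hasSum_unfold (hΦ j))
  have hsum : Summable fun i => ∫ x, ‖F i x‖ := by
    rw [← (Equiv.prodComm J Γ).summable_iff, summable_prod_of_nonneg]
    · refine ⟨fun j => (hn j).summable, ?_⟩
      refine hs.congr fun j => ?_
      exact (hn j).tsum_eq.symm
    · intro i
      exact integral_nonneg fun x => norm_nonneg _
  have key := hasSum_integral_of_summable_integral_norm hF hsum
  have e3 : HasSum (fun i => ∫ x, F i x) (∑' j, ∫ x, Φ j x) := by
    have h1 : Summable fun i : J × Γ => ∫ x, F (i.2, i.1) x := by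
      rw [← (Equiv.prodComm Γ J).summable_iff]
      exact key.summable
    have h2 := h1.hasSum.prod_fiberwise hc
    have h3 := (Equiv.prodComm J Γ).hasSum_iff (f := fun i => ∫ x, F i x) (a := ∑' j, ∫ x, Φ j x)
    refine h3.1 ?_
    rw [h2.tsum_eq]
    exact h1.hasSum
  have hfin : (∑' i, ∫⁻ x, ‖F i x‖ₑ) ≠ ⊤ := by
    have : ∀ i, ∫⁻ x, ‖F i x‖ₑ = ENNReal.ofReal (∫ x, ‖F i x‖) := fun i =>
      (ofReal_integral_norm_eq_lintegral_enorm (hF i)).symm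
    simp_rw [this]
    exact hsum.tsum_ofReal_ne_top
  have hae : ∀ᵐ x, Summable fun i => ‖F i x‖ := by
    have h1 : ∫⁻ x, ∑' i, ‖F i x‖ₑ ≠ ⊤ := by
      rw [lintegral_tsum fun i => (hF i).aestronglyMeasurable.enorm]
      exact hfin
    filter_upwards [ae_lt_top' (AEMeasurable.tsum fun i =>
      (hF i).aestronglyMeasurable.enorm) h1] with x hx
    have := ENNReal.summable_toReal hx.ne
    simpa using this
  have hm : AEStronglyMeasurable (fun x => ∑' i, F i x) :=
    aestronglyMeasurable_of_tendsto_ae (atTop : Filter (Finset (Γ × J)))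
      (fun t => Finset.aestronglyMeasurable_fun_sum t fun i _ => (hF i).aestronglyMeasurable)
      (by filter_upwards [hae] with x hx; exact hx.of_norm.hasSum)
  have hint2 : Integrable fun x => ∑' i, ‖F i x‖ := by
    refine ⟨aestronglyMeasurable_of_tendsto_ae (atTop : Filter (Finset (Γ × J)))
      (fun t => Finset.aestronglyMeasurable_fun_sum t fun i _ => (hF i).norm.aestronglyMeasurable)
      (by filter_upwards [hae] with x hx; exact hx.hasSum), ?_⟩
    rw [HasFiniteIntegral]
    refine lt_of_le_of_lt ?_ (lt_top_iff_ne_top.2 hfin)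
    rw [← lintegral_tsum fun i => (hF i).aestronglyMeasurable.enorm]
    refine lintegral_mono_ae ?_
    filter_upwards [hae] with x hx
    rw [Real.enorm_of_nonneg (tsum_nonneg fun i => norm_nonneg _),
      ENNReal.ofReal_tsum_of_nonneg (fun i => norm_nonneg _) hx]
    simp
  refine ⟨hint2.mono' hm ?_, hint2, key.unique e3⟩
  filter_upwards [hae] with x hx
  exact norm_tsum_le_tsum_norm hx

end FundWeight

end Unfolding

section MellinIntegrals

set_option linter.unusedSectionVars false

open MeasureTheory

lemma mellinConvergent_exp_neg_mul_sq {c : ℝ} (hc : 0 < c) {s : ℂ} (hs : 0 < s.re) :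
    MellinConvergent (fun t : ℝ => cexp (-(c : ℂ) * (t : ℂ) ^ 2)) s := by
  have h1 : MellinConvergent (fun t : ℝ => cexp (-(t : ℂ))) (s / 2) := by
    have h := Complex.GammaIntegral_convergent (s := s / 2) (by simpa using hs)
    unfold MellinConvergent
    refine h.congr_fun (fun t _ => ?_) measurableSet_Ioi
    simp [mul_comm]
  have h2 := (MellinConvergent.comp_mul_left (f := fun t : ℝ => cexp (-(t : ℂ))) hc).2 h1
  have h3 := (MellinConvergent.comp_rpow (f := fun t : ℝ => cexp (-((c * t : ℝ) : ℂ)))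
    (a := 2) (s := s) two_ne_zero).2 (by simpa using h2)
  simpa using h3

lemma mellin_exp_neg_mul_sq {c : ℝ} (hc : 0 < c) {s : ℂ} (hs : 0 < s.re) :
    mellin (fun t : ℝ => cexp (-(c : ℂ) * (t : ℂ) ^ 2)) s =
      (1 / 2) * ((c : ℂ) ^ (-s / 2) * Complex.Gamma (s / 2)) := by
  have h3 := mellin_comp_rpow (fun t : ℝ => cexp (-((c * t : ℝ) : ℂ))) s 2
  have e1 : (fun t : ℝ => cexp (-(c : ℂ) * (t : ℂ) ^ 2)) =
      fun t : ℝ => cexp (-((c * t ^ (2 : ℝ) : ℝ) : ℂ)) := by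
    ext t; simp
  rw [e1, h3]
  have h4 := Complex.integral_cpow_mul_exp_neg_mul_Ioi (a := s / 2) (by simpa using hs) hc
  have h5 : mellin (fun t : ℝ => cexp (-((c * t : ℝ) : ℂ))) (s / (2 : ℝ)) =
      (1 / (c : ℂ)) ^ (s / 2) * Complex.Gamma (s / 2) := by
    rw [← h4, mellin]
    simp
  rw [h5, one_div (c : ℂ), Complex.inv_cpow _ _ (by
    rw [Complex.arg_ofReal_of_nonneg hc.le]; exact Real.pi_pos.ne), ← Complex.cpow_neg]
  simp [neg_div]

/-- The radial profile of the Gaussian at a real place. -/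
def hre (b : Bool) (t : ℝ) : ℂ := (if b then (t : ℂ) else 1) * cexp (-(Real.pi : ℂ) * (t : ℂ) ^ 2)

lemma hre_true_eq : hre true = fun t : ℝ => (t : ℂ) ^ (1 : ℂ) •
    (fun t : ℝ => cexp (-(Real.pi : ℂ) * (t : ℂ) ^ 2)) t := by
  ext t; simp [hre]

lemma hre_false_eq : hre false = fun t : ℝ => cexp (-(Real.pi : ℂ) * (t : ℂ) ^ 2) := by
  ext t; simp [hre]

lemma mellinConvergent_hre (b : Bool) {s : ℂ} (hs : 0 < s.re) : MellinConvergent (hre b) s := by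
  cases b
  · rw [hre_false_eq]
    exact mellinConvergent_exp_neg_mul_sq Real.pi_pos hs
  · rw [hre_true_eq, MellinConvergent.cpow_smul]
    exact mellinConvergent_exp_neg_mul_sq Real.pi_pos (by simp; linarith)

lemma mellin_hre (b : Bool) {s : ℂ} (hs : 0 < s.re) :
    2 * mellin (hre b) s = Gammaℝ (s + if b then 1 else 0) := by
  cases b
  · rw [hre_false_eq, mellin_exp_neg_mul_sq Real.pi_pos hs, Gammaℝ_def]
    simp
  · rw [hre_true_eq, mellin_cpow_smul, mellin_exp_neg_mul_sq Real.pi_pos (by simp; linarith),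
      Gammaℝ_def]
    simp

section Radial

variable {E : Type*} [NormedAddCommGroup E] [NormedSpace ℝ E] [MeasurableSpace E] [BorelSpace E]
  [FiniteDimensional ℝ E] [Nontrivial E] (μ : Measure E) [μ.IsAddHaarMeasure]

lemma radial_aux (h : ℝ → ℂ) (s : ℂ) {y : ℝ} (hy : 0 < y) :
    y ^ (Module.finrank ℝ E - 1) • (h y * (y : ℂ) ^ (Module.finrank ℝ E * (s - 1))) =
      (y : ℂ) ^ (Module.finrank ℝ E * s - 1) • h y := by
  have hd : 1 ≤ Module.finrank ℝ E := Module.finrank_pos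
  have hy' : (y : ℂ) ≠ 0 := by exact_mod_cast hy.ne'
  rw [Complex.real_smul, smul_eq_mul]
  push_cast
  rw [← Complex.cpow_natCast, mul_left_comm, ← Complex.cpow_add _ _ hy', mul_comm (h y)]
  congr 2
  push_cast [hd]
  ring

lemma integrable_radial_iff (h : ℝ → ℂ) (s : ℂ) :
    Integrable (fun x : E => h ‖x‖ * (‖x‖ : ℂ) ^ (Module.finrank ℝ E * (s - 1))) μ ↔
      MellinConvergent h (Module.finrank ℝ E * s) := by
  rw [integrable_fun_norm_addHaar μ (f := fun y : ℝ => h y * (y : ℂ) ^ (Module.finrank ℝ E * (s - 1))),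
    MellinConvergent]
  exact integrableOn_congr_fun (fun y hy => radial_aux (E := E) h s hy) measurableSet_Ioi

lemma integral_radial (h : ℝ → ℂ) (s : ℂ) :
    ∫ x : E, h ‖x‖ * (‖x‖ : ℂ) ^ (Module.finrank ℝ E * (s - 1)) ∂μ =
      Module.finrank ℝ E * μ.real (Metric.ball 0 1) * mellin h (Module.finrank ℝ E * s) := by
  rw [integral_fun_norm_addHaar μ (fun y : ℝ => h y * (y : ℂ) ^ (Module.finrank ℝ E * (s - 1))),
    mellin, setIntegral_congr_fun measurableSet_Ioi
      (fun y hy => radial_aux (E := E) h s (Set.mem_Ioi.1 hy))]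
  simp [mul_assoc]

end Radial

/-- The sign character at a real place. -/
def sg (b : Bool) (t : ℝ) : ℝ := if b then (SignType.sign t : ℝ) else 1

lemma sg_mul (b : Bool) (s t : ℝ) : sg b (s * t) = sg b s * sg b t := by
  cases b <;> simp [sg, sign_mul]

lemma sg_one (b : Bool) : sg b 1 = 1 := by cases b <;> simp [sg]

lemma sg_inv (b : Bool) (t : ℝ) : sg b t⁻¹ = sg b t := by
  cases b
  · simp [sg]
  · rcases lt_trichotomy t 0 with h | h | h
    · simp [sg, sign_neg h, sign_neg (inv_lt_zero.2 h)]
    · simp [h]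
    · simp [sg, sign_pos h, sign_pos (inv_pos.2 h)]

lemma sg_mul_self (b : Bool) {t : ℝ} (ht : t ≠ 0) : sg b t * sg b t = 1 := by
  cases b
  · simp [sg]
  · rcases lt_or_gt_of_ne ht with h | h
    · simp [sg, sign_neg h]
    · simp [sg, sign_pos h]

lemma abs_sg_le (b : Bool) (t : ℝ) : |sg b t| ≤ 1 := by
  cases b
  · simp [sg]
  · rcases lt_trichotomy t 0 with h | h | h
    · simp [sg, sign_neg h]
    · simp [sg, h]
    · simp [sg, sign_pos h]

lemma sg_pos (b : Bool) {t : ℝ} (ht : 0 < t) : sg b t = 1 := by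
  cases b <;> simp [sg, sign_pos ht]

lemma sg_mul_gre (b : Bool) (t : ℝ) : (sg b t : ℂ) * gre b t = hre b ‖t‖ := by
  cases b
  · simp [sg, gre, hre, ← Complex.ofReal_pow]
  · have : ((SignType.sign t : ℝ) : ℂ) * (t : ℂ) = (|t| : ℝ) := by
      rw [← Complex.ofReal_mul, sign_mul_self]
    simp only [sg, gre, hre, if_true, Real.norm_eq_abs]
    rw [← mul_assoc, this, ← Complex.ofReal_pow, ← Complex.ofReal_pow, sq_abs]

lemma sg_mul_gre_inv (b : Bool) (t : ℝ) : (sg b t : ℂ) * gre b t⁻¹ = hre b ‖t‖⁻¹ := by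
  rw [← sg_inv, sg_mul_gre, norm_inv]

lemma real_place {h : ℝ → ℂ} {s : ℂ} :
    (MellinConvergent h s → Integrable fun t : ℝ => h ‖t‖ * (‖t‖ : ℂ) ^ (s - 1)) ∧
    ∫ t : ℝ, h ‖t‖ * (‖t‖ : ℂ) ^ (s - 1) = 2 * mellin h s := by
  have h1 := integrable_radial_iff (volume : Measure ℝ) h s
  have h2 := integral_radial (volume : Measure ℝ) h s
  simp only [Module.finrank_self, Nat.cast_one, one_mul] at h1 h2
  refine ⟨h1.2, h2.trans ?_⟩
  simp

lemma complex_place {h : ℝ → ℂ} {s : ℂ} :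
    (MellinConvergent h (2 * s) →
      Integrable fun z : ℂ => h ‖z‖ * (((‖z‖ ^ 2 : ℝ) : ℂ)) ^ (s - 1)) ∧
    ∫ z : ℂ, h ‖z‖ * ((‖z‖ ^ 2 : ℝ) : ℂ) ^ (s - 1) = 2 * Real.pi * mellin h (2 * s) := by
  have h1 := integrable_radial_iff (volume : Measure ℂ) h s
  have h2 := integral_radial (volume : Measure ℂ) h s
  simp only [Complex.finrank_real_complex, Nat.cast_ofNat] at h1 h2
  have e : ∀ z : ℂ, ((‖z‖ ^ 2 : ℝ) : ℂ) ^ (s - 1) = (‖z‖ : ℂ) ^ (2 * (s - 1)) := by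
    intro z
    rw [Complex.ofReal_pow, show (2 : ℂ) * (s - 1) = (2 : ℕ) * (s - 1) by norm_num,
      ← Complex.cpow_nat_mul', ]
    all_goals simp [Complex.arg_ofReal_of_nonneg, Real.pi_pos, Real.pi_pos.le]
  simp_rw [e]
  refine ⟨h1.2, h2.trans ?_⟩
  simp [Measure.real, Complex.volume_ball]

variable {ι κ : Type*} [Fintype ι] [Fintype κ]

/-- The sign character on `ℝ^ι × ℂ^κ`. -/
def om (p : ι → Bool) (x : (ι → ℝ) × (κ → ℂ)) : ℝ := ∏ w, sg (p w) (x.1 w)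

lemma om_mul (p : ι → Bool) (x y : (ι → ℝ) × (κ → ℂ)) : om p (x * y) = om p x * om p y := by
  simp [om, sg_mul, Finset.prod_mul_distrib]

lemma om_mul_self (p : ι → Bool) {x : (ι → ℝ) × (κ → ℂ)} (hx : nrm x ≠ 0) :
    om p x * om p x = 1 := by
  rw [om, ← Finset.prod_mul_distrib]
  exact Finset.prod_eq_one fun w _ => sg_mul_self _ (((nrm_ne_zero_iff x).1 hx).1 w)

lemma abs_om_le (p : ι → Bool) (x : (ι → ℝ) × (κ → ℂ)) : |om p x| ≤ 1 := by
  rw [om, Finset.abs_prod]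
  exact Finset.prod_le_one (fun _ _ => abs_nonneg _) fun w _ => abs_sg_le _ _

lemma abs_om (p : ι → Bool) {x : (ι → ℝ) × (κ → ℂ)} (hx : nrm x ≠ 0) : |om p x| = 1 := by
  have := om_mul_self p hx
  rcases mul_self_eq_one_iff.1 this with h | h <;> simp [h]

lemma ofReal_prod_cpow {α : Type*} (t : Finset α) (f : α → ℝ) (hf : ∀ a, 0 ≤ f a) (s : ℂ) :
    ((∏ a ∈ t, f a : ℝ) : ℂ) ^ s = ∏ a ∈ t, (f a : ℂ) ^ s := by
  classical
  induction t using Finset.induction_on with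
  | empty => simp
  | insert a t ha ih =>
    rw [Finset.prod_insert ha, Finset.prod_insert ha, Complex.ofReal_mul,
      Complex.mul_cpow_ofReal_nonneg (hf a) (Finset.prod_nonneg fun _ _ => hf _), ih]

lemma nrm_cpow (x : (ι → ℝ) × (κ → ℂ)) (s : ℂ) :
    (nrm x : ℂ) ^ s = (∏ w, (‖x.1 w‖ : ℂ) ^ s) * ∏ w, ((‖x.2 w‖ ^ 2 : ℝ) : ℂ) ^ s := by
  rw [nrm, Complex.ofReal_mul, Complex.mul_cpow_ofReal_nonneg
    (Finset.prod_nonneg fun _ _ => abs_nonneg _) (Finset.prod_nonneg fun _ _ => by positivity)]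
  congr 1
  · exact ofReal_prod_cpow _ (fun w => |x.1 w|) (fun _ => abs_nonneg _) s
  · exact ofReal_prod_cpow _ (fun w => ‖x.2 w‖ ^ 2) (fun _ => by positivity) s

/-- The archimedean factor. -/
def ZF (κ : Type*) [Fintype κ] (p : ι → Bool) (s : ℂ) : ℂ :=
  (∏ w, Gammaℝ (s + if p w then 1 else 0)) *
    (Real.pi * (2 * Real.pi : ℂ) ^ (-s) * Complex.Gamma s) ^ Fintype.card κ

lemma mellin_gco {s : ℂ} (hs : 0 < s.re) :
    2 * Real.pi * mellin (fun t : ℝ => cexp (-((2 * Real.pi : ℝ) : ℂ) * (t : ℂ) ^ 2)) (2 * s) =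
      Real.pi * (2 * Real.pi : ℂ) ^ (-s) * Complex.Gamma s := by
  rw [mellin_exp_neg_mul_sq (by positivity) (by simpa using hs)]
  rw [show -(2 * s) / 2 = -s by ring, show 2 * s / 2 = s by ring]
  push_cast
  ring

theorem integral_primal_kernel (p : ι → Bool) {s : ℂ} (hs : 0 < s.re) :
    Integrable (fun x : (ι → ℝ) × (κ → ℂ) => (om p x : ℂ) * gfn p x * (nrm x : ℂ) ^ (s - 1)) ∧
    ∫ x : (ι → ℝ) × (κ → ℂ), (om p x : ℂ) * gfn p x * (nrm x : ℂ) ^ (s - 1) = ZF κ p s := by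
  have e : (fun x : (ι → ℝ) × (κ → ℂ) => (om p x : ℂ) * gfn p x * (nrm x : ℂ) ^ (s - 1)) =
      pf (fun w t => hre (p w) ‖t‖ * (‖t‖ : ℂ) ^ (s - 1))
        (fun _ z => (fun t : ℝ => cexp (-((2 * Real.pi : ℝ) : ℂ) * (t : ℂ) ^ 2)) ‖z‖ *
          ((‖z‖ ^ 2 : ℝ) : ℂ) ^ (s - 1)) := by
    ext x
    rw [nrm_cpow]
    simp only [om, gfn, pf, gco, Complex.ofReal_prod, ← sg_mul_gre, Finset.prod_mul_distrib]
    push_cast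
    ring
  have h1 : ∀ w, MellinConvergent (hre (p w)) s := fun w => mellinConvergent_hre _ hs
  have h2 := mellinConvergent_exp_neg_mul_sq (c := 2 * Real.pi) (by positivity)
    (s := 2 * s) (by simpa using hs)
  rw [e]
  refine ⟨integrable_pf (fun w => real_place.1 (h1 w)) fun _ => complex_place.1 h2, ?_⟩
  rw [integral_pf, ZF, Finset.prod_congr rfl fun w _ => real_place.2.trans (mellin_hre (p w) hs),
    Finset.prod_congr rfl fun w _ => complex_place.2.trans (mellin_gco hs)]
  simp

theorem integral_dual_kernel (p : ι → Bool) {s : ℂ} (hs : s.re < 1) :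
    Integrable (fun x : (ι → ℝ) × (κ → ℂ) =>
      (om p x : ℂ) * gfn p x⁻¹ * (nrm x : ℂ) ^ (s - 2)) ∧
    ∫ x : (ι → ℝ) × (κ → ℂ), (om p x : ℂ) * gfn p x⁻¹ * (nrm x : ℂ) ^ (s - 2) =
      ZF κ p (1 - s) := by
  have e : (fun x : (ι → ℝ) × (κ → ℂ) => (om p x : ℂ) * gfn p x⁻¹ * (nrm x : ℂ) ^ (s - 2)) =
      pf (fun w t => (fun r => hre (p w) r⁻¹) ‖t‖ * (‖t‖ : ℂ) ^ ((s - 1) - 1))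
        (fun _ z => (fun r : ℝ => (fun t : ℝ => cexp (-((2 * Real.pi : ℝ) : ℂ) * (t : ℂ) ^ 2)) r⁻¹)
          ‖z‖ * ((‖z‖ ^ 2 : ℝ) : ℂ) ^ ((s - 1) - 1)) := by
    ext x
    rw [nrm_cpow, show s - 2 = s - 1 - 1 by ring]
    simp only [om, gfn, pf, gco, Complex.ofReal_prod, ← sg_mul_gre_inv, Finset.prod_mul_distrib,
      Prod.fst_inv, Prod.snd_inv, Pi.inv_apply, norm_inv]
    push_cast
    ring
  have hs' : 0 < (1 - s).re := by simpa using hs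
  have h1 : ∀ w, MellinConvergent (fun r => hre (p w) r⁻¹) (s - 1) := fun w => by
    have := (MellinConvergent.comp_rpow (f := hre (p w)) (s := s - 1) (a := -1) (by norm_num)).2
      (by
        have := mellinConvergent_hre (p w) hs'
        simpa [div_neg] using this)
    simpa [Real.rpow_neg_one] using this
  have h2 : MellinConvergent (fun r : ℝ =>
      (fun t : ℝ => cexp (-((2 * Real.pi : ℝ) : ℂ) * (t : ℂ) ^ 2)) r⁻¹) (2 * (s - 1)) := by
    have := (MellinConvergent.comp_rpow (f := fun t : ℝ =>
      cexp (-((2 * Real.pi : ℝ) : ℂ) * (t : ℂ) ^ 2)) (s := 2 * (s - 1)) (a := -1) (by norm_num)).2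
      (by
        have := mellinConvergent_exp_neg_mul_sq (c := 2 * Real.pi) (by positivity)
          (s := 2 * (1 - s)) (by simpa using hs)
        have e2 : 2 * (s - 1) / ((-1 : ℝ) : ℂ) = 2 * (1 - s) := by push_cast; ring
        rw [e2]
        exact this)
    simpa only [Real.rpow_neg_one] using this
  rw [e]
  refine ⟨integrable_pf (fun w => real_place.1 (h1 w)) fun _ => complex_place.1 h2, ?_⟩
  rw [integral_pf, ZF]
  have e3 : -(2 * (s - 1)) = 2 * (1 - s) := by ring
  have e4 : -(s - 1) = 1 - s := by ring
  have a1 : ∀ w, ∫ t : ℝ, (fun r => hre (p w) r⁻¹) ‖t‖ * (‖t‖ : ℂ) ^ ((s - 1) - 1) =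
      Gammaℝ ((1 - s) + if p w then 1 else 0) := by
    intro w
    rw [(real_place (h := fun r => hre (p w) r⁻¹)).2, mellin_comp_inv, e4]
    exact mellin_hre _ hs'
  have a2 : ∫ z : ℂ, (fun r : ℝ => (fun t : ℝ => cexp (-((2 * Real.pi : ℝ) : ℂ) * (t : ℂ) ^ 2)) r⁻¹)
      ‖z‖ * ((‖z‖ ^ 2 : ℝ) : ℂ) ^ ((s - 1) - 1) =
      Real.pi * (2 * Real.pi) ^ (-(1 - s)) * Gamma (1 - s) := by
    rw [(complex_place (h := fun r : ℝ =>
      (fun t : ℝ => cexp (-((2 * Real.pi : ℝ) : ℂ) * (t : ℂ) ^ 2)) r⁻¹)).2, mellin_comp_inv (fun t : ℝ => cexp (-((2 * Real.pi : ℝ) : ℂ) * (t : ℂ) ^ 2)), e3]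
    exact mellin_gco hs'
  rw [Finset.prod_congr rfl fun w _ => a1 w, Finset.prod_congr rfl fun w _ => a2]
  simp

end MellinIntegrals

section MellinSplit

open MeasureTheory

variable {α : Type*} [MeasurableSpace α]

lemma norm_ofReal_cpow_of_pos {t : ℝ} (ht : 0 < t) (s : ℂ) : ‖(t : ℂ) ^ s‖ = t ^ s.re := by
  rw [Complex.norm_cpow_eq_rpow_re_of_pos ht]

lemma measurable_ofReal_cpow {N : α → ℝ} (hN : Measurable N) (s : ℂ) :
    Measurable fun x => (N x : ℂ) ^ s :=
  (Complex.measurable_ofReal.comp hN).pow_const s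

lemma integrable_mul_cpow_of_le {μ : Measure α} {N : α → ℝ} {F : α → ℂ}
    (hNm : Measurable N) (hN : ∀ᵐ x ∂μ, 1 ≤ N x) {s s' : ℂ} (hs : s.re ≤ s'.re)
    (h : Integrable (fun x => F x * (N x : ℂ) ^ s') μ) :
    Integrable (fun x => F x * (N x : ℂ) ^ s) μ := by
  have e : (fun x => F x * (N x : ℂ) ^ s) =ᵐ[μ]
      fun x => (N x : ℂ) ^ (s - s') * (F x * (N x : ℂ) ^ s') := by
    filter_upwards [hN] with x hx
    have : (N x : ℂ) ≠ 0 := by exact_mod_cast (by linarith : N x ≠ 0)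
    rw [mul_left_comm, ← Complex.cpow_add _ _ this, sub_add_cancel]
  rw [integrable_congr e]
  refine h.bdd_mul (c := 1) (measurable_ofReal_cpow hNm _).aestronglyMeasurable ?_
  filter_upwards [hN] with x hx
  rw [norm_ofReal_cpow_of_pos (by linarith)]
  exact Real.rpow_le_one_of_one_le_of_nonpos hx (by simpa using hs)

lemma entire_of_one_le {μ : Measure α} {N : α → ℝ} {F : α → ℂ}
    (hNm : Measurable N) (hN : ∀ᵐ x ∂μ, 1 ≤ N x)
    (hF : ∀ σ : ℝ, ∃ s' : ℂ, σ ≤ s'.re ∧ Integrable (fun x => F x * (N x : ℂ) ^ s') μ) :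
    Differentiable ℂ (fun s : ℂ => ∫ x, F x * (N x : ℂ) ^ s ∂μ) ∧
      ∀ b : ℝ, ∃ M : ℝ, ∀ s : ℂ, s.re ≤ b → ‖∫ x, F x * (N x : ℂ) ^ s ∂μ‖ ≤ M := by
  have hI : ∀ s : ℂ, Integrable (fun x => F x * (N x : ℂ) ^ s) μ := fun s => by
    obtain ⟨s', h1, h2⟩ := hF s.re
    exact integrable_mul_cpow_of_le hNm hN h1 h2
  constructor
  · intro s₀
    have hlog : Measurable fun x => (Real.log (N x) : ℂ) :=
      Complex.measurable_ofReal.comp (Real.measurable_log.comp hNm)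
    refine (hasDerivAt_integral_of_dominated_loc_of_deriv_le (s := Metric.ball s₀ 1)
      (bound := fun x => ‖F x * (N x : ℂ) ^ (s₀ + 2)‖)
      (F' := fun s x => F x * ((N x : ℂ) ^ s * Real.log (N x)))
      (Metric.ball_mem_nhds _ one_pos)
      (Eventually.of_forall fun s => (hI s).aestronglyMeasurable) (hI s₀) ?_ ?_
      (hI _).norm ?_).2.differentiableAt
    · have : (fun x => F x * ((N x : ℂ) ^ s₀ * Real.log (N x))) =
          fun x => (F x * (N x : ℂ) ^ s₀) * Real.log (N x) := by ext; ring
      rw [this]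
      exact (hI s₀).aestronglyMeasurable.mul hlog.aestronglyMeasurable
    · filter_upwards [hN] with x hx s hs
      have h0 : 0 < N x := by linarith
      rw [norm_mul, norm_mul, norm_mul, norm_ofReal_cpow_of_pos h0, norm_ofReal_cpow_of_pos h0]
      refine mul_le_mul_of_nonneg_left ?_ (norm_nonneg _)
      have h1 : ‖((Real.log (N x) : ℝ) : ℂ)‖ ≤ N x := by
        rw [Complex.norm_real, Real.norm_eq_abs, abs_of_nonneg (Real.log_nonneg hx)]
        have := Real.log_le_sub_one_of_pos h0
        linarith
      have h2 : s.re ≤ s₀.re + 1 := by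
        rw [Metric.mem_ball, dist_eq_norm] at hs
        have := (Complex.abs_re_le_norm (s - s₀)).trans hs.le
        have := (abs_le.1 this).2
        simp only [Complex.sub_re] at this
        linarith
      calc N x ^ s.re * ‖((Real.log (N x) : ℝ) : ℂ)‖ ≤ N x ^ (s₀.re + 1) * N x ^ (1 : ℝ) := by
            rw [Real.rpow_one]
            exact mul_le_mul (Real.rpow_le_rpow_of_exponent_le hx h2) h1 (norm_nonneg _)
              (Real.rpow_nonneg h0.le _)
        _ = N x ^ (s₀ + 2).re := by
            rw [← Real.rpow_add h0]; congr 1; simp; ring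
    · filter_upwards [hN] with x hx s _
      have h0 : (N x : ℂ) ≠ 0 := by exact_mod_cast (by linarith : N x ≠ 0)
      have := ((hasDerivAt_id s).const_cpow (c := (N x : ℂ)) (Or.inl h0)).const_mul (F x)
      have hl : Complex.log (N x : ℂ) = (Real.log (N x) : ℂ) :=
        (Complex.ofReal_log (by linarith)).symm
      simpa [hl] using this
  · intro b
    refine ⟨∫ x, ‖F x * (N x : ℂ) ^ (b : ℂ)‖ ∂μ, fun s hs => ?_⟩
    refine norm_integral_le_of_norm_le (hI b).norm ?_
    filter_upwards [hN] with x hx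
    have h0 : 0 < N x := by linarith
    rw [norm_mul, norm_mul, norm_ofReal_cpow_of_pos h0, norm_ofReal_cpow_of_pos h0]
    refine mul_le_mul_of_nonneg_left ?_ (norm_nonneg _)
    exact Real.rpow_le_rpow_of_exponent_le hx (by simpa using hs)

lemma ofReal_inv_cpow {t : ℝ} (ht : 0 < t) (s : ℂ) : ((t⁻¹ : ℝ) : ℂ) ^ s = (t : ℂ) ^ (-s) := by
  have h1 : (t : ℂ).arg ≠ Real.pi := by
    rw [Complex.arg_ofReal_of_nonneg ht.le]; exact Real.pi_pos.ne
  rw [Complex.ofReal_inv, Complex.inv_cpow _ _ h1, Complex.cpow_neg]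

/-- Riemann's splitting of a Mellin transform over an abstract measure space. -/
theorem mellin_split {μ : Measure α} {N : α → ℝ} {F₁ F₂ R : α → ℂ} {c κ g₀ x₀ V : ℂ}
    {Z₁ Z₂ : ℂ → ℂ} (hNm : Measurable N) (hN : ∀ᵐ x ∂μ, 0 < N x)
    (h1 : ∀ s : ℂ, 1 < s.re → Integrable (fun x => F₁ x * (N x : ℂ) ^ (s - 1)) μ ∧
      ∫ x, F₁ x * (N x : ℂ) ^ (s - 1) ∂μ = Z₁ s)
    (h2 : ∀ s : ℂ, s.re < 0 → Integrable (fun x => F₂ x * (N x : ℂ) ^ (s - 2)) μ ∧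
      ∫ x, F₂ x * (N x : ℂ) ^ (s - 2) ∂μ = Z₂ s)
    (hR1 : ∀ z : ℂ, 0 < z.re → IntegrableOn (fun x => R x * (N x : ℂ) ^ (z - 1)) {x | N x < 1} μ ∧
      ∫ x in {x | N x < 1}, R x * (N x : ℂ) ^ (z - 1) ∂μ = V / z)
    (hR2 : ∀ z : ℂ, z.re < 0 → IntegrableOn (fun x => R x * (N x : ℂ) ^ (z - 1)) {x | N x < 1}ᶜ μ ∧
      ∫ x in {x | N x < 1}ᶜ, R x * (N x : ℂ) ^ (z - 1) ∂μ = -(V / z))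
    (hrel : ∀ᵐ x ∂μ, F₁ x + x₀ * c * R x = κ * (N x : ℂ)⁻¹ * (F₂ x + g₀ * c * R x)) :
    ∃ Λ₀ : ℂ → ℂ, Differentiable ℂ Λ₀ ∧
      (∀ a b : ℝ, ∃ M : ℝ, ∀ s : ℂ, a ≤ s.re → s.re ≤ b → ‖Λ₀ s‖ ≤ M) ∧
      (∀ s : ℂ, 1 < s.re → Z₁ s = Λ₀ s + c * V * (κ * g₀ / (s - 1) - x₀ / s)) ∧
      (∀ s : ℂ, s.re < 0 → κ * Z₂ s = Λ₀ s + c * V * (κ * g₀ / (s - 1) - x₀ / s)) := by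
  have hS : MeasurableSet {x | N x < 1} := measurableSet_lt hNm measurable_const
  set U : Set α := {x | N x < 1} with hU
  have hA := entire_of_one_le (μ := μ.restrict Uᶜ) (F := F₁) hNm
    (by filter_upwards [ae_restrict_mem hS.compl] with x hx; exact not_lt.1 hx)
    (fun σ => ⟨(max σ 1 + 1 : ℝ) - 1 + 1, by simp; linarith [le_max_left σ 1], by
      have := (h1 ((max σ 1 + 1 : ℝ) + 1) (by
        simp only [Complex.add_re, Complex.ofReal_re, Complex.one_re]
        linarith [le_max_right σ 1])).1.integrableOn (s := Uᶜ)
      simpa [IntegrableOn] using this⟩)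
  have hB := entire_of_one_le (μ := μ.restrict U) (F := F₂) (N := fun x => (N x)⁻¹) hNm.inv
    (by
      filter_upwards [ae_restrict_mem hS, ae_restrict_of_ae hN] with x hx hx0
      exact (one_le_inv₀ hx0).2 (le_of_lt hx))
    (fun σ => ⟨(max σ 3 : ℝ), by simp, by
      have := (h2 (2 - (max σ 3 : ℝ)) (by
        simp only [Complex.sub_re, Complex.ofReal_re, Complex.re_ofNat]
        linarith [le_max_right σ 3])).1.integrableOn (s := U)
      refine (integrable_congr ?_).1 this
      filter_upwards [ae_restrict_of_ae hN] with x hx0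
      rw [ofReal_inv_cpow hx0]
      congr 2
      ring⟩)
  have hBe : ∀ s : ℂ, ∫ x in U, F₂ x * ((((N x)⁻¹ : ℝ) : ℂ)) ^ (2 - s) ∂μ =
      ∫ x in U, F₂ x * (N x : ℂ) ^ (s - 2) ∂μ := fun s => by
    refine integral_congr_ae ?_
    filter_upwards [ae_restrict_of_ae hN] with x hx0
    rw [ofReal_inv_cpow hx0, neg_sub]
  refine ⟨fun s => (∫ x in Uᶜ, F₁ x * (N x : ℂ) ^ (s - 1) ∂μ) +
    κ * ∫ x in U, F₂ x * (((N x)⁻¹ : ℝ) : ℂ) ^ (2 - s) ∂μ, ?_, ?_, ?_, ?_⟩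
  · exact (hA.1.comp (differentiable_id.sub_const 1)).add
      ((hB.1.comp (differentiable_id.const_sub 2)).const_mul κ)
  · intro a b
    obtain ⟨M₁, hM₁⟩ := hA.2 (b - 1)
    obtain ⟨M₂, hM₂⟩ := hB.2 (2 - a)
    refine ⟨M₁ + ‖κ‖ * M₂, fun s ha hb => (norm_add_le _ _).trans (add_le_add ?_ ?_)⟩
    · exact hM₁ _ (by simpa using hb)
    · rw [norm_mul]
      exact mul_le_mul_of_nonneg_left (hM₂ _ (by simp; linarith)) (norm_nonneg _)
  · intro s hs
    beta_reduce
    rw [hBe]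
    obtain ⟨hi, he⟩ := h1 s hs
    obtain ⟨ha, ha'⟩ := hR1 s (by linarith)
    obtain ⟨hb, hb'⟩ := hR1 (s - 1) (by simpa using hs)
    rw [← he, ← integral_add_compl hS hi, add_comm, add_assoc]
    congr 1
    have e : ∀ᵐ x ∂(μ.restrict U), κ * (F₂ x * (N x : ℂ) ^ (s - 2)) =
        F₁ x * (N x : ℂ) ^ (s - 1) + x₀ * c * (R x * (N x : ℂ) ^ (s - 1)) -
          κ * g₀ * c * (R x * (N x : ℂ) ^ (s - 1 - 1)) := by
      filter_upwards [ae_restrict_of_ae hN, ae_restrict_of_ae hrel] with x hx0 hx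
      have h0 : (N x : ℂ) ≠ 0 := by exact_mod_cast hx0.ne'
      have e1 : (N x : ℂ) ^ (s - 1) = N x * (N x : ℂ) ^ (s - 2) := by
        rw [show s - 1 = 1 + (s - 2) by ring, Complex.cpow_add _ _ h0, Complex.cpow_one]
      have e2 : (N x : ℂ) ^ (s - 1 - 1) = (N x : ℂ) ^ (s - 2) := by
        rw [show s - 1 - 1 = s - 2 by ring]
      have : F₁ x = κ * (N x : ℂ)⁻¹ * (F₂ x + g₀ * c * R x) - x₀ * c * R x :=
        eq_sub_of_add_eq hx
      rw [e1, e2, this]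
      field_simp
      ring
    rw [← integral_const_mul, integral_congr_ae e, integral_sub, integral_add,
      integral_const_mul, integral_const_mul, ha', hb']
    · ring
    · exact hi.integrableOn
    · exact ha.const_mul _
    · exact hi.integrableOn.add (ha.const_mul _)
    · exact hb.const_mul _
  · intro s hs
    beta_reduce
    rw [hBe]
    obtain ⟨hi, he⟩ := h2 s hs
    obtain ⟨ha, ha'⟩ := hR2 s (by linarith)
    obtain ⟨hb, hb'⟩ := hR2 (s - 1) (by simp; linarith)
    rw [← he, ← integral_add_compl hS hi, mul_add, add_comm, add_right_comm]
    congr 1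
    have e : ∀ᵐ x ∂(μ.restrict Uᶜ), F₁ x * (N x : ℂ) ^ (s - 1) =
        κ * (F₂ x * (N x : ℂ) ^ (s - 2)) + κ * g₀ * c * (R x * (N x : ℂ) ^ (s - 1 - 1)) -
          x₀ * c * (R x * (N x : ℂ) ^ (s - 1)) := by
      filter_upwards [ae_restrict_of_ae hN, ae_restrict_of_ae hrel] with x hx0 hx
      have h0 : (N x : ℂ) ≠ 0 := by exact_mod_cast hx0.ne'
      have e1 : (N x : ℂ) ^ (s - 1) = N x * (N x : ℂ) ^ (s - 2) := by
        rw [show s - 1 = 1 + (s - 2) by ring, Complex.cpow_add _ _ h0, Complex.cpow_one]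
      have e2 : (N x : ℂ) ^ (s - 1 - 1) = (N x : ℂ) ^ (s - 2) := by
        rw [show s - 1 - 1 = s - 2 by ring]
      have : F₁ x = κ * (N x : ℂ)⁻¹ * (F₂ x + g₀ * c * R x) - x₀ * c * R x :=
        eq_sub_of_add_eq hx
      rw [e1, e2, this]
      field_simp
    rw [integral_congr_ae e, integral_sub, integral_add,
      integral_const_mul, integral_const_mul, integral_const_mul, ha', hb']
    · ring
    · exact hi.integrableOn.const_mul _
    · exact hb.const_mul _
    · exact (hi.integrableOn.const_mul _).add (hb.const_mul _)
    · exact ha.const_mul _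

end MellinSplit

section Push

set_option linter.unusedSectionVars false

open MeasureTheory

variable {ι κ : Type*} [Fintype ι] [Fintype κ]
variable {Γ : Type*} [Group Γ] {e : Γ →* (ι → ℝ) × (κ → ℂ)}
  {R : (ι → ℝ) × (κ → ℂ) → ℝ}

lemma nrm_smul_one (c : ℝ) (hc : 0 ≤ c) :
    nrm (c • (1 : (ι → ℝ) × (κ → ℂ))) = c ^ (Fintype.card ι + 2 * Fintype.card κ) := by
  simp only [nrm, Prod.smul_fst, Prod.smul_snd, Prod.fst_one, Prod.snd_one, Pi.smul_apply,
    Pi.one_apply, smul_eq_mul, mul_one, Complex.real_smul, Complex.norm_real, Real.norm_eq_abs,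
    abs_of_nonneg hc, Finset.prod_const, Finset.card_univ]
  rw [← pow_mul, pow_add]

lemma exists_smul_one_nrm (hd : 0 < Fintype.card ι + 2 * Fintype.card κ) {t : ℝ} (ht : 0 < t) :
    ∃ c : ℝ, 0 < c ∧ nrm (c • (1 : (ι → ℝ) × (κ → ℂ))) = t := by
  refine ⟨t ^ ((Fintype.card ι + 2 * Fintype.card κ : ℕ) : ℝ)⁻¹, Real.rpow_pos_of_pos ht _, ?_⟩
  rw [nrm_smul_one _ (Real.rpow_nonneg ht.le _), Real.rpow_inv_natCast_pow ht.le hd.ne']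

lemma smul_one_mul (c : ℝ) (x : (ι → ℝ) × (κ → ℂ)) :
    (c • (1 : (ι → ℝ) × (κ → ℂ))) * x = c • x := by
  rw [smul_mul_assoc, one_mul]

namespace FundWeight

/-- The distribution of the norm under the weight. -/
def nuR (R : (ι → ℝ) × (κ → ℂ) → ℝ) : Measure ℝ :=
  (volume.withDensity fun x => ENNReal.ofReal (R x)).map nrm

lemma nuR_Iic (R : (ι → ℝ) × (κ → ℂ) → ℝ) (t : ℝ) :
    nuR R (Set.Iic t) = ∫⁻ x, (Set.Iic t).indicator 1 (nrm x) * ENNReal.ofReal (R x) := by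
  have hm : MeasurableSet (nrm ⁻¹' Set.Iic t : Set ((ι → ℝ) × (κ → ℂ))) :=
    continuous_nrm.measurable measurableSet_Iic
  rw [nuR, Measure.map_apply continuous_nrm.measurable measurableSet_Iic,
    withDensity_apply _ hm, ← lintegral_indicator hm]
  refine lintegral_congr fun x => ?_
  by_cases hx : nrm x ≤ t <;> simp [Set.indicator, hx]

lemma nuR_Iic_pos (h : FundWeight Γ e R) (hd : 0 < Fintype.card ι + 2 * Fintype.card κ)
    {t : ℝ} (ht : 0 < t) : nuR R (Set.Iic t) = ENNReal.ofReal t * nuR R (Set.Iic 1) := by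
  obtain ⟨c, hc, hct⟩ := exists_smul_one_nrm (ι := ι) (κ := κ) hd ht
  rw [nuR_Iic, nuR_Iic]
  have h1 := lintegral_comp_mul (x := c • (1 : (ι → ℝ) × (κ → ℂ))) (by rw [hct]; exact ht.ne')
    (fun x => (Set.Iic t).indicator 1 (nrm x) * ENNReal.ofReal (R x))
  have h2 : ∀ v, (Set.Iic t).indicator (1 : ℝ → ENNReal)
      (nrm ((c • (1 : (ι → ℝ) × (κ → ℂ))) * v)) = (Set.Iic 1).indicator 1 (nrm v) := fun v => by
    rw [nrm_mul, hct]
    have : t * nrm v ≤ t ↔ nrm v ≤ 1 := by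
      constructor <;> intro h <;> nlinarith
    by_cases hv : nrm v ≤ 1
    · simp [Set.indicator, hv, this.2 hv]
    · simp [Set.indicator, hv, mt this.1 hv]
  simp only [h2] at h1
  simp only [smul_one_mul, h.scale c _ hc] at h1
  rw [h1, hct, ← mul_assoc, ← ENNReal.ofReal_mul ht.le, mul_inv_cancel₀ ht.ne', ENNReal.ofReal_one,
    one_mul]

lemma nuR_Iic_one_lt_top (h : FundWeight Γ e R) : nuR R (Set.Iic 1) < ⊤ := by
  have hm : MeasurableSet (nrm ⁻¹' Set.Iic 1 : Set ((ι → ℝ) × (κ → ℂ))) :=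
    continuous_nrm.measurable measurableSet_Iic
  rw [nuR, Measure.map_apply continuous_nrm.measurable measurableSet_Iic,
    withDensity_apply _ hm]
  exact h.fin.lintegral_lt_top

lemma nuR_Iic_zero (_h : FundWeight Γ e R) : nuR R (Set.Iic 0) = 0 := by
  rw [nuR_Iic]
  refine (lintegral_congr_ae ?_).trans lintegral_zero
  filter_upwards [ae_nrm_ne_zero] with x hx
  have : ¬ nrm x ≤ 0 := fun hh => hx (le_antisymm hh (nrm_nonneg x))
  simp [Set.indicator, this]

lemma nuR_eq (h : FundWeight Γ e R) (hd : 0 < Fintype.card ι + 2 * Fintype.card κ) :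
    nuR R = nuR R (Set.Iic 1) • (volume.restrict (Set.Ioi (0 : ℝ))) := by
  have key : ∀ t : ℝ, nuR R (Set.Iic t) =
      (nuR R (Set.Iic 1) • (volume.restrict (Set.Ioi (0 : ℝ)))) (Set.Iic t) := by
    intro t
    rw [Measure.smul_apply, Measure.restrict_apply measurableSet_Iic, Set.Iic_inter_Ioi,
      Real.volume_Ioc, sub_zero, smul_eq_mul]
    rcases le_or_gt t 0 with ht | ht
    · rw [ENNReal.ofReal_of_nonpos ht, mul_zero]
      exact measure_mono_null (Set.Iic_subset_Iic.2 ht) h.nuR_Iic_zero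
    · rw [h.nuR_Iic_pos hd ht, mul_comm]
  have hfin : ∀ t : ℝ, nuR R (Set.Iic t) ≠ ⊤ := fun t => by
    rw [key, Measure.smul_apply, Measure.restrict_apply measurableSet_Iic, Set.Iic_inter_Ioi,
      Real.volume_Ioc]
    exact ENNReal.mul_ne_top h.nuR_Iic_one_lt_top.ne ENNReal.ofReal_ne_top
  have hlf : IsLocallyFiniteMeasure (nuR R) := ⟨fun x => ⟨Set.Iic (x + 1), Iic_mem_nhds (by linarith),
    (hfin _).lt_top⟩⟩
  refine Measure.ext_of_Ioc _ _ fun a b hab => ?_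
  have hd : Set.Ioc a b = Set.Iic b \ Set.Iic a := by
    ext x; simp [and_comm]
  rw [hd, measure_sdiff (Set.Iic_subset_Iic.2 hab.le)
    measurableSet_Iic.nullMeasurableSet (hfin a), measure_sdiff (Set.Iic_subset_Iic.2 hab.le)
    measurableSet_Iic.nullMeasurableSet (by rw [← key]; exact hfin a), ← key, ← key]

/-- Integrals of functions of the norm against the weight. -/
lemma integral_nrm (h : FundWeight Γ e R) (hd : 0 < Fintype.card ι + 2 * Fintype.card κ)
    {f : ℝ → ℂ} (hf : Measurable f) {S : Set ℝ} (hS : MeasurableSet S)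
    (hfi : IntegrableOn f (Set.Ioi 0 ∩ S)) :
    IntegrableOn (fun x => (R x : ℂ) * f (nrm x)) (nrm ⁻¹' S) ∧
    ∫ x in nrm ⁻¹' S, (R x : ℂ) * f (nrm x) =
      ((nuR R (Set.Iic 1)).toReal : ℂ) * ∫ t in Set.Ioi 0 ∩ S, f t := by
  have hRm : Measurable fun x => (R x).toNNReal := h.meas.real_toNNReal
  have hRe : (fun x => ENNReal.ofReal (R x)) = fun x => (((R x).toNNReal : NNReal) : ENNReal) := rfl
  have hm : MeasurableSet (nrm ⁻¹' S : Set ((ι → ℝ) × (κ → ℂ))) := continuous_nrm.measurable hS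
  set g : ℝ → ℂ := S.indicator f with hg
  have hgm : Measurable g := hf.indicator hS
  have hgi : Integrable g (volume.restrict (Set.Ioi 0)) := by
    rw [hg, integrable_indicator_iff hS, IntegrableOn, Measure.restrict_restrict hS, Set.inter_comm]
    exact hfi
  have hgi2 : Integrable g (nuR R) := by
    rw [h.nuR_eq hd]
    exact hgi.smul_measure h.nuR_Iic_one_lt_top.ne
  have e1 : (nrm ⁻¹' S).indicator (fun x => (R x : ℂ) * f (nrm x)) =
      fun x => (R x).toNNReal • g (nrm x) := by
    ext x
    by_cases hx : nrm x ∈ S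
    · simp [hg, Set.indicator, hx, NNReal.smul_def, Real.coe_toNNReal _ (h.nonneg x)]
    · simp [hg, Set.indicator, hx]
  have hi3 : Integrable (fun x => (R x).toNNReal • g (nrm x)) := by
    rw [← integrable_withDensity_iff_integrable_smul hRm, ← hRe]
    rw [nuR, integrable_map_measure hgm.aestronglyMeasurable continuous_nrm.measurable.aemeasurable]
      at hgi2
    exact hgi2
  refine ⟨?_, ?_⟩
  · rw [← integrable_indicator_iff hm, e1]
    exact hi3
  · rw [← integral_indicator hm, e1, ← integral_withDensity_eq_integral_smul hRm, ← hRe]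
    have h4 : ∫ x, g (nrm x) ∂(volume.withDensity fun x => ENNReal.ofReal (R x)) =
        ∫ t, g t ∂(nuR R) := by
      rw [nuR, integral_map continuous_nrm.measurable.aemeasurable hgm.aestronglyMeasurable]
    rw [h4, h.nuR_eq hd, integral_smul_measure, hg, integral_indicator hS,
      Measure.restrict_restrict hS, Set.inter_comm, Complex.real_smul]
    congr 2
    rw [← h.nuR_eq hd]

lemma integral_nrm_cpow_lt (h : FundWeight Γ e R) (hd : 0 < Fintype.card ι + 2 * Fintype.card κ)
    {z : ℂ} (hz : 0 < z.re) :
    IntegrableOn (fun x => (R x : ℂ) * (nrm x : ℂ) ^ (z - 1)) {x | nrm x < 1} ∧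
    ∫ x in {x | nrm x < 1}, (R x : ℂ) * (nrm x : ℂ) ^ (z - 1) =
      ((nuR R (Set.Iic 1)).toReal : ℂ) / z := by
  have hm : Measurable fun t : ℝ => (t : ℂ) ^ (z - 1) := Complex.measurable_ofReal.pow_const _
  have hS : Set.Ioi (0 : ℝ) ∩ Set.Iio 1 = Set.Ioo 0 1 := Set.Ioi_inter_Iio
  have hi : IntegrableOn (fun t : ℝ => (t : ℂ) ^ (z - 1)) (Set.Ioo 0 1) := by
    have := intervalIntegral.intervalIntegrable_cpow' (a := 0) (b := 1) (r := z - 1) (by simpa using hz)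
    rw [intervalIntegrable_iff_integrableOn_Ioo_of_le zero_le_one] at this
    exact this
  have := h.integral_nrm hd hm (S := Set.Iio 1) measurableSet_Iio (by rw [hS]; exact hi)
  refine ⟨this.1, this.2.trans ?_⟩
  have hz0 : z ≠ 0 := fun h0 => by simp [h0] at hz
  rw [hS, ← integral_Ioc_eq_integral_Ioo, ← intervalIntegral.integral_of_le zero_le_one,
    integral_cpow (Or.inl (by simpa using hz))]
  simp [hz0, div_eq_mul_inv]

lemma integral_nrm_cpow_ge (h : FundWeight Γ e R) (hd : 0 < Fintype.card ι + 2 * Fintype.card κ)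
    {z : ℂ} (hz : z.re < 0) :
    IntegrableOn (fun x => (R x : ℂ) * (nrm x : ℂ) ^ (z - 1)) {x | nrm x < 1}ᶜ ∧
    ∫ x in {x | nrm x < 1}ᶜ, (R x : ℂ) * (nrm x : ℂ) ^ (z - 1) =
      -(((nuR R (Set.Iic 1)).toReal : ℂ) / z) := by
  have hm : Measurable fun t : ℝ => (t : ℂ) ^ (z - 1) := Complex.measurable_ofReal.pow_const _
  have hS : Set.Ioi (0 : ℝ) ∩ Set.Ici 1 = Set.Ici 1 :=
    Set.inter_eq_right.2 fun x hx => Set.mem_Ioi.2 (lt_of_lt_of_le one_pos hx)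
  have hset : ({x | nrm x < 1}ᶜ : Set ((ι → ℝ) × (κ → ℂ))) = nrm ⁻¹' Set.Ici 1 := by
    ext x; simp
  have hi : IntegrableOn (fun t : ℝ => (t : ℂ) ^ (z - 1)) (Set.Ici 1) := by
    rw [integrableOn_Ici_iff_integrableOn_Ioi]
    exact integrableOn_Ioi_cpow_of_lt (by simp; linarith) one_pos
  have := h.integral_nrm hd hm (S := Set.Ici 1) measurableSet_Ici (by rw [hS]; exact hi)
  rw [hset]
  refine ⟨this.1, this.2.trans ?_⟩
  rw [hS, integral_Ici_eq_integral_Ioi, integral_Ioi_cpow_of_lt (by simp; linarith) one_pos]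
  simp [div_eq_mul_inv]

end FundWeight

end Push

section Theta

open MeasureTheory

set_option linter.unusedSectionVars false

variable {ι κ : Type*} [Fintype ι] [Fintype κ]
variable {Γ : Type*} [Group Γ] [Countable Γ] {e : Γ →* (ι → ℝ) × (κ → ℂ)}
  {R : (ι → ℝ) × (κ → ℂ) → ℝ}

lemma om_mul_gfn_zero (p : ι → Bool) (x : (ι → ℝ) × (κ → ℂ)) :
    ((om p x : ℝ) : ℂ) * gfn p (0 : (ι → ℝ) × (κ → ℂ)) = gfn p (0 : (ι → ℝ) × (κ → ℂ)) := by
  by_cases hp : ∀ w, p w = false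
  · have : om p x = 1 := by
      simp [om, sg, hp]
    rw [this, Complex.ofReal_one, one_mul]
  · push Not at hp
    obtain ⟨w, hw⟩ := hp
    have : gfn p (0 : (ι → ℝ) × (κ → ℂ)) = 0 := by
      simp only [gfn, pf]
      rw [Finset.prod_eq_zero (Finset.mem_univ w), zero_mul]
      simp [gre, hw]
    rw [this, mul_zero]

lemma inv_mul_of_nrm_one {u v x : (ι → ℝ) × (κ → ℂ)} (h : u * v = 1) : (u * x)⁻¹ = v * x⁻¹ := by
  have h1 := Prod.ext_iff.1 h
  have a : ∀ w, u.1 w * v.1 w = 1 := fun w => congrFun h1.1 w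
  have b : ∀ w, u.2 w * v.2 w = 1 := fun w => congrFun h1.2 w
  ext w
  · have : u.1 w ≠ 0 := fun h0 => by simpa [h0] using a w
    simp only [Prod.fst_inv, Prod.fst_mul, Pi.inv_apply, Pi.mul_apply, mul_inv]
    rw [inv_eq_of_mul_eq_one_right (a w)]
  · have : u.2 w ≠ 0 := fun h0 => by simpa [h0] using b w
    simp only [Prod.snd_inv, Prod.snd_mul, Pi.inv_apply, Pi.mul_apply, mul_inv]
    rw [inv_eq_of_mul_eq_one_right (b w)]

lemma integral_comp_mul_real {x : (ι → ℝ) × (κ → ℂ)} (hx : nrm x ≠ 0)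
    (Φ : (ι → ℝ) × (κ → ℂ) → ℝ) :
    ∫ v, Φ (x * v) = (nrm x)⁻¹ * ∫ v, Φ v := by
  have h := integral_comp_mul hx (fun v => (Φ v : ℂ))
  rw [integral_complex_ofReal, integral_complex_ofReal] at h
  exact_mod_cast h

lemma primal_term (p : ι → Bool) {a : (ι → ℝ) × (κ → ℂ)} (ha : nrm a ≠ 0) (X : ℂ) {s : ℂ}
    (hs : 0 < s.re) :
    Integrable (fun x : (ι → ℝ) × (κ → ℂ) =>
      X * (om p x : ℂ) * gfn p (a * x) * (nrm x : ℂ) ^ (s - 1)) ∧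
    ∫ x : (ι → ℝ) × (κ → ℂ), X * (om p x : ℂ) * gfn p (a * x) * (nrm x : ℂ) ^ (s - 1) =
      X * om p a * (nrm a : ℂ) ^ (-s) * ZF κ p s ∧
    ∫ x : (ι → ℝ) × (κ → ℂ), ‖X * (om p x : ℂ) * gfn p (a * x) * (nrm x : ℂ) ^ (s - 1)‖ =
      ‖X‖ * nrm a ^ (-s.re) *
        ∫ x : (ι → ℝ) × (κ → ℂ), ‖(om p x : ℂ) * gfn p x * (nrm x : ℂ) ^ (s - 1)‖ := by
  obtain ⟨h1, h2⟩ := integral_primal_kernel (κ := κ) p hs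
  have ha0 : 0 < nrm a := lt_of_le_of_ne (nrm_nonneg a) ha.symm
  have hac : (nrm a : ℂ) ≠ 0 := by exact_mod_cast ha
  have hom : ((om p a : ℝ) : ℂ) * om p a = 1 := by exact_mod_cast om_mul_self p ha
  have e1 : (fun x : (ι → ℝ) × (κ → ℂ) =>
      X * (om p x : ℂ) * gfn p (a * x) * (nrm x : ℂ) ^ (s - 1)) =
      fun x => (X * om p a * (nrm a : ℂ) ^ (1 - s)) *
        ((om p (a * x) : ℂ) * gfn p (a * x) * (nrm (a * x) : ℂ) ^ (s - 1)) := by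
    ext x
    rw [om_mul, nrm_mul, Complex.ofReal_mul, Complex.ofReal_mul,
      Complex.mul_cpow_ofReal_nonneg ha0.le (nrm_nonneg x)]
    have : (nrm a : ℂ) ^ (1 - s) * (nrm a : ℂ) ^ (s - 1) = 1 := by
      rw [← Complex.cpow_add _ _ hac]; simp
    linear_combination (-(X * (om p x : ℂ) * gfn p (a * x) * (nrm x : ℂ) ^ (s - 1) *
      ((om p a : ℝ) : ℂ) * om p a)) * this -
      (X * (om p x : ℂ) * gfn p (a * x) * (nrm x : ℂ) ^ (s - 1)) * hom
  have e2 : ∀ x : (ι → ℝ) × (κ → ℂ), ‖X * (om p x : ℂ) * gfn p (a * x) * (nrm x : ℂ) ^ (s - 1)‖ =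
      ‖X * om p a * (nrm a : ℂ) ^ (1 - s)‖ *
        ‖(om p (a * x) : ℂ) * gfn p (a * x) * (nrm (a * x) : ℂ) ^ (s - 1)‖ := fun x => by
    rw [← norm_mul]; exact congrArg norm (congrFun e1 x)
  simp_rw [e2]
  rw [e1]
  refine ⟨(integrable_comp_mul ha h1).const_mul _, ?_, ?_⟩
  swap
  · rw [integral_const_mul, integral_comp_mul_real ha (fun x => ‖(om p x : ℂ) * gfn p x *
      (nrm x : ℂ) ^ (s - 1)‖), ← mul_assoc]
    congr 1
    rw [norm_mul, norm_mul, Complex.norm_real, Real.norm_eq_abs, abs_om p ha,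
      norm_ofReal_cpow_of_pos ha0, mul_one, mul_assoc]
    congr 1
    rw [← Real.rpow_neg_one, ← Real.rpow_add ha0]
    congr 1
    simp; ring
  rw [integral_const_mul, integral_comp_mul ha (fun x => (om p x : ℂ) * gfn p x *
    (nrm x : ℂ) ^ (s - 1)), h2]
  have : (nrm a : ℂ) ^ (1 - s) * (((nrm a)⁻¹ : ℝ) : ℂ) = (nrm a : ℂ) ^ (-s) := by
    rw [show 1 - s = -s + 1 by ring, Complex.cpow_add _ _ hac, Complex.cpow_one,
      Complex.ofReal_inv, mul_assoc, mul_inv_cancel₀ hac, mul_one]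
  rw [← this]
  ring

lemma dual_term (p : ι → Bool) {a : (ι → ℝ) × (κ → ℂ)} (ha : nrm a ≠ 0) (X : ℂ) {s : ℂ}
    (hs : s.re < 1) :
    Integrable (fun x : (ι → ℝ) × (κ → ℂ) =>
      X * (om p x : ℂ) * gfn p (a * x⁻¹) * (nrm x : ℂ) ^ (s - 2)) ∧
    ∫ x : (ι → ℝ) × (κ → ℂ), X * (om p x : ℂ) * gfn p (a * x⁻¹) * (nrm x : ℂ) ^ (s - 2) =
      X * om p a * (nrm a : ℂ) ^ (s - 1) * ZF κ p (1 - s) ∧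
    ∫ x : (ι → ℝ) × (κ → ℂ), ‖X * (om p x : ℂ) * gfn p (a * x⁻¹) * (nrm x : ℂ) ^ (s - 2)‖ =
      ‖X‖ * nrm a ^ (s.re - 1) *
        ∫ x : (ι → ℝ) × (κ → ℂ), ‖(om p x : ℂ) * gfn p x⁻¹ * (nrm x : ℂ) ^ (s - 2)‖ := by
  obtain ⟨h1, h2⟩ := integral_dual_kernel (κ := κ) p hs
  have ha0 : 0 < nrm a := lt_of_le_of_ne (nrm_nonneg a) ha.symm
  have hac : (nrm a : ℂ) ≠ 0 := by exact_mod_cast ha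
  have hom : ((om p a : ℝ) : ℂ) * om p a = 1 := by exact_mod_cast om_mul_self p ha
  have hai : nrm a⁻¹ ≠ 0 := by rw [nrm_inv]; exact inv_ne_zero ha
  have e1 : (fun x : (ι → ℝ) × (κ → ℂ) =>
      X * (om p x : ℂ) * gfn p (a * x⁻¹) * (nrm x : ℂ) ^ (s - 2)) =
      fun x => (X * om p a * (nrm a : ℂ) ^ (s - 2)) *
        ((om p (a⁻¹ * x) : ℂ) * gfn p (a⁻¹ * x)⁻¹ * (nrm (a⁻¹ * x) : ℂ) ^ (s - 2)) := by
    ext x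
    have hoi : om p a⁻¹ = om p a := by
      simp only [om, Prod.fst_inv, Pi.inv_apply, sg_inv]
    rw [inv_mul_of_nrm_one (by rw [mul_comm]; exact mul_inv_of_nrm ha), om_mul, hoi, nrm_mul,
      Complex.ofReal_mul, Complex.ofReal_mul,
      Complex.mul_cpow_ofReal_nonneg (nrm_nonneg _) (nrm_nonneg x), nrm_inv, ofReal_inv_cpow ha0]
    have : (nrm a : ℂ) ^ (s - 2) * (nrm a : ℂ) ^ (-(s - 2)) = 1 := by
      rw [← Complex.cpow_add _ _ hac]; simp
    linear_combination (-(X * (om p x : ℂ) * gfn p (a * x⁻¹) * (nrm x : ℂ) ^ (s - 2) *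
      ((om p a : ℝ) : ℂ) * om p a)) * this -
      (X * (om p x : ℂ) * gfn p (a * x⁻¹) * (nrm x : ℂ) ^ (s - 2)) * hom
  have e2 : ∀ x : (ι → ℝ) × (κ → ℂ), ‖X * (om p x : ℂ) * gfn p (a * x⁻¹) * (nrm x : ℂ) ^ (s - 2)‖ =
      ‖X * om p a * (nrm a : ℂ) ^ (s - 2)‖ *
        ‖(om p (a⁻¹ * x) : ℂ) * gfn p (a⁻¹ * x)⁻¹ * (nrm (a⁻¹ * x) : ℂ) ^ (s - 2)‖ := fun x => by
    rw [← norm_mul]; exact congrArg norm (congrFun e1 x)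
  simp_rw [e2]
  rw [e1]
  refine ⟨(integrable_comp_mul hai h1).const_mul _, ?_, ?_⟩
  swap
  · rw [integral_const_mul, integral_comp_mul_real hai (fun x => ‖(om p x : ℂ) * gfn p x⁻¹ *
      (nrm x : ℂ) ^ (s - 2)‖), ← mul_assoc]
    congr 1
    rw [norm_mul, norm_mul, Complex.norm_real, Real.norm_eq_abs, abs_om p ha,
      norm_ofReal_cpow_of_pos ha0, mul_one, mul_assoc, nrm_inv, inv_inv]
    congr 1
    nth_rewrite 2 [← Real.rpow_one (nrm a)]
    rw [← Real.rpow_add ha0]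
    congr 1
    simp; ring
  rw [integral_const_mul, integral_comp_mul hai (fun x => (om p x : ℂ) * gfn p x⁻¹ *
    (nrm x : ℂ) ^ (s - 2)), h2]
  have : (nrm a : ℂ) ^ (s - 2) * (((nrm a⁻¹)⁻¹ : ℝ) : ℂ) = (nrm a : ℂ) ^ (s - 1) := by
    rw [nrm_inv, inv_inv, show s - 1 = s - 2 + 1 by ring, Complex.cpow_add _ _ hac,
      Complex.cpow_one]
  rw [← this]
  ring

lemma om_conj (h : FundWeight Γ e R) (p : ι → Bool) (u : Γ) : om p (e u⁻¹) = om p (e u) := by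
  have h1 : om p (e u) * om p (e u⁻¹) = 1 := by
    rw [← om_mul, ← map_mul, mul_inv_cancel, map_one]
    simp [om, sg_one]
  have h2 := om_mul_self p (h.nrm_ne u)
  have h3 : om p (e u) ≠ 0 := fun h0 => by simp [h0] at h2
  exact mul_left_cancel₀ h3 (h1.trans h2.symm)

/-- Meromorphic continuation and functional equation of the Mellin transform of a theta series. -/
theorem theta_mellin (h : FundWeight Γ e R) (hd : 0 < Fintype.card ι + 2 * Fintype.card κ)
    {J₁ J₂ : Type*} [Countable J₁] [Countable J₂] (p : ι → Bool)
    (a : J₁ → (ι → ℝ) × (κ → ℂ)) (ha : ∀ j, nrm (a j) ≠ 0) (X : J₁ → ℂ)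
    (b : J₂ → (ι → ℝ) × (κ → ℂ)) (hb : ∀ j, nrm (b j) ≠ 0) (G : J₂ → ℂ) (C x₀ g₀ : ℂ)
    (hX : ∀ σ : ℝ, 1 < σ → Summable fun j => ‖X j‖ * nrm (a j) ^ (-σ))
    (hG : ∀ σ : ℝ, σ < 0 → Summable fun j => ‖G j‖ * nrm (b j) ^ (σ - 1))
    (hP : ∀ x : (ι → ℝ) × (κ → ℂ), nrm x ≠ 0 →
      (∑' i : Γ × J₁, om p (e i.1) * X i.2 * gfn p (e i.1 * a i.2 * x)) + x₀ * gfn p (0 : (ι → ℝ) × (κ → ℂ)) =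
      C * (nrm x : ℂ)⁻¹ *
        ((∑' i : Γ × J₂, om p (e i.1) * G i.2 * gfn p (e i.1 * b i.2 * x⁻¹)) + g₀ * gfn p (0 : (ι → ℝ) × (κ → ℂ)))) :
    ∃ Λ₀ : ℂ → ℂ, Differentiable ℂ Λ₀ ∧
      (∀ a b : ℝ, ∃ M : ℝ, ∀ s : ℂ, a ≤ s.re → s.re ≤ b → ‖Λ₀ s‖ ≤ M) ∧
      (∀ s : ℂ, 1 < s.re → (∑' j, X j * om p (a j) * (nrm (a j) : ℂ) ^ (-s)) * ZF κ p s =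
        Λ₀ s + gfn p (0 : (ι → ℝ) × (κ → ℂ)) *
          ((FundWeight.nuR R (Set.Iic 1)).toReal : ℂ) * (C * g₀ / (s - 1) - x₀ / s)) ∧
      (∀ s : ℂ, s.re < 0 →
        C * ((∑' j, G j * om p (b j) * (nrm (b j) : ℂ) ^ (s - 1)) * ZF κ p (1 - s)) =
        Λ₀ s + gfn p (0 : (ι → ℝ) × (κ → ℂ)) *
          ((FundWeight.nuR R (Set.Iic 1)).toReal : ℂ) * (C * g₀ / (s - 1) - x₀ / s)) := by
  set F₁ : (ι → ℝ) × (κ → ℂ) → ℂ := fun x => R x * om p x *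
    ∑' i : Γ × J₁, om p (e i.1) * X i.2 * gfn p (e i.1 * a i.2 * x) with hF₁
  set F₂ : (ι → ℝ) × (κ → ℂ) → ℂ := fun x => R x * om p x *
    ∑' i : Γ × J₂, om p (e i.1) * G i.2 * gfn p (e i.1 * b i.2 * x⁻¹) with hF₂
  have key := mellin_split (μ := (volume : Measure ((ι → ℝ) × (κ → ℂ)))) (N := nrm)
    (F₁ := F₁) (F₂ := F₂) (R := fun x => (R x : ℂ)) (c := gfn p (0 : (ι → ℝ) × (κ → ℂ)))
    (κ := C) (g₀ := g₀) (x₀ := x₀) (V := ((FundWeight.nuR R (Set.Iic 1)).toReal : ℂ))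
    (Z₁ := fun s => (∑' j, X j * om p (a j) * (nrm (a j) : ℂ) ^ (-s)) * ZF κ p s)
    (Z₂ := fun s => (∑' j, G j * om p (b j) * (nrm (b j) : ℂ) ^ (s - 1)) * ZF κ p (1 - s))
    continuous_nrm.measurable
    (by filter_upwards [ae_nrm_ne_zero] with x hx; exact lt_of_le_of_ne (nrm_nonneg x) hx.symm)
    ?_ ?_ (fun z hz => h.integral_nrm_cpow_lt hd hz) (fun z hz => h.integral_nrm_cpow_ge hd hz) ?_
  · obtain ⟨Λ₀, k1, k2, k3, k4⟩ := key
    exact ⟨Λ₀, k1, k2, k3, k4⟩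
  · intro s hs
    have hs0 : 0 < s.re := by linarith
    have hu := h.unfold_sum (J := J₁) (fun j x => X j * (om p x : ℂ) * gfn p (a j * x) *
      (nrm x : ℂ) ^ (s - 1)) (fun j => (primal_term p (ha j) (X j) hs0).1) ?_ (Equiv.refl Γ)
    · have e1 : (fun x => F₁ x * (nrm x : ℂ) ^ (s - 1)) = fun x => ∑' i : Γ × J₁, (R x : ℂ) *
          (X i.2 * (om p (e ((Equiv.refl Γ) i.1) * x) : ℂ) * gfn p (a i.2 * (e ((Equiv.refl Γ) i.1) * x)) *
          (nrm (e ((Equiv.refl Γ) i.1) * x) : ℂ) ^ (s - 1)) := by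
        ext x
        rw [hF₁]
        beta_reduce
        rw [← tsum_mul_left, ← tsum_mul_right]
        refine tsum_congr fun i => ?_
        rw [om_mul, nrm_mul, Equiv.refl_apply, h.nrm_one, one_mul,
          show a i.2 * (e i.1 * x) = e i.1 * a i.2 * x by ring]
        push_cast
        ring
      rw [e1]
      refine ⟨hu.1, hu.2.2.trans ?_⟩
      rw [← tsum_mul_right]
      exact tsum_congr fun j => (primal_term p (ha j) (X j) hs0).2.1
    · simp_rw [fun j => (primal_term p (ha j) (X j) hs0).2.2]
      exact (hX _ hs).mul_right _
  · intro s hs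
    have hs0 : s.re < 1 := by linarith
    have hu := h.unfold_sum (J := J₂) (fun j x => G j * (om p x : ℂ) * gfn p (b j * x⁻¹) *
      (nrm x : ℂ) ^ (s - 2)) (fun j => (dual_term p (hb j) (G j) hs0).1) ?_ (Equiv.inv Γ)
    · have e1 : (fun x => F₂ x * (nrm x : ℂ) ^ (s - 2)) = fun x => ∑' i : Γ × J₂, (R x : ℂ) *
          (G i.2 * (om p (e ((Equiv.inv Γ) i.1) * x) : ℂ) *
          gfn p (b i.2 * (e ((Equiv.inv Γ) i.1) * x)⁻¹) *
          (nrm (e ((Equiv.inv Γ) i.1) * x) : ℂ) ^ (s - 2)) := by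
        ext x
        rw [hF₂]
        beta_reduce
        rw [← tsum_mul_left, ← tsum_mul_right]
        refine tsum_congr fun i => ?_
        rw [om_mul, nrm_mul, Equiv.inv_apply, h.nrm_one, one_mul, om_conj h,
          inv_mul_of_nrm_one (u := e i.1⁻¹) (v := e i.1) (by rw [← map_mul, inv_mul_cancel, map_one]),
          show b i.2 * (e i.1 * x⁻¹) = e i.1 * b i.2 * x⁻¹ by ring]
        push_cast
        ring
      rw [e1]
      refine ⟨hu.1, hu.2.2.trans ?_⟩
      rw [← tsum_mul_right]
      exact tsum_congr fun j => (dual_term p (hb j) (G j) hs0).2.1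
    · simp_rw [fun j => (dual_term p (hb j) (G j) hs0).2.2]
      exact (hG _ hs).mul_right _
  · filter_upwards [ae_nrm_ne_zero] with x hx
    have h1 := hP x hx
    have h2 := om_mul_gfn_zero p x
    simp only [hF₁, hF₂]
    linear_combination (R x * om p x : ℂ) * h1 + (C * (nrm x : ℂ)⁻¹ * g₀ * R x - x₀ * R x) * h2

end Theta

section UnitWeight

open scoped Classical
open MeasureTheory NumberField.InfinitePlace NumberField.mixedEmbedding NumberField.Units
open NumberField.mixedEmbedding.fundamentalCone

variable (K : Type*) [Field K] [NumberField K]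

lemma countable_ringOfIntegers : Countable (𝓞 K) :=
  (Module.Free.chooseBasis ℤ (𝓞 K)).repr.toEquiv.countable_iff.2 inferInstance

lemma countable_units : Countable (𝓞 K)ˣ :=
  haveI := countable_ringOfIntegers K
  Function.Injective.countable Units.val_injective

/-- The diagonal embedding of the unit group in the mixed space. -/
def unitEmb : (𝓞 K)ˣ →* mixedSpace K :=
  ((mixedEmbedding K : K →* mixedSpace K).comp (algebraMap (𝓞 K) K : 𝓞 K →* K)).comp
    (Units.coeHom (𝓞 K))

omit [NumberField K] in
lemma unitEmb_apply (u : (𝓞 K)ˣ) : unitEmb K u = mixedEmbedding K (u : K) := rfl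

omit [NumberField K] in
lemma unitEmb_mul (u : (𝓞 K)ˣ) (x : mixedSpace K) : unitEmb K u * x = u • x := rfl

variable {K}

lemma nrm_eq_norm (x : mixedSpace K) : nrm x = mixedEmbedding.norm x := by
  rw [mixedEmbedding.norm_apply, nrm, ← Finset.prod_mul_prod_compl
    (Finset.univ.filter fun w : InfinitePlace K => w.IsReal)]
  rw [← Finset.prod_subtype_eq_prod_filter]
  congr 1
  · simp only [Finset.subtype_univ]
    refine Finset.prod_congr rfl fun w _ => ?_
    rw [normAtPlace_apply_of_isReal w.2, mult_isReal w, pow_one, Real.norm_eq_abs]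
  · rw [Finset.compl_filter, ← Finset.prod_subtype_eq_prod_filter]
    simp only [Finset.subtype_univ]
    refine Fintype.prod_equiv (Equiv.subtypeEquivRight fun w => not_isReal_iff_isComplex.symm) _ _
      fun w => ?_
    have hw := w.2
    rw [show ((Equiv.subtypeEquivRight fun w : InfinitePlace K => not_isReal_iff_isComplex.symm) w :
      InfinitePlace K) = w.1 from rfl]
    rw [normAtPlace_apply_of_isComplex hw, mult_isComplex w]

variable (K)

/-- The normalised indicator of the fundamental cone. -/
def coneWeight : mixedSpace K → ℝ :=
  (fundamentalCone K).indicator fun _ => ((torsionOrder K : ℝ))⁻¹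

lemma fundWeight_cone : FundWeight (𝓞 K)ˣ (unitEmb K) (coneWeight K) where
  nrm_one u := by
    rw [nrm_eq_norm, unitEmb_apply]
    exact norm_unit u
  meas := measurable_const.indicator (measurableSet_fundamentalCone K)
  nonneg x := Set.indicator_nonneg (fun _ _ => by positivity) x
  le_one x := by
    refine Set.indicator_le' (fun _ _ => ?_) (fun _ _ => zero_le_one) x
    exact inv_le_one_of_one_le₀ (by exact_mod_cast torsionOrder_pos K)
  sum_one x hx := by
    rw [nrm_eq_norm] at hx
    obtain ⟨u₀, h₀⟩ := exists_unit_smul_mem hx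
    have key : ∀ u : (𝓞 K)ˣ, coneWeight K (unitEmb K (u * u₀) * x) =
        (torsion K : Set (𝓞 K)ˣ).indicator (fun _ => ((torsionOrder K : ℝ))⁻¹) u := by
      intro u
      rw [unitEmb_mul, mul_smul, coneWeight]
      by_cases h : u ∈ torsion K
      · rw [Set.indicator_of_mem ((unit_smul_mem_iff_mem_torsion h₀ u).2 h),
          Set.indicator_of_mem (by exact h)]
      · rw [Set.indicator_of_notMem (fun h' => h ((unit_smul_mem_iff_mem_torsion h₀ u).1 h')),
          Set.indicator_of_notMem (by exact h)]
    rw [← (Equiv.mulRight u₀).hasSum_iff]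
    have : ((fun u => coneWeight K (unitEmb K u * x)) ∘ ⇑(Equiv.mulRight u₀)) =
        (torsion K : Set (𝓞 K)ˣ).indicator (fun _ => ((torsionOrder K : ℝ))⁻¹) := by
      funext u; exact key u
    rw [this, ← hasSum_subtype_iff_indicator]
    let _ : Fintype (torsion K) := Fintype.ofFinite _
    have h2 : HasSum (fun _ : torsion K => ((torsionOrder K : ℝ))⁻¹)
        (∑ _u : torsion K, ((torsionOrder K : ℝ))⁻¹) := hasSum_fintype _
    have h3 : (∑ _u : torsion K, ((torsionOrder K : ℝ))⁻¹) = 1 := by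
      rw [Finset.sum_const, Finset.card_univ, nsmul_eq_mul, ← Nat.card_eq_fintype_card]
      exact mul_inv_cancel₀ (by exact_mod_cast torsionOrder_ne_zero K)
    rw [h3] at h2
    exact h2
  scale c x hc := by
    simp only [coneWeight, Set.indicator, smul_mem_iff_mem hc.ne']
  fin := by
    have hm := measurableSet_fundamentalCone K
    unfold coneWeight
    rw [IntegrableOn, integrable_indicator_iff hm]
    refine integrableOn_const (hs := ?_) (hC := by simp)
    rw [Measure.restrict_apply hm]
    have : fundamentalCone K ∩ {x | nrm x ≤ 1} = normLeOne K := by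
      ext x; rw [mem_normLeOne, Set.mem_inter_iff, Set.mem_ofPred_eq, nrm_eq_norm]
    rw [this]
    exact (isBounded_normLeOne K).measure_lt_top.ne

end UnitWeight

section IdealZeta

open scoped Classical

variable {K : Type*} [Field K] [NumberField K]

lemma nK_pos : 0 < nK K := Module.finrank_pos

lemma nK_ge_one : (1 : ℝ) ≤ nK K := by exact_mod_cast nK_pos (K := K)

lemma absNorm_pos {I : Ideal (𝓞 K)} (hI : I ≠ ⊥) : (0 : ℝ) < Ideal.absNorm I := by
  have : Ideal.absNorm I ≠ 0 := fun h => hI (Ideal.absNorm_eq_zero_iff.1 h)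
  exact_mod_cast Nat.pos_of_ne_zero this

lemma absNorm_ge_one {I : Ideal (𝓞 K)} (hI : I ≠ ⊥) : (1 : ℝ) ≤ Ideal.absNorm I := by
  exact_mod_cast Nat.cast_pos.1 (absNorm_pos hI)

lemma two_le_absNorm_of_prime {p : Ideal (𝓞 K)} (hp : Prime p) : 2 ≤ Ideal.absNorm p := by
  have h0 : Ideal.absNorm p ≠ 0 := fun h => hp.ne_zero (Ideal.absNorm_eq_zero_iff.1 h)
  have h1 : Ideal.absNorm p ≠ 1 := fun h =>
    hp.not_isUnit (Ideal.isUnit_iff.2 (Ideal.absNorm_eq_one_iff.1 h))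
  omega

/-- The finite set of ideal divisors of a nonzero ideal. -/
def idealDivisors (q : Ideal (𝓞 K)) : Finset (Ideal (𝓞 K)) :=
  if h : q ≠ ⊥ then
    (((UniqueFactorizationMonoid.fintypeSubtypeDvd q h).elems).map (Function.Embedding.subtype _))
  else ∅

lemma mem_idealDivisors {q : Ideal (𝓞 K)} (hq : q ≠ ⊥) (g : Ideal (𝓞 K)) :
    g ∈ idealDivisors q ↔ g ∣ q := by
  rw [idealDivisors, dif_pos hq]
  simp only [Finset.mem_map, Function.Embedding.coe_subtype, Subtype.exists, exists_and_right,
    exists_eq_right]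
  constructor
  · rintro ⟨h, -⟩; exact h
  · intro h
    exact ⟨h, (UniqueFactorizationMonoid.fintypeSubtypeDvd q hq).complete ⟨g, h⟩⟩

lemma divisor_sieve {q : Ideal (𝓞 K)} (hq : q ≠ ⊥) (σ : ℝ) (hσ : 0 < σ)
    (S : Finset (Ideal (𝓞 K))) (hS : ∀ p ∈ S, Prime p) :
    (∏ p ∈ S, (1 - (Ideal.absNorm p : ℝ) ^ (-σ))) *
      ∑ g ∈ idealDivisors q, (Ideal.absNorm g : ℝ) ^ (-σ) ≤
      ∑ g ∈ (idealDivisors q).filter (fun g => ∀ p ∈ S, ¬ p ∣ g),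
        (Ideal.absNorm g : ℝ) ^ (-σ) := by
  induction S using Finset.induction_on with
  | empty => simp
  | insert p S hpS ih =>
    have hp := hS p (Finset.mem_insert_self _ _)
    have ih := ih fun p' h => hS p' (Finset.mem_insert_of_mem h)
    have hN := two_le_absNorm_of_prime hp
    have hx1 : 0 ≤ 1 - (Ideal.absNorm p : ℝ) ^ (-σ) := by
      have : (Ideal.absNorm p : ℝ) ^ (-σ) ≤ 1 :=
        Real.rpow_le_one_of_one_le_of_nonpos (by exact_mod_cast (by omega)) (by linarith)
      linarith
    rw [Finset.prod_insert hpS, mul_assoc]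
    refine (mul_le_mul_of_nonneg_left ih hx1).trans ?_
    set D := (idealDivisors q).filter (fun g => ∀ p ∈ S, ¬ p ∣ g) with hD
    have e1 : (idealDivisors q).filter (fun g => ∀ p' ∈ insert p S, ¬ p' ∣ g) =
        D.filter (fun g => ¬ p ∣ g) := by
      rw [hD, Finset.filter_filter]
      refine Finset.filter_congr fun g _ => ?_
      simp only [Finset.mem_insert, forall_eq_or_imp]
      tauto
    rw [e1]
    have e2 := Finset.sum_filter_add_sum_filter_not D (fun g => p ∣ g)
      (fun g => (Ideal.absNorm g : ℝ) ^ (-σ))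
    have e3 : ∑ g ∈ D.filter (fun g => p ∣ g), (Ideal.absNorm g : ℝ) ^ (-σ) ≤
        (Ideal.absNorm p : ℝ) ^ (-σ) * ∑ g ∈ D, (Ideal.absNorm g : ℝ) ^ (-σ) := by
      have hsub : D.filter (fun g => p ∣ g) ⊆ D.image (fun g => p * g) := by
        intro g hg
        rw [Finset.mem_filter] at hg
        obtain ⟨hgD, g', rfl⟩ := hg
        refine Finset.mem_image.2 ⟨g', ?_, rfl⟩
        rw [hD, Finset.mem_filter, mem_idealDivisors hq] at hgD ⊢
        exact ⟨(dvd_mul_left _ _).trans hgD.1, fun p' h h' => hgD.2 p' h (h'.mul_left _)⟩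
      refine (Finset.sum_le_sum_of_subset_of_nonneg hsub fun _ _ _ => by positivity).trans ?_
      rw [Finset.sum_image (fun a _ b _ h => mul_left_cancel₀ hp.ne_zero h), Finset.mul_sum]
      refine (Finset.sum_congr rfl fun g _ => ?_).le
      rw [map_mul, Nat.cast_mul, Real.mul_rpow (by positivity) (by positivity)]
    nlinarith

/-- The finite set of prime ideal divisors. -/
def idealPrimes (q : Ideal (𝓞 K)) : Finset (Ideal (𝓞 K)) :=
  (idealDivisors q).filter Prime

lemma mem_idealPrimes {q : Ideal (𝓞 K)} (hq : q ≠ ⊥) (g : Ideal (𝓞 K)) :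
    g ∈ idealPrimes q ↔ g ∣ q ∧ Prime g := by
  rw [idealPrimes, Finset.mem_filter, mem_idealDivisors hq]

lemma exists_prime_dvd {g : Ideal (𝓞 K)} (h0 : g ≠ ⊥) (h1 : g ≠ ⊤) : ∃ p, Prime p ∧ p ∣ g := by
  obtain ⟨p, hp, hd⟩ := WfDvdMonoid.exists_irreducible_factor
    (fun h => h1 (Ideal.isUnit_iff.1 h)) h0
  exact ⟨p, hp.prime, hd⟩

lemma sum_idealDivisors_le {q : Ideal (𝓞 K)} (hq : q ≠ ⊥) (σ : ℝ) (hσ : 0 < σ) :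
    ∑ g ∈ idealDivisors q, (Ideal.absNorm g : ℝ) ^ (-σ) ≤
      ∏ p ∈ idealPrimes q, (1 - (Ideal.absNorm p : ℝ) ^ (-σ))⁻¹ := by
  have h := divisor_sieve hq σ hσ (idealPrimes q) fun p h => ((mem_idealPrimes hq p).1 h).2
  have e : (idealDivisors q).filter (fun g => ∀ p ∈ idealPrimes q, ¬ p ∣ g) ⊆ {⊤} := by
    intro g hg
    rw [Finset.mem_filter, mem_idealDivisors hq] at hg
    rw [Finset.mem_singleton]
    by_contra h1
    have h0 : g ≠ ⊥ := by
      rintro rfl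
      exact hq (zero_dvd_iff.1 hg.1)
    obtain ⟨p, hp, hd⟩ := exists_prime_dvd h0 h1
    exact hg.2 p ((mem_idealPrimes hq p).2 ⟨hd.trans hg.1, hp⟩) hd
  have h2 := h.trans (Finset.sum_le_sum_of_subset_of_nonneg e fun _ _ _ => by positivity)
  rw [Finset.sum_singleton, Ideal.absNorm_top, Nat.cast_one, Real.one_rpow] at h2
  have hpos : 0 < ∏ p ∈ idealPrimes q, (1 - (Ideal.absNorm p : ℝ) ^ (-σ)) := by
    refine Finset.prod_pos fun p hp => ?_
    have := two_le_absNorm_of_prime ((mem_idealPrimes hq p).1 hp).2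
    have : (Ideal.absNorm p : ℝ) ^ (-σ) < 1 :=
      Real.rpow_lt_one_of_one_lt_of_neg (by exact_mod_cast (by omega)) (by linarith)
    linarith
  rw [Finset.prod_inv_distrib, ← one_div, le_div_iff₀ hpos, mul_comm]
  exact h2

omit [NumberField K] in
lemma list_prod_mem_prime {p : Ideal (𝓞 K)} (hp : p.IsPrime) (l : List (𝓞 K)) (h : l.prod ∈ p) :
    ∃ x ∈ l, x ∈ p := by
  induction l with
  | nil => exact absurd ((Ideal.eq_top_iff_one _).2 (by simpa using h)) hp.ne_top
  | cons a l ih =>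
    rw [List.prod_cons] at h
    rcases hp.mem_or_mem h with h | h
    · exact ⟨a, List.mem_cons_self, h⟩
    · obtain ⟨x, hx, hxp⟩ := ih h
      exact ⟨x, List.mem_cons_of_mem _ hx, hxp⟩

lemma exists_rational_prime {p : Ideal (𝓞 K)} (hp : Prime p) :
    ∃ ℓ : ℕ, ℓ.Prime ∧ (ℓ : 𝓞 K) ∈ p ∧ ℓ ≤ Ideal.absNorm p := by
  have hN := two_le_absNorm_of_prime hp
  have hpp := Ideal.isPrime_of_prime hp
  have hm := Ideal.absNorm_mem p
  rw [← Nat.prod_primeFactorsList (n := Ideal.absNorm p) (by omega), Nat.cast_list_prod] at hm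
  obtain ⟨x, hx, hxp⟩ := list_prod_mem_prime hpp _ hm
  obtain ⟨ℓ, hℓ, rfl⟩ := List.mem_map.1 hx
  exact ⟨ℓ, Nat.prime_of_mem_primeFactorsList hℓ, hxp,
    Nat.le_of_dvd (by omega) (Nat.dvd_of_mem_primeFactorsList hℓ)⟩

/-- A rational prime below a prime ideal. -/
def below (p : Ideal (𝓞 K)) : ℕ := if hp : Prime p then (exists_rational_prime hp).choose else 0

lemma below_spec {p : Ideal (𝓞 K)} (hp : Prime p) :
    (below p).Prime ∧ (below p : 𝓞 K) ∈ p ∧ below p ≤ Ideal.absNorm p := by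
  rw [below, dif_pos hp]
  exact (exists_rational_prime hp).choose_spec

lemma prod_primes_dvd {q : Ideal (𝓞 K)} (S : Finset (Ideal (𝓞 K)))
    (hS : ∀ p ∈ S, Prime p ∧ p ∣ q) : ∏ p ∈ S, p ∣ q := by
  refine Finset.prod_dvd_of_coprime (fun p hp p' hp' hne => ?_) fun p hp => (hS p hp).2
  have h1 : p.IsPrime := Ideal.isPrime_of_prime (hS p hp).1
  have h2 : p'.IsPrime := Ideal.isPrime_of_prime (hS p' hp').1
  have h3 := h1.isMaximal (hS p hp).1.ne_zero
  have h4 := h2.isMaximal (hS p' hp').1.ne_zero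
  exact Ideal.isCoprime_of_isMaximal hne

lemma card_below_le (S : Finset (Ideal (𝓞 K))) (hS : ∀ p ∈ S, Prime p) (ℓ : ℕ) :
    (S.filter fun p => below p = ℓ).card ≤ nK K := by
  rcases (S.filter fun p => below p = ℓ).eq_empty_or_nonempty with h | ⟨p₀, h₀⟩
  · rw [h]; simp
  have hℓ : ℓ.Prime := by
    rw [Finset.mem_filter] at h₀
    rw [← h₀.2]
    exact (below_spec (hS _ h₀.1)).1
  have hd : ∏ p ∈ S.filter (fun p => below p = ℓ), p ∣ Ideal.span {(ℓ : 𝓞 K)} := by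
    refine prod_primes_dvd _ fun p hp => ?_
    rw [Finset.mem_filter] at hp
    refine ⟨hS p hp.1, ?_⟩
    rw [Ideal.dvd_span_singleton, ← hp.2]
    exact (below_spec (hS p hp.1)).2.1
  have h1 := Nat.le_of_dvd (by
    rw [Ideal.absNorm_span_natCast]; exact pow_pos hℓ.pos _)
    (Ideal.absNorm_dvd_absNorm_of_le (Ideal.dvd_iff_le.1 hd))
  rw [Ideal.absNorm_span_natCast, map_prod, RingOfIntegers.rank] at h1
  have h2 : ℓ ^ (S.filter fun p => below p = ℓ).card ≤
      ∏ p ∈ S.filter (fun p => below p = ℓ), Ideal.absNorm p := by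
    rw [← Finset.prod_const]
    refine Finset.prod_le_prod' fun p hp => ?_
    rw [Finset.mem_filter] at hp
    rw [← hp.2]
    exact (below_spec (hS p hp.1)).2.2
  exact (Nat.pow_le_pow_iff_right hℓ.one_lt).1 (h2.trans h1)

lemma sum_nat_rpow_le (A : Finset ℕ) (hA : ∀ m ∈ A, 2 ≤ m) (σ : ℝ) (hσ : 1 < σ) :
    ∑ m ∈ A, (m : ℝ) ^ (-σ) ≤ 1 / (σ - 1) := by
  have hsub : A ⊆ Finset.Ico 2 (A.sup id + 3) := fun m hm => by
    rw [Finset.mem_Ico]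
    have : m ≤ A.sup id := Finset.le_sup (f := id) hm
    exact ⟨hA m hm, by omega⟩
  refine (Finset.sum_le_sum_of_subset_of_nonneg hsub fun _ _ _ => by positivity).trans ?_
  set N := A.sup id with hN
  have h := AntitoneOn.sum_le_integral_Ico (a := 1) (b := N + 2) (f := fun x : ℝ => x ^ (-σ))
    (by omega) (fun x hx y hy hxy => by
      rw [Set.mem_Icc] at hx
      push_cast at hx
      exact Real.rpow_le_rpow_of_nonpos (by linarith [hx.1]) hxy (by linarith))
  have e : ∑ m ∈ Finset.Ico 2 (N + 3), (m : ℝ) ^ (-σ) =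
      ∑ i ∈ Finset.Ico 1 (N + 2), ((i + 1 : ℕ) : ℝ) ^ (-σ) :=
    (Finset.sum_Ico_add' (fun m : ℕ => (m : ℝ) ^ (-σ)) 1 (N + 2) 1).symm
  rw [e]
  refine h.trans ?_
  rw [integral_rpow (Or.inr ⟨by linarith, by
    rw [Set.uIcc_of_le (by push_cast; linarith [(Nat.cast_nonneg N : (0:ℝ) ≤ N)])]
    simp⟩)]
  rw [Nat.cast_one, Real.one_rpow, show -σ + 1 = -(σ - 1) by ring, div_neg, ← neg_div, neg_sub]
  exact div_le_div_of_nonneg_right (by linarith [Real.rpow_nonneg (Nat.cast_nonneg (N + 2) : (0:ℝ) ≤ _) (-(σ - 1))])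
    (by linarith)

lemma sum_primes_rpow_le (S : Finset (Ideal (𝓞 K))) (hS : ∀ p ∈ S, Prime p) (σ : ℝ) (hσ : 1 < σ) :
    ∑ p ∈ S, (Ideal.absNorm p : ℝ) ^ (-σ) ≤ nK K / (σ - 1) := by
  have h1 : ∑ p ∈ S, (Ideal.absNorm p : ℝ) ^ (-σ) ≤ ∑ p ∈ S, (below p : ℝ) ^ (-σ) := by
    refine Finset.sum_le_sum fun p hp => ?_
    have := below_spec (hS p hp)
    exact Real.rpow_le_rpow_of_nonpos (by exact_mod_cast this.1.pos) (by exact_mod_cast this.2.2)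
      (by linarith)
  refine h1.trans ?_
  rw [← Finset.sum_fiberwise_of_maps_to (t := S.image below)
    (fun p hp => Finset.mem_image_of_mem _ hp)]
  have h2 : ∀ ℓ ∈ S.image below, ∑ p ∈ S with below p = ℓ, (below p : ℝ) ^ (-σ) ≤
      nK K * (ℓ : ℝ) ^ (-σ) := by
    intro ℓ _
    rw [Finset.sum_congr rfl (g := fun _ => (ℓ : ℝ) ^ (-σ)) fun p hp => by
      rw [(Finset.mem_filter.1 hp).2], Finset.sum_const, nsmul_eq_mul]
    exact mul_le_mul_of_nonneg_right (by exact_mod_cast card_below_le S hS ℓ) (by positivity)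
  refine (Finset.sum_le_sum h2).trans ?_
  rw [← Finset.mul_sum, div_eq_mul_one_div]
  refine mul_le_mul_of_nonneg_left (sum_nat_rpow_le _ (fun m hm => ?_) σ hσ) (Nat.cast_nonneg _)
  obtain ⟨p, hp, rfl⟩ := Finset.mem_image.1 hm
  exact (below_spec (hS p hp)).1.two_le

lemma inv_one_sub_le_exp {x : ℝ} (h0 : 0 ≤ x) (h : x ≤ 1 / 2) : (1 - x)⁻¹ ≤ Real.exp (2 * x) := by
  have h1 : 1 + 2 * x ≤ Real.exp (2 * x) := by linarith [Real.add_one_le_exp (2 * x)]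
  refine le_trans ?_ h1
  rw [inv_le_iff_one_le_mul₀ (by linarith)]
  nlinarith

lemma prime_rpow_le_half {p : Ideal (𝓞 K)} (hp : Prime p) {σ : ℝ} (hσ : 1 ≤ σ) :
    (Ideal.absNorm p : ℝ) ^ (-σ) ≤ 1 / 2 := by
  have h : (2 : ℝ) ≤ Ideal.absNorm p := by exact_mod_cast two_le_absNorm_of_prime hp
  calc (Ideal.absNorm p : ℝ) ^ (-σ) ≤ (Ideal.absNorm p : ℝ) ^ (-1 : ℝ) :=
        Real.rpow_le_rpow_of_exponent_le (by linarith) (by linarith)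
    _ = ((Ideal.absNorm p : ℝ))⁻¹ := Real.rpow_neg_one _
    _ ≤ 1 / 2 := by rw [one_div]; exact inv_anti₀ (by norm_num) h

lemma prod_primes_le (S : Finset (Ideal (𝓞 K))) (hS : ∀ p ∈ S, Prime p) (σ : ℝ) (hσ : 1 < σ) :
    ∏ p ∈ S, (1 - (Ideal.absNorm p : ℝ) ^ (-σ))⁻¹ ≤ Real.exp (2 * nK K / (σ - 1)) := by
  calc _ ≤ ∏ p ∈ S, Real.exp (2 * (Ideal.absNorm p : ℝ) ^ (-σ)) :=
        Finset.prod_le_prod (fun p hp => inv_nonneg.2 (by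
          linarith [prime_rpow_le_half (hS p hp) hσ.le]))
          fun p hp => inv_one_sub_le_exp (by positivity) (prime_rpow_le_half (hS p hp) hσ.le)
    _ = Real.exp (2 * ∑ p ∈ S, (Ideal.absNorm p : ℝ) ^ (-σ)) := by
        rw [← Real.exp_sum, Finset.mul_sum]
    _ ≤ _ := Real.exp_le_exp.2 (by
        rw [mul_div_assoc]
        exact mul_le_mul_of_nonneg_left (sum_primes_rpow_le S hS σ hσ) (by norm_num))

lemma sum_ideals_le (F : Finset {I : Ideal (𝓞 K) // I ≠ ⊥}) (σ : ℝ) (hσ : 1 < σ) :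
    ∑ I ∈ F, (Ideal.absNorm I.1 : ℝ) ^ (-σ) ≤ Real.exp (2 * nK K / (σ - 1)) := by
  set q : Ideal (𝓞 K) := ∏ I ∈ F, I.1 with hq
  have hq0 : q ≠ ⊥ := by
    rw [hq]
    exact Finset.prod_ne_zero_iff.2 fun I _ => I.2
  have h1 : ∑ I ∈ F, (Ideal.absNorm I.1 : ℝ) ^ (-σ) ≤
      ∑ g ∈ idealDivisors q, (Ideal.absNorm g : ℝ) ^ (-σ) := by
    have e := Finset.sum_map F (Function.Embedding.subtype _)
      (fun g : Ideal (𝓞 K) => (Ideal.absNorm g : ℝ) ^ (-σ))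
    rw [Function.Embedding.coe_subtype] at e
    rw [← e]
    refine Finset.sum_le_sum_of_subset_of_nonneg (fun g hg => ?_) fun _ _ _ => by positivity
    obtain ⟨I, hI, rfl⟩ := Finset.mem_map.1 hg
    rw [mem_idealDivisors hq0]
    exact Finset.dvd_prod_of_mem _ hI
  refine h1.trans ((sum_idealDivisors_le hq0 σ (by linarith)).trans ?_)
  exact prod_primes_le _ (fun p h => ((mem_idealPrimes hq0 p).1 h).2) σ hσ

variable (K)

lemma summable_ideals {σ : ℝ} (hσ : 1 < σ) :
    Summable fun I : {I : Ideal (𝓞 K) // I ≠ ⊥} => (Ideal.absNorm I.1 : ℝ) ^ (-σ) :=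
  summable_of_sum_le (fun _ => by positivity) fun F => sum_ideals_le F σ hσ

lemma tsum_ideals_le {σ : ℝ} (hσ : 1 < σ) :
    ∑' I : {I : Ideal (𝓞 K) // I ≠ ⊥}, (Ideal.absNorm I.1 : ℝ) ^ (-σ) ≤
      Real.exp (2 * nK K / (σ - 1)) :=
  Real.tsum_le_of_sum_le (fun _ => by positivity) fun F => sum_ideals_le F σ hσ

end IdealZeta

section LBounds

open scoped Classical

variable {K : Type*} [Field K] [NumberField K]

lemma ideal_sieve {f : Ideal (𝓞 K) → ℂ} (hf : ∀ a b, f (a * b) = f a * f b)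
    (hs : Summable fun I : {I : Ideal (𝓞 K) // I ≠ ⊥} => f I.1)
    (S : Finset (Ideal (𝓞 K))) (hS : ∀ p ∈ S, Prime p) :
    (∏ p ∈ S, (1 - f p)) * ∑' I : {I : Ideal (𝓞 K) // I ≠ ⊥}, f I.1 =
      ∑' I : {I : Ideal (𝓞 K) // I ≠ ⊥}, {I | ∀ p ∈ S, ¬ p ∣ I.1}.indicator (fun I => f I.1) I := by
  induction S using Finset.induction_on with
  | empty => simp
  | insert p S hpS ih =>
    have hp := hS p (Finset.mem_insert_self _ _)
    have ih := ih fun p' h => hS p' (Finset.mem_insert_of_mem h)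
    rw [Finset.prod_insert hpS, mul_assoc, ih]
    set A : Set {I : Ideal (𝓞 K) // I ≠ ⊥} := {I | ∀ p ∈ S, ¬ p ∣ I.1} with hA
    set B : Set {I : Ideal (𝓞 K) // I ≠ ⊥} := {I | ∀ p' ∈ insert p S, ¬ p' ∣ I.1} with hB
    let φ : {I : Ideal (𝓞 K) // I ≠ ⊥} → {I : Ideal (𝓞 K) // I ≠ ⊥} :=
      fun I => ⟨p * I.1, mul_ne_zero hp.ne_zero I.2⟩
    have hφ : Function.Injective φ := fun I J h => by
      have := congrArg Subtype.val h
      exact Subtype.ext (mul_left_cancel₀ hp.ne_zero this)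
    have hmem : ∀ I, φ I ∈ A ↔ I ∈ A := by
      intro I
      simp only [hA, Set.mem_ofPred_eq]
      refine forall₂_congr fun p' hp' => not_congr ⟨fun h => ?_, fun h => h.mul_left _⟩
      rcases (hS p' (Finset.mem_insert_of_mem hp')).dvd_or_dvd h with h | h
      · exfalso
        have : p' = p := associated_iff_eq.1
          ((hS p' (Finset.mem_insert_of_mem hp')).associated_of_dvd hp h)
        exact hpS (this ▸ hp')
      · exact h
    have e1 : (∑' I, (A \ B).indicator (fun I => f I.1) I) = f p * ∑' I, A.indicator (fun I => f I.1) I := by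
      rw [← tsum_mul_left]
      have hsupp : Function.support ((A \ B).indicator fun I : {I : Ideal (𝓞 K) // I ≠ ⊥} => f I.1) ⊆
          Set.range φ := by
        intro I hI
        have hI' := Set.mem_of_indicator_ne_zero hI
        obtain ⟨hIA, hIB⟩ := hI'
        simp only [hB, Set.mem_ofPred_eq, Finset.mem_insert, forall_eq_or_imp, not_and_or, not_not] at hIB
        rcases hIB with h | h
        · obtain ⟨J, hJ⟩ := h
          have hJ0 : J ≠ ⊥ := by
            rintro rfl
            exact I.2 (by rw [hJ]; exact mul_zero p)
          exact ⟨⟨J, hJ0⟩, Subtype.ext hJ.symm⟩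
        · exact absurd hIA h
      rw [← hφ.tsum_eq hsupp]
      refine tsum_congr fun I => ?_
      have hd : φ I ∉ B := by
        simp only [hB, Set.mem_ofPred_eq, Finset.mem_insert, forall_eq_or_imp, not_and_or, not_not]
        exact Or.inl (dvd_mul_right _ _)
      by_cases hI : I ∈ A
      · have hm : φ I ∈ A \ B := ⟨(hmem I).2 hI, hd⟩
        rw [Set.indicator_of_mem hm, Set.indicator_of_mem hI]
        exact hf _ _
      · rw [Set.indicator_of_notMem (fun h => hI ((hmem I).1 h.1)), Set.indicator_of_notMem hI, mul_zero]
    have hBA : B ⊆ A := fun I h p' hp' => h p' (Finset.mem_insert_of_mem hp')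
    have e2 : (∑' I, A.indicator (fun I : {I : Ideal (𝓞 K) // I ≠ ⊥} => f I.1) I) =
        (∑' I, B.indicator (fun I : {I : Ideal (𝓞 K) // I ≠ ⊥} => f I.1) I) +
        ∑' I, (A \ B).indicator (fun I : {I : Ideal (𝓞 K) // I ≠ ⊥} => f I.1) I := by
      rw [← (hs.indicator B).tsum_add (hs.indicator (A \ B))]
      refine tsum_congr fun I => ?_
      by_cases hB' : I ∈ B
      · simp [hB', hBA hB']
      · by_cases hA' : I ∈ A <;> simp [hB', hA']
    linear_combination e2 + e1

variable {𝔮 : Ideal (𝓞 K)} (χ : HeckeChar K 𝔮)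

lemma HeckeChar.norm_le_one (I : Ideal (𝓞 K)) : ‖χ.toFun I‖ ≤ 1 := by
  by_cases h : IsCoprime I 𝔮
  · exact (χ.norm_one' I h).le
  · rw [χ.eq_zero' I h]; simp

lemma HeckeChar.map_top : χ.toFun ⊤ = 1 := by
  have h1 := χ.map_mul' ⊤ ⊤
  rw [← Ideal.one_eq_top, one_mul] at h1
  have h2 := χ.norm_one' 1 isCoprime_one_left
  have h3 : χ.toFun 1 ≠ 0 := fun h => by rw [h] at h2; simp at h2
  rw [← Ideal.one_eq_top]
  exact (mul_right_cancel₀ h3 (by rw [one_mul]; exact h1)).symm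

/-- The terms of the Dirichlet series. -/
def lterm (s : ℂ) (I : Ideal (𝓞 K)) : ℂ := χ.toFun I * (Ideal.absNorm I : ℂ) ^ (-s)

lemma lterm_mul (s : ℂ) (a b : Ideal (𝓞 K)) : lterm χ s (a * b) = lterm χ s a * lterm χ s b := by
  rw [lterm, lterm, lterm, χ.map_mul', map_mul, Nat.cast_mul, natCast_mul_natCast_cpow]
  ring

lemma norm_absNorm_cpow {I : Ideal (𝓞 K)} (hI : I ≠ ⊥) (s : ℂ) :
    ‖(Ideal.absNorm I : ℂ) ^ s‖ = (Ideal.absNorm I : ℝ) ^ s.re := by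
  rw [show ((Ideal.absNorm I : ℕ) : ℂ) = ((Ideal.absNorm I : ℝ) : ℂ) by push_cast; rfl,
    norm_cpow_eq_rpow_re_of_pos (absNorm_pos hI)]

lemma norm_lterm_le (s : ℂ) {I : Ideal (𝓞 K)} (hI : I ≠ ⊥) :
    ‖lterm χ s I‖ ≤ (Ideal.absNorm I : ℝ) ^ (-s.re) := by
  rw [lterm, norm_mul, norm_absNorm_cpow hI, neg_re]
  exact mul_le_of_le_one_left (by positivity) (χ.norm_le_one I)

lemma summable_norm_lterm {s : ℂ} (hs : 1 < s.re) :
    Summable fun I : {I : Ideal (𝓞 K) // I ≠ ⊥} => ‖lterm χ s I.1‖ :=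
  (summable_ideals K hs).of_nonneg_of_le (fun _ => norm_nonneg _) fun I => norm_lterm_le χ s I.2

lemma norm_LSer_le {s : ℂ} (hs : 1 < s.re) : ‖LSer χ s‖ ≤ Real.exp (2 * nK K / (s.re - 1)) := by
  refine (norm_tsum_le_tsum_norm (summable_norm_lterm χ hs)).trans (le_trans ?_ (tsum_ideals_le K hs))
  exact (summable_norm_lterm χ hs).tsum_le_tsum (fun I => norm_lterm_le χ s I.2)
    (summable_ideals K hs)

lemma le_norm_LSer {s : ℂ} (hs : 1 < s.re) : Real.exp (-(2 * nK K / (s.re - 1))) ≤ ‖LSer χ s‖ := by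
  have hsum := summable_norm_lterm χ hs
  set E := Real.exp (2 * nK K / (s.re - 1)) with hE
  have hEpos : 0 < E := Real.exp_pos _
  have key : ∀ δ > 0, 1 - δ ≤ E * ‖LSer χ s‖ := by
    intro δ hδ
    have ht := hsum.hasSum
    obtain ⟨F, hF⟩ := summable_iff_vanishing_norm.1 hsum δ hδ
    set q : Ideal (𝓞 K) := ∏ I ∈ F, I.1 with hq
    have hq0 : q ≠ ⊥ := by
      rw [hq]
      exact Finset.prod_ne_zero_iff.2 fun I _ => I.2
    have hS : ∀ p ∈ idealPrimes q, Prime p := fun p h => ((mem_idealPrimes hq0 p).1 h).2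
    have h1 := ideal_sieve (lterm_mul χ s) hsum.of_norm (idealPrimes q) hS
    set A : Set {I : Ideal (𝓞 K) // I ≠ ⊥} := {I | ∀ p ∈ idealPrimes q, ¬ p ∣ I.1} with hA
    have hP : ‖∏ p ∈ idealPrimes q, (1 - lterm χ s p)‖ ≤ E := by
      rw [norm_prod]
      refine le_trans (Finset.prod_le_prod (fun _ _ => norm_nonneg _) fun p hp => ?_)
        (prod_primes_le (idealPrimes q) hS s.re hs)
      have hb := norm_lterm_le χ s (hS p hp).ne_zero
      have hh := prime_rpow_le_half (hS p hp) hs.le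
      have h0 : 0 ≤ (Ideal.absNorm p : ℝ) ^ (-s.re) := by positivity
      refine (norm_sub_le _ _).trans ?_
      rw [norm_one]
      refine (add_le_add_right hb 1).trans ?_
      rw [← one_div, le_div_iff₀ (by linarith)]
      nlinarith
    have h2 : ‖(∑' I : {I : Ideal (𝓞 K) // I ≠ ⊥}, A.indicator (fun I => lterm χ s I.1) I) - 1‖ ≤ δ := by
      have hone : (1 : ℂ) = ∑' I : {I : Ideal (𝓞 K) // I ≠ ⊥},
          ({⟨⊤, top_ne_bot⟩} : Set _).indicator (fun I => lterm χ s I.1) I := by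
        rw [tsum_eq_single ⟨⊤, top_ne_bot⟩ fun b hb => Set.indicator_of_notMem (by simpa using hb) _]
        rw [Set.indicator_of_mem (Set.mem_singleton _)]
        simp [lterm, χ.map_top]
      rw [hone, ← (hsum.of_norm.indicator _).tsum_sub (hsum.of_norm.indicator _)]
      have hle : ∀ I : {I : Ideal (𝓞 K) // I ≠ ⊥}, ‖A.indicator (fun I => lterm χ s I.1) I -
          ({⟨⊤, top_ne_bot⟩} : Set _).indicator (fun I => lterm χ s I.1) I‖ ≤
          (↑F : Set {I : Ideal (𝓞 K) // I ≠ ⊥})ᶜ.indicator (fun I => ‖lterm χ s I.1‖) I := by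
        intro I
        have hnn : 0 ≤ (↑F : Set {I : Ideal (𝓞 K) // I ≠ ⊥})ᶜ.indicator
          (fun I => ‖lterm χ s I.1‖) I := Set.indicator_nonneg (fun _ _ => norm_nonneg _) _
        by_cases hI : I = ⟨⊤, top_ne_bot⟩
        · have hIA : I ∈ A := by
            intro p hp hd
            rw [hI] at hd
            exact (hS p hp).not_isUnit (isUnit_of_dvd_one (by rw [Ideal.one_eq_top]; exact hd))
          rw [Set.indicator_of_mem hIA, Set.indicator_of_mem (by exact hI), sub_self, norm_zero]
          exact hnn
        · rw [Set.indicator_of_notMem (s := {_}) (by exact hI), sub_zero]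
          by_cases hIF : I ∈ F
          · have hIA : I ∉ A := by
              intro hIA
              obtain ⟨p, hp, hd⟩ := exists_prime_dvd I.2 fun h => hI (Subtype.ext h)
              exact hIA p ((mem_idealPrimes hq0 p).2 ⟨hd.trans (Finset.dvd_prod_of_mem _ hIF), hp⟩) hd
            rw [Set.indicator_of_notMem hIA, norm_zero]
            exact hnn
          · have hm : I ∈ (↑F : Set {I : Ideal (𝓞 K) // I ≠ ⊥})ᶜ := by simpa using hIF
            rw [Set.indicator_of_mem hm]
            by_cases hIA : I ∈ A
            · rw [Set.indicator_of_mem hIA]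
            · rw [Set.indicator_of_notMem hIA, norm_zero]; exact norm_nonneg _
      have hs2 := hsum.indicator ((↑F : Set {I : Ideal (𝓞 K) // I ≠ ⊥})ᶜ)
      refine (tsum_of_norm_bounded hs2.hasSum hle).trans ?_
      refine hs2.tsum_le_of_sum_le fun G => ?_
      have hdisj : Disjoint (G.filter fun I => I ∉ F) F :=
        Finset.disjoint_left.2 fun I h h' => (Finset.mem_filter.1 h).2 h'
      have h3 := hF _ hdisj
      rw [Finset.sum_filter] at h3
      refine le_trans (le_of_eq ?_) ((le_abs_self _).trans h3.le)
      exact Finset.sum_congr rfl fun I _ => by simp [Set.indicator]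
    rw [← h1] at h2
    have h4 : 1 - δ ≤ ‖(∏ p ∈ idealPrimes q, (1 - lterm χ s p)) *
        ∑' I : {I : Ideal (𝓞 K) // I ≠ ⊥}, lterm χ s I.1‖ := by
      have := norm_sub_norm_le (1 : ℂ) (1 - (∏ p ∈ idealPrimes q, (1 - lterm χ s p)) *
        ∑' I : {I : Ideal (𝓞 K) // I ≠ ⊥}, lterm χ s I.1)
      rw [norm_one, sub_sub_cancel, norm_sub_rev] at this
      linarith
    refine h4.trans ?_
    rw [norm_mul]
    exact mul_le_mul_of_nonneg_right hP (norm_nonneg _)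
  have h5 : 1 ≤ E * ‖LSer χ s‖ := le_of_forall_sub_le key
  rw [Real.exp_neg, inv_le_iff_one_le_mul₀ hEpos]
  linarith

end LBounds

section DivisorBound

open scoped Classical

lemma card_small_primes_le {K : Type*} [Field K] [NumberField K] (S : Finset (Ideal (𝓞 K)))
    (hS : ∀ p ∈ S, Prime p) (P : ℕ) :
    (S.filter fun p => Ideal.absNorm p < P).card ≤ P * nK K := by
  have hmaps : ∀ p ∈ S.filter (fun p => Ideal.absNorm p < P), below p ∈ Finset.range P := by
    intro p hp
    rw [Finset.mem_filter] at hp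
    exact Finset.mem_range.2 ((below_spec (hS p hp.1)).2.2.trans_lt hp.2)
  rw [Finset.card_eq_sum_card_fiberwise hmaps]
  refine (Finset.sum_le_card_nsmul _ _ (nK K) fun ℓ _ => ?_).trans (by simp)
  refine le_trans (Finset.card_le_card ?_) (card_below_le S hS ℓ)
  intro p hp
  simp only [Finset.mem_filter] at hp ⊢
  exact ⟨hp.1.1, hp.2⟩

lemma exists_divisor_bound {δ : ℝ} (hδ : 0 < δ) : ∃ C : ℝ, 0 < C ∧
    ∀ (K : Type) [Field K] [NumberField K] (q : Ideal (𝓞 K)), q ≠ ⊥ →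
      ∑ g ∈ idealDivisors q, (Ideal.absNorm g : ℝ) ^ (-(1 / 2) : ℝ) ≤
        Real.exp (C * nK K) * (Ideal.absNorm q : ℝ) ^ δ := by
  obtain ⟨P, hP⟩ := exists_nat_ge (max 4 ((2 : ℝ) ^ (1 / δ)))
  have hP4 : (4 : ℝ) ≤ P := (le_max_left _ _).trans hP
  have hP2 : (2 : ℝ) ^ (1 / δ) ≤ P := (le_max_right _ _).trans hP
  refine ⟨P * Real.log 4, by have := Real.log_pos (by norm_num : (1:ℝ) < 4); positivity, ?_⟩
  intro K _ _ q hq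
  have hS : ∀ p ∈ idealPrimes q, Prime p := fun p h => ((mem_idealPrimes hq p).1 h).2
  refine (sum_idealDivisors_le hq (1 / 2) (by norm_num)).trans ?_
  have hfac : ∀ p ∈ idealPrimes q, (1 - (Ideal.absNorm p : ℝ) ^ (-(1 / 2) : ℝ))⁻¹ ≤
      (Ideal.absNorm p : ℝ) ^ δ * (if Ideal.absNorm p < P then 4 else 1) := by
    intro p hp
    have h2 : (2 : ℝ) ≤ Ideal.absNorm p := by exact_mod_cast two_le_absNorm_of_prime (hS p hp)
    have h1 : (1 : ℝ) ≤ (Ideal.absNorm p : ℝ) ^ δ := Real.one_le_rpow (by linarith) hδ.le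
    split_ifs with h
    · have h3 : (Ideal.absNorm p : ℝ) ^ (-(1 / 2) : ℝ) ≤ 3 / 4 := by
        rw [Real.rpow_neg (by positivity), ← Real.sqrt_eq_rpow]
        rw [inv_le_comm₀ (Real.sqrt_pos.2 (by linarith)) (by norm_num)]
        exact Real.le_sqrt_of_sq_le (by norm_num; linarith)
      have : (1 - (Ideal.absNorm p : ℝ) ^ (-(1 / 2) : ℝ))⁻¹ ≤ 4 := by
        rw [inv_le_comm₀ (by linarith) (by norm_num)]
        linarith
      nlinarith
    · have hNP : (P : ℝ) ≤ Ideal.absNorm p := by exact_mod_cast not_lt.1 h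
      have h4N : (4 : ℝ) ≤ Ideal.absNorm p := hP4.trans hNP
      have h3 : (Ideal.absNorm p : ℝ) ^ (-(1 / 2) : ℝ) ≤ 1 / 2 := by
        rw [Real.rpow_neg (by positivity), ← Real.sqrt_eq_rpow]
        rw [inv_le_comm₀ (Real.sqrt_pos.2 (by linarith)) (by norm_num)]
        refine Real.le_sqrt_of_sq_le ?_
        rw [one_div, inv_inv]
        linarith
      have h4 : (1 - (Ideal.absNorm p : ℝ) ^ (-(1 / 2) : ℝ))⁻¹ ≤ 2 := by
        rw [inv_le_comm₀ (by linarith) (by norm_num)]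
        linarith
      have h5 : (2 : ℝ) ≤ (Ideal.absNorm p : ℝ) ^ δ := by
        calc (2 : ℝ) = ((2 : ℝ) ^ (1 / δ)) ^ δ := by
              rw [← Real.rpow_mul (by norm_num), one_div_mul_cancel hδ.ne', Real.rpow_one]
          _ ≤ _ := Real.rpow_le_rpow (by positivity) (hP2.trans hNP) hδ.le
      linarith
  refine (Finset.prod_le_prod (fun p hp => ?_) hfac).trans ?_
  · have h2 : (2 : ℝ) ≤ Ideal.absNorm p := by exact_mod_cast two_le_absNorm_of_prime (hS p hp)
    have : (Ideal.absNorm p : ℝ) ^ (-(1 / 2) : ℝ) ≤ 1 :=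
      Real.rpow_le_one_of_one_le_of_nonpos (by linarith) (by norm_num)
    exact inv_nonneg.2 (by linarith)
  rw [Finset.prod_mul_distrib, mul_comm]
  refine mul_le_mul ?_ ?_ (Finset.prod_nonneg fun _ _ => by positivity) (Real.exp_pos _).le
  · rw [Finset.prod_ite, Finset.prod_const, Finset.prod_const_one, mul_one,
      mul_assoc, mul_comm (Real.log 4), ← mul_assoc, mul_comm, Real.exp_mul,
      Real.exp_log (by norm_num), ← Real.rpow_natCast]
    refine Real.rpow_le_rpow_of_exponent_le (by norm_num) ?_
    exact_mod_cast card_small_primes_le _ hS P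
  · rw [Real.finsetProd_rpow _ _ (fun _ _ => by positivity), ← Nat.cast_prod, ← map_prod]
    refine Real.rpow_le_rpow (by positivity) ?_ hδ.le
    have hd : ∏ p ∈ idealPrimes q, p ∣ q :=
      prod_primes_dvd _ fun p h => ⟨hS p h, ((mem_idealPrimes hq p).1 h).1⟩
    have := Nat.le_of_dvd (by exact_mod_cast absNorm_pos hq)
      (Ideal.absNorm_dvd_absNorm_of_le (Ideal.dvd_iff_le.1 hd))
    exact_mod_cast this

lemma sum_gcd_le {K : Type*} [Field K] [NumberField K] {q : Ideal (𝓞 K)} (hq : q ≠ ⊥)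
    (F : Finset {I : Ideal (𝓞 K) // I ≠ ⊥}) {η : ℝ} (hη : 0 < η) :
    ∑ c ∈ F, (Ideal.absNorm (c.1 ⊔ q) : ℝ) ^ (1 / 2 : ℝ) * (Ideal.absNorm c.1 : ℝ) ^ (-(1 + η)) ≤
      (∑ g ∈ idealDivisors q, (Ideal.absNorm g : ℝ) ^ (-(1 / 2) : ℝ)) *
        Real.exp (2 * nK K / η) := by
  have hmaps : ∀ c ∈ F, c.1 ⊔ q ∈ idealDivisors q := fun c _ =>
    (mem_idealDivisors hq _).2 (Ideal.dvd_iff_le.2 le_sup_right)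
  rw [← Finset.sum_fiberwise_of_maps_to hmaps, Finset.sum_mul]
  refine Finset.sum_le_sum fun g hg => ?_
  have hg0 : g ≠ ⊥ := by
    rintro rfl
    exact hq (zero_dvd_iff.1 ((mem_idealDivisors hq _).1 hg))
  set G := F.filter fun c => c.1 ⊔ q = g with hG
  let φ : {I : Ideal (𝓞 K) // I ≠ ⊥} → {I : Ideal (𝓞 K) // I ≠ ⊥} :=
    fun I => ⟨g * I.1, mul_ne_zero hg0 I.2⟩
  have hφ : Function.Injective φ := fun I J h => by
    have := congrArg Subtype.val h
    exact Subtype.ext (mul_left_cancel₀ hg0 this)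
  have hN := absNorm_pos hg0
  have h1N := absNorm_ge_one hg0
  have hsub : G ⊆ (G.preimage φ hφ.injOn).image φ := by
    intro c hc
    have hgc : g ∣ c.1 := by
      rw [← (Finset.mem_filter.1 hc).2]
      exact Ideal.dvd_iff_le.2 le_sup_left
    obtain ⟨h, hh⟩ := hgc
    have hh0 : h ≠ ⊥ := by
      rintro rfl
      exact c.2 (by rw [hh]; exact mul_zero g)
    have e : φ ⟨h, hh0⟩ = c := Subtype.ext hh.symm
    exact Finset.mem_image.2 ⟨⟨h, hh0⟩, Finset.mem_preimage.2 (e ▸ hc), e⟩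
  calc ∑ c ∈ G, (Ideal.absNorm (c.1 ⊔ q) : ℝ) ^ (1 / 2 : ℝ) * (Ideal.absNorm c.1 : ℝ) ^ (-(1 + η))
      = ∑ c ∈ G, (Ideal.absNorm g : ℝ) ^ (1 / 2 : ℝ) * (Ideal.absNorm c.1 : ℝ) ^ (-(1 + η)) :=
        Finset.sum_congr rfl fun c hc => by rw [(Finset.mem_filter.1 hc).2]
    _ ≤ ∑ c ∈ (G.preimage φ hφ.injOn).image φ,
        (Ideal.absNorm g : ℝ) ^ (1 / 2 : ℝ) * (Ideal.absNorm c.1 : ℝ) ^ (-(1 + η)) :=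
        Finset.sum_le_sum_of_subset_of_nonneg hsub fun _ _ _ => by positivity
    _ = ∑ h ∈ G.preimage φ hφ.injOn, (Ideal.absNorm g : ℝ) ^ (1 / 2 - (1 + η) : ℝ) *
        (Ideal.absNorm h.1 : ℝ) ^ (-(1 + η)) := by
        rw [Finset.sum_image fun a _ b _ h => hφ h]
        refine Finset.sum_congr rfl fun h _ => ?_
        have e : (Ideal.absNorm (φ h).1 : ℝ) = Ideal.absNorm g * Ideal.absNorm h.1 := by
          rw [← Nat.cast_mul, ← map_mul]
        have hh0 : (0 : ℝ) ≤ (Ideal.absNorm h.1 : ℝ) := Nat.cast_nonneg _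
        rw [e, Real.mul_rpow hN.le hh0, ← mul_assoc, ← Real.rpow_add hN, sub_eq_add_neg]
    _ = (Ideal.absNorm g : ℝ) ^ (1 / 2 - (1 + η) : ℝ) *
        ∑ h ∈ G.preimage φ hφ.injOn, (Ideal.absNorm h.1 : ℝ) ^ (-(1 + η)) := by
        rw [Finset.mul_sum]
    _ ≤ (Ideal.absNorm g : ℝ) ^ (-(1 / 2) : ℝ) * Real.exp (2 * nK K / η) := by
        refine mul_le_mul ?_ ?_ (Finset.sum_nonneg fun I _ =>
          Real.rpow_nonneg (Nat.cast_nonneg (Ideal.absNorm I.1)) _) (Real.rpow_nonneg hN.le _)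
        · exact Real.rpow_le_rpow_of_exponent_le h1N (by linarith)
        · have := sum_ideals_le (G.preimage φ hφ.injOn) (1 + η) (by linarith)
          rwa [add_sub_cancel_left] at this

end DivisorBound

section SignData

open scoped Classical
open NumberField.InfinitePlace NumberField.mixedEmbedding

variable {K : Type*} [Field K] [NumberField K]

lemma totPos_of_forall {α : 𝓞 K}
    (h : ∀ w : {w : InfinitePlace K // w.IsReal}, 0 < (mixedEmbedding K (α : K)).1 w) :
    TotPos K α := by
  intro φ
  have hψ : ComplexEmbedding.IsReal (Complex.ofRealHom.comp φ) := by
    rw [ComplexEmbedding.isReal_iff]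
    ext x
    simp
  have hw : (InfinitePlace.mk (Complex.ofRealHom.comp φ)).IsReal := isReal_mk_iff.2 hψ
  have h1 := h ⟨_, hw⟩
  rw [mixedEmbedding_apply_isReal] at h1
  have h2 : (embedding_of_isReal hw (α : K) : ℂ) = ((φ (α : K) : ℝ) : ℂ) := by
    rw [embedding_of_isReal_apply, embedding_mk_eq_of_isReal hψ]
    rfl
  rw [Complex.ofReal_inj] at h2
  rwa [h2] at h1

omit [NumberField K] in
lemma embedding_real_ne_zero {α : 𝓞 K} (hα : α ≠ 0) (w : {w : InfinitePlace K // w.IsReal}) :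
    (mixedEmbedding K (α : K)).1 w ≠ 0 := by
  rw [mixedEmbedding_apply_isReal]
  exact (map_ne_zero _).2 (RingOfIntegers.coe_ne_zero_iff.2 hα)

lemma exists_sign_elem {q : Ideal (𝓞 K)} (hq : q ≠ ⊥) (w : {w : InfinitePlace K // w.IsReal}) :
    ∃ e : 𝓞 K, e - 1 ∈ q ∧ (mixedEmbedding K (e : K)).1 w < 0 ∧
      ∀ w' ≠ w, 0 < (mixedEmbedding K (e : K)).1 w' := by
  obtain ⟨x, hx⟩ := (Metric.denseRange_iff.1 (denseRange_algebraMap_pi K))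
    (fun v => if v = w.1 then -1 else 1) (1 / 2) (by norm_num)
  rw [dist_pi_lt_iff (by norm_num)] at hx
  have hx' : ∀ v : {w : InfinitePlace K // w.IsReal},
      |(if v = w then (-1 : ℝ) else 1) - (mixedEmbedding K x).1 v| < 1 / 2 := by
    intro v
    have h1 := hx v.1
    rw [dist_eq_norm] at h1
    have h2 : v.1 ((if v = w then (-1 : K) else 1) - x) < 1 / 2 := by
      convert h1 using 1
      by_cases hv : v = w
      · rw [if_pos hv, if_pos (congrArg Subtype.val hv)]
        rfl
      · rw [if_neg hv, if_neg fun h => hv (Subtype.ext h)]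
        rfl
    rw [← norm_embedding_of_isReal v.2, map_sub, Real.norm_eq_abs] at h2
    rw [mixedEmbedding_apply_isReal]
    convert h2 using 3
    split_ifs <;> simp
  obtain ⟨y, hy, hyx⟩ :=
    ((IsFractionRing.isAlgebraic_iff ℤ ℚ K).2
      (Algebra.IsAlgebraic.isAlgebraic (R := ℚ) x)).exists_integral_multiple
  obtain ⟨z, hz⟩ : ∃ z : 𝓞 K, (z : K) = y * x := ⟨⟨y • x, hyx⟩, zsmul_eq_mul _ _⟩
  have hk : (1 : ℝ) ≤ Ideal.absNorm q := absNorm_ge_one hq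
  have hy1 : (1 : ℝ) ≤ (y : ℝ) ^ 2 := by
    have : 0 < y ^ 2 := by positivity
    exact_mod_cast Int.add_one_le_iff.2 this
  have hky := one_le_mul_of_one_le_of_one_le hk hy1
  have hval : ∀ v : {w : InfinitePlace K // w.IsReal},
      (mixedEmbedding K ((1 + 2 * (Ideal.absNorm q : 𝓞 K) * y * z : 𝓞 K) : K)).1 v =
        1 + 2 * (Ideal.absNorm q * y ^ 2) * (mixedEmbedding K x).1 v := by
    intro v
    have : ((1 + 2 * (Ideal.absNorm q : 𝓞 K) * y * z : 𝓞 K) : K) =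
        1 + 2 * (Ideal.absNorm q : K) * y * (y * x) := by
      simp only [map_add, map_mul, map_one, map_natCast, map_intCast, map_ofNat, hz]
    rw [this, mixedEmbedding_apply_isReal, mixedEmbedding_apply_isReal]
    simp only [map_add, map_mul, map_one, map_natCast, map_intCast, map_ofNat]
    ring
  refine ⟨1 + 2 * (Ideal.absNorm q : 𝓞 K) * y * z, ?_, ?_, fun w' hw' => ?_⟩
  · have : (1 + 2 * (Ideal.absNorm q : 𝓞 K) * y * z) - 1 = (2 * y * z) * (Ideal.absNorm q : 𝓞 K) := by
      ring
    rw [this]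
    exact q.mul_mem_left _ (Ideal.absNorm_mem q)
  · have h1 := hx' w
    rw [if_pos rfl, abs_lt] at h1
    rw [hval]
    nlinarith [h1.1]
  · have h1 := hx' w'
    rw [if_neg hw', abs_lt] at h1
    rw [hval]
    nlinarith [h1.2]

lemma nrm_embedding_ne_zero {x : K} (hx : x ≠ 0) : nrm (mixedEmbedding K x) ≠ 0 := by
  rw [nrm_eq_norm, Ne, norm_eq_zero_iff' ⟨x, rfl⟩]
  exact (map_ne_zero _).2 hx

section Char

variable {q : Ideal (𝓞 K)} (χ : HeckeChar K q)

lemma HeckeChar.span_mul (α β : 𝓞 K) :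
    χ.toFun (Ideal.span {α * β}) = χ.toFun (Ideal.span {α}) * χ.toFun (Ideal.span {β}) := by
  rw [← Ideal.span_singleton_mul_span_singleton, χ.map_mul']

lemma HeckeChar.exists_sign (hq : q ≠ ⊥) : ∃ p : Par K, ∀ α : 𝓞 K, α ≠ 0 → α - 1 ∈ q →
    χ.toFun (Ideal.span {α}) = om p (mixedEmbedding K (α : K)) := by
  choose e he1 heneg hepos using exists_sign_elem hq
  refine ⟨fun w => if χ.toFun (Ideal.span {e w}) = 1 then false else true, fun α hα hα1 => ?_⟩
  set p : Par K := fun w => if χ.toFun (Ideal.span {e w}) = 1 then false else true with hp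
  have hsq : ∀ w, χ.toFun (Ideal.span {e w}) * χ.toFun (Ideal.span {e w}) = 1 := by
    intro w
    rw [← χ.span_mul]
    refine χ.ray_one' _ (totPos_of_forall fun v => ?_) ?_
    · have : (mixedEmbedding K ((e w : 𝓞 K) : K)).1 v ≠ 0 := by
        by_cases hv : v = w
        · rw [hv]; exact (heneg w).ne
        · exact (hepos w v hv).ne'
      rw [show ((e w * e w : 𝓞 K) : K) = (e w : K) * (e w : K) from rfl, map_mul]
      exact mul_self_pos.2 this
    · have : e w * e w - 1 = e w * (e w - 1) + (e w - 1) := by ring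
      rw [this]
      exact q.add_mem (q.mul_mem_left _ (he1 w)) (he1 w)
  have hsg : ∀ w, χ.toFun (Ideal.span {e w}) = (sg (p w) (-1) : ℝ) := by
    intro w
    by_cases h : χ.toFun (Ideal.span {e w}) = 1
    · simp [hp, h, sg]
    · have h' := (mul_self_eq_one_iff.1 (hsq w)).resolve_left h
      have h1 : (-1 : ℂ) ≠ 1 := by norm_num
      simp [hp, h', sg, h1]
  set S := Finset.univ.filter fun w : {w : InfinitePlace K // w.IsReal} =>
    (mixedEmbedding K (α : K)).1 w < 0 with hS
  have hprodmod : ∀ S : Finset {w : InfinitePlace K // w.IsReal}, α * ∏ w ∈ S, e w - 1 ∈ q := by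
    intro S
    induction S using Finset.induction_on with
    | empty => simpa using hα1
    | insert w S hw ih =>
      rw [Finset.prod_insert hw]
      have : α * (e w * ∏ x ∈ S, e x) - 1 =
          e w * (α * ∏ x ∈ S, e x - 1) + (e w - 1) := by ring
      rw [this]
      exact q.add_mem (q.mul_mem_left _ ih) (he1 w)
  have hχprod : ∀ S : Finset {w : InfinitePlace K // w.IsReal},
      χ.toFun (Ideal.span {∏ w ∈ S, e w}) = ((∏ w ∈ S, sg (p w) (-1) : ℝ) : ℂ) := by
    intro S
    induction S using Finset.induction_on with
    | empty => simp [χ.map_top]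
    | insert w S hw ih => rw [Finset.prod_insert hw, Finset.prod_insert hw, χ.span_mul, ih, hsg]; simp
  have hom : om p (mixedEmbedding K (α : K)) = ∏ w ∈ S, sg (p w) (-1) := by
    rw [om, hS, Finset.prod_filter]
    refine Finset.prod_congr rfl fun w _ => ?_
    rcases lt_or_gt_of_ne (embedding_real_ne_zero hα w) with h | h
    · rw [if_pos h]
      cases p w
      · simp [sg]
      · simp only [sg, if_true]
        rw [sign_neg h, sign_neg (by norm_num)]
    · rw [if_neg (not_lt.2 h.le), sg_pos _ h]
  have hpos : TotPos K (α * ∏ w ∈ S, e w) := by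
    refine totPos_of_forall fun v => ?_
    have e1 : (mixedEmbedding K ((α * ∏ w ∈ S, e w : 𝓞 K) : K)).1 v =
        (mixedEmbedding K (α : K)).1 v * ∏ w ∈ S, (mixedEmbedding K (e w : K)).1 v := by
      rw [mixedEmbedding_apply_isReal, mixedEmbedding_apply_isReal]
      simp [mixedEmbedding_apply_isReal]
    rw [e1]
    by_cases hv : v ∈ S
    · rw [← Finset.mul_prod_erase _ _ hv, ← mul_assoc]
      refine mul_pos (mul_pos_of_neg_of_neg (Finset.mem_filter.1 hv).2 (heneg v))
        (Finset.prod_pos fun w hw => hepos w v (Finset.ne_of_mem_erase hw).symm)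
    · refine mul_pos ?_ (Finset.prod_pos fun w hw => hepos w v fun h => hv (h ▸ hw))
      refine lt_of_le_of_ne (not_lt.1 fun h => hv ?_) (embedding_real_ne_zero hα v).symm
      exact Finset.mem_filter.2 ⟨Finset.mem_univ _, h⟩
  have h1 := χ.ray_one' _ hpos (hprodmod S)
  rw [χ.span_mul, hχprod, ← hom] at h1
  have h2 : (om p (mixedEmbedding K (α : K)) : ℂ) * om p (mixedEmbedding K (α : K)) = 1 := by
    rw [← Complex.ofReal_mul, om_mul_self p]
    · simp
    · exact nrm_embedding_ne_zero (RingOfIntegers.coe_ne_zero_iff.2 hα)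
  calc _ = χ.toFun (Ideal.span {α}) * ((om p (mixedEmbedding K (α : K)) : ℂ) *
        om p (mixedEmbedding K (α : K))) := by rw [h2, mul_one]
    _ = _ := by rw [← mul_assoc, h1, one_mul]

/-- A Hecke character restricted to principal ideals factors as a residue character times a
sign character. -/
lemma HeckeChar.exists_mulChar (hq : q ≠ ⊥) : ∃ (p : Par K) (X : MulChar (𝓞 K ⧸ q) ℂ),
    ∀ α : 𝓞 K, α ≠ 0 → χ.toFun (Ideal.span {α}) =
      X (Ideal.Quotient.mk q α) * om p (mixedEmbedding K (α : K)) := by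
  obtain ⟨p, hp⟩ := χ.exists_sign hq
  have hom : ∀ α : 𝓞 K, α ≠ 0 →
      (om p (mixedEmbedding K (α : K)) : ℂ) * om p (mixedEmbedding K (α : K)) = 1 := by
    intro α hα
    rw [← Complex.ofReal_mul, om_mul_self p
      (nrm_embedding_ne_zero (RingOfIntegers.coe_ne_zero_iff.2 hα)), Complex.ofReal_one]
  set g : 𝓞 K → ℂ := fun α => χ.toFun (Ideal.span {α}) * om p (mixedEmbedding K (α : K)) with hg
  have gmul : ∀ α β, g (α * β) = g α * g β := by
    intro α β
    simp only [hg]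
    rw [χ.span_mul, show ((α * β : 𝓞 K) : K) = (α : K) * (β : K) from rfl, map_mul, om_mul]
    push_cast
    ring
  have gone : ∀ α, α ≠ 0 → α - 1 ∈ q → g α = 1 := fun α hα h => by
    simp only [hg]
    rw [hp α hα h, hom α hα]
  have gnc : ∀ α : 𝓞 K, ¬ IsCoprime (Ideal.span {α}) q → g α = 0 := fun α h => by
    simp only [hg]
    rw [χ.eq_zero' _ h, zero_mul]
  have cop : ∀ α : 𝓞 K, IsCoprime (Ideal.span {α}) q ↔ IsUnit (Ideal.Quotient.mk q α) := by
    intro α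
    rw [Ideal.isCoprime_iff_exists]
    constructor
    · rintro ⟨i, hi, j, hj, hij⟩
      obtain ⟨c, rfl⟩ := Ideal.mem_span_singleton'.1 hi
      refine IsUnit.of_mul_eq_one (Ideal.Quotient.mk q c) ?_
      rw [← map_mul, ← map_one (Ideal.Quotient.mk q), Ideal.Quotient.eq]
      have : α * c - 1 = -j := by linear_combination hij
      rw [this]
      exact q.neg_mem hj
    · intro h
      obtain ⟨b, hb⟩ := h.exists_right_inv
      obtain ⟨c, rfl⟩ := Ideal.Quotient.mk_surjective b
      rw [← map_mul, ← map_one (Ideal.Quotient.mk q), Ideal.Quotient.eq] at hb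
      exact ⟨α * c, Ideal.mem_span_singleton'.2 ⟨c, mul_comm _ _⟩, -(α * c - 1), q.neg_mem hb,
        by ring⟩
  have gper : ∀ α β : 𝓞 K, α ≠ 0 → β ≠ 0 → Ideal.Quotient.mk q α = Ideal.Quotient.mk q β →
      g α = g β := by
    intro α β hα hβ h
    by_cases hu : IsUnit (Ideal.Quotient.mk q α)
    · obtain ⟨b, hb⟩ := hu.exists_right_inv
      obtain ⟨c, hc0, rfl⟩ : ∃ c : 𝓞 K, c ≠ 0 ∧ Ideal.Quotient.mk q c = b := by
        obtain ⟨c, rfl⟩ := Ideal.Quotient.mk_surjective b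
        by_cases hc : c = 0
        · obtain ⟨m, hm, hm0⟩ := Submodule.exists_mem_ne_zero_of_ne_bot hq
          exact ⟨m, hm0, by rw [hc, map_zero, Ideal.Quotient.eq_zero_iff_mem]; exact hm⟩
        · exact ⟨c, hc, rfl⟩
      have h1 : ∀ x : 𝓞 K, x ≠ 0 → Ideal.Quotient.mk q x * Ideal.Quotient.mk q c = 1 →
          g x * g c = 1 := by
        intro x hx hxc
        rw [← gmul]
        refine gone _ (mul_ne_zero hx hc0) ?_
        rwa [← map_mul, ← map_one (Ideal.Quotient.mk q), Ideal.Quotient.eq] at hxc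
      have h2 := h1 α hα hb
      have h3 := h1 β hβ (h ▸ hb)
      have hgc : g c ≠ 0 := right_ne_zero_of_mul_eq_one h2
      exact mul_right_cancel₀ hgc (h2.trans h3.symm)
    · rw [gnc α fun hh => hu ((cop α).1 hh), gnc β fun hh => hu (h ▸ (cop β).1 hh)]
  have hrep : ∀ a : 𝓞 K ⧸ q, ∃ c : 𝓞 K, c ≠ 0 ∧ Ideal.Quotient.mk q c = a := by
    intro a
    obtain ⟨c, rfl⟩ := Ideal.Quotient.mk_surjective a
    by_cases hc : c = 0
    · obtain ⟨m, hm, hm0⟩ := Submodule.exists_mem_ne_zero_of_ne_bot hq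
      exact ⟨m, hm0, by rw [hc, map_zero, Ideal.Quotient.eq_zero_iff_mem]; exact hm⟩
    · exact ⟨c, hc, rfl⟩
  choose rep hrep0 hrepmk using hrep
  let X : MulChar (𝓞 K ⧸ q) ℂ :=
    { toFun := fun a => g (rep a)
      map_one' := by
        refine gone _ (hrep0 _) ?_
        rw [← Ideal.Quotient.eq, hrepmk, map_one]
      map_mul' := fun a b => by
        rw [← gmul]
        exact gper _ _ (hrep0 _) (mul_ne_zero (hrep0 _) (hrep0 _))
          (by rw [map_mul, hrepmk, hrepmk, hrepmk])
      map_nonunit' := fun a ha => gnc _ fun h => ha (hrepmk a ▸ (cop _).1 h) }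
  refine ⟨p, X, fun α hα => ?_⟩
  have : X (Ideal.Quotient.mk q α) = g α := gper _ _ (hrep0 _) hα (hrepmk _)
  rw [this]
  simp only [hg]
  rw [mul_assoc, hom α hα, mul_one]

end Char

end SignData

section IdealPoisson

open scoped Classical nonZeroDivisors
open NumberField.InfinitePlace NumberField.mixedEmbedding MeasureTheory

set_option linter.unusedSectionVars false

variable {K : Type*} [Field K] [NumberField K]

/-- The integral ideals `𝔠` for which `𝔉 𝔠` is principal. -/
def PrincCofactor (F : FractionalIdeal (𝓞 K)⁰ K) : Type _ :=
  {c : Ideal (𝓞 K) // c ≠ ⊥ ∧ ∃ ξ : K, ξ ≠ 0 ∧ FractionalIdeal.spanSingleton (𝓞 K)⁰ ξ = F * c}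

namespace PrincCofactor

variable {F : FractionalIdeal (𝓞 K)⁰ K}

/-- A generator of the principal fractional ideal `𝔉 𝔠`. -/
def gen (c : PrincCofactor F) : K := c.2.2.choose

lemma gen_ne_zero (c : PrincCofactor F) : c.gen ≠ 0 := c.2.2.choose_spec.1

lemma span_gen (c : PrincCofactor F) :
    FractionalIdeal.spanSingleton (𝓞 K)⁰ c.gen = F * c.1 := c.2.2.choose_spec.2

lemma mul_gen_mem (u : (𝓞 K)ˣ) (c : PrincCofactor F) : (u : K) * c.gen ∈ F := by
  have h1 : FractionalIdeal.spanSingleton (𝓞 K)⁰ c.gen ≤ F := by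
    rw [c.span_gen]
    calc F * c.1 ≤ F * 1 := mul_le_mul_right FractionalIdeal.coeIdeal_le_one F
      _ = F := mul_one F
  have h2 := FractionalIdeal.spanSingleton_le_iff_mem.1 h1
  rw [show (u : K) * c.gen = (u : 𝓞 K) • c.gen from (Algebra.smul_def _ _).symm]
  exact Submodule.smul_mem (F : Submodule (𝓞 K) K) _ h2

lemma span_unit_mul (u : (𝓞 K)ˣ) (x : K) : FractionalIdeal.spanSingleton (𝓞 K)⁰ ((u : K) * x) =
    FractionalIdeal.spanSingleton (𝓞 K)⁰ x := by
  apply le_antisymm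
  · rw [FractionalIdeal.spanSingleton_le_iff_mem, FractionalIdeal.mem_spanSingleton]
    exact ⟨u, Algebra.smul_def _ _⟩
  · rw [FractionalIdeal.spanSingleton_le_iff_mem, FractionalIdeal.mem_spanSingleton]
    refine ⟨(u⁻¹ : (𝓞 K)ˣ), ?_⟩
    rw [Algebra.smul_def, ← mul_assoc, ← map_mul, Units.inv_mul, map_one, one_mul]

lemma exists_unit_of_span_eq {x y : K} (hy : y ≠ 0)
    (h : FractionalIdeal.spanSingleton (𝓞 K)⁰ x = FractionalIdeal.spanSingleton (𝓞 K)⁰ y) :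
    ∃ u : (𝓞 K)ˣ, (u : K) * y = x := by
  have h1 : x ∈ FractionalIdeal.spanSingleton (𝓞 K)⁰ y := by
    rw [← h]; exact FractionalIdeal.mem_spanSingleton_self _ _
  have h2 : y ∈ FractionalIdeal.spanSingleton (𝓞 K)⁰ x := by
    rw [h]; exact FractionalIdeal.mem_spanSingleton_self _ _
  obtain ⟨a, ha⟩ := (FractionalIdeal.mem_spanSingleton _).1 h1
  obtain ⟨b, hb⟩ := (FractionalIdeal.mem_spanSingleton _).1 h2
  rw [Algebra.smul_def] at ha hb
  have hab : b * a = 1 := by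
    apply RingOfIntegers.coe_injective
    rw [map_mul, map_one]
    refine mul_right_cancel₀ hy ?_
    rw [one_mul, mul_assoc, ha, hb]
  exact ⟨⟨a, b, by rw [mul_comm]; exact hab, hab⟩, ha⟩

/-- Units times cofactors parametrise the nonzero elements of `𝔉`. -/
lemma bijective_mul_gen (hF : F ≠ 0) : Function.Bijective
    (fun i : (𝓞 K)ˣ × PrincCofactor F =>
      (⟨(i.1 : K) * i.2.gen, mul_gen_mem i.1 i.2,
        mul_ne_zero (by simp) i.2.gen_ne_zero⟩ : {ξ : K // ξ ∈ F ∧ ξ ≠ 0})) := by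
  constructor
  · rintro ⟨u, c⟩ ⟨v, d⟩ h
    have h1 : (u : K) * c.gen = (v : K) * d.gen := congrArg Subtype.val h
    have h2 := congrArg (FractionalIdeal.spanSingleton (𝓞 K)⁰) h1
    rw [span_unit_mul, span_unit_mul, c.span_gen, d.span_gen] at h2
    have h3 : c = d := Subtype.ext (FractionalIdeal.coeIdeal_injective (mul_left_cancel₀ hF h2))
    subst h3
    have h4 := mul_right_cancel₀ c.gen_ne_zero h1
    exact Prod.ext (Units.ext (RingOfIntegers.coe_injective h4)) rfl
  · rintro ⟨ξ, hξ, hξ0⟩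
    have h1 : FractionalIdeal.spanSingleton (𝓞 K)⁰ ξ ≤ F :=
      FractionalIdeal.spanSingleton_le_iff_mem.2 hξ
    have h2 : F⁻¹ * FractionalIdeal.spanSingleton (𝓞 K)⁰ ξ ≤ 1 := by
      calc _ ≤ F⁻¹ * F := mul_le_mul_right h1 _
        _ = 1 := inv_mul_cancel₀ hF
    obtain ⟨c, hc⟩ := FractionalIdeal.le_one_iff_exists_coeIdeal.1 h2
    have hc' : FractionalIdeal.spanSingleton (𝓞 K)⁰ ξ = F * c := by
      rw [hc, mul_inv_cancel_left₀ hF]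
    have hc0 : c ≠ ⊥ := by
      rintro rfl
      rw [FractionalIdeal.coeIdeal_bot, mul_zero, FractionalIdeal.spanSingleton_eq_zero_iff] at hc'
      exact hξ0 hc'
    let d : PrincCofactor F := ⟨c, hc0, ξ, hξ0, hc'⟩
    obtain ⟨u, hu⟩ := exists_unit_of_span_eq d.gen_ne_zero (x := ξ) (by rw [hc', d.span_gen])
    exact ⟨(u, d), Subtype.ext hu⟩

lemma nrm_gen (c : PrincCofactor F) :
    nrm (mixedEmbedding K c.gen) = FractionalIdeal.absNorm F * Ideal.absNorm c.1 := by
  rw [nrm_eq_norm, norm_eq_norm, ← FractionalIdeal.absNorm_span_singleton (𝓞 K), c.span_gen,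
    map_mul, FractionalIdeal.coeIdeal_absNorm]
  push_cast
  rfl

lemma gen_injective (hF : F ≠ 0) : Function.Injective (gen : PrincCofactor F → K) := by
  intro c d h
  have h2 := congrArg (FractionalIdeal.spanSingleton (𝓞 K)⁰) h
  rw [c.span_gen, d.span_gen] at h2
  exact Subtype.ext (FractionalIdeal.coeIdeal_injective (mul_left_cancel₀ hF h2))

lemma countable (hF : F ≠ 0) : Countable (PrincCofactor F) := by
  have : Countable K := (Module.finBasis ℚ K).equivFun.toEquiv.countable_iff.2 inferInstance
  exact (gen_injective hF).countable

end PrincCofactor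

variable (K) in
/-- The constant in the Poisson summation formula for the ideal lattice of `I`. -/
def idealConst (I : (FractionalIdeal (𝓞 K)⁰ K)ˣ) (p : Par K) : ℂ :=
  gfc {w : InfinitePlace K // w.IsComplex} p *
    ((volume.real (ZSpan.fundamentalDomain (fractionalIdealLatticeBasis K I)))⁻¹ : ℝ)

/-- Coordinates on a fractional ideal. -/
lemma bijective_coord (I : (FractionalIdeal (𝓞 K)⁰ K)ˣ) :
    ∃ f : (Module.Free.ChooseBasisIndex ℤ I → ℤ) ≃ {y : K // y ∈ (I : FractionalIdeal (𝓞 K)⁰ K)},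
      ∀ k, (f k : K) = ∑ i, (k i : ℚ) • basisOfFractionalIdeal K I i := by
  have hmem : ∀ x : K, x ∈ (I : FractionalIdeal (𝓞 K)⁰ K) ↔
      ∃ k : Module.Free.ChooseBasisIndex ℤ I → ℤ,
        ∑ i, (k i : ℚ) • basisOfFractionalIdeal K I i = x := by
    intro x
    have h := mem_span_basisOfFractionalIdeal K (I := I) (x := x)
    rw [SetLike.mem_coe] at h
    rw [← h, Submodule.mem_span_range_iff_exists_fun]
    simp only [Int.cast_smul_eq_zsmul]
  refine ⟨Equiv.ofBijective (fun k => ⟨∑ i, (k i : ℚ) • basisOfFractionalIdeal K I i,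
    (hmem _).2 ⟨k, rfl⟩⟩) ⟨fun k l h => ?_, fun y => ?_⟩, fun k => rfl⟩
  · have h1 := congrArg Subtype.val h
    have h2 := congrArg (fun z => (basisOfFractionalIdeal K I).equivFun z) h1
    simp only [← Module.Basis.equivFun_symm_apply, LinearEquiv.apply_symm_apply] at h2
    ext i
    exact_mod_cast congrFun h2 i
  · obtain ⟨k, hk⟩ := (hmem y).1 y.2
    exact ⟨k, Subtype.ext hk⟩

lemma bijective_dual_coord (I : (FractionalIdeal (𝓞 K)⁰ K)ˣ) :
    ∃ f : (Module.Free.ChooseBasisIndex ℤ I → ℤ) ≃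
        {y : K // y ∈ FractionalIdeal.dual ℤ ℚ (I : FractionalIdeal (𝓞 K)⁰ K)},
      ∀ m i, Algebra.trace ℚ K ((f m : K) * basisOfFractionalIdeal K I i) = m i := by
  have hnd := traceForm_nondegenerate ℚ K
  set β := basisOfFractionalIdeal K I with hβ
  set δ := (Algebra.traceForm ℚ K).dualBasis hnd β with hδ
  have hpair : ∀ (m : Module.Free.ChooseBasisIndex ℤ I → ℚ) i,
      Algebra.trace ℚ K ((∑ j, m j • δ j) * β i) = m i := by
    intro m i
    rw [← Algebra.traceForm_apply, map_sum, LinearMap.sum_apply]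
    simp only [map_smul, LinearMap.smul_apply, hδ, LinearMap.BilinForm.apply_dualBasis_left]
    simp
  have hI : (I : FractionalIdeal (𝓞 K)⁰ K) ≠ 0 := I.ne_zero
  obtain ⟨g, hg⟩ := bijective_coord I
  have hmem : ∀ x : K, x ∈ FractionalIdeal.dual ℤ ℚ (I : FractionalIdeal (𝓞 K)⁰ K) ↔
      ∃ k : Module.Free.ChooseBasisIndex ℤ I → ℤ, ∀ i, Algebra.trace ℚ K (x * β i) = k i := by
    intro x
    rw [FractionalIdeal.mem_dual hI]
    constructor
    · intro h
      have h1 : ∀ i, ∃ k : ℤ, Algebra.trace ℚ K (x * β i) = k := by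
        intro i
        have hb : β i ∈ (I : FractionalIdeal (𝓞 K)⁰ K) := by
          have := (g (Pi.single i 1)).2
          rw [hg] at this
          convert this using 1
          simp [Pi.single_apply, hβ]
        obtain ⟨k, hk⟩ := h _ hb
        exact ⟨k, by rw [← Algebra.traceForm_apply, ← hk]; rfl⟩
      choose k hk using h1
      exact ⟨k, hk⟩
    · rintro ⟨k, hk⟩ a ha
      obtain ⟨l, hl⟩ := g.surjective ⟨a, ha⟩
      have hl' : ∑ i, (l i : ℚ) • β i = a := by rw [← hg l, hl]
      refine ⟨∑ i, l i * k i, ?_⟩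
      rw [← hl', Algebra.traceForm_apply, Finset.mul_sum, map_sum]
      simp [hk]
  refine ⟨Equiv.ofBijective (fun m => ⟨∑ j, (m j : ℚ) • δ j,
    (hmem _).2 ⟨m, hpair (fun j => (m j : ℚ))⟩⟩) ⟨fun k l h => ?_, fun y => ?_⟩, fun m i => hpair (fun j => (m j : ℚ)) i⟩
  · have h1 := congrArg Subtype.val h
    ext i
    have h2 := congrArg (fun z => Algebra.trace ℚ K (z * β i)) h1
    simp only [hpair (fun j => (k j : ℚ)) i, hpair (fun j => (l j : ℚ)) i] at h2
    exact_mod_cast h2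
  · obtain ⟨k, hk⟩ := (hmem y).1 y.2
    refine ⟨k, Subtype.ext ?_⟩
    change ∑ j, (k j : ℚ) • δ j = y
    rw [← sub_eq_zero]
    refine hnd.1 _ fun z => ?_
    rw [← β.sum_repr z, map_sum]
    refine Finset.sum_eq_zero fun i _ => ?_
    rw [map_smul, map_sub, LinearMap.sub_apply, Algebra.traceForm_apply, Algebra.traceForm_apply,
      hpair (fun j => (k j : ℚ)) i, hk, sub_self, smul_zero]

/-- Poisson summation over a fractional ideal. -/
lemma poisson_ideal (I : (FractionalIdeal (𝓞 K)⁰ K)ˣ) (p : Par K) {x : mixedSpace K}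
    (hx : nrm x ≠ 0) (a : mixedSpace K) :
    (Summable fun y : {y : K // y ∈ (I : FractionalIdeal (𝓞 K)⁰ K)} =>
      gfn p (x * (a + mixedEmbedding K y.1))) ∧
    (Summable fun ξ : {y : K // y ∈ FractionalIdeal.dual ℤ ℚ (I : FractionalIdeal (𝓞 K)⁰ K)} =>
      gfn p (mixedEmbedding K ξ.1 * x⁻¹)) ∧
    ∑' y : {y : K // y ∈ (I : FractionalIdeal (𝓞 K)⁰ K)}, gfn p (x * (a + mixedEmbedding K y.1)) =
      idealConst K I p * ((nrm x)⁻¹ : ℝ) *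
        ∑' ξ : {y : K // y ∈ FractionalIdeal.dual ℤ ℚ (I : FractionalIdeal (𝓞 K)⁰ K)},
          cexp (2 * Real.pi * Complex.I * (mtr (mixedEmbedding K ξ.1 * a) : ℂ)) *
            gfn p (mixedEmbedding K ξ.1 * x⁻¹) := by
  obtain ⟨g, hg⟩ := bijective_coord I
  obtain ⟨f, hf⟩ := bijective_dual_coord I
  have h := poisson_lattice (fractionalIdealLatticeBasis K I) p hx a
    (fun m => mixedEmbedding K (f m).1) (fun m i => by
      rw [fractionalIdealLatticeBasis_apply, ← map_mul]
      exact (mtr_mixedEmbedding _).trans (by rw [hf]; simp))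
  have hgk : ∀ k, mixedEmbedding K (g k).1 = ∑ i, (k i : ℝ) • fractionalIdealLatticeBasis K I i := by
    intro k
    rw [hg, map_sum]
    refine Finset.sum_congr rfl fun i _ => ?_
    rw [fractionalIdealLatticeBasis_apply, Int.cast_smul_eq_zsmul, Int.cast_smul_eq_zsmul, map_zsmul]
  simp only [← hgk] at h
  refine ⟨g.summable_iff.1 h.1, f.summable_iff.1 h.2.1, ?_⟩
  rw [← g.tsum_eq, ← f.tsum_eq]
  exact h.2.2

end IdealPoisson

section ThetaIdeal

open scoped Classical nonZeroDivisors
open NumberField.InfinitePlace NumberField.mixedEmbedding MeasureTheory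

variable {K : Type*} [Field K] [NumberField K]

/-- The residue class modulo `q` of an integral element of `K`. -/
def resid (q : Ideal (𝓞 K)) (y : K) : 𝓞 K ⧸ q :=
  if h : ∃ d : 𝓞 K, (d : K) = y then Ideal.Quotient.mk q h.choose else 0

omit [NumberField K] in
lemma resid_coe (q : Ideal (𝓞 K)) (d : 𝓞 K) : resid q (d : K) = Ideal.Quotient.mk q d := by
  have h : ∃ e : 𝓞 K, (e : K) = d := ⟨d, rfl⟩
  rw [resid, dif_pos h, RingOfIntegers.coe_injective h.choose_spec]

omit [NumberField K] in
lemma resid_zero (q : Ideal (𝓞 K)) : resid q (0 : K) = 0 := by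
  have h : resid q ((0 : 𝓞 K) : K) = 0 := by rw [resid_coe, map_zero]
  exact h

lemma tsum_fractionalIdeal {F : FractionalIdeal (𝓞 K)⁰ K} (hF : F ≠ 0) (f : K → ℂ)
    (hf : Summable fun y : {y : K // y ∈ F} => f y.1) :
    ∑' y : {y : K // y ∈ F}, f y.1 =
      (∑' i : (𝓞 K)ˣ × PrincCofactor F, f ((i.1 : K) * i.2.gen)) + f 0 := by
  have hbij := PrincCofactor.bijective_mul_gen hF
  let z : {y : K // y ∈ F} := ⟨0, F.zero_mem⟩
  let j : (𝓞 K)ˣ × PrincCofactor F → {y : K // y ∈ F} := fun i =>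
    ⟨(i.1 : K) * i.2.gen, PrincCofactor.mul_gen_mem i.1 i.2⟩
  have hj : Function.Injective j := fun a b h => hbij.1 (Subtype.ext (by
    have h' : (a.1 : K) * a.2.gen = (b.1 : K) * b.2.gen := congrArg Subtype.val h
    exact h'))
  rw [hf.tsum_eq_add_tsum_ite z, add_comm]
  congr 1
  rw [← hj.tsum_eq]
  · refine tsum_congr fun i => if_neg fun h => ?_
    exact mul_ne_zero (by simp) i.2.gen_ne_zero (congrArg Subtype.val h)
  · intro y hy
    have hy0 : y ≠ z := fun h => hy (if_pos h)
    obtain ⟨i, hi⟩ := hbij.2 ⟨y.1, y.2, fun h => hy0 (Subtype.ext h)⟩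
    have h' : (i.1 : K) * i.2.gen = y.1 := congrArg Subtype.val hi
    exact ⟨i, Subtype.ext h'⟩

variable {b q : Ideal (𝓞 K)}

omit [NumberField K] in
lemma exists_crtLift (h : IsCoprime b q) (a : 𝓞 K ⧸ q) :
    ∃ d ∈ b, Ideal.Quotient.mk q d = a := by
  obtain ⟨c, rfl⟩ := Ideal.Quotient.mk_surjective a
  obtain ⟨i, hi, j, hj, hij⟩ := Ideal.isCoprime_iff_exists.1 h
  refine ⟨c * i, b.mul_mem_left _ hi, ?_⟩
  rw [Ideal.Quotient.eq]
  have : c * i - c = -(c * j) := by linear_combination c * hij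
  rw [this]
  exact q.neg_mem (q.mul_mem_left _ hj)

/-- A lift to `b` of a residue class modulo `q`. -/
def crtLift (h : IsCoprime b q) (a : 𝓞 K ⧸ q) : 𝓞 K := (exists_crtLift h a).choose

omit [NumberField K] in
lemma crtLift_mem (h : IsCoprime b q) (a : 𝓞 K ⧸ q) : crtLift h a ∈ b :=
  (exists_crtLift h a).choose_spec.1

omit [NumberField K] in
lemma mk_crtLift (h : IsCoprime b q) (a : 𝓞 K ⧸ q) : Ideal.Quotient.mk q (crtLift h a) = a :=
  (exists_crtLift h a).choose_spec.2

/-- The product `b q` as an invertible fractional ideal. -/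
def prodUnit (hb : b ≠ ⊥) (hq : q ≠ ⊥) : (FractionalIdeal (𝓞 K)⁰ K)ˣ :=
  Units.mk0 ((b * q : Ideal (𝓞 K)) : FractionalIdeal (𝓞 K)⁰ K)
    (FractionalIdeal.coeIdeal_ne_zero.2 (mul_ne_zero hb hq))

variable (b q) in
/-- The dual of the fractional ideal `b q`. -/
def dualProd : FractionalIdeal (𝓞 K)⁰ K :=
  FractionalIdeal.dual ℤ ℚ ((b * q : Ideal (𝓞 K)) : FractionalIdeal (𝓞 K)⁰ K)

/-- The additive character of `𝓞 K ⧸ q` attached to `ξ`. -/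
def addPsi (h : IsCoprime b q) (ξ : K) (a : 𝓞 K ⧸ q) : ℂ :=
  cexp (2 * Real.pi * Complex.I * ((Algebra.trace ℚ K (ξ * (crtLift h a : K)) : ℚ) : ℂ))

lemma cexp_trace_eq (hb : b ≠ ⊥) (hq : q ≠ ⊥) {ξ : K} (hξ : ξ ∈ dualProd b q) {c d : 𝓞 K}
    (hcd : c - d ∈ b * q) :
    cexp (2 * Real.pi * Complex.I * ((Algebra.trace ℚ K (ξ * (c : K)) : ℚ) : ℂ)) =
      cexp (2 * Real.pi * Complex.I * ((Algebra.trace ℚ K (ξ * (d : K)) : ℚ) : ℂ)) := by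
  have hne : ((b * q : Ideal (𝓞 K)) : FractionalIdeal (𝓞 K)⁰ K) ≠ 0 :=
    FractionalIdeal.coeIdeal_ne_zero.2 (mul_ne_zero hb hq)
  obtain ⟨n, hn⟩ := (FractionalIdeal.mem_dual hne).1 hξ _
    (FractionalIdeal.mem_coeIdeal_of_mem (𝓞 K)⁰ hcd)
  rw [Algebra.traceForm_apply] at hn
  have e : Algebra.trace ℚ K (ξ * (c : K)) = Algebra.trace ℚ K (ξ * (d : K)) + n := by
    have : ξ * (c : K) = ξ * (d : K) + ξ * ((c - d : 𝓞 K) : K) := by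
      rw [show ((c - d : 𝓞 K) : K) = (c : K) - (d : K) from rfl]; ring
    rw [this, map_add, ← hn]
    rfl
  rw [e]
  push_cast
  rw [mul_add, Complex.exp_add, show 2 * (Real.pi : ℂ) * Complex.I * (n : ℂ) =
    n * (2 * Real.pi * Complex.I) by ring, Complex.exp_int_mul_two_pi_mul_I, mul_one]

lemma addPsi_mk (h : IsCoprime b q) (hb : b ≠ ⊥) (hq : q ≠ ⊥) {ξ : K} (hξ : ξ ∈ dualProd b q)
    {d : 𝓞 K} (hd : d ∈ b) : addPsi h ξ (Ideal.Quotient.mk q d) =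
      cexp (2 * Real.pi * Complex.I * ((Algebra.trace ℚ K (ξ * (d : K)) : ℚ) : ℂ)) := by
  refine cexp_trace_eq hb hq hξ ?_
  rw [Ideal.mul_eq_inf_of_isCoprime h]
  exact ⟨b.sub_mem (crtLift_mem h _) hd, by rw [SetLike.mem_coe, ← Ideal.Quotient.eq, mk_crtLift]⟩

variable [Fintype (𝓞 K ⧸ q)]

/-- The Gauss sum attached to `ξ`. -/
def gaussCoeff (h : IsCoprime b q) (X : MulChar (𝓞 K ⧸ q) ℂ) (ξ : K) : ℂ :=
  ∑ a, X a * addPsi h ξ a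

lemma gaussCoeff_zero (h : IsCoprime b q) (X : MulChar (𝓞 K ⧸ q) ℂ) :
    gaussCoeff h X 0 = ∑ a, X a := by
  simp [gaussCoeff, addPsi]

lemma gaussCoeff_unit_mul (h : IsCoprime b q) (hb : b ≠ ⊥) (hq : q ≠ ⊥) (X : MulChar (𝓞 K ⧸ q) ℂ)
    {ξ : K} (hξ : ξ ∈ dualProd b q) (u : (𝓞 K)ˣ) :
    gaussCoeff h X ((u : K) * ξ) =
      X (Ideal.Quotient.mk q ((u⁻¹ : (𝓞 K)ˣ) : 𝓞 K)) * gaussCoeff h X ξ := by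
  have huv : Ideal.Quotient.mk q (u : 𝓞 K) * Ideal.Quotient.mk q ((u⁻¹ : (𝓞 K)ˣ) : 𝓞 K) = 1 := by
    rw [← map_mul, Units.mul_inv, map_one]
  have hvu : Ideal.Quotient.mk q ((u⁻¹ : (𝓞 K)ˣ) : 𝓞 K) * Ideal.Quotient.mk q (u : 𝓞 K) = 1 := by
    rw [mul_comm, huv]
  let E : (𝓞 K ⧸ q) ≃ (𝓞 K ⧸ q) :=
    ⟨fun a => Ideal.Quotient.mk q (u : 𝓞 K) * a,
      fun a => Ideal.Quotient.mk q ((u⁻¹ : (𝓞 K)ˣ) : 𝓞 K) * a,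
      fun a => by simp only [← mul_assoc, hvu, one_mul],
      fun a => by simp only [← mul_assoc, huv, one_mul]⟩
  rw [gaussCoeff, gaussCoeff, Finset.mul_sum]
  refine Fintype.sum_equiv E _ _ fun a => ?_
  have e1 : E a = Ideal.Quotient.mk q ((u : 𝓞 K) * crtLift h a) := by
    rw [map_mul, mk_crtLift]; rfl
  rw [← mul_assoc, ← map_mul]
  congr 1
  · congr 1
    show a = _ * (Ideal.Quotient.mk q (u : 𝓞 K) * a)
    rw [← mul_assoc, hvu, one_mul]
  · rw [e1, addPsi_mk h hb hq hξ (b.mul_mem_left _ (crtLift_mem h a)), addPsi,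
      show ((((u : 𝓞 K) * crtLift h a : 𝓞 K)) : K) = (u : K) * (crtLift h a : K) from rfl,
      mul_comm (u : K) ξ, mul_assoc ξ]

omit [Fintype (𝓞 K ⧸ q)] in
lemma norm_addPsi (h : IsCoprime b q) (ξ : K) (a : 𝓞 K ⧸ q) : ‖addPsi h ξ a‖ = 1 := by
  rw [addPsi, show 2 * (Real.pi : ℂ) * Complex.I *
    ((Algebra.trace ℚ K (ξ * (crtLift h a : K)) : ℚ) : ℂ) =
    ((2 * Real.pi * (Algebra.trace ℚ K (ξ * (crtLift h a : K)) : ℚ) : ℝ) : ℂ) * Complex.I by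
      push_cast; ring, Complex.norm_exp_ofReal_mul_I]

omit [NumberField K] [Fintype (𝓞 K ⧸ q)] in
lemma crt_add_mem (h : IsCoprime b q) (a : 𝓞 K ⧸ q) {y : K}
    (hy : y ∈ ((b * q : Ideal (𝓞 K)) : FractionalIdeal (𝓞 K)⁰ K)) :
    (crtLift h a : K) + y ∈ (b : FractionalIdeal (𝓞 K)⁰ K) := by
  obtain ⟨d, hd, rfl⟩ := (FractionalIdeal.mem_coeIdeal (𝓞 K)⁰).1 hy
  exact FractionalIdeal.mem_coeIdeal_of_mem (𝓞 K)⁰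
    (b.add_mem (crtLift_mem h a) (Ideal.mul_le_left hd))

omit [NumberField K] [Fintype (𝓞 K ⧸ q)] in
lemma bijective_crt (h : IsCoprime b q) : Function.Bijective
    (fun i : (𝓞 K ⧸ q) × {y : K // y ∈ ((b * q : Ideal (𝓞 K)) : FractionalIdeal (𝓞 K)⁰ K)} =>
      (⟨(crtLift h i.1 : K) + i.2.1, crt_add_mem h i.1 i.2.2⟩ :
        {y : K // y ∈ (b : FractionalIdeal (𝓞 K)⁰ K)})) := by
  constructor
  · rintro ⟨a, y, hy⟩ ⟨a', y', hy'⟩ hh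
    have h1 : (crtLift h a : K) + y = (crtLift h a' : K) + y' := congrArg Subtype.val hh
    obtain ⟨d, hd, rfl⟩ := (FractionalIdeal.mem_coeIdeal (𝓞 K)⁰).1 hy
    obtain ⟨d', hd', rfl⟩ := (FractionalIdeal.mem_coeIdeal (𝓞 K)⁰).1 hy'
    have h2 : crtLift h a + d = crtLift h a' + d' := by
      apply RingOfIntegers.coe_injective
      exact h1
    have h3 := congrArg (Ideal.Quotient.mk q) h2
    rw [map_add, map_add, mk_crtLift, mk_crtLift,
      Ideal.Quotient.eq_zero_iff_mem.2 (Ideal.mul_le_right hd),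
      Ideal.Quotient.eq_zero_iff_mem.2 (Ideal.mul_le_right hd'), add_zero, add_zero] at h3
    subst h3
    exact Prod.ext rfl (Subtype.ext (add_left_cancel h1))
  · rintro ⟨y, hy⟩
    obtain ⟨d, hd, rfl⟩ := (FractionalIdeal.mem_coeIdeal (𝓞 K)⁰).1 hy
    refine ⟨⟨Ideal.Quotient.mk q d, ⟨((d - crtLift h (Ideal.Quotient.mk q d) : 𝓞 K) : K), ?_⟩⟩, ?_⟩
    · refine FractionalIdeal.mem_coeIdeal_of_mem (𝓞 K)⁰ ?_
      rw [Ideal.mul_eq_inf_of_isCoprime h]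
      exact ⟨b.sub_mem hd (crtLift_mem h _), by rw [SetLike.mem_coe, ← Ideal.Quotient.eq, mk_crtLift]⟩
    · refine Subtype.ext ?_
      show (crtLift h (Ideal.Quotient.mk q d) : K) +
        ((d : K) - (crtLift h (Ideal.Quotient.mk q d) : K)) = (d : K)
      ring

/-- The theta identity for the ideal `b` twisted by a residue character. -/
lemma theta_ideal (h : IsCoprime b q) (hb : b ≠ ⊥) (hq : q ≠ ⊥) (X : MulChar (𝓞 K ⧸ q) ℂ)
    (hX : ∀ a, ‖X a‖ ≤ 1) (p : Par K) {x : mixedSpace K} (hx : nrm x ≠ 0) :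
    (Summable fun y : {y : K // y ∈ (b : FractionalIdeal (𝓞 K)⁰ K)} =>
      X (resid q y.1) * gfn p (mixedEmbedding K y.1 * x)) ∧
    (Summable fun ξ : {y : K // y ∈ dualProd b q} =>
      gaussCoeff h X ξ.1 * gfn p (mixedEmbedding K ξ.1 * x⁻¹)) ∧
    ∑' y : {y : K // y ∈ (b : FractionalIdeal (𝓞 K)⁰ K)},
        X (resid q y.1) * gfn p (mixedEmbedding K y.1 * x) =
      idealConst K (prodUnit hb hq) p * ((nrm x)⁻¹ : ℝ) *
        ∑' ξ : {y : K // y ∈ dualProd b q},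
          gaussCoeff h X ξ.1 * gfn p (mixedEmbedding K ξ.1 * x⁻¹) := by
  have hP := fun a : 𝓞 K ⧸ q => poisson_ideal (prodUnit hb hq) p hx
    (mixedEmbedding K (crtLift h a : K))
  have hterm : ∀ i : (𝓞 K ⧸ q) × {y : K // y ∈ ((b * q : Ideal (𝓞 K)) : FractionalIdeal (𝓞 K)⁰ K)},
      X (resid q ((crtLift h i.1 : K) + i.2.1)) *
        gfn p (mixedEmbedding K ((crtLift h i.1 : K) + i.2.1) * x) =
      X i.1 * gfn p (x * (mixedEmbedding K (crtLift h i.1 : K) + mixedEmbedding K i.2.1)) := by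
    rintro ⟨a, y, hy⟩
    obtain ⟨d, hd, rfl⟩ := (FractionalIdeal.mem_coeIdeal (𝓞 K)⁰).1 hy
    have e1 : resid q ((crtLift h a : K) + (d : K)) = a := by
      rw [show (crtLift h a : K) + (d : K) = ((crtLift h a + d : 𝓞 K) : K) from rfl, resid_coe,
        map_add, mk_crtLift, Ideal.Quotient.eq_zero_iff_mem.2 (Ideal.mul_le_right hd), add_zero]
    show X (resid q ((crtLift h a : K) + (d : K))) *
      gfn p (mixedEmbedding K ((crtLift h a : K) + (d : K)) * x) = X a *
      gfn p (x * (mixedEmbedding K (crtLift h a : K) + mixedEmbedding K (d : K)))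
    rw [e1, map_add (mixedEmbedding K), mul_comm x]
  have hsum : Summable fun i : (𝓞 K ⧸ q) ×
      {y : K // y ∈ ((b * q : Ideal (𝓞 K)) : FractionalIdeal (𝓞 K)⁰ K)} =>
      X i.1 * gfn p (x * (mixedEmbedding K (crtLift h i.1 : K) + mixedEmbedding K i.2.1)) := by
    refine Summable.of_norm ((summable_prod_of_nonneg fun i => norm_nonneg _).2 ⟨fun a => ?_, ?_⟩)
    · exact ((hP a).1.mul_left (X a)).norm
    · exact Summable.of_finite
  have hsum' : Summable fun i : (𝓞 K ⧸ q) ×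
      {y : K // y ∈ ((b * q : Ideal (𝓞 K)) : FractionalIdeal (𝓞 K)⁰ K)} =>
      X (resid q ((crtLift h i.1 : K) + i.2.1)) *
        gfn p (mixedEmbedding K ((crtLift h i.1 : K) + i.2.1) * x) :=
    hsum.congr fun i => (hterm i).symm
  let E := Equiv.ofBijective _ (bijective_crt h)
  have hdual : ∀ a, Summable fun ξ : {y : K // y ∈ dualProd b q} =>
      X a * addPsi h ξ.1 a * gfn p (mixedEmbedding K ξ.1 * x⁻¹) := fun a => by
    refine Summable.of_norm_bounded (hP a).2.1.norm fun ξ => ?_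
    rw [norm_mul, norm_mul, norm_addPsi, mul_one]
    exact mul_le_of_le_one_left (norm_nonneg _) (hX a)
  have hgc : (fun ξ : {y : K // y ∈ dualProd b q} =>
      gaussCoeff h X ξ.1 * gfn p (mixedEmbedding K ξ.1 * x⁻¹)) =
      fun ξ => ∑ a, X a * addPsi h ξ.1 a * gfn p (mixedEmbedding K ξ.1 * x⁻¹) := by
    funext ξ
    rw [gaussCoeff, Finset.sum_mul]
  refine ⟨E.summable_iff.1 hsum', ?_, ?_⟩
  · rw [hgc]
    exact summable_sum fun a _ => hdual a
  · rw [← E.tsum_eq, hgc, Summable.tsum_finsetSum fun a _ => hdual a]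
    show ∑' i : (𝓞 K ⧸ q) × {y : K // y ∈ ((b * q : Ideal (𝓞 K)) : FractionalIdeal (𝓞 K)⁰ K)},
      X (resid q ((crtLift h i.1 : K) + i.2.1)) *
        gfn p (mixedEmbedding K ((crtLift h i.1 : K) + i.2.1) * x) = _
    rw [tsum_congr hterm, hsum.tsum_prod, tsum_fintype, Finset.mul_sum]
    refine Finset.sum_congr rfl fun a _ => ?_
    show ∑' y : {y : K // y ∈ ((b * q : Ideal (𝓞 K)) : FractionalIdeal (𝓞 K)⁰ K)}, X a * gfn p
      (x * (mixedEmbedding K (crtLift h a : K) + mixedEmbedding K y.1)) = _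
    rw [tsum_mul_left]
    have h3 := (hP a).2.2
    have h4 : ∀ ξ : {y : K // y ∈ dualProd b q}, X a * addPsi h ξ.1 a *
        gfn p (mixedEmbedding K ξ.1 * x⁻¹) = X a * (cexp (2 * Real.pi * Complex.I *
          (mtr (mixedEmbedding K ξ.1 * mixedEmbedding K (crtLift h a : K)) : ℂ)) *
            gfn p (mixedEmbedding K ξ.1 * x⁻¹)) := fun ξ => by
      rw [← map_mul, mtr_mixedEmbedding, addPsi, Complex.ofReal_ratCast, mul_assoc]
    rw [tsum_congr h4, tsum_mul_left]
    refine (congrArg (X a * ·) h3).trans ?_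
    show X a * (_ * ∑' ξ : {y : K // y ∈ dualProd b q}, _) = _
    ring

end ThetaIdeal

section ClassMellin

open scoped Classical nonZeroDivisors
open NumberField.InfinitePlace NumberField.mixedEmbedding MeasureTheory

variable {K : Type*} [Field K] [NumberField K]

lemma mulChar_norm_le_one {R : Type*} [CommRing R] [Finite R] (X : MulChar R ℂ) (a : R) :
    ‖X a‖ ≤ 1 := by
  by_cases ha : IsUnit a
  · have : Finite Rˣ := inferInstance
    cases nonempty_fintype Rˣ
    have h := X.apply_mem_rootsOfUnity ha.unit
    have h2 := norm_eq_one_of_mem_rootsOfUnity h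
    rw [MulChar.coe_equivToUnitHom] at h2
    exact h2.le
  · rw [X.map_nonunit ha]
    simp

variable {b q : Ideal (𝓞 K)}

lemma finite_quot (hq : q ≠ ⊥) : Finite (𝓞 K ⧸ q) := Ideal.finiteQuotientOfFreeOfNeBot q hq

lemma PrincCofactor.summable_rpow {F : FractionalIdeal (𝓞 K)⁰ K} {σ : ℝ} (hσ : 1 < σ) :
    Summable fun c : PrincCofactor F => nrm (mixedEmbedding K c.gen) ^ (-σ) := by
  let j : PrincCofactor F → {I : Ideal (𝓞 K) // I ≠ ⊥} := fun c => ⟨c.1, c.2.1⟩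
  have hj : Function.Injective j := fun c d h => Subtype.ext (congrArg (fun z => z.1) h)
  refine (((summable_ideals K hσ).comp_injective hj).mul_left
    ((FractionalIdeal.absNorm F : ℝ) ^ (-σ))).congr fun c => ?_
  rw [PrincCofactor.nrm_gen, Real.mul_rpow]
  · rfl
  · exact_mod_cast FractionalIdeal.absNorm_nonneg F
  · positivity

lemma PrincCofactor.exists_coe (c : PrincCofactor (b : FractionalIdeal (𝓞 K)⁰ K)) :
    ∃ d : 𝓞 K, d ≠ 0 ∧ (d : K) = c.gen ∧ Ideal.span {d} = b * c.1 := by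
  have h := PrincCofactor.mul_gen_mem 1 c
  rw [Units.val_one, map_one, one_mul] at h
  obtain ⟨d, -, hd⟩ := (FractionalIdeal.mem_coeIdeal (𝓞 K)⁰).1 h
  refine ⟨d, ?_, hd, ?_⟩
  · rintro rfl
    exact c.gen_ne_zero (by rw [← hd, map_zero])
  · apply FractionalIdeal.coeIdeal_injective (R := 𝓞 K) (K := K)
    show ((Ideal.span {d} : Ideal (𝓞 K)) : FractionalIdeal (𝓞 K)⁰ K) =
      ((b * c.1 : Ideal (𝓞 K)) : FractionalIdeal (𝓞 K)⁰ K)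
    rw [FractionalIdeal.coeIdeal_span_singleton, FractionalIdeal.coeIdeal_mul]
    exact (congrArg _ hd).trans c.span_gen

lemma dualProd_ne_zero (hb : b ≠ ⊥) (hq : q ≠ ⊥) : dualProd b q ≠ 0 :=
  FractionalIdeal.dual_ne_zero ℤ ℚ (FractionalIdeal.coeIdeal_ne_zero.2 (mul_ne_zero hb hq))

lemma card_places_pos : 0 < Fintype.card {w : InfinitePlace K // w.IsReal} +
    2 * Fintype.card {w : InfinitePlace K // w.IsComplex} := by
  have := card_add_two_mul_card_eq_rank K
  rw [nrRealPlaces, nrComplexPlaces] at this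
  rw [this]
  exact Module.finrank_pos

variable (K) in
/-- The volume constant of the fundamental cone. -/
def coneVol : ℂ := ((FundWeight.nuR (coneWeight K) (Set.Iic 1)).toReal : ℂ)

lemma class_mellin (χ : HeckeChar K q) (h : IsCoprime b q) (hb : b ≠ ⊥) (hq : q ≠ ⊥)
    [Fintype (𝓞 K ⧸ q)] (p : Par K) (X : MulChar (𝓞 K ⧸ q) ℂ)
    (hX : ∀ α : 𝓞 K, α ≠ 0 → χ.toFun (Ideal.span {α}) =
      X (Ideal.Quotient.mk q α) * om p (mixedEmbedding K (α : K))) :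
    ∃ Λ₀ : ℂ → ℂ, Differentiable ℂ Λ₀ ∧
      (∀ a b : ℝ, ∃ M : ℝ, ∀ s : ℂ, a ≤ s.re → s.re ≤ b → ‖Λ₀ s‖ ≤ M) ∧
      (∀ s : ℂ, 1 < s.re → χ.toFun b * (Ideal.absNorm b : ℂ) ^ (-s) *
          (∑' c : PrincCofactor (b : FractionalIdeal (𝓞 K)⁰ K), lterm χ s c.1) *
          ZF {w : InfinitePlace K // w.IsComplex} p s =
        Λ₀ s + gfn p (0 : mixedSpace K) * coneVol K *
          (idealConst K (prodUnit hb hq) p * (∑ a, X a) / (s - 1) - X 0 / s)) ∧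
      (∀ s : ℂ, s.re < 0 → idealConst K (prodUnit hb hq) p *
          ((∑' c : PrincCofactor (dualProd b q), gaussCoeff h X c.gen *
            om p (mixedEmbedding K c.gen) * (nrm (mixedEmbedding K c.gen) : ℂ) ^ (s - 1)) *
            ZF {w : InfinitePlace K // w.IsComplex} p (1 - s)) =
        Λ₀ s + gfn p (0 : mixedSpace K) * coneVol K *
          (idealConst K (prodUnit hb hq) p * (∑ a, X a) / (s - 1) - X 0 / s)) := by
  have hbF : (b : FractionalIdeal (𝓞 K)⁰ K) ≠ 0 := FractionalIdeal.coeIdeal_ne_zero.2 hb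
  have hdF := dualProd_ne_zero hb hq
  have := PrincCofactor.countable hbF
  have := PrincCofactor.countable hdF
  have := countable_units K
  have hX1 := mulChar_norm_le_one X
  have hnz : ∀ {F : FractionalIdeal (𝓞 K)⁰ K} (c : PrincCofactor F),
      nrm (mixedEmbedding K c.gen) ≠ 0 := fun c => nrm_embedding_ne_zero c.gen_ne_zero
  have hunz : ∀ u : (𝓞 K)ˣ, nrm (unitEmb K u) ≠ 0 := fun u => by
    rw [(fundWeight_cone K).nrm_one]; exact one_ne_zero
  have hu : ∀ u : (𝓞 K)ˣ, X (Ideal.Quotient.mk q (u : 𝓞 K)) = om p (unitEmb K u) := by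
    intro u
    have h1 := hX u u.ne_zero
    rw [Ideal.span_singleton_eq_top.2 u.isUnit, χ.map_top] at h1
    have h2 : (om p (unitEmb K u) : ℂ) * om p (unitEmb K u) = 1 := by
      rw [← Complex.ofReal_mul, om_mul_self p (hunz u), Complex.ofReal_one]
    calc X (Ideal.Quotient.mk q (u : 𝓞 K)) = X (Ideal.Quotient.mk q (u : 𝓞 K)) *
          ((om p (unitEmb K u) : ℂ) * om p (unitEmb K u)) := by rw [h2, mul_one]
      _ = (X (Ideal.Quotient.mk q (u : 𝓞 K)) * om p (unitEmb K u)) * om p (unitEmb K u) := by ring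
      _ = _ := by rw [unitEmb_apply, ← h1, one_mul]
  have hsumX : ∀ σ : ℝ, 1 < σ → Summable fun c : PrincCofactor (b : FractionalIdeal (𝓞 K)⁰ K) =>
      ‖X (resid q c.gen)‖ * nrm (mixedEmbedding K c.gen) ^ (-σ) := fun σ hσ =>
    (PrincCofactor.summable_rpow hσ).of_nonneg_of_le
      (fun c => mul_nonneg (norm_nonneg _) (Real.rpow_nonneg (nrm_nonneg _) _))
      fun c => mul_le_of_le_one_left (Real.rpow_nonneg (nrm_nonneg _) _) (hX1 _)
  have hsumG : ∀ σ : ℝ, σ < 0 → Summable fun c : PrincCofactor (dualProd b q) =>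
      ‖gaussCoeff h X c.gen‖ * nrm (mixedEmbedding K c.gen) ^ (σ - 1) := by
    intro σ hσ
    have h1 := (PrincCofactor.summable_rpow (F := dualProd b q) (σ := 1 - σ) (by linarith)).mul_left
      (Fintype.card (𝓞 K ⧸ q) : ℝ)
    rw [neg_sub] at h1
    refine h1.of_nonneg_of_le
      (fun c => mul_nonneg (norm_nonneg _) (Real.rpow_nonneg (nrm_nonneg _) _)) fun c => ?_
    refine mul_le_mul_of_nonneg_right ?_ (Real.rpow_nonneg (nrm_nonneg _) _)
    refine (norm_sum_le _ _).trans ?_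
    calc _ ≤ ∑ a : 𝓞 K ⧸ q, (1 : ℝ) := Finset.sum_le_sum fun a _ => by
          rw [norm_mul, norm_addPsi, mul_one]; exact hX1 a
      _ = _ := by simp
  have hP : ∀ x : mixedSpace K, nrm x ≠ 0 →
      (∑' i : (𝓞 K)ˣ × PrincCofactor (b : FractionalIdeal (𝓞 K)⁰ K), om p (unitEmb K i.1) *
        X (resid q i.2.gen) * gfn p (unitEmb K i.1 * mixedEmbedding K i.2.gen * x)) +
          X 0 * gfn p (0 : mixedSpace K) =
      idealConst K (prodUnit hb hq) p * (nrm x : ℂ)⁻¹ *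
        ((∑' i : (𝓞 K)ˣ × PrincCofactor (dualProd b q), om p (unitEmb K i.1) *
          gaussCoeff h X i.2.gen * gfn p (unitEmb K i.1 * mixedEmbedding K i.2.gen * x⁻¹)) +
            (∑ a, X a) * gfn p (0 : mixedSpace K)) := by
    intro x hx
    obtain ⟨h1, h2, h3⟩ := theta_ideal h hb hq X hX1 p hx
    rw [tsum_fractionalIdeal hbF (fun y => X (resid q y) * gfn p (mixedEmbedding K y * x)) h1,
      tsum_fractionalIdeal hdF
        (fun y => gaussCoeff h X y * gfn p (mixedEmbedding K y * x⁻¹)) h2] at h3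
    rw [map_zero, zero_mul, zero_mul, resid_zero, gaussCoeff_zero, Complex.ofReal_inv] at h3
    refine Eq.trans ?_ (h3.trans ?_)
    · congr 1
      refine tsum_congr fun i => ?_
      obtain ⟨d, -, hd, -⟩ := i.2.exists_coe
      rw [map_mul, unitEmb_apply, ← hd,
        show (i.1 : K) * (d : K) = (((i.1 : 𝓞 K) * d : 𝓞 K) : K) from rfl, resid_coe, resid_coe,
        map_mul, map_mul, hu, unitEmb_apply]
    · congr 2
      refine tsum_congr fun i => ?_
      have hm : i.2.gen ∈ dualProd b q := by
        have := PrincCofactor.mul_gen_mem 1 i.2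
        rwa [Units.val_one, map_one, one_mul] at this
      rw [gaussCoeff_unit_mul h hb hq X hm, hu, om_conj (fundWeight_cone K), map_mul, unitEmb_apply]
  obtain ⟨Λ₀, hd, hbd, h1, h2⟩ := theta_mellin (fundWeight_cone K) card_places_pos p
    (fun c : PrincCofactor (b : FractionalIdeal (𝓞 K)⁰ K) => mixedEmbedding K c.gen) hnz
    (fun c => X (resid q c.gen))
    (fun c : PrincCofactor (dualProd b q) => mixedEmbedding K c.gen) hnz
    (fun c => gaussCoeff h X c.gen) (idealConst K (prodUnit hb hq) p) (X 0) (∑ a, X a)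
    hsumX hsumG hP
  refine ⟨Λ₀, hd, hbd, fun s hs => ?_, h2⟩
  rw [coneVol, ← h1 s hs, ← tsum_mul_left]
  congr 1
  refine tsum_congr fun c => ?_
  obtain ⟨d, hd0, hd, hdc⟩ := c.exists_coe
  rw [PrincCofactor.nrm_gen, FractionalIdeal.coeIdeal_absNorm, ← hd, resid_coe, ← hX d hd0, hdc,
    χ.map_mul', lterm]
  push_cast
  rw [natCast_mul_natCast_cpow]
  ring

end ClassMellin

section GaussBound

open scoped Classical nonZeroDivisors

lemma mulChar_norm_unit {R : Type*} [CommRing R] [Finite R] (X : MulChar R ℂ) (u : Rˣ) :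
    ‖X u‖ = 1 := by
  refine le_antisymm (mulChar_norm_le_one X u) ?_
  have h := mulChar_norm_le_one X ((u⁻¹ : Rˣ) : R)
  have h2 : ‖X u‖ * ‖X ((u⁻¹ : Rˣ) : R)‖ = 1 := by
    rw [← norm_mul, ← map_mul, Units.mul_inv, map_one, norm_one]
  nlinarith [norm_nonneg (X u)]

/-- A Gauss sum over a finite ring is bounded by the size of the annihilator of the additive
character. -/
lemma norm_gaussSum_sq_le {R : Type*} [CommRing R] [Fintype R] (X : MulChar R ℂ)
    (ψ : AddChar R ℂ) :
    ‖gaussSum X ψ‖ ^ 2 ≤ Fintype.card R *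
      (Finset.univ.filter fun e : R => ψ.mulShift e = 1).card := by
  set A := Finset.univ.filter fun e : R => ψ.mulShift e = 1 with hA
  have hunit : ∀ u : Rˣ, ‖gaussSum X (ψ.mulShift u)‖ = ‖gaussSum X ψ‖ := fun u => by
    rw [← gaussSum_mulShift X ψ u, norm_mul, mulChar_norm_unit, one_mul]
  have h1 : (Fintype.card Rˣ : ℝ) * ‖gaussSum X ψ‖ ^ 2 ≤
      ∑ d : R, ‖gaussSum X (ψ.mulShift d)‖ ^ 2 := by
    calc (Fintype.card Rˣ : ℝ) * ‖gaussSum X ψ‖ ^ 2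
        = ∑ u : Rˣ, ‖gaussSum X (ψ.mulShift u)‖ ^ 2 := by simp [hunit]
      _ = ∑ d ∈ Finset.univ.map ⟨((↑) : Rˣ → R), Units.val_injective⟩,
          ‖gaussSum X (ψ.mulShift d)‖ ^ 2 := by rw [Finset.sum_map]; rfl
      _ ≤ _ := Finset.sum_le_univ_sum_of_nonneg fun _ => by positivity
  have h2 : ((∑ d : R, ‖gaussSum X (ψ.mulShift d)‖ ^ 2 : ℝ) : ℂ) =
      ∑ a : R, ∑ a' : R, X a * (starRingEnd ℂ) (X a') *
        (if ψ.mulShift (a - a') = 1 then (Fintype.card R : ℂ) else 0) := by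
    push_cast
    calc _ = ∑ d : R, ∑ a : R, ∑ a' : R, X a * (starRingEnd ℂ) (X a') * ψ.mulShift (a - a') d := by
          refine Finset.sum_congr rfl fun d _ => ?_
          rw [← Complex.ofReal_pow, ← Complex.normSq_eq_norm_sq, ← Complex.mul_conj, gaussSum,
            map_sum, Finset.sum_mul_sum]
          refine Finset.sum_congr rfl fun a _ => Finset.sum_congr rfl fun a' _ => ?_
          rw [map_mul, ← AddChar.map_neg_eq_conj]
          simp only [AddChar.mulShift_apply]
          rw [show (a - a') * d = d * a + -(d * a') by ring, AddChar.map_add_eq_mul]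
          ring_nf
      _ = _ := by
          rw [Finset.sum_comm]
          refine Finset.sum_congr rfl fun a _ => ?_
          rw [Finset.sum_comm]
          refine Finset.sum_congr rfl fun a' _ => ?_
          rw [← Finset.mul_sum, AddChar.sum_eq_ite]
          rfl
  have h3 : ∑ d : R, ‖gaussSum X (ψ.mulShift d)‖ ^ 2 ≤
      Fintype.card R * (Fintype.card Rˣ * A.card) := by
    have e : ∑ d : R, ‖gaussSum X (ψ.mulShift d)‖ ^ 2 =
        ‖((∑ d : R, ‖gaussSum X (ψ.mulShift d)‖ ^ 2 : ℝ) : ℂ)‖ := by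
      rw [Complex.norm_real, Real.norm_of_nonneg (Finset.sum_nonneg fun _ _ => by positivity)]
    rw [e, h2]
    calc _ ≤ ∑ a : R, ∑ a' : R, (if IsUnit a then (1 : ℝ) else 0) *
          (if a - a' ∈ A then (Fintype.card R : ℝ) else 0) := by
          refine (norm_sum_le _ _).trans (Finset.sum_le_sum fun a _ =>
            (norm_sum_le _ _).trans (Finset.sum_le_sum fun a' _ => ?_))
          rw [norm_mul, norm_mul, RCLike.norm_conj]
          have hx : ‖X a‖ ≤ if IsUnit a then (1 : ℝ) else 0 := by
            split_ifs with ha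
            · exact mulChar_norm_le_one X a
            · rw [X.map_nonunit ha, norm_zero]
          have hy : ‖(if ψ.mulShift (a - a') = 1 then (Fintype.card R : ℂ) else 0)‖ ≤
              if a - a' ∈ A then (Fintype.card R : ℝ) else 0 := by
            simp only [hA, Finset.mem_filter, Finset.mem_univ, true_and]
            split_ifs <;> simp
          refine mul_le_mul ?_ hy (norm_nonneg _) (by split_ifs <;> norm_num)
          calc ‖X a‖ * ‖X a'‖ ≤ ‖X a‖ * 1 :=
                mul_le_mul_of_nonneg_left (mulChar_norm_le_one X a') (norm_nonneg _)
            _ ≤ _ := by rw [mul_one]; exact hx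
      _ = ∑ a : R, (if IsUnit a then (1 : ℝ) else 0) * (A.card * Fintype.card R) := by
          refine Finset.sum_congr rfl fun a _ => ?_
          rw [← Finset.mul_sum]
          congr 1
          rw [Fintype.sum_equiv (Equiv.subLeft a) (fun a' => if a - a' ∈ A then
            (Fintype.card R : ℝ) else 0) (fun e => if e ∈ A then (Fintype.card R : ℝ) else 0)
            fun _ => rfl, Finset.sum_ite_mem, Finset.univ_inter, Finset.sum_const, nsmul_eq_mul]
      _ = _ := by
          rw [← Finset.sum_mul, Finset.sum_boole]
          have : (Finset.univ.filter fun a : R => IsUnit a).card = Fintype.card Rˣ := by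
            rw [← Finset.card_univ, ← Finset.card_map ⟨((↑) : Rˣ → R), Units.val_injective⟩]
            congr 1
            ext a
            simp only [Finset.mem_filter, Finset.mem_univ, true_and, Finset.mem_map,
              Function.Embedding.coeFn_mk]
            rfl
          rw [this]
          ring
  have hc : (0 : ℝ) < Fintype.card Rˣ := by exact_mod_cast Fintype.card_pos
  refine le_of_mul_le_mul_left ((h1.trans h3).trans_eq ?_) hc
  ring

variable {K : Type*} [Field K] [NumberField K] {b q : Ideal (𝓞 K)}

/-- `addPsi` as an additive character. -/
def psiChar (h : IsCoprime b q) (hb : b ≠ ⊥) (hq : q ≠ ⊥) {ξ : K} (hξ : ξ ∈ dualProd b q) :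
    AddChar (𝓞 K ⧸ q) ℂ where
  toFun := addPsi h ξ
  map_zero_eq_one' := by
    have := addPsi_mk h hb hq hξ b.zero_mem
    rw [map_zero] at this
    rw [this]
    simp
  map_add_eq_mul' a a' := by
    have h1 := addPsi_mk h hb hq hξ (b.add_mem (crtLift_mem h a) (crtLift_mem h a'))
    rw [map_add, mk_crtLift, mk_crtLift] at h1
    rw [h1, addPsi, addPsi, ← Complex.exp_add,
      show ((crtLift h a + crtLift h a' : 𝓞 K) : K) = (crtLift h a : K) + (crtLift h a' : K) from rfl,
      mul_add, map_add]
    push_cast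
    ring_nf

lemma mem_dual_one_of_mulShift (h : IsCoprime b q) (hb : b ≠ ⊥) (hq : q ≠ ⊥) {ξ : K}
    (hξ : ξ ∈ dualProd b q) {d : 𝓞 K} (hd : d ∈ b)
    (h1 : (psiChar h hb hq hξ).mulShift (Ideal.Quotient.mk q d) = 1) :
    ξ * (d : K) ∈ FractionalIdeal.dual ℤ ℚ (1 : FractionalIdeal (𝓞 K)⁰ K) := by
  rw [FractionalIdeal.mem_dual (one_ne_zero : (1 : FractionalIdeal (𝓞 K)⁰ K) ≠ 0)]
  intro a ha
  obtain ⟨r, rfl⟩ := (FractionalIdeal.mem_one_iff (𝓞 K)⁰).1 ha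
  have h2 := DFunLike.congr_fun h1 (Ideal.Quotient.mk q r)
  rw [AddChar.mulShift_apply, AddChar.one_apply, ← map_mul] at h2
  change addPsi h ξ _ = 1 at h2
  rw [addPsi_mk h hb hq hξ (b.mul_mem_right r hd), Complex.exp_eq_one_iff] at h2
  obtain ⟨n, hn⟩ := h2
  refine ⟨n, ?_⟩
  rw [Algebra.traceForm_apply, mul_assoc]
  have h3 : ((Algebra.trace ℚ K (ξ * ((d * r : 𝓞 K) : K)) : ℚ) : ℂ) = n := by
    have h2pi : (2 * Real.pi * Complex.I : ℂ) ≠ 0 := Complex.two_pi_I_ne_zero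
    apply mul_left_cancel₀ h2pi
    rw [hn, mul_comm]
  have h4 : Algebra.trace ℚ K (ξ * ((d * r : 𝓞 K) : K)) = n := by exact_mod_cast h3
  exact h4.symm

/-- The annihilating residues are divisible by the part of `q` prime to `c`. -/
lemma mul_mem_of_mulShift (h : IsCoprime b q) (hb : b ≠ ⊥) (hq : q ≠ ⊥)
    (c : PrincCofactor (dualProd b q)) (hξ : c.gen ∈ dualProd b q) {e : 𝓞 K ⧸ q}
    (h1 : (psiChar h hb hq hξ).mulShift e = 1) {x : 𝓞 K} (hx : x ∈ c.1) :
    crtLift h e * x ∈ q := by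
  have h2 := mem_dual_one_of_mulShift h hb hq hξ (crtLift_mem h e) (by rwa [mk_crtLift])
  set d := crtLift h e
  set D : FractionalIdeal (𝓞 K)⁰ K := FractionalIdeal.dual ℤ ℚ (1 : FractionalIdeal (𝓞 K)⁰ K)
  have hD : D ≠ 0 := FractionalIdeal.dual_ne_zero ℤ ℚ one_ne_zero
  have hbq : ((b * q : Ideal (𝓞 K)) : FractionalIdeal (𝓞 K)⁰ K) ≠ 0 :=
    FractionalIdeal.coeIdeal_ne_zero.2 (mul_ne_zero hb hq)
  have h3 : FractionalIdeal.spanSingleton (𝓞 K)⁰ (c.gen * (d : K)) ≤ D :=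
    FractionalIdeal.spanSingleton_le_iff_mem.2 h2
  have hdp : dualProd b q = D * ((b * q : Ideal (𝓞 K)) : FractionalIdeal (𝓞 K)⁰ K)⁻¹ :=
    FractionalIdeal.dual_eq_mul_inv ℤ ℚ _
  rw [← FractionalIdeal.spanSingleton_mul_spanSingleton, c.span_gen] at h3
  generalize c.1 = C at h3 hx
  rw [hdp] at h3
  have h4 : (C : FractionalIdeal (𝓞 K)⁰ K) * FractionalIdeal.spanSingleton (𝓞 K)⁰ (d : K) ≤
      ((b * q : Ideal (𝓞 K)) : FractionalIdeal (𝓞 K)⁰ K) := by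
    have h5 := mul_le_mul_right h3
      (D⁻¹ * ((b * q : Ideal (𝓞 K)) : FractionalIdeal (𝓞 K)⁰ K))
    have e1 : D⁻¹ * ((b * q : Ideal (𝓞 K)) : FractionalIdeal (𝓞 K)⁰ K) *
        (D * ((b * q : Ideal (𝓞 K)) : FractionalIdeal (𝓞 K)⁰ K)⁻¹ * C *
          FractionalIdeal.spanSingleton (𝓞 K)⁰ (d : K)) =
        C * FractionalIdeal.spanSingleton (𝓞 K)⁰ (d : K) := by
      field_simp
    have e2 : D⁻¹ * ((b * q : Ideal (𝓞 K)) : FractionalIdeal (𝓞 K)⁰ K) * D =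
        ((b * q : Ideal (𝓞 K)) : FractionalIdeal (𝓞 K)⁰ K) := by
      field_simp
    rw [e2] at h5
    exact e1.symm.le.trans h5
  rw [← FractionalIdeal.coeIdeal_span_singleton, ← FractionalIdeal.coeIdeal_mul,
    FractionalIdeal.coeIdeal_le_coeIdeal] at h4
  have h6 := h4 (Ideal.mul_mem_mul hx (Ideal.mem_span_singleton_self d))
  rw [mul_comm]
  exact Ideal.mul_le_right h6

lemma card_annihilator_le (hq : q ≠ ⊥) [Fintype (𝓞 K ⧸ q)] (c : Ideal (𝓞 K)) :
    (Finset.univ.filter fun e : 𝓞 K ⧸ q => ∀ d, Ideal.Quotient.mk q d = e → ∀ x ∈ c, d * x ∈ q).card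
      ≤ Ideal.absNorm (c ⊔ q) := by
  obtain ⟨q', hq'⟩ := Ideal.dvd_iff_le.2 (le_sup_right : q ≤ c ⊔ q)
  have hg : c ⊔ q ≠ ⊥ := fun h => hq (by rw [hq', h, Ideal.bot_mul])
  have hq'0 : q' ≠ ⊥ := fun h => hq (by rw [hq', h, Ideal.mul_bot])
  have hle : q ≤ q' := by
    conv_lhs => rw [hq']
    exact Ideal.mul_le_right
  let J := q'.map (Ideal.Quotient.mk q)
  have hsub : ∀ e : 𝓞 K ⧸ q, (∀ d, Ideal.Quotient.mk q d = e → ∀ x ∈ c, d * x ∈ q) → e ∈ J := by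
    intro e he
    obtain ⟨d, rfl⟩ := Ideal.Quotient.mk_surjective e
    have h1 := he d rfl
    refine Ideal.mem_map_of_mem _ ?_
    have h2 : Ideal.span {d} * (c ⊔ q) ≤ q' * (c ⊔ q) := by
      rw [mul_comm q', ← hq', Ideal.mul_sup]
      refine sup_le ?_ Ideal.mul_le_right
      rw [Ideal.span_singleton_mul_le_iff]
      exact fun x hx => h1 x hx
    have h3 := Ideal.dvd_iff_le.1 ((mul_dvd_mul_iff_right hg).1 (Ideal.dvd_iff_le.2 h2))
    exact h3 (Ideal.mem_span_singleton_self d)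
  have hcard : Nat.card J * Ideal.absNorm q' = Ideal.absNorm q := by
    have e1 := Submodule.card_eq_card_quotient_mul_card J
    have e2 : Nat.card ((𝓞 K ⧸ q) ⧸ J) = Ideal.absNorm q' :=
      Nat.card_congr (DoubleQuot.quotQuotEquivQuotOfLE hle).toEquiv
    rw [e2] at e1
    exact e1.symm
  have h5 : Nat.card J = Ideal.absNorm (c ⊔ q) := by
    have h6 : Ideal.absNorm q' ≠ 0 := by
      rw [Ne, Ideal.absNorm_eq_zero_iff]; exact hq'0
    have h7 : Ideal.absNorm q = Ideal.absNorm (c ⊔ q) * Ideal.absNorm q' := by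
      conv_lhs => rw [hq']
      rw [map_mul]
    exact Nat.eq_of_mul_eq_mul_right (Nat.pos_of_ne_zero h6) (hcard.trans h7)
  rw [← h5, ← Set.ncard_coe_finset]
  refine (Set.ncard_le_ncard (t := (J : Set (𝓞 K ⧸ q))) ?_ (Set.toFinite _)).trans_eq rfl
  intro e he
  exact hsub e (by simpa using he)

lemma norm_gaussCoeff_le (h : IsCoprime b q) (hb : b ≠ ⊥) (hq : q ≠ ⊥) [Fintype (𝓞 K ⧸ q)]
    (X : MulChar (𝓞 K ⧸ q) ℂ) (c : PrincCofactor (dualProd b q)) :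
    ‖gaussCoeff h X c.gen‖ ≤
      (Ideal.absNorm q : ℝ) ^ (1 / 2 : ℝ) * (Ideal.absNorm (c.1 ⊔ q) : ℝ) ^ (1 / 2 : ℝ) := by
  have hξ : c.gen ∈ dualProd b q := by
    have := PrincCofactor.mul_gen_mem 1 c
    rwa [Units.val_one, map_one, one_mul] at this
  have h1 := norm_gaussSum_sq_le X (psiChar h hb hq hξ)
  have h2 : (Fintype.card (𝓞 K ⧸ q) : ℝ) = Ideal.absNorm q := by
    rw [← Nat.card_eq_fintype_card]; rfl
  rw [h2] at h1
  have h3 : ((Finset.univ.filter fun e : 𝓞 K ⧸ q => (psiChar h hb hq hξ).mulShift e = 1).card : ℝ)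
      ≤ Ideal.absNorm (c.1 ⊔ q) := by
    refine le_trans ?_ (Nat.cast_le.2 (card_annihilator_le hq c.1))
    refine Nat.cast_le.2 (Finset.card_le_card fun e he => ?_)
    rw [Finset.mem_filter] at he ⊢
    refine ⟨he.1, fun d hd x hx => ?_⟩
    have h4 := mul_mem_of_mulShift h hb hq c hξ he.2 hx
    have h5 : d - crtLift h e ∈ q := by rw [← Ideal.Quotient.eq, hd, mk_crtLift]
    rw [show d * x = (d - crtLift h e) * x + crtLift h e * x by ring]
    exact q.add_mem (q.mul_mem_right x h5) h4
  rw [← Real.mul_rpow (Nat.cast_nonneg _) (Nat.cast_nonneg _), ← Real.sqrt_eq_rpow]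
  refine Real.le_sqrt_of_sq_le ?_
  exact h1.trans (mul_le_mul_of_nonneg_left h3 (Nat.cast_nonneg _))

end GaussBound

section ClassConstants

open scoped Classical nonZeroDivisors
open NumberField.InfinitePlace NumberField.mixedEmbedding MeasureTheory

variable {K : Type*} [Field K] [NumberField K] {b q : Ideal (𝓞 K)}

variable (K) in
lemma DK_pos : 0 < DK K := Int.natAbs_pos.2 (discr_ne_zero K)

lemma norm_gfc (κ : Type*) [Fintype κ] {ι : Type*} [Fintype ι] (p : ι → Bool) :
    ‖gfc κ p‖ = (1 / 2) ^ Fintype.card κ := by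
  rw [gfc, norm_mul, norm_prod, Finset.prod_eq_one, one_mul, norm_pow]
  · norm_num
  · intro w _
    split_ifs <;> simp

lemma volume_real_fundamentalDomain (hb : b ≠ ⊥) (hq : q ≠ ⊥) : volume.real
    (ZSpan.fundamentalDomain (fractionalIdealLatticeBasis K (prodUnit hb hq))) =
      (Ideal.absNorm b : ℝ) * Ideal.absNorm q *
        ((1 / 2) ^ nrComplexPlaces K * Real.sqrt (DK K)) := by
  rw [Measure.real, volume_fundamentalDomain_fractionalIdealLatticeBasis,
    volume_fundamentalDomain_latticeBasis, ENNReal.toReal_mul, ENNReal.toReal_mul, prodUnit,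
    Units.val_mk0, FractionalIdeal.coeIdeal_absNorm, map_mul, ENNReal.toReal_ofReal]
  · congr 1
    · push_cast; rfl
    · rw [ENNReal.toReal_pow, ENNReal.toReal_inv, ENNReal.coe_toReal, Real.coe_sqrt, coe_nnnorm,
        Int.norm_eq_abs, DK, Nat.cast_natAbs, Int.cast_abs]
      norm_num
  · exact_mod_cast Nat.zero_le _

lemma norm_idealConst (hb : b ≠ ⊥) (hq : q ≠ ⊥) (p : Par K) :
    ‖idealConst K (prodUnit hb hq) p‖ =
      ((Ideal.absNorm b : ℝ) * Ideal.absNorm q * Real.sqrt (DK K))⁻¹ := by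
  have h2 : ((1 : ℝ) / 2) ^ nrComplexPlaces K ≠ 0 := by positivity
  rw [idealConst, norm_mul, norm_gfc, volume_real_fundamentalDomain, Complex.norm_real, norm_inv, Real.norm_of_nonneg
    (by positivity)]
  rw [nrComplexPlaces] at h2 ⊢
  rw [mul_left_comm, mul_inv, ← mul_assoc, mul_inv_cancel₀ h2, one_mul]

lemma absNorm_dualProd (b q : Ideal (𝓞 K)) :
    (FractionalIdeal.absNorm (dualProd b q) : ℝ) =
      ((Ideal.absNorm b : ℝ) * Ideal.absNorm q * DK K)⁻¹ := by
  have h1 : FractionalIdeal.dual ℤ ℚ (1 : FractionalIdeal (𝓞 K)⁰ K) =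
      (((differentIdeal ℤ (𝓞 K) : Ideal (𝓞 K)) : FractionalIdeal (𝓞 K)⁰ K))⁻¹ := by
    rw [coeIdeal_differentIdeal ℤ ℚ K (𝓞 K), inv_inv]
  rw [dualProd, FractionalIdeal.dual_eq_mul_inv, h1, map_mul, map_inv₀, map_inv₀,
    FractionalIdeal.coeIdeal_absNorm, FractionalIdeal.coeIdeal_absNorm,
    NumberField.absNorm_differentIdeal K, map_mul, DK]
  push_cast
  rw [← mul_inv, mul_comm]

lemma exists_idealConst_eq (hq : q ≠ ⊥) (p : Par K) : ∃ κ : ℂ, ∀ (b : Ideal (𝓞 K)) (hb : b ≠ ⊥),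
    idealConst K (prodUnit hb hq) p = κ * (Ideal.absNorm b : ℂ)⁻¹ := by
  refine ⟨gfc {w : InfinitePlace K // w.IsComplex} p *
    (((Ideal.absNorm q : ℝ) * ((1 / 2) ^ nrComplexPlaces K * Real.sqrt (DK K)))⁻¹ : ℝ),
    fun b hb => ?_⟩
  rw [idealConst, volume_real_fundamentalDomain, mul_assoc (Ideal.absNorm b : ℝ), mul_inv, mul_assoc]
  push_cast
  ring

/-- An integral ideal coprime to `q` in a prescribed ideal class. -/
lemma exists_coprime_rep (hq : q ≠ ⊥) (C : ClassGroup (𝓞 K)) :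
    ∃ B : (Ideal (𝓞 K))⁰, IsCoprime (B : Ideal (𝓞 K)) q ∧ ClassGroup.mk0 B = C := by
  obtain ⟨J, hJ⟩ := ClassGroup.mk0_surjective C⁻¹
  have hJ0 : (J : Ideal (𝓞 K)) ≠ ⊥ := nonZeroDivisors.coe_ne_zero J
  obtain ⟨a, ha⟩ := IsDedekindDomain.exists_sup_span_eq
    (I := (J : Ideal (𝓞 K)) * q) (J := J) Ideal.mul_le_left (mul_ne_zero hJ0 hq)
  have haJ : Ideal.span {a} ≤ (J : Ideal (𝓞 K)) := ha ▸ le_sup_right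
  by_cases ha0 : a = 0
  · have h1 : (J : Ideal (𝓞 K)) * q = J * 1 := by
      rw [mul_one]
      simpa [ha0] using ha
    have h2 : q = 1 := mul_left_cancel₀ hJ0 h1
    obtain ⟨B, hB⟩ := ClassGroup.mk0_surjective C
    exact ⟨B, h2 ▸ isCoprime_one_right, hB⟩
  · obtain ⟨B, hB⟩ := Ideal.dvd_iff_le.2 haJ
    have hsp : (Ideal.span {a} : Ideal (𝓞 K)) ≠ ⊥ := by simpa using ha0
    have hB0 : B ≠ ⊥ := by
      rintro rfl
      exact hsp (hB.trans (mul_zero _))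
    refine ⟨⟨B, mem_nonZeroDivisors_of_ne_zero hB0⟩, ?_, ?_⟩
    · rw [Ideal.isCoprime_iff_sup_eq]
      have h3 : (J : Ideal (𝓞 K)) * (B ⊔ q) = J * 1 := by
        rw [Ideal.mul_sup, ← hB, sup_comm, ha, mul_one]
      exact (mul_left_cancel₀ hJ0 h3).trans Ideal.one_eq_top
    · have h4 : J * ⟨B, mem_nonZeroDivisors_of_ne_zero hB0⟩ =
          (⟨Ideal.span {a}, mem_nonZeroDivisors_of_ne_zero hsp⟩ : (Ideal (𝓞 K))⁰) :=
        Subtype.ext hB.symm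
      have h5 := congrArg ClassGroup.mk0 h4
      rw [map_mul, hJ, (ClassGroup.mk0_eq_one_iff (mem_nonZeroDivisors_of_ne_zero hsp)).2
        ⟨a, rfl⟩] at h5
      exact (inv_mul_eq_one.1 h5).symm

/-- Being a cofactor of an integral ideal is a condition on ideal classes. -/
lemma exists_span_mul_iff (B I : (Ideal (𝓞 K))⁰) :
    (∃ ξ : K, ξ ≠ 0 ∧ FractionalIdeal.spanSingleton (𝓞 K)⁰ ξ =
      ((B : Ideal (𝓞 K)) : FractionalIdeal (𝓞 K)⁰ K) * (I : Ideal (𝓞 K))) ↔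
      ClassGroup.mk0 I = (ClassGroup.mk0 B)⁻¹ := by
  rw [eq_comm, inv_eq_iff_mul_eq_one, ← map_mul, ClassGroup.mk0_eq_one_iff]
  constructor
  · rintro ⟨ξ, h0, h⟩
    rw [← FractionalIdeal.coeIdeal_mul] at h
    have h1 : ξ ∈ (((B : Ideal (𝓞 K)) * (I : Ideal (𝓞 K)) : Ideal (𝓞 K)) :
        FractionalIdeal (𝓞 K)⁰ K) := by
      rw [← h]; exact FractionalIdeal.mem_spanSingleton_self _ _
    obtain ⟨a, -, rfl⟩ := (FractionalIdeal.mem_coeIdeal _).1 h1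
    rw [← FractionalIdeal.coeIdeal_span_singleton] at h
    exact ⟨a, (FractionalIdeal.coeIdeal_injective h).symm⟩
  · rintro ⟨a, ha⟩
    have ha' : (B : Ideal (𝓞 K)) * (I : Ideal (𝓞 K)) = Ideal.span {a} := ha
    refine ⟨(a : K), ?_, ?_⟩
    · intro h
      have : a = 0 := RingOfIntegers.coe_injective h
      rw [this] at ha'
      exact nonZeroDivisors.coe_ne_zero (B * I) (ha'.trans (by simp))
    · rw [← FractionalIdeal.coeIdeal_mul, ha', FractionalIdeal.coeIdeal_span_singleton]

end ClassConstants

section ClassSums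

open scoped Classical nonZeroDivisors
open NumberField.InfinitePlace NumberField.mixedEmbedding MeasureTheory

variable {K : Type*} [Field K] [NumberField K] {q : Ideal (𝓞 K)}

/-- A chosen integral ideal coprime to `q` in each ideal class. -/
def coRep (hq : q ≠ ⊥) (C : ClassGroup (𝓞 K)) : (Ideal (𝓞 K))⁰ := (exists_coprime_rep hq C).choose

lemma isCoprime_coRep (hq : q ≠ ⊥) (C : ClassGroup (𝓞 K)) :
    IsCoprime (coRep hq C : Ideal (𝓞 K)) q := (exists_coprime_rep hq C).choose_spec.1

lemma mk0_coRep (hq : q ≠ ⊥) (C : ClassGroup (𝓞 K)) : ClassGroup.mk0 (coRep hq C) = C :=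
  (exists_coprime_rep hq C).choose_spec.2

lemma coRep_ne_bot (hq : q ≠ ⊥) (C : ClassGroup (𝓞 K)) : (coRep hq C : Ideal (𝓞 K)) ≠ ⊥ :=
  nonZeroDivisors.coe_ne_zero _

/-- Collect the cofactors of a family of fractional ideals. -/
def cofactorMap {ι : Type*} (F : ι → FractionalIdeal (𝓞 K)⁰ K) (x : Σ i, PrincCofactor (F i)) :
    {I : Ideal (𝓞 K) // I ≠ ⊥} := ⟨x.2.1, x.2.2.1⟩

lemma cofactorMap_bijective (hq : q ≠ ⊥) : Function.Bijective (cofactorMap fun C =>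
    ((coRep hq C : Ideal (𝓞 K)) : FractionalIdeal (𝓞 K)⁰ K)) := by
  constructor
  · rintro ⟨C, c⟩ ⟨C', c'⟩ h
    obtain ⟨I, hI0, hI⟩ := c
    obtain ⟨I', hI0', hI'⟩ := c'
    obtain rfl : I = I' := congrArg Subtype.val h
    have h1 := (exists_span_mul_iff (coRep hq C)
      ⟨I, mem_nonZeroDivisors_of_ne_zero hI0⟩).1 hI
    have h2 := (exists_span_mul_iff (coRep hq C')
      ⟨I, mem_nonZeroDivisors_of_ne_zero hI0⟩).1 hI'
    rw [mk0_coRep] at h1 h2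
    obtain rfl : C = C' := inv_injective (h1.symm.trans h2)
    rfl
  · rintro ⟨I, hI0⟩
    refine ⟨⟨(ClassGroup.mk0 ⟨I, mem_nonZeroDivisors_of_ne_zero hI0⟩)⁻¹, I, hI0, ?_⟩, rfl⟩
    refine (exists_span_mul_iff (coRep hq _) ⟨I, mem_nonZeroDivisors_of_ne_zero hI0⟩).2 ?_
    rw [mk0_coRep, inv_inv]

lemma cofactorMap_dual_injective (hq : q ≠ ⊥) : Function.Injective (cofactorMap fun C =>
    dualProd (coRep hq C : Ideal (𝓞 K)) q) := by
  rintro ⟨C, I, hI0, ξ, hξ0, hξ⟩ ⟨C', I', hI0', ξ', hξ0', hξ'⟩ h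
  obtain rfl : I = I' := congrArg Subtype.val h
  suffices hCC : C = C' by subst hCC; rfl
  obtain ⟨J, hJ⟩ := ClassGroup.mk0_surjective C⁻¹
  obtain ⟨a, ha0, ha⟩ := (exists_span_mul_iff (coRep hq C) J).2 (by rw [hJ, mk0_coRep])
  have hB0 : ((coRep hq C : Ideal (𝓞 K)) : FractionalIdeal (𝓞 K)⁰ K) ≠ 0 :=
    FractionalIdeal.coeIdeal_ne_zero.2 (coRep_ne_bot hq C)
  have hB0' : ((coRep hq C' : Ideal (𝓞 K)) : FractionalIdeal (𝓞 K)⁰ K) ≠ 0 :=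
    FractionalIdeal.coeIdeal_ne_zero.2 (coRep_ne_bot hq C')
  have hs0' : FractionalIdeal.spanSingleton (𝓞 K)⁰ ξ' ≠ 0 := by
    rwa [Ne, FractionalIdeal.spanSingleton_eq_zero_iff]
  have key : FractionalIdeal.spanSingleton (𝓞 K)⁰ ξ * ((coRep hq C : Ideal (𝓞 K)) :
      FractionalIdeal (𝓞 K)⁰ K) = FractionalIdeal.spanSingleton (𝓞 K)⁰ ξ' *
        ((coRep hq C' : Ideal (𝓞 K)) : FractionalIdeal (𝓞 K)⁰ K) := by
    rw [hξ, hξ', dualProd, dualProd, FractionalIdeal.dual_eq_mul_inv,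
      FractionalIdeal.dual_eq_mul_inv ℤ ℚ (((coRep hq C' : Ideal (𝓞 K)) * q : Ideal (𝓞 K)) : 
        FractionalIdeal (𝓞 K)⁰ K), FractionalIdeal.coeIdeal_mul, FractionalIdeal.coeIdeal_mul,
      mul_inv, mul_inv]
    field_simp
  have h3 := (exists_span_mul_iff (coRep hq C') J).1 ⟨a * ξ / ξ', by positivity, by
    rw [div_eq_mul_inv, ← FractionalIdeal.spanSingleton_mul_spanSingleton,
      ← FractionalIdeal.spanSingleton_mul_spanSingleton, ha, ← FractionalIdeal.spanSingleton_inv]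
    calc _ = (FractionalIdeal.spanSingleton (𝓞 K)⁰ ξ * ((coRep hq C : Ideal (𝓞 K)) :
          FractionalIdeal (𝓞 K)⁰ K)) * (J : Ideal (𝓞 K)) *
            (FractionalIdeal.spanSingleton (𝓞 K)⁰ ξ')⁻¹ := by ring
      _ = _ := by rw [key]; field_simp⟩
  rw [hJ, mk0_coRep] at h3
  exact inv_injective h3

variable (χ : HeckeChar K q)

lemma LSer_eq_sum (hq : q ≠ ⊥) {s : ℂ} (hs : 1 < s.re) : LSer χ s =
    ∑ C, ∑' c : PrincCofactor ((coRep hq C : Ideal (𝓞 K)) : FractionalIdeal (𝓞 K)⁰ K),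
      lterm χ s c.1 := by
  have hsum := (summable_norm_lterm χ hs).of_norm
  have h1 := (Equiv.ofBijective _ (cofactorMap_bijective hq)).tsum_eq
    (fun I : {I : Ideal (𝓞 K) // I ≠ ⊥} => lterm χ s I.1)
  have h2 := ((Equiv.ofBijective _ (cofactorMap_bijective hq)).summable_iff
    (f := fun I : {I : Ideal (𝓞 K) // I ≠ ⊥} => lterm χ s I.1)).2 hsum
  rw [← tsum_fintype (L := .unconditional _)]
  refine Eq.trans (show LSer χ s = _ from h1.symm) ?_
  exact h2.tsum_sigma

lemma sum_tsum_le {ι : Type*} [Fintype ι] {F : ι → FractionalIdeal (𝓞 K)⁰ K}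
    (hF : Function.Injective (cofactorMap F)) {g : Ideal (𝓞 K) → ℝ} (hg : ∀ I, 0 ≤ g I) {M : ℝ}
    (hM : ∀ S : Finset {I : Ideal (𝓞 K) // I ≠ ⊥}, ∑ I ∈ S, g I.1 ≤ M) :
    (∀ i, Summable fun c : PrincCofactor (F i) => g c.1) ∧
      ∑ i, ∑' c : PrincCofactor (F i), g c.1 ≤ M := by
  have h1 : Summable fun I : {I : Ideal (𝓞 K) // I ≠ ⊥} => g I.1 :=
    summable_of_sum_le (fun _ => hg _) hM
  have h2 : Summable fun x : Σ i, PrincCofactor (F i) => g x.2.1 := h1.comp_injective hF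
  refine ⟨fun i => h2.sigma_factor i, ?_⟩
  rw [← tsum_fintype (L := .unconditional _), ← h2.tsum_sigma]
  refine (tsum_comp_le_tsum_of_inj h1 (fun _ => hg _) hF).trans ?_
  exact h1.tsum_le_of_sum_le hM

end ClassSums

section ClassChar

open scoped Classical nonZeroDivisors
open NumberField.InfinitePlace NumberField.mixedEmbedding MeasureTheory

variable {K : Type*} [Field K] [NumberField K] {q : Ideal (𝓞 K)} (χ : HeckeChar K q)

lemma HeckeChar.ne_zero {I : Ideal (𝓞 K)} (h : IsCoprime I q) : χ.toFun I ≠ 0 := by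
  intro h0
  have := χ.norm_one' I h
  rw [h0, norm_zero] at this
  exact zero_ne_one this

lemma om_of_forall_false {p : Par K} (hp : ∀ w, p w = false) (x : mixedSpace K) : om p x = 1 := by
  simp [om, sg, hp]

variable {p : Par K}

section Unramified

variable (hp : ∀ w, p w = false)
  (hX : ∀ α : 𝓞 K, α ≠ 0 → χ.toFun (Ideal.span {α}) =
    (1 : MulChar (𝓞 K ⧸ q) ℂ) (Ideal.Quotient.mk q α) * om p (mixedEmbedding K (α : K)))

include hp hX

lemma HeckeChar.eq_one_of_principal {I : Ideal (𝓞 K)} (hI0 : I ≠ ⊥) (hI : IsCoprime I q)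
    (h : Submodule.IsPrincipal I) : χ.toFun I = 1 := by
  obtain ⟨a, ha⟩ := h
  have ha' : I = Ideal.span {a} := ha
  have ha0 : a ≠ 0 := by
    rintro rfl
    exact hI0 (ha'.trans (by simp))
  have h1 := hX a ha0
  rw [om_of_forall_false hp, Complex.ofReal_one, mul_one, ← ha'] at h1
  have hu : IsUnit (Ideal.Quotient.mk q a) := by
    by_contra hu
    rw [MulChar.map_nonunit _ hu] at h1
    exact χ.ne_zero hI h1
  rw [h1, MulChar.one_apply hu]

lemma HeckeChar.eq_of_mk0_eq (hq : q ≠ ⊥) {A B : (Ideal (𝓞 K))⁰} (hA : IsCoprime (A : Ideal (𝓞 K)) q)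
    (hB : IsCoprime (B : Ideal (𝓞 K)) q) (h : ClassGroup.mk0 A = ClassGroup.mk0 B) :
    χ.toFun A = χ.toFun B := by
  obtain ⟨J, hJ, hJc⟩ := exists_coprime_rep hq (ClassGroup.mk0 A)⁻¹
  have key : ∀ D : (Ideal (𝓞 K))⁰, IsCoprime (D : Ideal (𝓞 K)) q →
      ClassGroup.mk0 D = ClassGroup.mk0 A → χ.toFun D * χ.toFun J = 1 := by
    intro D hD hDA
    rw [← χ.map_mul']
    have h1 : ClassGroup.mk0 (D * J) = 1 := by rw [map_mul, hJc, hDA, mul_inv_cancel]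
    exact χ.eq_one_of_principal hp hX (nonZeroDivisors.coe_ne_zero (D * J)) (hD.mul_left hJ)
      ((ClassGroup.mk0_eq_one_iff (D * J).2).1 h1)
  exact mul_right_cancel₀ (χ.ne_zero hJ) ((key A hA rfl).trans (key B hB h.symm).symm)

lemma HeckeChar.sum_inv_coRep (hq : q ≠ ⊥) (hnt : ¬ IsTrivialChar χ) :
    ∑ C, (χ.toFun (coRep hq C))⁻¹ = 0 := by
  let f : ClassGroup (𝓞 K) →* ℂ :=
    { toFun := fun C => (χ.toFun (coRep hq C))⁻¹
      map_one' := by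
        rw [χ.eq_one_of_principal hp hX (coRep_ne_bot hq 1) (isCoprime_coRep hq 1)
          ((ClassGroup.mk0_eq_one_iff (coRep hq 1).2).1 (mk0_coRep hq 1)), inv_one]
      map_mul' := fun C D => by
        rw [← mul_inv, ← χ.map_mul', ← Submonoid.coe_mul]
        congr 1
        refine χ.eq_of_mk0_eq hp hX hq (isCoprime_coRep hq _)
          ((isCoprime_coRep hq C).mul_left (isCoprime_coRep hq D)) ?_
        rw [map_mul, mk0_coRep, mk0_coRep, mk0_coRep] }
  refine sum_hom_units_eq_zero f fun hf => hnt fun I hI => ?_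
  by_cases hI0 : I = ⊥
  · subst hI0
    have h1 := χ.map_mul' ⊥ ⊥
    rw [Ideal.bot_mul] at h1
    exact (mul_eq_left₀ (χ.ne_zero hI)).1 h1.symm
  · have h1 : χ.toFun I = χ.toFun (coRep hq (ClassGroup.mk0
        ⟨I, mem_nonZeroDivisors_of_ne_zero hI0⟩)) :=
      χ.eq_of_mk0_eq hp hX hq (A := ⟨I, mem_nonZeroDivisors_of_ne_zero hI0⟩) hI
        (isCoprime_coRep hq _) (mk0_coRep hq _).symm
    have h2 := DFunLike.congr_fun hf (ClassGroup.mk0 ⟨I, mem_nonZeroDivisors_of_ne_zero hI0⟩)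
    rw [h1]
    exact inv_eq_one.1 h2

end Unramified

lemma HeckeChar.residue_eq_zero (hq : q ≠ ⊥) [Fintype (𝓞 K ⧸ q)] (X : MulChar (𝓞 K ⧸ q) ℂ)
    (hX : ∀ α : 𝓞 K, α ≠ 0 → χ.toFun (Ideal.span {α}) =
      X (Ideal.Quotient.mk q α) * om p (mixedEmbedding K (α : K)))
    (hnt : ¬ IsTrivialChar χ) :
    gfn p (0 : mixedSpace K) * (∑ a, X a) * ∑ C, (χ.toFun (coRep hq C))⁻¹ = 0 := by
  by_cases hp : ∀ w, p w = false
  · by_cases hX1 : X = 1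
    · subst hX1
      rw [χ.sum_inv_coRep hp hX hq hnt, mul_zero]
    · rw [MulChar.sum_eq_zero_of_ne_one hX1, mul_zero, zero_mul]
  · have : gfn p (0 : mixedSpace K) = 0 := by
      push Not at hp
      obtain ⟨w, hw⟩ := hp
      rw [gfn, pf, Finset.prod_eq_zero (Finset.mem_univ w), zero_mul]
      simp [gre, hw]
    rw [this, zero_mul, zero_mul]

end ClassChar

/-- Boundedness on vertical strips. -/
def StripBdd (f : ℂ → ℂ) : Prop :=
  ∀ a b : ℝ, ∃ M : ℝ, ∀ s : ℂ, a ≤ s.re → s.re ≤ b → ‖f s‖ ≤ M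

lemma StripBdd.const (c : ℂ) : StripBdd fun _ => c := fun _ _ => ⟨‖c‖, fun _ _ _ => le_rfl⟩

lemma StripBdd.mul {f g : ℂ → ℂ} (hf : StripBdd f) (hg : StripBdd g) :
    StripBdd fun s => f s * g s := by
  intro a b
  obtain ⟨M, hM⟩ := hf a b
  obtain ⟨N, hN⟩ := hg a b
  refine ⟨M * N, fun s h1 h2 => ?_⟩
  rw [norm_mul]
  exact mul_le_mul (hM s h1 h2) (hN s h1 h2) (norm_nonneg _) ((norm_nonneg _).trans (hM s h1 h2))

lemma StripBdd.sum {ι : Type*} [Fintype ι] {f : ι → ℂ → ℂ} (hf : ∀ i, StripBdd (f i)) :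
    StripBdd fun s => ∑ i, f i s := by
  intro a b
  choose M hM using fun i => hf i a b
  exact ⟨∑ i, M i, fun s h1 h2 => (norm_sum_le _ _).trans
    (Finset.sum_le_sum fun i _ => hM i s h1 h2)⟩

lemma StripBdd.natCast_cpow {n : ℕ} (hn : 0 < n) : StripBdd fun s => (n : ℂ) ^ s := by
  intro a b
  refine ⟨(n : ℝ) ^ b, fun s _ h2 => ?_⟩
  rw [Complex.norm_natCast_cpow_of_pos hn]
  exact Real.rpow_le_rpow_of_exponent_le (by exact_mod_cast hn) h2

section Completed

open scoped Classical nonZeroDivisors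
open NumberField.InfinitePlace NumberField.mixedEmbedding MeasureTheory

variable {K : Type*} [Field K] [NumberField K] {q : Ideal (𝓞 K)} (χ : HeckeChar K q)

lemma dual_term_bound (hq : q ≠ ⊥) [Fintype (𝓞 K ⧸ q)] (p : Par K) (X : MulChar (𝓞 K ⧸ q) ℂ)
    (C : ClassGroup (𝓞 K)) {s : ℂ}
    (hsum : Summable fun c : PrincCofactor (dualProd (coRep hq C : Ideal (𝓞 K)) q) =>
      (Ideal.absNorm (c.1 ⊔ q) : ℝ) ^ (1 / 2 : ℝ) * (Ideal.absNorm c.1 : ℝ) ^ (-(1 + -s.re))) :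
    ‖(χ.toFun (coRep hq C))⁻¹ * (Ideal.absNorm (coRep hq C : Ideal (𝓞 K)) : ℂ) ^ s *
      (idealConst K (prodUnit (coRep_ne_bot hq C) hq) p *
        ((∑' c : PrincCofactor (dualProd (coRep hq C : Ideal (𝓞 K)) q),
          gaussCoeff (isCoprime_coRep hq C) X c.gen * om p (mixedEmbedding K c.gen) *
            (nrm (mixedEmbedding K c.gen) : ℂ) ^ (s - 1)) *
              ZF {w : InfinitePlace K // w.IsComplex} p (1 - s)))‖ ≤
      ‖ZF {w : InfinitePlace K // w.IsComplex} p (1 - s)‖ *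
        ((DK K : ℝ) ^ (1 / 2 - s.re) * (Ideal.absNorm q : ℝ) ^ (1 / 2 - s.re)) *
        ∑' c : PrincCofactor (dualProd (coRep hq C : Ideal (𝓞 K)) q),
          (Ideal.absNorm (c.1 ⊔ q) : ℝ) ^ (1 / 2 : ℝ) *
            (Ideal.absNorm c.1 : ℝ) ^ (-(1 + -s.re)) := by
  set B : Ideal (𝓞 K) := (coRep hq C : Ideal (𝓞 K)) with hB
  have hBp : 0 < Ideal.absNorm B := by exact_mod_cast absNorm_pos (coRep_ne_bot hq C)
  have hqp : 0 < Ideal.absNorm q := by exact_mod_cast absNorm_pos hq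
  have hD := DK_pos K
  set nb : ℝ := (Ideal.absNorm B : ℝ) with hnb
  set nq : ℝ := (Ideal.absNorm q : ℝ) with hnq
  set D : ℝ := (DK K : ℝ) with hDd
  have hnb0 : 0 < nb := Nat.cast_pos.2 hBp
  have hnq0 : 0 < nq := Nat.cast_pos.2 hqp
  have hD0 : 0 < D := Nat.cast_pos.2 hD
  have hterm : ∀ c : PrincCofactor (dualProd B q),
      ‖gaussCoeff (isCoprime_coRep hq C) X c.gen * om p (mixedEmbedding K c.gen) *
        (nrm (mixedEmbedding K c.gen) : ℂ) ^ (s - 1)‖ ≤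
      nq ^ (1 / 2 : ℝ) * (nb * nq * D) ^ (1 - s.re) *
        ((Ideal.absNorm (c.1 ⊔ q) : ℝ) ^ (1 / 2 : ℝ) *
          (Ideal.absNorm c.1 : ℝ) ^ (-(1 + -s.re))) := by
    intro c
    have hn0 : 0 < nrm (mixedEmbedding K c.gen) :=
      lt_of_le_of_ne (nrm_nonneg _) (nrm_embedding_ne_zero c.gen_ne_zero).symm
    rw [norm_mul, norm_mul, Complex.norm_real, Real.norm_eq_abs,
      Complex.norm_cpow_eq_rpow_re_of_pos hn0, PrincCofactor.nrm_gen, absNorm_dualProd,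
      Complex.sub_re, Complex.one_re, Real.mul_rpow (by positivity) (by positivity),
      Real.inv_rpow (by positivity), ← Real.rpow_neg (by positivity), neg_sub]
    have h1 := norm_gaussCoeff_le (isCoprime_coRep hq C) (coRep_ne_bot hq C) hq X c
    have h2 := abs_om_le p (mixedEmbedding K c.gen)
    calc _ ≤ ((nq ^ (1 / 2 : ℝ) * (Ideal.absNorm (c.1 ⊔ q) : ℝ) ^ (1 / 2 : ℝ)) * 1) *
          ((nb * nq * D) ^ (1 - s.re) * (Ideal.absNorm c.1 : ℝ) ^ (s.re - 1)) := by
          refine mul_le_mul_of_nonneg_right ?_ (by positivity)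
          exact mul_le_mul h1 h2 (abs_nonneg _) (by positivity)
      _ = _ := by
          rw [show -(1 + -s.re) = s.re - 1 by ring]; ring
  have hnorm := (hsum.mul_left (nq ^ (1 / 2 : ℝ) * (nb * nq * D) ^ (1 - s.re)))
  have h3 := tsum_of_norm_bounded hnorm.hasSum hterm
  rw [tsum_mul_left] at h3
  set Sg := ∑' c : PrincCofactor (dualProd B q), (Ideal.absNorm (c.1 ⊔ q) : ℝ) ^ (1 / 2 : ℝ) *
    (Ideal.absNorm c.1 : ℝ) ^ (-(1 + -s.re)) with hS
  set Z := ‖ZF {w : InfinitePlace K // w.IsComplex} p (1 - s)‖ with hZ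
  have hZ0 : 0 ≤ Z := norm_nonneg _
  rw [norm_mul, norm_mul, norm_mul, norm_mul, norm_inv, χ.norm_one' _ (isCoprime_coRep hq C),
    inv_one, one_mul, Complex.norm_natCast_cpow_of_pos hBp, norm_idealConst, ← hnb, ← hnq, ← hDd,
    ← hZ]
  calc nb ^ s.re * ((nb * nq * Real.sqrt D)⁻¹ * (_ * Z)) ≤
      nb ^ s.re * ((nb * nq * Real.sqrt D)⁻¹ *
        (nq ^ (1 / 2 : ℝ) * (nb * nq * D) ^ (1 - s.re) * Sg * Z)) := by
        gcongr
    _ = Z * (D ^ (1 / 2 - s.re) * nq ^ (1 / 2 - s.re)) * Sg := by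
        rw [Real.mul_rpow (by positivity) hD0.le, Real.mul_rpow hnb0.le hnq0.le, Real.sqrt_eq_rpow]
        have e1 : nb ^ s.re * nb⁻¹ * nb ^ (1 - s.re) = 1 := by
          rw [← Real.rpow_neg_one, ← Real.rpow_add hnb0, ← Real.rpow_add hnb0,
            show s.re + -1 + (1 - s.re) = 0 by ring, Real.rpow_zero]
        have e2 : nq⁻¹ * nq ^ (1 / 2 : ℝ) * nq ^ (1 - s.re) = nq ^ (1 / 2 - s.re) := by
          rw [← Real.rpow_neg_one, ← Real.rpow_add hnq0, ← Real.rpow_add hnq0]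
          congr 1; ring
        have e3 : (D ^ (1 / 2 : ℝ))⁻¹ * D ^ (1 - s.re) = D ^ (1 / 2 - s.re) := by
          rw [← Real.rpow_neg hD0.le, ← Real.rpow_add hD0]
          congr 1; ring
        rw [← e2, ← e3, mul_inv, mul_inv]
        linear_combination (nq⁻¹ * nq ^ (1 / 2 : ℝ) * nq ^ (1 - s.re) * (D ^ (1 / 2 : ℝ))⁻¹ *
          D ^ (1 - s.re) * Sg * Z) * e1

/-- The completed Hecke `L`-function and its functional equation bound. -/
theorem exists_completed (hq : q ≠ ⊥) : ∃ (p : Par K) (E P Q : ℂ → ℂ),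
    Differentiable ℂ E ∧ Differentiable ℂ P ∧ Differentiable ℂ Q ∧
    StripBdd E ∧ StripBdd P ∧ StripBdd Q ∧
    (∀ s : ℂ, 1 < s.re → LSer χ s * ZF {w : InfinitePlace K // w.IsComplex} p s =
      E s + P s / (s - 1) - Q s / s) ∧
    (¬ IsTrivialChar χ → P 1 = 0) ∧
    ∀ s : ℂ, s.re < 0 → ‖E s + P s / (s - 1) - Q s / s‖ ≤
      ‖ZF {w : InfinitePlace K // w.IsComplex} p (1 - s)‖ *
        ((DK K : ℝ) ^ (1 / 2 - s.re) * (Ideal.absNorm q : ℝ) ^ (1 / 2 - s.re)) *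
        ((∑ g ∈ idealDivisors q, (Ideal.absNorm g : ℝ) ^ (-(1 / 2) : ℝ)) *
          Real.exp (2 * nK K / (-s.re))) := by
  have := finite_quot hq
  have := Fintype.ofFinite (𝓞 K ⧸ q)
  obtain ⟨p, X, hX⟩ := χ.exists_mulChar hq
  obtain ⟨κ, hκ⟩ := exists_idealConst_eq hq p
  choose Λ hΛd hΛb hΛ1 hΛ2 using fun C => class_mellin χ (isCoprime_coRep hq C)
    (coRep_ne_bot hq C) hq p X hX
  set N : ClassGroup (𝓞 K) → ℕ := fun C => Ideal.absNorm (coRep hq C : Ideal (𝓞 K)) with hN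
  have hNpos : ∀ C, 0 < N C := fun C => by exact_mod_cast absNorm_pos (coRep_ne_bot hq C)
  have hNne : ∀ C, (N C : ℂ) ≠ 0 := fun C => by exact_mod_cast (hNpos C).ne'
  set w : ClassGroup (𝓞 K) → ℂ → ℂ := fun C s => (χ.toFun (coRep hq C))⁻¹ * (N C : ℂ) ^ s with hw
  have hwd : ∀ C, Differentiable ℂ (w C) := fun C => by
    refine Differentiable.const_mul ?_ _
    intro s
    exact (hasStrictDerivAt_const_cpow (Or.inl (hNne C))).hasDerivAt.differentiableAt
  have hwb : ∀ C, StripBdd (w C) := fun C =>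
    (StripBdd.const _).mul (StripBdd.natCast_cpow (hNpos C))
  set g := gfn p (0 : mixedSpace K) * coneVol K with hg
  set kC : ClassGroup (𝓞 K) → ℂ := fun C => idealConst K (prodUnit (coRep_ne_bot hq C) hq) p with hkC
  have hΛ : ∀ s, ∑ C, w C s * (Λ C s + g * (kC C * (∑ a, X a) / (s - 1) - X 0 / s)) =
      (∑ C, w C s * Λ C s) + (∑ C, w C s * (g * (kC C * ∑ a, X a))) / (s - 1) -
        (∑ C, w C s * (g * X 0)) / s := by
    intro s
    rw [Finset.sum_div, Finset.sum_div, ← Finset.sum_add_distrib, ← Finset.sum_sub_distrib]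
    refine Finset.sum_congr rfl fun C _ => ?_
    ring
  refine ⟨p, fun s => ∑ C, w C s * Λ C s, fun s => ∑ C, w C s * (g * (kC C * ∑ a, X a)),
    fun s => ∑ C, w C s * (g * X 0), ?_, ?_, ?_, ?_, ?_, ?_, ?_, ?_, ?_⟩
  · exact Differentiable.fun_sum fun C _ => (hwd C).mul (hΛd C)
  · exact Differentiable.fun_sum fun C _ => (hwd C).mul_const _
  · exact Differentiable.fun_sum fun C _ => (hwd C).mul_const _
  · exact StripBdd.sum fun C => (hwb C).mul (hΛb C)
  · exact StripBdd.sum fun C => (hwb C).mul (StripBdd.const _)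
  · exact StripBdd.sum fun C => (hwb C).mul (StripBdd.const _)
  · intro s hs
    dsimp only
    rw [← hΛ, LSer_eq_sum χ hq hs, Finset.sum_mul]
    refine Finset.sum_congr rfl fun C _ => ?_
    rw [← hΛ1 C s hs, hw]
    have h1 := χ.ne_zero (isCoprime_coRep hq C)
    have h2 : (N C : ℂ) ^ s * (N C : ℂ) ^ (-s) = 1 := by
      rw [← Complex.cpow_add _ _ (hNne C), add_neg_cancel, Complex.cpow_zero]
    linear_combination (-(∑' c : PrincCofactor ((coRep hq C : Ideal (𝓞 K)) :
      FractionalIdeal (𝓞 K)⁰ K), lterm χ s c.1) * ZF {w : InfinitePlace K // w.IsComplex} p s) *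
        (h2 + (N C : ℂ) ^ s * (N C : ℂ) ^ (-s) * inv_mul_cancel₀ h1)
  · intro hnt
    have h1 := χ.residue_eq_zero hq X hX hnt
    calc ∑ C, w C 1 * (g * (kC C * ∑ a, X a)) =
        ∑ C, (coneVol K * κ) * (gfn p (0 : mixedSpace K) * (∑ a, X a)) *
          (χ.toFun (coRep hq C))⁻¹ := by
          refine Finset.sum_congr rfl fun C _ => ?_
          simp only [hw, hkC, hg]
          rw [hκ, Complex.cpow_one]
          have := hNne C
          simp only [hN] at this ⊢
          field_simp
      _ = 0 := by
          rw [← Finset.mul_sum]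
          rw [mul_assoc, h1, mul_zero]
  · intro s hs
    dsimp only
    rw [← hΛ]
    obtain ⟨hsum, hle⟩ := sum_tsum_le (cofactorMap_dual_injective hq)
      (g := fun I => (Ideal.absNorm (I ⊔ q) : ℝ) ^ (1 / 2 : ℝ) *
        (Ideal.absNorm I : ℝ) ^ (-(1 + -s.re))) (fun I => by positivity)
      (fun S => sum_gcd_le hq S (η := -s.re) (by linarith))
    calc _ ≤ ∑ C, ‖w C s * (Λ C s + g * (kC C * (∑ a, X a) / (s - 1) - X 0 / s))‖ :=
          norm_sum_le _ _
      _ ≤ ∑ C, ‖ZF {w : InfinitePlace K // w.IsComplex} p (1 - s)‖ *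
        ((DK K : ℝ) ^ (1 / 2 - s.re) * (Ideal.absNorm q : ℝ) ^ (1 / 2 - s.re)) *
        ∑' c : PrincCofactor (dualProd (coRep hq C : Ideal (𝓞 K)) q),
          (Ideal.absNorm (c.1 ⊔ q) : ℝ) ^ (1 / 2 : ℝ) *
            (Ideal.absNorm c.1 : ℝ) ^ (-(1 + -s.re)) := by
          refine Finset.sum_le_sum fun C _ => ?_
          rw [← hΛ2 C s hs]
          exact dual_term_bound χ hq p X C (hsum C)
      _ ≤ _ := by
          rw [← Finset.mul_sum]
          exact mul_le_mul_of_nonneg_left hle (by positivity)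

end Completed

lemma norm_exp_gauss (m t₀ : ℝ) (s : ℂ) :
    ‖cexp (m * (s - t₀ * I) ^ 2)‖ = Real.exp (m * (s.re ^ 2 - (s.im - t₀) ^ 2)) := by
  rw [Complex.norm_exp]
  congr 1
  simp [pow_two]

lemma one_add_rpow_mul_exp_le {m x : ℝ} (hm : 0 ≤ m) (hx : 0 ≤ x) :
    (1 + x) ^ m * Real.exp (m * (4 - x ^ 2)) ≤ Real.exp (5 * m) := by
  rw [Real.rpow_def_of_pos (by linarith), ← Real.exp_add, Real.exp_le_exp]
  have h1 : Real.log (1 + x) ≤ x := by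
    have := Real.log_le_sub_one_of_pos (show 0 < 1 + x by linarith)
    linarith
  have h2 : Real.log (1 + x) + (4 - x ^ 2) ≤ 5 := by nlinarith [sq_nonneg (x - 1 / 2)]
  calc _ = m * (Real.log (1 + x) + (4 - x ^ 2)) := by ring
    _ ≤ m * 5 := mul_le_mul_of_nonneg_left h2 hm
    _ = _ := by ring

/-- Convexity in a vertical strip, with polynomial growth on the edges measured from height
`t₀`. -/
lemma strip_convexity {f : ℂ → ℂ} {a b m α β t₀ M : ℝ} (hab : a < b) (hab2 : b - a ≤ 2)
    (ha : a ^ 2 ≤ 4) (hb : b ^ 2 ≤ 4) (hm : 0 ≤ m)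
    (hf : DiffContOnCl ℂ f (re ⁻¹' Set.Ioo a b))
    (hgr : ∀ s : ℂ, a < s.re → s.re < b → 1 ≤ |s.im| → ‖f s‖ ≤ M * Real.exp (M * |s.im|))
    (hfa : ∀ s : ℂ, s.re = a → ‖f s‖ ≤ Real.exp α * (1 + |s.im - t₀|) ^ m)
    (hfb : ∀ s : ℂ, s.re = b → ‖f s‖ ≤ Real.exp β * (1 + |s.im - t₀|) ^ m)
    {s : ℂ} (hsa : a ≤ s.re) (hsb : s.re ≤ b) (hst : s.im = t₀) :
    ‖f s‖ ≤ Real.exp (5 * m + ((b - s.re) * α + (s.re - a) * β) / (b - a)) := by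
  have hba : 0 < b - a := by linarith
  set l : ℝ → ℝ := fun σ => ((b - σ) * α + (σ - a) * β) / (b - a) with hl
  set E : ℂ → ℂ := fun z => cexp (m * (z - t₀ * I) ^ 2) *
    cexp (-(((b - z) * α + (z - a) * β) / (b - a))) with hE
  have hEn : ∀ z, ‖E z‖ = Real.exp (m * (z.re ^ 2 - (z.im - t₀) ^ 2)) * Real.exp (-l z.re) := by
    intro z
    rw [hE, norm_mul, norm_exp_gauss, Complex.norm_exp]
    congr 3
    have : (((b : ℂ) - z) * α + (z - a) * β) / (b - a) =
      (((b - z) * α + (z - a) * β) / ((b - a : ℝ) : ℂ)) := by push_cast; rfl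
    rw [this, Complex.neg_re, Complex.div_ofReal_re]
    simp [hl]
  have hEd : Differentiable ℂ E := by
    intro z
    fun_prop
  set l₀ := |α| + |β| with hl0
  have hlb : ∀ σ, a ≤ σ → σ ≤ b → -l σ ≤ l₀ := by
    intro σ h1 h2
    rw [hl, hl0]
    dsimp only
    rw [neg_le, le_div_iff₀ hba]
    have := neg_abs_le α
    have := neg_abs_le β
    nlinarith [abs_nonneg α, abs_nonneg β]
  have hsq : ∀ z : ℂ, a ≤ z.re → z.re ≤ b → z.re ^ 2 ≤ 4 := fun z h1 h2 => by
    have h3 := abs_le_of_sq_le_sq' (show a ^ 2 ≤ 2 ^ 2 by linarith) (by norm_num)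
    have h4 := abs_le_of_sq_le_sq' (show b ^ 2 ≤ 2 ^ 2 by linarith) (by norm_num)
    nlinarith
  have hEdge : ∀ z : ℂ, z.re ^ 2 ≤ 4 → ∀ γ, l z.re = γ →
      ‖f z‖ ≤ Real.exp γ * (1 + |z.im - t₀|) ^ m → ‖f z * E z‖ ≤ Real.exp (5 * m) := by
    intro z hz γ hγ h
    rw [norm_mul, hEn, hγ]
    have h1 : Real.exp (m * (z.re ^ 2 - (z.im - t₀) ^ 2)) ≤
        Real.exp (m * (4 - |z.im - t₀| ^ 2)) := by
      rw [Real.exp_le_exp, sq_abs]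
      exact mul_le_mul_of_nonneg_left (by linarith) hm
    calc _ ≤ (Real.exp γ * (1 + |z.im - t₀|) ^ m) *
          (Real.exp (m * (4 - |z.im - t₀| ^ 2)) * Real.exp (-γ)) := by gcongr
      _ = ((1 + |z.im - t₀|) ^ m * Real.exp (m * (4 - |z.im - t₀| ^ 2))) *
          (Real.exp γ * Real.exp (-γ)) := by ring
      _ ≤ _ := by
          rw [← Real.exp_add, add_neg_cancel, Real.exp_zero, mul_one]
          exact one_add_rpow_mul_exp_le hm (abs_nonneg _)
  have key : ‖f s * E s‖ ≤ Real.exp (5 * m) := by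
    refine PhragmenLindelof.vertical_strip (a := a) (b := b) (f := fun z => f z * E z) ?_ ?_ ?_ ?_
      hsa hsb
    · exact hf.smul hEd.diffContOnCl
    · refine ⟨1, ?_, |M|, ?_⟩
      · rw [lt_div_iff₀ hba]
        linarith [Real.pi_gt_three]
      · refine Asymptotics.IsBigO.of_bound (|M| * (Real.exp (m * 4) * Real.exp l₀)) ?_
        have h1 : ∀ᶠ z in Filter.comap (abs ∘ im) atTop ⊓ Filter.principal (re ⁻¹' Set.Ioo a b),
            1 ≤ |z.im| :=
          Filter.mem_inf_of_left ⟨Set.Ici 1, Filter.mem_atTop 1, fun z hz => hz⟩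
        have h2 : ∀ᶠ z in Filter.comap (abs ∘ im) atTop ⊓ Filter.principal (re ⁻¹' Set.Ioo a b),
            z ∈ re ⁻¹' Set.Ioo a b := Filter.mem_inf_of_right (Filter.mem_principal_self _)
        filter_upwards [h1, h2] with z hz1 hz2
        rw [norm_mul, hEn, Real.norm_eq_abs, Real.abs_exp]
        have h3 : ‖f z‖ ≤ |M| * Real.exp (|M| * Real.exp (1 * |z.im|)) := by
          refine (hgr z hz2.1 hz2.2 hz1).trans ?_
          have h4 : |z.im| ≤ Real.exp (1 * |z.im|) := by
            rw [one_mul]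
            linarith [Real.add_one_le_exp |z.im|]
          have h5 : M * |z.im| ≤ |M| * Real.exp (1 * |z.im|) :=
            mul_le_mul (le_abs_self M) h4 (abs_nonneg _) (abs_nonneg _)
          exact mul_le_mul (le_abs_self M) (Real.exp_le_exp.2 h5) (Real.exp_nonneg _) (abs_nonneg _)
        have h6 : Real.exp (m * (z.re ^ 2 - (z.im - t₀) ^ 2)) ≤ Real.exp (m * 4) := by
          rw [Real.exp_le_exp]
          refine mul_le_mul_of_nonneg_left ?_ hm
          nlinarith [hsq z hz2.1.le hz2.2.le, sq_nonneg (z.im - t₀)]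
        have h7 := Real.exp_le_exp.2 (hlb z.re hz2.1.le hz2.2.le)
        calc _ ≤ (|M| * Real.exp (|M| * Real.exp (1 * |z.im|))) *
              (Real.exp (m * 4) * Real.exp l₀) := by gcongr
          _ = _ := by ring
    · intro z hz
      refine hEdge z (by rwa [hz]) α ?_ (hfa z hz)
      simp only [hl, hz]
      field_simp
      ring
    · intro z hz
      refine hEdge z (by rwa [hz]) β ?_ (hfb z hz)
      simp only [hl, hz]
      field_simp
      ring
  rw [norm_mul, hEn, hst] at key
  have h8 : 1 ≤ Real.exp (m * (s.re ^ 2 - (t₀ - t₀) ^ 2)) := by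
    rw [Real.one_le_exp_iff]
    have : 0 ≤ s.re ^ 2 - (t₀ - t₀) ^ 2 := by rw [sub_self]; nlinarith [sq_nonneg s.re]
    exact mul_nonneg hm this
  have h9 : ‖f s‖ * Real.exp (-l s.re) ≤ Real.exp (5 * m) := by
    refine le_trans ?_ key
    refine mul_le_mul_of_nonneg_left ?_ (norm_nonneg _)
    exact le_mul_of_one_le_left (Real.exp_nonneg _) h8
  rw [Real.exp_neg, ← div_eq_mul_inv, div_le_iff₀ (Real.exp_pos _), ← Real.exp_add] at h9
  exact h9

lemma norm_Gamma_le {s : ℂ} (hs : 0 < s.re) : ‖Complex.Gamma s‖ ≤ Real.Gamma s.re := by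
  rw [Complex.Gamma_eq_integral hs, Real.Gamma_eq_integral hs, Complex.GammaIntegral]
  refine (MeasureTheory.norm_integral_le_integral_norm _).trans (le_of_eq ?_)
  refine MeasureTheory.setIntegral_congr_fun measurableSet_Ioi fun x hx => ?_
  have hx : 0 < x := hx
  simp only [norm_mul, Complex.norm_real, Real.norm_eq_abs, Real.abs_exp,
    Complex.norm_cpow_eq_rpow_re_of_pos hx, Complex.sub_re, Complex.one_re]

lemma exists_Gammaℝ_bound {a : ℝ} (ha : 0 < a) (b : ℝ) :
    ∃ M : ℝ, ∀ s : ℂ, a ≤ s.re → s.re ≤ b → ‖Gammaℝ s‖ ≤ M := by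
  have hc : ContinuousOn Real.Gamma (Set.Icc (a / 2) (b / 2)) :=
    Real.differentiableOn_Gamma_Ioi.continuousOn.mono fun x hx =>
      Set.mem_Ioi.2 (lt_of_lt_of_le (by linarith) hx.1)
  obtain ⟨M, hM⟩ := (isCompact_Icc.bddAbove_image hc)
  refine ⟨M, fun s h1 h2 => ?_⟩
  have h3 : (s / 2).re = s.re / 2 := by
    rw [show (2 : ℂ) = ((2 : ℝ) : ℂ) by norm_num, Complex.div_ofReal_re]
  have h4 : ‖Complex.Gamma (s / 2)‖ ≤ M := by
    refine (norm_Gamma_le (by rw [h3]; linarith)).trans (hM ⟨_, ?_, rfl⟩)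
    rw [h3]
    constructor <;> linarith
  rw [Gammaℝ_def, norm_mul, Complex.norm_cpow_eq_rpow_re_of_pos Real.pi_pos]
  refine (mul_le_of_le_one_left (norm_nonneg _) ?_).trans h4
  refine Real.rpow_le_one_of_one_le_of_nonpos (by linarith [Real.pi_gt_three]) ?_
  rw [neg_div, Complex.neg_re, h3]
  linarith

lemma differentiableAt_Gammaℝ {s : ℂ} (hs : 0 < s.re) : DifferentiableAt ℂ Gammaℝ s := by
  have h := (differentiable_Gammaℝ_inv s).inv (inv_ne_zero (Gammaℝ_ne_zero_of_re_pos hs))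
  simpa [Pi.inv_def] using h

lemma Gammaℝ_conj (s : ℂ) : Gammaℝ (starRingEnd ℂ s) = starRingEnd ℂ (Gammaℝ s) := by
  have h2 : starRingEnd ℂ s / 2 = starRingEnd ℂ (s / 2) := by rw [map_div₀, map_ofNat]
  have h3 : -starRingEnd ℂ s / 2 = starRingEnd ℂ (-s / 2) := by rw [map_div₀, map_ofNat, map_neg]
  rw [Gammaℝ_def, Gammaℝ_def, map_mul, h2, h3, Complex.Gamma_conj, Complex.cpow_conj]
  · simp
  · rw [Complex.arg_ofReal_of_nonneg Real.pi_pos.le]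
    exact Real.pi_pos.ne

lemma norm_cos_le (z : ℂ) : ‖Complex.cos z‖ ≤ Real.exp |z.im| := by
  have h1 : ‖cexp (z * I)‖ ≤ Real.exp |z.im| := by
    rw [Complex.norm_exp, Real.exp_le_exp]
    simpa using neg_le_abs z.im
  have h2 : ‖cexp (-z * I)‖ ≤ Real.exp |z.im| := by
    rw [Complex.norm_exp, Real.exp_le_exp]
    simpa using le_abs_self z.im
  rw [Complex.cos, norm_div]
  have := norm_add_le (cexp (z * I)) (cexp (-z * I))
  rw [Complex.norm_ofNat, div_le_iff₀ two_pos]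
  linarith

lemma Gammaℝ_ne_zero_of_im {s : ℂ} (hs : s.im ≠ 0) : Gammaℝ s ≠ 0 := by
  rw [Ne, Gammaℝ_eq_zero_iff]
  rintro ⟨n, rfl⟩
  simp at hs

lemma inv_Gammaℝ_eq {z : ℂ} (hz : z.im ≠ 0) :
    (Gammaℝ z)⁻¹ = Gammaℝ (2 - z) * Complex.cos (Real.pi * (1 - z) / 2) := by
  have h := Gammaℝ_one_sub_mul_Gammaℝ_one_add (1 - z)
  rw [show 1 - (1 - z) = z by ring, show 1 + (1 - z) = 2 - z by ring] at h
  have h1 := Gammaℝ_ne_zero_of_im hz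
  have h2 : Gammaℝ (2 - z) ≠ 0 := Gammaℝ_ne_zero_of_im (by simpa using hz)
  have h3 : Complex.cos (Real.pi * (1 - z) / 2) ≠ 0 := by
    intro h0
    rw [h0, inv_zero] at h
    exact mul_ne_zero h1 h2 h
  rw [inv_eq_iff_eq_inv, mul_inv, ← h]
  field_simp

/-- Growth at most exponential in the imaginary part, in a vertical strip. -/
def StripExp (a b : ℝ) (f : ℂ → ℂ) : Prop :=
  ∃ M : ℝ, 0 ≤ M ∧ ∀ s : ℂ, a ≤ s.re → s.re ≤ b → 1 ≤ |s.im| → ‖f s‖ ≤ M * Real.exp (M * |s.im|)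

lemma StripExp.mul {a b : ℝ} {f g : ℂ → ℂ} (hf : StripExp a b f) (hg : StripExp a b g) :
    StripExp a b fun s => f s * g s := by
  obtain ⟨M, hM0, hM⟩ := hf
  obtain ⟨N, hN0, hN⟩ := hg
  refine ⟨M * N + (M + N), by positivity, fun s h1 h2 h3 => ?_⟩
  have h4 : Real.exp (M * |s.im|) * Real.exp (N * |s.im|) ≤
      Real.exp ((M * N + (M + N)) * |s.im|) := by
    rw [← Real.exp_add, Real.exp_le_exp]
    nlinarith [mul_nonneg hM0 hN0]
  rw [norm_mul]
  calc _ ≤ (M * Real.exp (M * |s.im|)) * (N * Real.exp (N * |s.im|)) :=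
        mul_le_mul (hM s h1 h2 h3) (hN s h1 h2 h3) (norm_nonneg _) (by positivity)
    _ = M * N * (Real.exp (M * |s.im|) * Real.exp (N * |s.im|)) := by ring
    _ ≤ _ := mul_le_mul (by linarith) h4 (by positivity) (by positivity)

lemma StripExp.of_bdd {a b M : ℝ} {f : ℂ → ℂ}
    (h : ∀ s : ℂ, a ≤ s.re → s.re ≤ b → 1 ≤ |s.im| → ‖f s‖ ≤ M) : StripExp a b f := by
  refine ⟨|M|, abs_nonneg M, fun s h1 h2 h3 => ?_⟩
  refine ((h s h1 h2 h3).trans (le_abs_self M)).trans ?_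
  exact le_mul_of_one_le_right (abs_nonneg _) (Real.one_le_exp (by positivity))

lemma StripExp.add {a b : ℝ} {f g : ℂ → ℂ} (hf : StripExp a b f) (hg : StripExp a b g) :
    StripExp a b fun s => f s + g s := by
  obtain ⟨M, hM0, hM⟩ := hf
  obtain ⟨N, hN0, hN⟩ := hg
  refine ⟨M + N, by positivity, fun s h1 h2 h3 => ?_⟩
  have h4 : Real.exp (M * |s.im|) ≤ Real.exp ((M + N) * |s.im|) := by gcongr; linarith
  have h5 : Real.exp (N * |s.im|) ≤ Real.exp ((M + N) * |s.im|) := by gcongr; linarith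
  calc _ ≤ _ := norm_add_le _ _
    _ ≤ M * Real.exp (M * |s.im|) + N * Real.exp (N * |s.im|) :=
        add_le_add (hM s h1 h2 h3) (hN s h1 h2 h3)
    _ ≤ M * Real.exp ((M + N) * |s.im|) + N * Real.exp ((M + N) * |s.im|) := by gcongr
    _ = _ := by ring

lemma StripExp.pow {a b : ℝ} {f : ℂ → ℂ} (hf : StripExp a b f) (n : ℕ) :
    StripExp a b fun s => f s ^ n := by
  induction n with
  | zero => exact StripExp.of_bdd (M := 1) fun s _ _ _ => by simp
  | succ n ih => simpa only [pow_succ] using ih.mul hf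

lemma StripExp.prod {a b : ℝ} {ι : Type*} (S : Finset ι) {f : ι → ℂ → ℂ}
    (hf : ∀ i, StripExp a b (f i)) : StripExp a b fun s => ∏ i ∈ S, f i s := by
  classical
  induction S using Finset.induction_on with
  | empty => exact StripExp.of_bdd (M := 1) fun s _ _ _ => by simp
  | insert i S hi ih => simpa only [Finset.prod_insert hi] using (hf i).mul ih

lemma stripExp_inv_Gammaℝ {a b : ℝ} (ha : -2 ≤ a) (hb : b ≤ 3) :
    StripExp a b fun s => (Gammaℝ s)⁻¹ := by
  obtain ⟨M, hM⟩ := exists_Gammaℝ_bound one_pos 4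
  have key : ∀ z : ℂ, -2 ≤ z.re → z.re ≤ 1 → 1 ≤ |z.im| →
      ‖(Gammaℝ z)⁻¹‖ ≤ |M| * Real.exp (2 * |z.im|) := by
    intro z h1 h2 h3
    have hz : z.im ≠ 0 := by
      intro h
      rw [h, abs_zero] at h3
      linarith
    rw [inv_Gammaℝ_eq hz, norm_mul]
    refine mul_le_mul ((hM _ ?_ ?_).trans (le_abs_self M)) ((norm_cos_le _).trans ?_)
      (norm_nonneg _) (abs_nonneg _)
    · simp only [Complex.sub_re, Complex.re_ofNat]
      linarith
    · simp only [Complex.sub_re, Complex.re_ofNat]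
      linarith
    · rw [Real.exp_le_exp]
      have : (Real.pi * (1 - z) / 2 : ℂ).im = -(Real.pi / 2 * z.im) := by
        rw [show (2 : ℂ) = ((2 : ℝ) : ℂ) by norm_num, Complex.div_ofReal_im]
        simp
        ring
      rw [this, abs_neg, abs_mul, abs_of_pos (by positivity)]
      nlinarith [Real.pi_le_four, abs_nonneg z.im]
  refine ⟨8 * |M| + 2, by positivity, fun z h1 h2 h3 => ?_⟩
  have h5 : Real.exp (2 * |z.im|) ≤ Real.exp ((8 * |M| + 2) * |z.im|) := by
    rw [Real.exp_le_exp]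
    nlinarith [abs_nonneg M, abs_nonneg z.im]
  have h6 : 8 * |M| * Real.exp (2 * |z.im|) ≤ (8 * |M| + 2) * Real.exp ((8 * |M| + 2) * |z.im|) :=
    mul_le_mul (by linarith) h5 (by positivity) (by positivity)
  refine le_trans ?_ h6
  rcases le_or_gt z.re 1 with h4 | h4
  · refine (key z (by linarith) h4 h3).trans ?_
    nlinarith [mul_nonneg (abs_nonneg M) (Real.exp_nonneg (2 * |z.im|))]
  · have hz : (z - 2).im = z.im := by simp
    have hz2 : z - 2 ≠ 0 := by
      intro h
      rw [h, Complex.zero_im] at hz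
      rw [← hz, abs_zero] at h3
      linarith
    have h7 := key (z - 2) (by simp; linarith) (by simp; linarith) (by rwa [hz])
    have h8 : ‖(Gammaℝ z)⁻¹‖ = ‖(Gammaℝ (z - 2))⁻¹‖ * (2 * Real.pi / ‖z - 2‖) := by
      have := Gammaℝ_add_two hz2
      rw [sub_add_cancel] at this
      rw [this]
      simp only [norm_inv, norm_div, norm_mul, Complex.norm_real, Real.norm_eq_abs,
        abs_of_pos Real.pi_pos, Complex.norm_ofNat]
      field_simp
    have h9 : 1 ≤ ‖z - 2‖ := by
      have := Complex.abs_im_le_norm (z - 2)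
      rw [hz] at this
      linarith
    have h10 : 2 * Real.pi / ‖z - 2‖ ≤ 8 := by
      rw [div_le_iff₀ (by linarith)]
      linarith [Real.pi_le_four]
    rw [h8]
    rw [hz] at h7
    calc _ ≤ |M| * Real.exp (2 * |z.im|) * 8 := mul_le_mul h7 h10 (by positivity) (by positivity)
      _ = _ := by ring

/-- The ratio `Γ_ℝ(1 - s) / Γ_ℝ(s)`. -/
def gammaRatio (s : ℂ) : ℂ := Gammaℝ (1 - s) * (Gammaℝ s)⁻¹

lemma norm_gammaRatio_half {s : ℂ} (hs : s.re = 1 / 2) : ‖gammaRatio s‖ = 1 := by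
  have h1 : 1 - s = starRingEnd ℂ s := by
    apply Complex.ext
    · simp [hs]
      norm_num
    · simp
  have h2 : Gammaℝ s ≠ 0 := Gammaℝ_ne_zero_of_re_pos (by rw [hs]; norm_num)
  rw [gammaRatio, h1, Gammaℝ_conj, norm_mul, norm_inv, RCLike.norm_conj]
  exact mul_inv_cancel₀ (norm_ne_zero_iff.2 h2)

lemma gammaRatio_sub_two {u : ℂ} (h1 : u ≠ 1) (h2 : u ≠ 2) :
    gammaRatio (u - 2) = gammaRatio u * ((1 - u) * (u - 2) / (4 * (Real.pi : ℂ) ^ 2)) := by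
  have hA := Gammaℝ_add_two (s := 1 - u) (sub_ne_zero.2 h1.symm)
  have hB := Gammaℝ_add_two (s := u - 2) (sub_ne_zero.2 h2)
  rw [sub_add_cancel] at hB
  have hpi : (Real.pi : ℂ) ≠ 0 := by exact_mod_cast Real.pi_ne_zero
  have h3 := sub_ne_zero.2 h2
  rw [gammaRatio, gammaRatio, show 1 - (u - 2) = 1 - u + 2 by ring, hA, hB]
  simp only [mul_inv, div_eq_mul_inv, inv_inv]
  field_simp
  norm_num

lemma norm_gammaRatio_le {s : ℂ} (h1 : -(3 / 2) ≤ s.re) (h2 : s.re ≤ 1 / 2) :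
    ‖gammaRatio s‖ ≤ Real.exp 10 * (2 + |s.im|) ^ (1 / 2 - s.re) := by
  set t₀ := s.im with ht
  have hT : 0 < 2 + |t₀| := by positivity
  have hd : ∀ z : ℂ, z.re < 1 → DifferentiableAt ℂ gammaRatio z := by
    intro z hz
    have h3 : DifferentiableAt ℂ (fun z => Gammaℝ (1 - z)) z :=
      DifferentiableAt.comp z (differentiableAt_Gammaℝ (by simpa using hz)) (by fun_prop)
    exact h3.mul (differentiable_Gammaℝ_inv z)
  have hgr : StripExp (-(3 / 2)) (1 / 2) gammaRatio := by
    obtain ⟨M, hM⟩ := exists_Gammaℝ_bound (a := 1 / 2) (by norm_num) (5 / 2)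
    refine StripExp.mul (StripExp.of_bdd (M := M) fun z h3 h4 _ => hM _ ?_ ?_)
      (stripExp_inv_Gammaℝ (by norm_num) (by norm_num))
    · simp only [Complex.sub_re, Complex.one_re]
      linarith
    · simp only [Complex.sub_re, Complex.one_re]
      linarith
  obtain ⟨M, -, hM⟩ := hgr
  have key := strip_convexity (f := gammaRatio) (a := -(3 / 2)) (b := 1 / 2) (m := 2)
    (α := 2 * Real.log (2 + |t₀|)) (β := 0) (t₀ := t₀) (M := M) (s := s)
    (by norm_num) (by norm_num) (by norm_num) (by norm_num) (by norm_num) ?_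
    (fun z h3 h4 h5 => hM z h3.le h4.le h5) ?_ ?_ h1 h2 rfl
  · refine key.trans (le_of_eq ?_)
    rw [Real.rpow_def_of_pos hT, ← Real.exp_add]
    congr 1
    ring
  · refine DifferentiableOn.diffContOnCl fun z hz => ?_
    rw [closure_preimage_re, closure_Ioo (by norm_num)] at hz
    exact (hd z (lt_of_le_of_lt hz.2 (by norm_num))).differentiableWithinAt
  · intro z hz
    have h3 : (z + 2).re = 1 / 2 := by
      rw [Complex.add_re, hz]
      norm_num
    have h4 := gammaRatio_sub_two (u := z + 2)
      (fun h => by rw [h] at h3; norm_num at h3) (fun h => by rw [h] at h3; norm_num at h3)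
    rw [add_sub_cancel_right] at h4
    have h5 : ‖1 - (z + 2)‖ ≤ 2 + |z.im| := by
      refine (Complex.norm_le_abs_re_add_abs_im _).trans ?_
      have : (1 - (z + 2)).re = 1 / 2 := by
        rw [Complex.sub_re, h3]
        norm_num
      rw [this]
      simp only [Complex.sub_im, Complex.one_im, Complex.add_im, Complex.im_ofNat, add_zero,
        zero_sub, abs_neg]
      norm_num
    have h6 : ‖z‖ ≤ 2 + |z.im| := by
      refine (Complex.norm_le_abs_re_add_abs_im _).trans ?_
      rw [hz]
      norm_num
    have h7 : 2 + |z.im| ≤ (2 + |t₀|) * (1 + |z.im - t₀|) := by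
      have : |z.im| ≤ |t₀| + |z.im - t₀| := by
        have := abs_add_le t₀ (z.im - t₀)
        rwa [add_sub_cancel] at this
      nlinarith [abs_nonneg t₀, abs_nonneg (z.im - t₀)]
    rw [h4, norm_mul, norm_gammaRatio_half h3, one_mul, norm_div, norm_mul]
    have h8 : 1 ≤ ‖(4 * (Real.pi : ℂ) ^ 2)‖ := by
      rw [norm_mul, norm_pow, Complex.norm_real, Real.norm_eq_abs, abs_of_pos Real.pi_pos,
        Complex.norm_ofNat]
      nlinarith [Real.pi_gt_three]
    refine (div_le_self (by positivity) h8).trans ?_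
    have h9 : Real.exp (2 * Real.log (2 + |t₀|)) = (2 + |t₀|) ^ 2 := by
      rw [two_mul, Real.exp_add, Real.exp_log hT, sq]
    rw [h9, show ((2 : ℝ) : ℝ) = ((2 : ℕ) : ℝ) by norm_num, Real.rpow_natCast, Nat.cast_ofNat,
      ← mul_pow, sq]
    refine mul_le_mul (h5.trans h7) (h6.trans h7) (norm_nonneg _) (by positivity)
  · intro z hz
    rw [norm_gammaRatio_half hz, Real.exp_zero, one_mul]
    exact Real.one_le_rpow (by linarith [abs_nonneg (z.im - t₀)]) (by norm_num)

lemma norm_gammaRatio_sub_one_le {s : ℂ} (h1 : -(1 / 2) ≤ s.re) (h2 : s.re ≤ 0) :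
    ‖Gammaℝ (2 - s) * (Gammaℝ (1 + s))⁻¹‖ ≤ Real.exp 13 * (2 + |s.im|) ^ (1 / 2 - s.re) := by
  have hT : 0 < 2 + |s.im| := by positivity
  have hs1 : s - 1 ≠ 0 := by
    intro h
    have := congrArg Complex.re h
    simp only [Complex.sub_re, Complex.one_re, Complex.zero_re] at this
    linarith
  have hpi : (Real.pi : ℂ) ≠ 0 := by exact_mod_cast Real.pi_ne_zero
  have hA := Gammaℝ_add_two hs1
  have h3 : Gammaℝ (2 - s) * (Gammaℝ (1 + s))⁻¹ =
      gammaRatio (s - 1) * (2 * Real.pi / (s - 1)) := by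
    rw [gammaRatio, show 1 + s = s - 1 + 2 by ring, hA, show 1 - (s - 1) = 2 - s by ring]
    simp only [mul_inv, div_eq_mul_inv, inv_inv]
    ring
  have h4 := norm_gammaRatio_le (s := s - 1) (by simp; linarith) (by simp; linarith)
  have h5 : (2 + |s.im|) / 3 ≤ ‖s - 1‖ := by
    have h6 := Complex.abs_im_le_norm (s - 1)
    have h7 := Complex.abs_re_le_norm (s - 1)
    rw [Complex.sub_im, Complex.one_im, sub_zero] at h6
    rw [Complex.sub_re, Complex.one_re] at h7
    have := neg_le_abs (s.re - 1)
    linarith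
  rw [h3, norm_mul]
  have h6 : ‖(2 * Real.pi / (s - 1) : ℂ)‖ ≤ Real.exp 3 / (2 + |s.im|) := by
    rw [norm_div, norm_mul, Complex.norm_real, Complex.norm_ofNat, Real.norm_eq_abs,
      abs_of_pos Real.pi_pos, div_le_div_iff₀ (lt_of_lt_of_le (by positivity) h5) hT]
    have h7 : (18.9 : ℝ) ≤ Real.exp 3 := by
      have h8 := Real.exp_one_gt_d9
      have h9 : Real.exp 3 = Real.exp 1 ^ 3 := by rw [← Real.exp_nat_mul]; norm_num
      rw [h9]
      calc (18.9 : ℝ) ≤ 2.7 ^ 3 := by norm_num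
        _ ≤ _ := pow_le_pow_left₀ (by norm_num) (by linarith) 3
    have h8 := Real.pi_lt_d2
    calc 2 * Real.pi * (2 + |s.im|) ≤ 18.9 * ((2 + |s.im|) / 3) := by nlinarith
      _ ≤ _ := mul_le_mul h7 h5 (by positivity) (by positivity)
  calc _ ≤ (Real.exp 10 * (2 + |(s - 1).im|) ^ (1 / 2 - (s - 1).re)) *
        (Real.exp 3 / (2 + |s.im|)) := mul_le_mul h4 h6 (norm_nonneg _) (by positivity)
    _ = (Real.exp 10 * Real.exp 3) * ((2 + |s.im|) ^ (1 / 2 - s.re + 1) / (2 + |s.im|)) := by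
        rw [Complex.sub_im, Complex.one_im, sub_zero, Complex.sub_re, Complex.one_re,
          show 1 / 2 - (s.re - 1) = 1 / 2 - s.re + 1 by ring]
        ring
    _ = _ := by
        rw [← Real.exp_add, Real.rpow_add_one hT.ne', mul_div_assoc, div_self hT.ne', mul_one]
        norm_num

section ZF

variable {ι : Type*} [Fintype ι] (κ : Type*) [Fintype κ] (p : ι → Bool)

lemma complex_factor_eq (s : ℂ) : Real.pi * (2 * Real.pi : ℂ) ^ (-s) * Complex.Gamma s =
    Real.pi / 2 * (Gammaℝ s * Gammaℝ (s + 1)) := by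
  rw [Gammaℝ_mul_Gammaℝ_add_one, Gammaℂ_def]
  ring

lemma inv_ZF_eq (s : ℂ) : (ZF κ p s)⁻¹ = (∏ w, (Gammaℝ (s + if p w then 1 else 0))⁻¹) *
    (2 / Real.pi * ((Gammaℝ s)⁻¹ * (Gammaℝ (s + 1))⁻¹)) ^ Fintype.card κ := by
  rw [ZF, complex_factor_eq, mul_inv, ← Finset.prod_inv_distrib, ← inv_pow, mul_inv, mul_inv,
    inv_div]

lemma differentiable_inv_ZF : Differentiable ℂ fun s => (ZF κ p s)⁻¹ := by
  simp_rw [inv_ZF_eq]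
  have h : ∀ c : ℂ, Differentiable ℂ fun s => (Gammaℝ (s + c))⁻¹ := fun c =>
    differentiable_Gammaℝ_inv.comp (differentiable_id.add_const c)
  refine Differentiable.mul (Differentiable.fun_finsetProd fun w _ => h _)
    (((differentiable_Gammaℝ_inv.mul (h 1)).const_mul _).pow _)

lemma ZF_ne_zero {s : ℂ} (hs : 0 < s.re) : ZF κ p s ≠ 0 := by
  have h : ∀ c : ℝ, 0 ≤ c → Gammaℝ (s + c) ≠ 0 := fun c hc =>
    Gammaℝ_ne_zero_of_re_pos (by rw [Complex.add_re, Complex.ofReal_re]; linarith)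
  have hpi : (Real.pi : ℂ) ≠ 0 := by exact_mod_cast Real.pi_ne_zero
  rw [ZF, complex_factor_eq]
  refine mul_ne_zero (Finset.prod_ne_zero_iff.2 fun w _ => ?_) (pow_ne_zero _ ?_)
  · split_ifs
    · simpa using h 1 zero_le_one
    · simpa using h 0 le_rfl
  · refine mul_ne_zero (div_ne_zero hpi two_ne_zero) (mul_ne_zero ?_ ?_)
    · simpa using h 0 le_rfl
    · simpa using h 1 zero_le_one

lemma stripExp_inv_ZF : StripExp (-2) 2 fun s => (ZF κ p s)⁻¹ := by
  simp_rw [inv_ZF_eq]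
  have h0 : StripExp (-2) 2 fun s => (Gammaℝ s)⁻¹ :=
    stripExp_inv_Gammaℝ (by norm_num) (by norm_num)
  have h1 : StripExp (-2) 2 fun s => (Gammaℝ (s + 1))⁻¹ := by
    obtain ⟨M, hM0, hM⟩ := stripExp_inv_Gammaℝ (a := -1) (b := 3) (by norm_num) le_rfl
    refine ⟨M, hM0, fun s h1 h2 h3 => ?_⟩
    have := hM (s + 1) (by simp; linarith) (by simp; linarith) (by simpa using h3)
    simpa using this
  refine StripExp.mul (StripExp.prod _ fun w => ?_) (StripExp.pow (StripExp.mul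
    (StripExp.of_bdd (M := ‖(2 / Real.pi : ℂ)‖) fun _ _ _ _ => le_rfl) (h0.mul h1)) _)
  split_ifs
  · exact h1
  · simpa only [add_zero] using h0

lemma norm_ZF_ratio_le {s : ℂ} (h1 : -(1 / 2) ≤ s.re) (h2 : s.re ≤ 0) :
    ‖ZF κ p (1 - s)‖ * ‖(ZF κ p s)⁻¹‖ ≤
      (Real.exp 13 * (2 + |s.im|) ^ (1 / 2 - s.re)) ^ (Fintype.card ι + 2 * Fintype.card κ) := by
  set B := Real.exp 13 * (2 + |s.im|) ^ (1 / 2 - s.re) with hB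
  have hpi : (Real.pi : ℂ) ≠ 0 := by exact_mod_cast Real.pi_ne_zero
  have h3 : ‖Gammaℝ (1 - s) * (Gammaℝ s)⁻¹‖ ≤ B := by
    refine (norm_gammaRatio_le (by linarith) (by linarith)).trans ?_
    rw [hB]
    gcongr
    norm_num
  have h4 : ‖Gammaℝ (2 - s) * (Gammaℝ (1 + s))⁻¹‖ ≤ B := norm_gammaRatio_sub_one_le h1 h2
  rw [← norm_mul, inv_ZF_eq, ZF, complex_factor_eq]
  have h5 : (∏ w, Gammaℝ (1 - s + if p w then 1 else 0)) *
      (Real.pi / 2 * (Gammaℝ (1 - s) * Gammaℝ (1 - s + 1))) ^ Fintype.card κ *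
      ((∏ w, (Gammaℝ (s + if p w then 1 else 0))⁻¹) *
      (2 / Real.pi * ((Gammaℝ s)⁻¹ * (Gammaℝ (s + 1))⁻¹)) ^ Fintype.card κ) =
      (∏ w, (Gammaℝ (1 - s + if p w then 1 else 0) * (Gammaℝ (s + if p w then 1 else 0))⁻¹)) *
      ((Gammaℝ (1 - s) * (Gammaℝ s)⁻¹) * (Gammaℝ (2 - s) * (Gammaℝ (1 + s))⁻¹)) ^
        Fintype.card κ := by
    rw [Finset.prod_mul_distrib, mul_mul_mul_comm, ← mul_pow]
    congr 2
    rw [show 1 - s + 1 = 2 - s by ring, add_comm s 1]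
    field_simp
  rw [h5, norm_mul, norm_pow, norm_prod, pow_add, pow_mul]
  have hB0 : 0 ≤ B := by positivity
  refine mul_le_mul ?_ ?_ (by positivity) (by positivity)
  · calc _ ≤ ∏ _w : ι, B := by
          refine Finset.prod_le_prod (fun _ _ => norm_nonneg _) fun w _ => ?_
          split_ifs
          · simpa only [show 1 - s + 1 = 2 - s by ring, add_comm s 1] using h4
          · simpa only [add_zero] using h3
      _ = _ := by simp
  · refine pow_le_pow_left₀ (norm_nonneg _) ?_ _
    rw [norm_mul, sq]
    exact mul_le_mul h3 h4 (norm_nonneg _) hB0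

end ZF

/-- The factor cancelling the pole at `s = 1` when `b` holds. -/
def poleFactor (b : Prop) (s : ℂ) : ℂ := open scoped Classical in if b then (s - 1) / (s + 1) else 1

lemma add_one_ne_zero {s : ℂ} (hs : -1 < s.re) : s + 1 ≠ 0 := by
  intro h
  have := congrArg Complex.re h
  simp only [Complex.add_re, Complex.one_re, Complex.zero_re] at this
  linarith

lemma differentiableAt_poleFactor (b : Prop) {s : ℂ} (hs : -1 < s.re) :
    DifferentiableAt ℂ (poleFactor b) s := by
  unfold poleFactor
  by_cases hb : b
  · simp only [hb, if_true]
    exact DifferentiableAt.div (by fun_prop) (by fun_prop) (add_one_ne_zero hs)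
  · simp only [hb, if_false]
    fun_prop

lemma norm_poleFactor_le (b : Prop) {s : ℂ} (hs : -(1 / 2) ≤ s.re) : ‖poleFactor b s‖ ≤ 5 := by
  unfold poleFactor
  split_ifs
  · have h1 : 1 / 2 ≤ ‖s + 1‖ := by
      refine le_trans ?_ (Complex.re_le_norm _)
      simp only [Complex.add_re, Complex.one_re]
      linarith
    have h2 : ‖s - 1‖ ≤ ‖s + 1‖ + 2 := by
      have := norm_sub_le (s + 1) 2
      rwa [show s + 1 - 2 = s - 1 by ring, Complex.norm_ofNat] at this
    rw [norm_div, div_le_iff₀ (by linarith)]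
    linarith
  · rw [norm_one]
    norm_num

lemma norm_poleFactor_le_one (b : Prop) {s : ℂ} (hs : 0 < s.re) : ‖poleFactor b s‖ ≤ 1 := by
  unfold poleFactor
  split_ifs
  · rw [norm_div]
    refine div_le_one_of_le₀ ?_ (norm_nonneg _)
    rw [← sq_le_sq₀ (norm_nonneg _) (norm_nonneg _), Complex.sq_norm, Complex.sq_norm,
      Complex.normSq_apply, Complex.normSq_apply]
    simp only [Complex.add_re, Complex.sub_re, Complex.one_re, Complex.add_im, Complex.sub_im,
      Complex.one_im]
    nlinarith
  · rw [norm_one]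

lemma le_norm_poleFactor (b : Prop) {s : ℂ} (hs : 1 < s.re) :
    Real.exp (-(2 / (s.re - 1))) ≤ ‖poleFactor b s‖ := by
  have h0 : 0 < s.re - 1 := by linarith
  unfold poleFactor
  split_ifs
  · have h1 : (s.re - 1) / (s.re + 1) ≤ ‖(s - 1) / (s + 1)‖ := by
      rw [norm_div, div_le_div_iff₀ (by linarith)
        (norm_pos_iff.2 (add_one_ne_zero (by linarith))),
        ← sq_le_sq₀ (by positivity) (by have := norm_nonneg (s - 1); nlinarith), mul_pow,
        mul_pow, Complex.sq_norm, Complex.sq_norm, Complex.normSq_apply, Complex.normSq_apply]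
      simp only [Complex.add_re, Complex.sub_re, Complex.one_re, Complex.add_im, Complex.sub_im,
        Complex.one_im, add_zero, sub_zero]
      nlinarith [mul_nonneg (sq_nonneg s.im) (show 0 ≤ 4 * s.re by linarith)]
    refine le_trans ?_ h1
    rw [Real.exp_neg, inv_le_comm₀ (Real.exp_pos _) (by positivity), inv_div]
    have := Real.add_one_le_exp (2 / (s.re - 1))
    have h2 : (s.re + 1) / (s.re - 1) = 2 / (s.re - 1) + 1 := by
      field_simp
      ring
    linarith
  · rw [norm_one, Real.exp_le_one_iff]
    have : 0 ≤ 2 / (s.re - 1) := by positivity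
    linarith

section Regular

open scoped Classical

variable {K : Type*} [Field K] [NumberField K] {q : Ideal (𝓞 K)} (χ : HeckeChar K q)

/-- The `L`-function with its possible pole removed, with growth and its bound to the left of the
critical strip. -/
theorem exists_regular {L : ℂ → ℂ} (hL : IsLFun χ L) (hq : q ≠ ⊥) : ∃ F : ℂ → ℂ,
    (∀ s : ℂ, -1 < s.re → DifferentiableAt ℂ F s) ∧
    (∀ s : ℂ, s ≠ 1 → F s = L s * poleFactor (IsTrivialChar χ) s) ∧
    StripExp (-(1 / 2)) 2 F ∧
    ∀ s : ℂ, -(1 / 2) ≤ s.re → s.re < 0 → ‖F s‖ ≤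
      5 * ((Real.exp 13 * (2 + |s.im|) ^ (1 / 2 - s.re)) ^ nK K *
        ((DK K : ℝ) ^ (1 / 2 - s.re) * (Ideal.absNorm q : ℝ) ^ (1 / 2 - s.re)) *
        ((∑ g ∈ idealDivisors q, (Ideal.absNorm g : ℝ) ^ (-(1 / 2) : ℝ)) *
          Real.exp (2 * nK K / (-s.re)))) := by
  obtain ⟨p, E, P, Q, hE, hP, hQ, hEb, hPb, hQb, hser, hP1, hbound⟩ := exists_completed χ hq
  set b : Prop := IsTrivialChar χ with hb
  set Z : ℂ → ℂ := fun s => (ZF {w : InfinitePlace K // w.IsComplex} p s)⁻¹ with hZ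
  have hZd : Differentiable ℂ Z := differentiable_inv_ZF {w : InfinitePlace K // w.IsComplex} p
  set G : ℂ → ℂ := fun s => E s + P s / (s - 1) - Q s / s with hG
  have hLG : ∀ s : ℂ, s ≠ 0 → s ≠ 1 → L s = G s * Z s := by
    have hU : IsOpen (({0, 1} : Set ℂ)ᶜ) := (Set.toFinite _).isClosed.isOpen_compl
    have hconn : IsPreconnected (({0, 1} : Set ℂ)ᶜ) :=
      (Set.Countable.isConnected_compl_of_one_lt_rank (by rw [Complex.rank_real_complex]; norm_num)
        (Set.toFinite _).countable).isPreconnected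
    have hm : ∀ s ∈ (({0, 1} : Set ℂ)ᶜ), s ≠ 0 ∧ s - 1 ≠ 0 := by
      intro s hs
      simp only [Set.mem_compl_iff, Set.mem_insert_iff, Set.mem_singleton_iff, not_or] at hs
      exact ⟨hs.1, sub_ne_zero.2 hs.2⟩
    have h1 : AnalyticOnNhd ℂ L (({0, 1} : Set ℂ)ᶜ) :=
      DifferentiableOn.analyticOnNhd (fun s hs =>
        (hL.1 s (sub_ne_zero.1 (hm s hs).2)).differentiableWithinAt) hU
    have h2 : AnalyticOnNhd ℂ (fun s => G s * Z s) (({0, 1} : Set ℂ)ᶜ) := by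
      refine DifferentiableOn.analyticOnNhd (fun s hs => ?_) hU
      refine DifferentiableAt.differentiableWithinAt (DifferentiableAt.mul ?_ (hZd s))
      exact ((hE s).add ((hP s).div (by fun_prop) (hm s hs).2)).sub
        ((hQ s).div (by fun_prop) (hm s hs).1)
    have h3 : L =ᶠ[nhds 2] fun s => G s * Z s := by
      have : ∀ᶠ s : ℂ in nhds 2, 1 < s.re :=
        (isOpen_lt continuous_const Complex.continuous_re).mem_nhds (by simp)
      filter_upwards [this] with s hs
      rw [hL.2 s hs, hG, hZ]
      dsimp only
      rw [← hser s hs, mul_assoc, mul_inv_cancel₀ (ZF_ne_zero {w : InfinitePlace K // w.IsComplex} p (by linarith)), mul_one]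
    intro s hs0 hs1
    refine h1.eqOn_of_preconnected_of_eventuallyEq h2 hconn (z₀ := 2) (by simp) h3 ?_
    simp [hs0, hs1]
  obtain ⟨H, hHd, hH⟩ : ∃ H : ℂ → ℂ, (DifferentiableAt ℂ H 1) ∧
      ∀ s : ℂ, s ≠ 1 → s ≠ 0 → s + 1 ≠ 0 → G s * poleFactor b s = H s := by
    by_cases hbt : b
    · refine ⟨fun s => (E s * (s - 1) + P s - Q s * (s - 1) / s) / (s + 1), ?_, ?_⟩
      · refine DifferentiableAt.div (((hE 1).mul (by fun_prop)).add (hP 1) |>.sub ?_)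
          (by fun_prop) (by norm_num)
        exact DifferentiableAt.div ((hQ 1).mul (by fun_prop)) (by fun_prop) one_ne_zero
      · intro s h1 h0 h2
        have h3 := sub_ne_zero.2 h1
        simp only [hG, poleFactor, hbt, if_true]
        field_simp
    · refine ⟨fun s => E s + dslope P 1 s - Q s / s, ?_, ?_⟩
      · have h1 : DifferentiableOn ℂ (dslope P 1) Set.univ :=
          (Complex.differentiableOn_dslope Filter.univ_mem).2 hP.differentiableOn
        exact ((hE 1).add (h1.differentiableAt Filter.univ_mem)).sub
          ((hQ 1).div (by fun_prop) one_ne_zero)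
      · intro s h1 h0 h2
        simp only [hG, poleFactor, hbt, if_false, mul_one]
        rw [dslope_of_ne _ h1, slope_def_field, hP1 hbt, sub_zero]
  set F : ℂ → ℂ := Function.update (fun s => L s * poleFactor b s) 1 (H 1 * Z 1) with hF
  have hF1 : ∀ s : ℂ, s ≠ 1 → F s = L s * poleFactor b s := fun s hs => by
    rw [hF, Function.update_of_ne hs]
  have hFG : ∀ s : ℂ, s ≠ 0 → s ≠ 1 → F s = G s * Z s * poleFactor b s := fun s h0 h1 => by
    rw [hF1 s h1, hLG s h0 h1]
  refine ⟨F, ?_, hF1, ?_, ?_⟩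
  · intro s hs
    by_cases h1 : s = 1
    · subst h1
      have h2 : F =ᶠ[nhds 1] fun s => H s * Z s := by
        have h3 : ∀ᶠ s : ℂ in nhds 1, 0 < s.re :=
          (isOpen_lt continuous_const Complex.continuous_re).mem_nhds (by simp)
        filter_upwards [h3] with s hs
        by_cases h1 : s = 1
        · rw [h1, hF, Function.update_self]
        · have h0 : s ≠ 0 := by
            rintro rfl
            simp at hs
          rw [hFG s h0 h1, ← hH s h1 h0 (add_one_ne_zero (by linarith))]
          ring
      exact (hHd.mul (hZd 1)).congr_of_eventuallyEq h2
    · have h2 : F =ᶠ[nhds s] fun s => L s * poleFactor b s := by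
        filter_upwards [isOpen_ne.mem_nhds h1] with z hz using hF1 z hz
      exact ((hL.1 s h1).mul (differentiableAt_poleFactor b hs)).congr_of_eventuallyEq h2
  · have hbd : ∀ f : ℂ → ℂ, StripBdd f → StripExp (-(1 / 2)) 2 f := by
      intro f hf
      obtain ⟨M, hM⟩ := hf (-(1 / 2)) 2
      exact StripExp.of_bdd fun s h1 h2 _ => hM s h1 h2
    have hinv : ∀ c : ℝ, StripExp (-(1 / 2)) 2 fun s => (s - c)⁻¹ := by
      intro c
      refine StripExp.of_bdd (M := 1) fun s _ _ h3 => ?_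
      rw [norm_inv]
      refine inv_le_one_of_one_le₀ (h3.trans ?_)
      simpa using Complex.abs_im_le_norm (s - c)
    have hGe : StripExp (-(1 / 2)) 2 fun s => E s + P s * (s - (1 : ℝ))⁻¹ +
        (fun _ => (-1 : ℂ)) s * (Q s * (s - (0 : ℝ))⁻¹) :=
      ((hbd E hEb).add ((hbd P hPb).mul (hinv 1))).add
        ((hbd _ (StripBdd.const (-1))).mul ((hbd Q hQb).mul (hinv 0)))
    have hZe : StripExp (-(1 / 2)) 2 Z := by
      obtain ⟨M, hM0, hM⟩ := stripExp_inv_ZF {w : InfinitePlace K // w.IsComplex} p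
      exact ⟨M, hM0, fun s h1 h2 h3 => hM s (by linarith) h2 h3⟩
    obtain ⟨M, hM0, hM⟩ := (hGe.mul hZe).mul (StripExp.of_bdd (f := poleFactor b) (M := 5)
      fun s h1 _ _ => norm_poleFactor_le b h1)
    refine ⟨M, hM0, fun s h1 h2 h3 => ?_⟩
    have h4 : s.im ≠ 0 := by
      intro h
      rw [h, abs_zero] at h3
      linarith
    rw [hFG s (by rintro rfl; simp at h4) (by rintro rfl; simp at h4)]
    refine le_trans (le_of_eq ?_) (hM s h1 h2 h3)
    simp only [hG, Complex.ofReal_one, Complex.ofReal_zero, sub_zero]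
    ring_nf
  · intro s h1 h2
    have h0 : s ≠ 0 := by
      rintro rfl
      simp at h2
    have h0' : s ≠ 1 := by
      rintro rfl
      norm_num at h2
    rw [hFG s h0 h0', norm_mul, norm_mul, mul_comm]
    refine mul_le_mul (norm_poleFactor_le b h1) ?_ (by positivity) (by norm_num)
    have h3 := norm_ZF_ratio_le {w : InfinitePlace K // w.IsComplex} p h1 h2.le
    have hcard : Fintype.card {w : InfinitePlace K // w.IsReal} + 2 * Fintype.card {w : InfinitePlace K // w.IsComplex} = nK K :=
      InfinitePlace.card_add_two_mul_card_eq_rank K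
    rw [hcard] at h3
    calc _ ≤ (‖ZF {w : InfinitePlace K // w.IsComplex} p (1 - s)‖ * ((DK K : ℝ) ^ (1 / 2 - s.re) *
          (Ideal.absNorm q : ℝ) ^ (1 / 2 - s.re)) *
          ((∑ g ∈ idealDivisors q, (Ideal.absNorm g : ℝ) ^ (-(1 / 2) : ℝ)) *
            Real.exp (2 * nK K / (-s.re)))) * ‖Z s‖ :=
          mul_le_mul_of_nonneg_right (hbound s h2) (norm_nonneg _)
      _ = (‖ZF {w : InfinitePlace K // w.IsComplex} p (1 - s)‖ * ‖Z s‖) * (((DK K : ℝ) ^ (1 / 2 - s.re) *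
          (Ideal.absNorm q : ℝ) ^ (1 / 2 - s.re)) *
          ((∑ g ∈ idealDivisors q, (Ideal.absNorm g : ℝ) ^ (-(1 / 2) : ℝ)) *
            Real.exp (2 * nK K / (-s.re)))) := by ring
      _ ≤ (Real.exp 13 * (2 + |s.im|) ^ (1 / 2 - s.re)) ^ nK K *
          (((DK K : ℝ) ^ (1 / 2 - s.re) *
          (Ideal.absNorm q : ℝ) ^ (1 / 2 - s.re)) *
          ((∑ g ∈ idealDivisors q, (Ideal.absNorm g : ℝ) ^ (-(1 / 2) : ℝ)) *
            Real.exp (2 * nK K / (-s.re)))) := by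
          refine mul_le_mul_of_nonneg_right h3 ?_
          have : 0 ≤ ∑ g ∈ idealDivisors q, (Ideal.absNorm g : ℝ) ^ (-(1 / 2) : ℝ) :=
            Finset.sum_nonneg fun _ _ => by positivity
          positivity
      _ = _ := by ring

end Regular

/-- The analytic conductor exponent `log (D_K N𝔮) + n_K log (T + 3)`. -/
def logCond (K : Type*) [Field K] [NumberField K] (q : Ideal (𝓞 K)) (T : ℝ) : ℝ :=
  Real.log ((DK K : ℝ) * (Ideal.absNorm q : ℝ)) + (nK K : ℝ) * Real.log (T + 3)

section LogCond

variable {K : Type*} [Field K] [NumberField K] {q : Ideal (𝓞 K)}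

lemma log_DK_nonneg (K : Type*) [Field K] [NumberField K] : 0 ≤ Real.log (DK K : ℝ) :=
  Real.log_nonneg (by exact_mod_cast DK_pos K)

lemma logCond_eq (hq : q ≠ ⊥) (T : ℝ) : logCond K q T =
    Real.log (DK K : ℝ) + Real.log (Ideal.absNorm q : ℝ) + (nK K : ℝ) * Real.log (T + 3) := by
  have hD : (0 : ℝ) < DK K := by exact_mod_cast DK_pos K
  rw [logCond, Real.log_mul hD.ne' (absNorm_pos hq).ne']

lemma log_absNorm_le_logCond (hq : q ≠ ⊥) {T : ℝ} (hT : 1 ≤ T) :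
    Real.log (Ideal.absNorm q : ℝ) ≤ logCond K q T := by
  have h1 : 0 ≤ (nK K : ℝ) * Real.log (T + 3) :=
    mul_nonneg (Nat.cast_nonneg _) (Real.log_nonneg (by linarith))
  rw [logCond_eq hq]
  linarith [log_DK_nonneg K]

lemma log_absNorm_nonneg (q : Ideal (𝓞 K)) : 0 ≤ Real.log (Ideal.absNorm q : ℝ) := by
  rcases Nat.eq_zero_or_pos (Ideal.absNorm q) with h | h
  · simp [h]
  · exact Real.log_nonneg (by exact_mod_cast h)

lemma logCond_nonneg (hq : q ≠ ⊥) {T : ℝ} (hT : 1 ≤ T) : 0 ≤ logCond K q T :=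
  (log_absNorm_nonneg q).trans (log_absNorm_le_logCond hq hT)

end LogCond

lemma left_edge_bound {η δ B D N₀ T X x S : ℝ} {k : ℕ} (hk : (1 : ℝ) ≤ k) (hη : 0 < η)
    (hD : 0 < D) (hN : 0 < N₀) (hT : 1 ≤ T) (hX : 0 ≤ X) (hx : 0 ≤ x)
    (hXx : 2 + X ≤ (T + 3) * (1 + x)) (hS0 : 0 ≤ S) (hS : S ≤ Real.exp (B * k) * N₀ ^ δ) :
    5 * ((Real.exp 13 * (2 + X) ^ (1 / 2 + η)) ^ k * (D ^ (1 / 2 + η) * N₀ ^ (1 / 2 + η)) *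
      (S * Real.exp (2 * k / η))) ≤
    Real.exp ((15 + B + 2 / η) * k + (1 / 2 + η) *
      (Real.log D + Real.log N₀ + k * Real.log (T + 3)) + δ * Real.log N₀) *
      (1 + x) ^ (k * (1 / 2 + η)) := by
  have hT3 : 0 < T + 3 := by linarith
  have ha0 : 0 < 1 / 2 + η := by linarith
  have e1 : (5 : ℝ) ≤ Real.exp (2 * k) := by
    have h1 := Real.exp_one_gt_d9
    calc (5 : ℝ) ≤ Real.exp 1 * Real.exp 1 := by nlinarith
      _ = Real.exp 2 := by rw [← Real.exp_add]; norm_num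
      _ ≤ _ := Real.exp_le_exp.2 (by linarith)
  have e2 : (Real.exp 13 * (2 + X) ^ (1 / 2 + η)) ^ k ≤
      Real.exp (k * (13 + (1 / 2 + η) * Real.log (T + 3))) * (1 + x) ^ (k * (1 / 2 + η)) := by
    have h2 : (2 + X) ^ (1 / 2 + η) ≤
        Real.exp ((1 / 2 + η) * Real.log (T + 3)) * (1 + x) ^ (1 / 2 + η) := by
      refine (Real.rpow_le_rpow (by positivity) hXx ha0.le).trans (le_of_eq ?_)
      rw [Real.mul_rpow hT3.le (by positivity), Real.rpow_def_of_pos hT3, mul_comm (Real.log _)]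
    calc _ ≤ (Real.exp 13 * (Real.exp ((1 / 2 + η) * Real.log (T + 3)) *
          (1 + x) ^ (1 / 2 + η))) ^ k := by gcongr
      _ = _ := by
          rw [← mul_assoc, ← Real.exp_add, mul_pow, ← Real.exp_nat_mul, ← Real.rpow_mul_natCast
            (by positivity), mul_comm (k : ℝ) (1 / 2 + η)]
  have e3 : D ^ (1 / 2 + η) * N₀ ^ (1 / 2 + η) =
      Real.exp ((1 / 2 + η) * (Real.log D + Real.log N₀)) := by
    rw [Real.rpow_def_of_pos hD, Real.rpow_def_of_pos hN, ← Real.exp_add]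
    congr 1
    ring
  have e4 : S * Real.exp (2 * k / η) ≤ Real.exp (B * k + δ * Real.log N₀ + 2 / η * k) := by
    refine (mul_le_mul_of_nonneg_right hS (Real.exp_nonneg _)).trans (le_of_eq ?_)
    rw [Real.rpow_def_of_pos hN, ← Real.exp_add, ← Real.exp_add]
    congr 1
    ring
  rw [e3]
  have e5 := mul_le_mul (mul_le_mul_of_nonneg_right e2
    (Real.exp_nonneg ((1 / 2 + η) * (Real.log D + Real.log N₀)))) e4 (by positivity)
    (by positivity)
  refine (mul_le_mul e1 e5 (by positivity) (by positivity)).trans (le_of_eq ?_)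
  have e6 : Real.exp ((15 + B + 2 / η) * k + (1 / 2 + η) *
      (Real.log D + Real.log N₀ + k * Real.log (T + 3)) + δ * Real.log N₀) =
      Real.exp (2 * k) * Real.exp (k * (13 + (1 / 2 + η) * Real.log (T + 3))) *
        Real.exp ((1 / 2 + η) * (Real.log D + Real.log N₀)) *
        Real.exp (B * k + δ * Real.log N₀ + 2 / η * k) := by
    rw [← Real.exp_add, ← Real.exp_add, ← Real.exp_add]
    congr 1
    ring
  rw [e6]
  ring

/-- The convexity bound. -/
theorem exists_convexity {η δ : ℝ} (hη : 0 < η) (hη4 : η ≤ 1 / 4) (hδ : 0 < δ) :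
    ∃ C : ℝ, 0 < C ∧ ∀ (K : Type) [Field K] [NumberField K] (q : Ideal (𝓞 K)) (χ : HeckeChar K q)
      (L : ℂ → ℂ), IsLFun χ L → q ≠ ⊥ → ∃ F : ℂ → ℂ,
      (∀ s : ℂ, -1 < s.re → DifferentiableAt ℂ F s) ∧
      (∀ s : ℂ, s ≠ 1 → F s = L s * poleFactor (IsTrivialChar χ) s) ∧
      (∀ s : ℂ, 1 < s.re → Real.exp (-(4 * nK K / (s.re - 1))) ≤ ‖F s‖ ∧
        ‖F s‖ ≤ Real.exp (2 * nK K / (s.re - 1))) ∧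
      ∀ T : ℝ, 1 ≤ T → ∀ s : ℂ, -η ≤ s.re → s.re ≤ 1 + η → |s.im| ≤ T + 1 →
        ‖F s‖ ≤ Real.exp (((1 + η - s.re) / 2 + δ) * logCond K q T + C * nK K) := by
  obtain ⟨B, hB0, hB⟩ := exists_divisor_bound hδ
  refine ⟨20 + B + 4 / η, by positivity, fun K _ _ q χ L hL hq => ?_⟩
  obtain ⟨F, hFd, hFL, ⟨M, hM0, hM⟩, hF⟩ := exists_regular χ hL hq
  have hn1 : (1 : ℝ) ≤ nK K := nK_ge_one
  have hD : (0 : ℝ) < DK K := by exact_mod_cast DK_pos K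
  have hN : (0 : ℝ) < Ideal.absNorm q := absNorm_pos hq
  have hseries : ∀ s : ℂ, 1 < s.re → Real.exp (-(4 * nK K / (s.re - 1))) ≤ ‖F s‖ ∧
        ‖F s‖ ≤ Real.exp (2 * nK K / (s.re - 1)) := by
    intro s hs
    have hs0 : 0 < s.re - 1 := by linarith
    rw [hFL s (by rintro rfl; simp at hs), hL.2 s hs, norm_mul]
    constructor
    · have h1 := le_norm_LSer χ hs
      have h2 := le_norm_poleFactor (IsTrivialChar χ) hs
      refine le_trans ?_ (mul_le_mul h1 h2 (Real.exp_nonneg _) (norm_nonneg _))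
      rw [← Real.exp_add, Real.exp_le_exp, ← neg_add, neg_le_neg_iff, ← add_div]
      exact div_le_div_of_nonneg_right (by linarith) hs0.le
    · exact (mul_le_of_le_one_right (norm_nonneg _) (norm_poleFactor_le_one _ (by linarith))).trans
        (norm_LSer_le χ hs)
  refine ⟨F, hFd, hFL, hseries, fun T hT s hs1 hs2 hs3 => ?_⟩
  set n : ℝ := (nK K : ℝ) with hn
  set ℒ := logCond K q T with hℒ
  set N := Real.log (Ideal.absNorm q : ℝ) with hNdef
  have hℒe : ℒ = Real.log (DK K : ℝ) + N + n * Real.log (T + 3) := logCond_eq hq T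
  have hNℒ : N ≤ ℒ := log_absNorm_le_logCond hq hT
  have hN0 : 0 ≤ N := log_absNorm_nonneg q
  have hT3 : 0 < T + 3 := by linarith
  set t₀ := s.im with ht₀
  have ha0 : 0 < 1 / 2 + η := by linarith
  have hm0 : 0 ≤ n * (1 / 2 + η) := by positivity
  set α := (15 + B + 2 / η) * n + (1 / 2 + η) * ℒ + δ * N with hα
  set β := 2 / η * n with hβ
  have key := strip_convexity (f := F) (a := -η) (b := 1 + η) (m := n * (1 / 2 + η))
    (α := α) (β := β) (t₀ := t₀) (M := M) (s := s) (by linarith) (by linarith) (by nlinarith)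
    (by nlinarith) hm0 ?_ (fun z h1 h2 h3 => hM z (by linarith) (by linarith) h3) ?_ ?_ hs1 hs2 rfl
  · refine key.trans (Real.exp_le_exp.2 ?_)
    have hw : 0 < 1 + η - -η := by linarith
    have h1 : ((1 + η - s.re) * α + (s.re - -η) * β) / (1 + η - -η) =
        (1 + η - s.re) / 2 * ℒ + (1 + η - s.re) / (1 + η - -η) * ((15 + B + 2 / η) * n + δ * N) +
          (s.re - -η) / (1 + η - -η) * β := by
      rw [hα]
      field_simp
      ring
    have h2 : (1 + η - s.re) / (1 + η - -η) ≤ 1 := by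
      rw [div_le_one hw]
      linarith
    have h3 : (s.re - -η) / (1 + η - -η) ≤ 1 := by
      rw [div_le_one hw]
      linarith
    have h4 : 0 ≤ (15 + B + 2 / η) * n + δ * N := by positivity
    have h5 : 0 ≤ β := by positivity
    have h6 := mul_le_mul_of_nonneg_right h2 h4
    have h7 := mul_le_mul_of_nonneg_right h3 h5
    have h8 := mul_le_mul_of_nonneg_left hNℒ hδ.le
    have h9 : (20 + B + 4 / η) * n = 5 * n + (15 + B + 2 / η) * n + β := by
      rw [hβ]
      ring
    have h10 : 5 * (n * (1 / 2 + η)) ≤ 5 * n := by nlinarith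
    rw [h1, h9]
    linarith
  · refine DifferentiableOn.diffContOnCl fun z hz => ?_
    rw [closure_preimage_re, closure_Ioo (by linarith)] at hz
    exact (hFd z (lt_of_lt_of_le (by linarith) hz.1)).differentiableWithinAt
  · intro z hz
    refine (hF z (by rw [hz]; linarith) (by rw [hz]; linarith)).trans ?_
    rw [hz, sub_neg_eq_add, neg_neg]
    have h1 : |z.im| ≤ |t₀| + |z.im - t₀| := by
      have := abs_add_le t₀ (z.im - t₀)
      rwa [add_sub_cancel] at this
    rw [hα, hℒe]
    exact left_edge_bound hn1 hη hD hN hT (abs_nonneg _) (abs_nonneg _)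
      (by nlinarith [abs_nonneg (z.im - t₀)])
      (Finset.sum_nonneg fun _ _ => by positivity) (hB K q hq)
  · intro z hz
    refine (hseries z (by rw [hz]; linarith)).2.trans ?_
    rw [hz, add_sub_cancel_left, hβ, show 2 * n / η = 2 / η * n by ring]
    exact le_mul_of_one_le_right (Real.exp_nonneg _)
      (Real.one_le_rpow (by linarith [abs_nonneg (z.im - t₀)]) hm0)

section JensenDerivative

open Metric

/-- A nonvanishing holomorphic function on a disc has a holomorphic logarithm. -/
lemma exists_log_on_ball {h : ℂ → ℂ} {c : ℂ} {r : ℝ} (hr : 0 < r)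
    (hd : DifferentiableOn ℂ h (ball c r)) (h0 : ∀ z ∈ ball c r, h z ≠ 0) :
    ∃ l : ℂ → ℂ, (∀ z ∈ ball c r, HasDerivAt l (logDeriv h z) z) ∧
      ∀ z ∈ ball c r, h z = exp (l z) := by
  have hc : c ∈ ball c r := mem_ball_self hr
  have hq : DifferentiableOn ℂ (logDeriv h) (ball c r) := by
    have : logDeriv h = fun z => deriv h z / h z := rfl
    rw [this]
    exact (hd.deriv isOpen_ball).div hd h0
  obtain ⟨l, hlc, hl⟩ := hq.isExactOn_ball.with_val_at c (log (h c))
  refine ⟨l, hl, fun z hz => ?_⟩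
  have hder : ∀ z ∈ ball c r, HasDerivAt (fun z => h z * exp (-l z)) 0 z := by
    intro z hz
    have h1 : HasDerivAt h (deriv h z) z :=
      ((hd z hz).differentiableAt (isOpen_ball.mem_nhds hz)).hasDerivAt
    have h2 := h1.mul (hl z hz).neg.cexp
    have h3 : deriv h z * exp ((-l) z) + h z * (exp ((-l) z) * -logDeriv h z) = 0 := by
      rw [logDeriv_apply]
      field_simp [h0 z hz]
      ring
    rw [h3] at h2
    exact h2
  have hconst := isOpen_ball.is_const_of_deriv_eq_zero (convex_ball c r).isPreconnected
    (fun z hz => (hder z hz).differentiableAt.differentiableWithinAt)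
    (fun z hz => (hder z hz).deriv) hz hc
  simp only [hlc, exp_neg, exp_log (h0 c hc)] at hconst
  rw [mul_inv_cancel₀ (h0 c hc)] at hconst
  exact (mul_inv_eq_one₀ (exp_ne_zero _)).mp hconst

lemma deriv_re_eq_integral {l : ℂ → ℂ} {c : ℂ} {R r : ℝ} (hR : 0 < R) (hRr : R < r)
    (hd : DifferentiableOn ℂ l (ball c r)) :
    (deriv l c).re =
      (Real.pi * R)⁻¹ * ∫ θ in (0 : ℝ)..2 * Real.pi, Real.cos θ * (l (circleMap c R θ)).re := by
  have hsub : closedBall c R ⊆ ball c r := closedBall_subset_ball hRr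
  have h1 := two_pi_I_inv_smul_circleIntegral_sub_sq_inv_smul_of_differentiable isOpen_ball hsub hd
    (mem_ball_self hR)
  have h2 : (∮ z in C(c, R), l z) = 0 :=
    circleIntegral_eq_zero_of_differentiable_on_off_countable hR.le Set.countable_empty
      (hd.continuousOn.mono hsub) (fun z hz => (hd z (hsub (ball_subset_closedBall hz.1))).differentiableAt
        (isOpen_ball.mem_nhds (hsub (ball_subset_closedBall hz.1))))
  have hcont : Continuous fun θ : ℝ => l (circleMap c R θ) := by
    refine (hd.continuousOn.mono hsub).comp_continuous (continuous_circleMap c R) fun θ => ?_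
    exact circleMap_mem_closedBall c hR.le θ
  have hRc : (R : ℂ) ≠ 0 := by exact_mod_cast hR.ne'
  have hpi : (Real.pi : ℂ) ≠ 0 := by exact_mod_cast Real.pi_ne_zero
  have i1 : (∮ z in C(c, R), ((z - c) ^ 2)⁻¹ • l z) =
      ∫ θ in (0 : ℝ)..2 * Real.pi, I * (R : ℂ)⁻¹ * (exp (-(θ * I)) * l (circleMap c R θ)) := by
    rw [circleIntegral]
    refine intervalIntegral.integral_congr fun θ _ => ?_
    simp only [deriv_circleMap, circleMap, smul_eq_mul, zero_add, add_sub_cancel_left, exp_neg]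
    field_simp [exp_ne_zero]
  have i2 : (∮ z in C(c, R), l z) =
      ∫ θ in (0 : ℝ)..2 * Real.pi, I * R * (exp (θ * I) * l (circleMap c R θ)) := by
    rw [circleIntegral]
    refine intervalIntegral.integral_congr fun θ _ => ?_
    simp only [deriv_circleMap, circleMap, smul_eq_mul, zero_add]
    ring
  rw [i1, intervalIntegral.integral_const_mul] at h1
  rw [i2, intervalIntegral.integral_const_mul] at h2
  have h3 : ∫ θ in (0 : ℝ)..2 * Real.pi, exp (θ * I) * l (circleMap c R θ) = 0 := by
    rcases mul_eq_zero.mp h2 with h | h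
    · exact absurd h (mul_ne_zero I_ne_zero hRc)
    · exact h
  have h4 : ∫ θ in (0 : ℝ)..2 * Real.pi, exp (-(θ * I)) * l (circleMap c R θ) =
      ∫ θ in (0 : ℝ)..2 * Real.pi, 2 * (((Real.cos θ : ℝ) : ℂ) * l (circleMap c R θ)) := by
    have : ∀ θ : ℝ, 2 * (((Real.cos θ : ℝ) : ℂ) * l (circleMap c R θ)) =
        exp (θ * I) * l (circleMap c R θ) + exp (-(θ * I)) * l (circleMap c R θ) := by
      intro θ
      rw [ofReal_cos, cos]
      ring_nf
    simp_rw [this]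
    rw [intervalIntegral.integral_add, h3, zero_add]
    · exact (Continuous.mul (by fun_prop) hcont).intervalIntegrable _ _
    · exact (Continuous.mul (by fun_prop) hcont).intervalIntegrable _ _
  rw [h4, intervalIntegral.integral_const_mul] at h1
  have h5 : deriv l c = ((Real.pi * R : ℝ) : ℂ)⁻¹ *
      ∫ θ in (0 : ℝ)..2 * Real.pi, ((Real.cos θ : ℝ) : ℂ) * l (circleMap c R θ) := by
    rw [← h1, smul_eq_mul]
    push_cast
    field_simp
  rw [h5, ← ofReal_inv, re_ofReal_mul]
  congr 1
  have h6 := reCLM.intervalIntegral_comp_comm (μ := MeasureTheory.volume)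
    (f := fun θ : ℝ => ((Real.cos θ : ℝ) : ℂ) * l (circleMap c R θ)) (a := 0) (b := 2 * Real.pi)
    ((Continuous.mul (by fun_prop) hcont).intervalIntegrable _ _)
  simp only [reCLM_apply, re_ofReal_mul] at h6
  exact h6.symm

/-- The Jensen-type formula for the logarithmic derivative of a nonvanishing function. -/
lemma logDeriv_re_eq_integral {h : ℂ → ℂ} {c : ℂ} {R r : ℝ} (hR : 0 < R) (hRr : R < r)
    (hd : DifferentiableOn ℂ h (ball c r)) (h0 : ∀ z ∈ ball c r, h z ≠ 0) :
    (logDeriv h c).re = (Real.pi * R)⁻¹ *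
      ∫ θ in (0 : ℝ)..2 * Real.pi, Real.cos θ * Real.log ‖h (circleMap c R θ)‖ := by
  obtain ⟨l, hl, hle⟩ := exists_log_on_ball (hR.trans hRr) hd h0
  have hdl : DifferentiableOn ℂ l (ball c r) :=
    fun z hz => (hl z hz).differentiableAt.differentiableWithinAt
  rw [← (hl c (mem_ball_self (hR.trans hRr))).deriv, deriv_re_eq_integral hR hRr hdl]
  congr 1
  refine intervalIntegral.integral_congr fun θ _ => ?_
  have hθ : circleMap c R θ ∈ ball c r :=
    closedBall_subset_ball hRr (circleMap_mem_closedBall c hR.le θ)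
  simp only [hle _ hθ, norm_exp, Real.log_exp]

end JensenDerivative

section JensenDerivative

open Metric ComplexConjugate

lemma exists_extract_zero {g : ℂ → ℂ} {U : Set ℂ} (hU : IsOpen U) (hg : DifferentiableOn ℂ g U)
    {ρ : ℂ} (hρ : ρ ∈ U) (h0 : ¬ ∀ᶠ z in 𝓝 ρ, g z = 0) :
    ∃ (n : ℕ) (k : ℂ → ℂ), DifferentiableOn ℂ k U ∧ k ρ ≠ 0 ∧ ∀ z, g z = (z - ρ) ^ n * k z := by
  obtain ⟨n, g0, hg0, hg0ρ, he⟩ :=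
    (hg.analyticAt (hU.mem_nhds hρ)).exists_eventuallyEq_pow_smul_nonzero_iff.mpr h0
  simp only [smul_eq_mul] at he
  let k : ℂ → ℂ := Function.update (fun z => g z / (z - ρ) ^ n) ρ (g0 ρ)
  have hkρ : k ρ = g0 ρ := Function.update_self ..
  have hk : ∀ z, z ≠ ρ → k z = g z / (z - ρ) ^ n := fun z hz => Function.update_of_ne hz ..
  have hpow : ∀ z, z ≠ ρ → (z - ρ) ^ n ≠ 0 := fun z hz => pow_ne_zero _ (sub_ne_zero.mpr hz)
  refine ⟨n, k, fun z hz => ?_, by rwa [hkρ], fun z => ?_⟩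
  · refine DifferentiableAt.differentiableWithinAt ?_
    by_cases hzρ : z = ρ
    · subst hzρ
      refine hg0.differentiableAt.congr_of_eventuallyEq ?_
      filter_upwards [he] with w hw
      by_cases hwz : w = z
      · rw [hwz, hkρ]
      · rw [hk w hwz, hw, mul_div_cancel_left₀ _ (hpow w hwz)]
    · have h1 : DifferentiableAt ℂ (fun w => g w / (w - ρ) ^ n) z :=
        ((hg z hz).differentiableAt (hU.mem_nhds hz)).div (by fun_prop) (hpow z hzρ)
      refine h1.congr_of_eventuallyEq ?_
      filter_upwards [isOpen_ne.mem_nhds hzρ] with w hw using hk w hw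
  · by_cases hzρ : z = ρ
    · subst hzρ
      rw [hkρ]
      exact he.self_of_nhds
    · rw [hk z hzρ, mul_div_cancel₀ _ (hpow z hzρ)]

lemma exists_extract_zeros {F : ℂ → ℂ} {U : Set ℂ} (hU : IsOpen U) (hF : DifferentiableOn ℂ F U)
    (h0 : ∀ z ∈ U, ¬ ∀ᶠ w in 𝓝 z, F w = 0) (Z : Finset ℂ) (hZ : ∀ ρ ∈ Z, ρ ∈ U) :
    ∃ (n : ℂ → ℕ) (g : ℂ → ℂ), DifferentiableOn ℂ g U ∧ (∀ ρ ∈ Z, g ρ ≠ 0) ∧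
      ∀ z, F z = (∏ ρ ∈ Z, (z - ρ) ^ n ρ) * g z := by
  classical
  induction Z using Finset.induction_on with
  | empty => exact ⟨fun _ => 0, F, hF, by simp, by simp⟩
  | insert ρ Z hρZ ih =>
    obtain ⟨n, g, hg, hgZ, hFg⟩ := ih fun ρ hρ => hZ ρ (Finset.mem_insert_of_mem hρ)
    have hρ : ρ ∈ U := hZ ρ (Finset.mem_insert_self ρ Z)
    have hg0 : ¬ ∀ᶠ z in 𝓝 ρ, g z = 0 := by
      refine fun h => h0 ρ hρ ?_
      filter_upwards [h] with z hz
      rw [hFg, hz, mul_zero]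
    obtain ⟨k, f, hf, hfρ, hgf⟩ := exists_extract_zero hU hg hρ hg0
    refine ⟨Function.update n ρ k, f, hf, ?_, fun z => ?_⟩
    · intro w hw
      rcases Finset.mem_insert.mp hw with rfl | hw
      · exact hfρ
      · have := hgZ w hw
        rw [hgf] at this
        exact right_ne_zero_of_mul this
    · rw [Finset.prod_insert hρZ, Function.update_self, hFg, hgf]
      have : ∏ w ∈ Z, (z - w) ^ Function.update n ρ k w = ∏ w ∈ Z, (z - w) ^ n w := by
        refine Finset.prod_congr rfl fun w hw => ?_
        rw [Function.update_of_ne (ne_of_mem_of_not_mem hw hρZ)]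
      rw [this]
      ring

lemma finite_zeros {F : ℂ → ℂ} {U A : Set ℂ} (hU : IsOpen U) (hF : DifferentiableOn ℂ F U)
    (h0 : ∀ z ∈ U, ¬ ∀ᶠ w in 𝓝 z, F w = 0) (hA : IsCompact A) (hAU : A ⊆ U) :
    {z ∈ A | F z = 0}.Finite := by
  obtain ⟨t, -, ht⟩ := hA.elim_nhds_subcover (fun z => {w | F w = 0 → w = z}) (by
    intro z hz
    have hz' : z ∈ U := hAU hz
    have h := (hF.analyticAt (hU.mem_nhds hz')).eventually_eq_zero_or_eventually_ne_zero.resolve_left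
      (h0 z hz')
    have h2 := eventually_nhdsWithin_iff.mp h
    filter_upwards [h2] with w hw hFw
    by_contra hne
    exact hw hne hFw)
  refine t.finite_toSet.subset fun z hz => ?_
  obtain ⟨w, hw, hzw⟩ := Set.mem_iUnion₂.mp (ht hz.1)
  rw [hzw hz.2]
  exact hw

lemma not_eventually_zero_on_ball {F : ℂ → ℂ} {c : ℂ} {r : ℝ}
    (hF : DifferentiableOn ℂ F (ball c r)) (hc : F c ≠ 0) :
    ∀ z ∈ ball c r, ¬ ∀ᶠ w in 𝓝 z, F w = 0 := by
  intro z hz h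
  have hr : 0 < r := dist_nonneg.trans_lt hz
  have := (hF.analyticOnNhd isOpen_ball).eqOn_zero_of_preconnected_of_eventuallyEq_zero
    (convex_ball c r).isPreconnected hz h
  exact hc (this (mem_ball_self hr))

/-- Some circle of radius in a given interval avoids the zeros of `F`. -/
lemma exists_radius {F : ℂ → ℂ} {c : ℂ} {a b r : ℝ} (hab : a < b) (hbr : b < r)
    (hF : DifferentiableOn ℂ F (ball c r)) (hc : F c ≠ 0) :
    ∃ R, a < R ∧ R < b ∧ ∀ z ∈ sphere c R, F z ≠ 0 := by
  have hfin := finite_zeros isOpen_ball hF (not_eventually_zero_on_ball hF hc)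
    (isCompact_closedBall c b) (closedBall_subset_ball hbr)
  obtain ⟨R, hR, hRn⟩ := ((Set.Ioo_infinite hab).sdiff (hfin.image fun z => dist z c)).nonempty
  refine ⟨R, hR.1, hR.2, fun z hz h => hRn ⟨z, ⟨?_, h⟩, hz⟩⟩
  rw [mem_closedBall, mem_sphere.mp hz]
  exact hR.2.le

lemma multiplicity_le {F G : ℂ → ℂ} {ρ : ℂ} {m n : ℕ} (hm : ZeroOrderAtLeast F ρ m)
    (hG : ContinuousAt G ρ) (hG0 : G ρ ≠ 0) (hF : ∀ z, F z = (z - ρ) ^ n * G z) : m ≤ n := by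
  by_contra! hlt
  obtain ⟨g, hg, he⟩ := hm
  obtain ⟨d, rfl⟩ := Nat.exists_eq_add_of_lt hlt
  have h1 : ∀ᶠ z in 𝓝[≠] ρ, G z = (z - ρ) ^ (d + 1) * g z := by
    filter_upwards [he.filter_mono nhdsWithin_le_nhds, self_mem_nhdsWithin] with z hz hne
    have hp : (z - ρ) ^ n ≠ 0 := pow_ne_zero _ (sub_ne_zero.mpr hne)
    rw [hF, show n + d + 1 = n + (d + 1) by ring, pow_add, mul_assoc] at hz
    exact mul_left_cancel₀ hp hz
  have h2 : Tendsto G (𝓝[≠] ρ) (𝓝 0) := by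
    have h3 : ContinuousAt (fun z => (z - ρ) ^ (d + 1) * g z) ρ :=
      ContinuousAt.mul (by fun_prop) hg.continuousAt
    have h4 := h3.tendsto.mono_left (nhdsWithin_le_nhds (s := {ρ}ᶜ))
    simp only [sub_self, ne_eq, Nat.succ_ne_zero, not_false_eq_true, zero_pow, zero_mul] at h4
    exact (tendsto_congr' h1).mpr h4
  exact hG0 (tendsto_nhds_unique (hG.tendsto.mono_left nhdsWithin_le_nhds) h2)

/-- The value `R ≠ 0` on the circle of the reflected factor of a zero `ρ`. -/
lemma norm_reflected {c ρ z : ℂ} {R : ℝ} (hR : 0 < R) (hz : ‖z - c‖ = R) :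
    ‖((R : ℂ) ^ 2 - conj (ρ - c) * (z - c)) / R‖ = ‖z - ρ‖ := by
  have h1 : (R : ℂ) ^ 2 = conj (z - c) * (z - c) := by
    rw [conj_mul', hz]
  rw [h1, ← sub_mul, ← map_sub, norm_div, norm_mul, hz, norm_conj, norm_real, Real.norm_of_nonneg hR.le,
    mul_div_cancel_right₀ _ hR.ne']
  congr 1
  ring

lemma reflected_ne_zero {c ρ z : ℂ} {R : ℝ} (hR : 0 < R) (hz : ‖z - c‖ ≤ R) (hρ : ‖ρ - c‖ < R) :
    ((R : ℂ) ^ 2 - conj (ρ - c) * (z - c)) / R ≠ 0 := by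
  refine div_ne_zero (fun h => ?_) (by exact_mod_cast hR.ne')
  have h1 : ‖(R : ℂ) ^ 2‖ = ‖conj (ρ - c) * (z - c)‖ := by rw [sub_eq_zero.mp h]
  rw [norm_mul, norm_conj, norm_pow, norm_real, Real.norm_of_nonneg hR.le] at h1
  nlinarith [norm_nonneg (z - c), norm_nonneg (ρ - c)]

/-- A Jensen-type bound for the logarithmic derivative at the centre of a disc, in terms of
the zeros in the disc and of the values on the boundary. -/
theorem neg_logDeriv_add_sum_le {F : ℂ → ℂ} {c : ℂ} {R r : ℝ} (hR : 0 < R) (hRr : R < r)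
    (hF : DifferentiableOn ℂ F (ball c r)) (hFc : F c ≠ 0) (hsph : ∀ z ∈ sphere c R, F z ≠ 0)
    (hre : ∀ z ∈ ball c R, F z = 0 → z.re ≤ c.re) (S : Finset ℂ) (m : ℂ → ℕ)
    (hS : ∀ ρ ∈ S, ρ ∈ ball c R ∧ F ρ = 0 ∧ ZeroOrderAtLeast F ρ (m ρ)) :
    -(logDeriv F c).re + ∑ ρ ∈ S, (m ρ : ℝ) * ((1 / (c - ρ)).re - (c - ρ).re / R ^ 2) ≤
      -((Real.pi * R)⁻¹ *
        ∫ θ in (0 : ℝ)..2 * Real.pi, Real.cos θ * Real.log ‖F (circleMap c R θ)‖) := by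
  classical
  have hsub : closedBall c R ⊆ ball c r := closedBall_subset_ball hRr
  have hnz := not_eventually_zero_on_ball hF hFc
  have hfin := finite_zeros isOpen_ball hF hnz (isCompact_closedBall c R) hsub
  let Z : Finset ℂ := hfin.toFinset
  have hZ : ∀ ρ, ρ ∈ Z ↔ ρ ∈ closedBall c R ∧ F ρ = 0 := fun ρ => hfin.mem_toFinset
  obtain ⟨n, g, hg, hgZ, hFg⟩ := exists_extract_zeros isOpen_ball hF hnz Z
    fun ρ hρ => hsub ((hZ ρ).mp hρ).1
  have hg0 : ∀ z ∈ closedBall c R, g z ≠ 0 := by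
    intro z hz
    by_cases hFz : F z = 0
    · exact hgZ z ((hZ z).mpr ⟨hz, hFz⟩)
    · rw [hFg] at hFz
      exact right_ne_zero_of_mul hFz
  have hZball : ∀ ρ ∈ Z, ρ ∈ ball c R := by
    intro ρ hρ
    obtain ⟨h1, h2⟩ := (hZ ρ).mp hρ
    refine lt_of_le_of_ne h1 fun h => hsph ρ h h2
  have hZc : ∀ ρ ∈ Z, ρ ≠ c := fun ρ hρ h => hFc (h ▸ ((hZ ρ).mp hρ).2)
  let B : ℂ → ℂ → ℂ := fun ρ z => ((R : ℂ) ^ 2 - conj (ρ - c) * (z - c)) / R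
  let h : ℂ → ℂ := fun z => (∏ ρ ∈ Z, B ρ z ^ n ρ) * g z
  have hBd : ∀ ρ, Differentiable ℂ (B ρ) := fun ρ => by fun_prop
  have hPd : Differentiable ℂ fun z => ∏ ρ ∈ Z, B ρ z ^ n ρ := by fun_prop
  have hhd : DifferentiableOn ℂ h (ball c r) := hPd.differentiableOn.mul hg
  have hB0 : ∀ ρ ∈ Z, ∀ z ∈ closedBall c R, B ρ z ≠ 0 := fun ρ hρ z hz =>
    reflected_ne_zero hR (mem_closedBall_iff_norm.mp hz) (mem_ball_iff_norm.mp (hZball ρ hρ))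
  have hh0 : ∀ z ∈ closedBall c R, h z ≠ 0 := fun z hz =>
    mul_ne_zero (Finset.prod_ne_zero_iff.mpr fun ρ hρ => pow_ne_zero _ (hB0 ρ hρ z hz)) (hg0 z hz)
  obtain ⟨δ, hδ, hδs⟩ := (isCompact_closedBall c R).exists_thickening_subset_open
    (hhd.continuousOn.isOpen_inter_preimage isOpen_ball isOpen_ne)
    (fun z hz => ⟨hsub hz, hh0 z hz⟩)
  rw [thickening_closedBall hδ hR.le] at hδs
  have hformula := logDeriv_re_eq_integral hR (show R < δ + R by linarith)
    (hhd.mono fun z hz => (hδs hz).1) (fun z hz => (hδs hz).2)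
  have hcB : c ∈ closedBall c R := mem_closedBall_self hR.le
  have hgd : DifferentiableAt ℂ g c := (hg c (hsub hcB)).differentiableAt
    (isOpen_ball.mem_nhds (hsub hcB))
  have hlh : logDeriv h c = ∑ ρ ∈ Z, (n ρ : ℂ) * (-conj (ρ - c) / R ^ 2) + logDeriv g c := by
    rw [logDeriv_mul c (Finset.prod_ne_zero_iff.mpr fun ρ hρ => pow_ne_zero _ (hB0 ρ hρ c hcB))
      (hg0 c hcB) hPd.differentiableAt hgd,
      logDeriv_prod (f := fun ρ z => B ρ z ^ n ρ)
        (fun ρ hρ => pow_ne_zero _ (hB0 ρ hρ c hcB)) (fun ρ _ => by fun_prop)]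
    congr 1
    refine Finset.sum_congr rfl fun ρ _ => ?_
    rw [logDeriv_fun_pow (hBd ρ).differentiableAt]
    congr 1
    have hd : HasDerivAt (B ρ) (-conj (ρ - c) / R) c := by
      have h1 := (((hasDerivAt_id c).sub_const c).const_mul (conj (ρ - c))).const_sub ((R : ℂ) ^ 2)
      simpa [B] using h1.div_const (R : ℂ)
    rw [logDeriv_apply, hd.deriv]
    simp only [B, sub_self, mul_zero, sub_zero]
    field_simp
  have hlF : logDeriv F c = ∑ ρ ∈ Z, (n ρ : ℂ) * (1 / (c - ρ)) + logDeriv g c := by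
    rw [funext hFg, logDeriv_mul c (Finset.prod_ne_zero_iff.mpr fun ρ hρ =>
      pow_ne_zero _ (sub_ne_zero.mpr (hZc ρ hρ).symm)) (hg0 c hcB) (by fun_prop) hgd,
      logDeriv_prod (f := fun ρ z => (z - ρ) ^ n ρ)
        (fun ρ hρ => pow_ne_zero _ (sub_ne_zero.mpr (hZc ρ hρ).symm))
        (fun ρ _ => by fun_prop)]
    congr 1
    refine Finset.sum_congr rfl fun ρ _ => ?_
    rw [logDeriv_fun_pow (by fun_prop), logDeriv_apply]
    simp
  have hintg : ∫ θ in (0 : ℝ)..2 * Real.pi, Real.cos θ * Real.log ‖h (circleMap c R θ)‖ =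
      ∫ θ in (0 : ℝ)..2 * Real.pi, Real.cos θ * Real.log ‖F (circleMap c R θ)‖ := by
    refine intervalIntegral.integral_congr fun θ _ => ?_
    have hz : ‖circleMap c R θ - c‖ = R := by
      simp [abs_of_pos hR]
    simp only [hFg, h, B, norm_mul, norm_prod, norm_pow, norm_reflected hR hz]
  have hterm : ∀ ρ ∈ Z, 0 ≤ (1 / (c - ρ)).re - (c - ρ).re / R ^ 2 := by
    intro ρ hρ
    have h1 : 0 ≤ (c - ρ).re := by
      rw [sub_re, sub_nonneg]
      exact hre ρ (hZball ρ hρ) ((hZ ρ).mp hρ).2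
    have h2 : normSq (c - ρ) ≤ R ^ 2 := by
      rw [normSq_eq_norm_sq, norm_sub_rev]
      exact pow_le_pow_left₀ (norm_nonneg _) (mem_ball_iff_norm.mp (hZball ρ hρ)).le 2
    have h3 : 0 < normSq (c - ρ) := normSq_pos.mpr (sub_ne_zero.mpr (hZc ρ hρ).symm)
    rw [one_div, inv_re, sub_nonneg]
    gcongr
  have hmn : ∀ ρ ∈ S, m ρ ≤ n ρ := by
    intro ρ hρ
    obtain ⟨h1, h2, h3⟩ := hS ρ hρ
    have hρZ : ρ ∈ Z := (hZ ρ).mpr ⟨ball_subset_closedBall h1, h2⟩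
    refine multiplicity_le h3 (G := fun z => (∏ w ∈ Z.erase ρ, (z - w) ^ n w) * g z) ?_ ?_ ?_
    · have : ContinuousAt g ρ := (hg.continuousOn).continuousAt
        (isOpen_ball.mem_nhds (ball_subset_ball hRr.le h1))
      exact ContinuousAt.mul (by fun_prop) this
    · refine mul_ne_zero (Finset.prod_ne_zero_iff.mpr fun w hw => pow_ne_zero _ ?_) (hgZ ρ hρZ)
      exact sub_ne_zero.mpr (Finset.ne_of_mem_erase hw).symm
    · intro z
      rw [hFg, ← Finset.mul_prod_erase Z _ hρZ, mul_assoc]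
  have hsum : ∑ ρ ∈ S, (m ρ : ℝ) * ((1 / (c - ρ)).re - (c - ρ).re / R ^ 2) ≤
      ∑ ρ ∈ Z, (n ρ : ℝ) * ((1 / (c - ρ)).re - (c - ρ).re / R ^ 2) := by
    have hSZ : S ⊆ Z := fun ρ hρ =>
      (hZ ρ).mpr ⟨ball_subset_closedBall (hS ρ hρ).1, (hS ρ hρ).2.1⟩
    refine (Finset.sum_le_sum fun ρ hρ => ?_).trans
      (Finset.sum_le_sum_of_subset_of_nonneg hSZ fun ρ hρ _ => ?_)
    · exact mul_le_mul_of_nonneg_right (by exact_mod_cast hmn ρ hρ) (hterm ρ (hSZ hρ))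
    · exact mul_nonneg (Nat.cast_nonneg _) (hterm ρ hρ)
  have hkey : (logDeriv F c).re = (logDeriv h c).re +
      ∑ ρ ∈ Z, (n ρ : ℝ) * ((1 / (c - ρ)).re - (c - ρ).re / R ^ 2) := by
    rw [hlh, hlF, add_re, add_re, re_sum, re_sum, add_right_comm, ← Finset.sum_add_distrib]
    congr 1
    refine Finset.sum_congr rfl fun ρ _ => ?_
    rw [← ofReal_natCast, re_ofReal_mul, re_ofReal_mul, ← mul_add, ← ofReal_pow, div_ofReal_re]
    congr 1
    simp only [neg_re, conj_re, sub_re]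
    ring
  rw [hintg] at hformula
  rw [← hformula]
  linarith

end JensenDerivative

section BoundaryIntegral

lemma integral_comp_neg_cos {f : ℝ → ℝ} (hf : Continuous f) (hf0 : f 0 = 0) :
    ∫ θ in (0 : ℝ)..2 * Real.pi, f (max (-Real.cos θ) 0) =
      ∫ θ in (Real.pi / 2)..(3 * Real.pi / 2), f (-Real.cos θ) := by
  have hpi := Real.pi_pos
  have hc : Continuous fun θ : ℝ => f (max (-Real.cos θ) 0) := by fun_prop
  have hi : ∀ a b, IntervalIntegrable (fun θ : ℝ => f (max (-Real.cos θ) 0))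
      MeasureTheory.volume a b := fun a b => hc.intervalIntegrable a b
  rw [← intervalIntegral.integral_add_adjacent_intervals (hi 0 (3 * Real.pi / 2)) (hi _ _),
    ← intervalIntegral.integral_add_adjacent_intervals (hi 0 (Real.pi / 2)) (hi _ _)]
  have h1 : ∫ θ in (0 : ℝ)..Real.pi / 2, f (max (-Real.cos θ) 0) = 0 := by
    refine (intervalIntegral.integral_congr (g := fun _ => (0 : ℝ)) fun θ hθ => ?_).trans
      intervalIntegral.integral_zero
    rw [Set.uIcc_of_le (by linarith)] at hθ
    have := Real.cos_nonneg_of_mem_Icc (x := θ) ⟨by linarith [hθ.1], hθ.2⟩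
    simp only [max_eq_right (neg_nonpos.mpr this), hf0]
  have h3 : ∫ θ in (3 * Real.pi / 2)..2 * Real.pi, f (max (-Real.cos θ) 0) = 0 := by
    refine (intervalIntegral.integral_congr (g := fun _ => (0 : ℝ)) fun θ hθ => ?_).trans
      intervalIntegral.integral_zero
    rw [Set.uIcc_of_le (by linarith)] at hθ
    have := Real.cos_nonneg_of_mem_Icc (x := θ - 2 * Real.pi)
      ⟨by linarith [hθ.1], by linarith [hθ.2]⟩
    rw [Real.cos_sub_two_pi] at this
    simp only [max_eq_right (neg_nonpos.mpr this), hf0]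
  rw [h1, h3, zero_add, add_zero]
  refine intervalIntegral.integral_congr fun θ hθ => ?_
  rw [Set.uIcc_of_le (by linarith)] at hθ
  have := Real.cos_nonpos_of_pi_div_two_le_of_le hθ.1 (by linarith [hθ.2])
  simp only [max_eq_left (neg_nonneg.mpr this)]

lemma cos_three_pi_div_two : Real.cos (3 * Real.pi / 2) = 0 := by
  rw [show 3 * Real.pi / 2 = Real.pi / 2 + Real.pi by ring, Real.cos_add_pi, Real.cos_pi_div_two,
    neg_zero]

lemma sin_three_pi_div_two : Real.sin (3 * Real.pi / 2) = -1 := by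
  rw [show 3 * Real.pi / 2 = Real.pi / 2 + Real.pi by ring, Real.sin_add_pi, Real.sin_pi_div_two]

lemma integral_neg_cos : ∫ θ in (0 : ℝ)..2 * Real.pi, max (-Real.cos θ) 0 = 2 := by
  rw [integral_comp_neg_cos (f := fun x => x) continuous_id rfl]
  simp only [intervalIntegral.integral_neg, integral_cos, sin_three_pi_div_two,
    Real.sin_pi_div_two]
  norm_num

lemma integral_neg_cos_sq :
    ∫ θ in (0 : ℝ)..2 * Real.pi, max (-Real.cos θ) 0 ^ 2 = Real.pi / 2 := by
  rw [integral_comp_neg_cos (f := fun x => x ^ 2) (by fun_prop) (by norm_num)]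
  simp only [neg_sq, integral_cos_sq, cos_three_pi_div_two, Real.cos_pi_div_two]
  ring

/-- The boundary integral of `-cos θ` against a function of controlled growth. -/
lemma boundary_integral_le {g : ℝ → ℝ} {a b d : ℝ} (hg : Continuous g)
    (h : ∀ θ, -(Real.cos θ * g θ) ≤ a * max (-Real.cos θ) 0 ^ 2 + b * max (-Real.cos θ) 0 + d) :
    -(∫ θ in (0 : ℝ)..2 * Real.pi, Real.cos θ * g θ) ≤
      a * (Real.pi / 2) + b * 2 + d * (2 * Real.pi) := by
  have hi : ∀ {f : ℝ → ℝ}, Continuous f → IntervalIntegrable f MeasureTheory.volume 0 (2 * Real.pi) :=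
    fun hf => hf.intervalIntegrable _ _
  rw [← intervalIntegral.integral_neg]
  refine (intervalIntegral.integral_mono_on (by positivity) (hi (by fun_prop)) (hi (by fun_prop))
    fun θ _ => h θ).trans (le_of_eq ?_)
  rw [intervalIntegral.integral_add (hi (by fun_prop)) (hi (by fun_prop)),
    intervalIntegral.integral_add (hi (by fun_prop)) (hi (by fun_prop)),
    intervalIntegral.integral_const_mul, intervalIntegral.integral_const_mul, integral_neg_cos,
    integral_neg_cos_sq, intervalIntegral.integral_const, smul_eq_mul]
  ring

end BoundaryIntegral

section LogDerivBound

open Metric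

variable {K : Type} [Field K] [NumberField K]

/-- Pointwise bound on the boundary circle. -/
lemma boundary_pointwise {F : ℂ → ℂ} {η δ C l n T R : ℝ} {c : ℂ} (hη : 0 < η) (hδ : 0 ≤ δ)
    (hC : 0 ≤ C) (hl : 0 ≤ l) (hn : 0 ≤ n)
    (hlow : ∀ s : ℂ, 1 < s.re → Real.exp (-(4 * n / (s.re - 1))) ≤ ‖F s‖)
    (hup : ∀ s : ℂ, 1 < s.re → ‖F s‖ ≤ Real.exp (2 * n / (s.re - 1)))
    (hconv : ∀ s : ℂ, -η ≤ s.re → s.re ≤ 1 + η → |s.im| ≤ T + 1 →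
      ‖F s‖ ≤ Real.exp (((1 + η - s.re) / 2 + δ) * l + C * n))
    (hc : 1 < c.re) (hT : |c.im| ≤ T) (hR : 9 / 10 < R) (hR1 : R < 1)
    (h0 : ∀ z ∈ sphere c R, F z ≠ 0) (θ : ℝ) :
    -(Real.cos θ * Real.log ‖F (circleMap c R θ)‖) ≤
      (R / 2 * l) * max (-Real.cos θ) 0 ^ 2 + ((η / 2 + δ) * l) * max (-Real.cos θ) 0 +
        (5 + C + 2 / η) * n := by
  have hR0 : 0 < R := by linarith
  set z := circleMap c R θ with hz
  have hre : z.re = c.re + R * Real.cos θ := by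
    rw [hz, circleMap, add_re, re_ofReal_mul, exp_ofReal_mul_I_re]
  have him : z.im = c.im + R * Real.sin θ := by
    rw [hz, circleMap, add_im, im_ofReal_mul, exp_ofReal_mul_I_im]
  have hz0 : 0 < ‖F z‖ := norm_pos_iff.mpr (h0 z (circleMap_mem_sphere c hR0.le θ))
  have h2η : 0 ≤ 2 / η := by positivity
  have hcos1 := Real.neg_one_le_cos θ
  rcases le_or_gt 0 (Real.cos θ) with hcos | hcos
  · rw [max_eq_right (neg_nonpos.mpr hcos)]
    rcases hcos.eq_or_lt with hcos | hcos
    · rw [← hcos]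
      simp only [zero_mul, neg_zero]
      positivity
    · have h1 : R * Real.cos θ ≤ z.re - 1 := by linarith
      have hRc : 0 < R * Real.cos θ := by positivity
      have h2 := (Real.le_log_iff_exp_le hz0).mpr (hlow z (by linarith))
      have h3 : 4 * n / (z.re - 1) ≤ 4 * n / (R * Real.cos θ) := by gcongr
      have h4 : Real.cos θ * (4 * n / (R * Real.cos θ)) ≤ 5 * n := by
        rw [show Real.cos θ * (4 * n / (R * Real.cos θ)) = 4 * n / R by field_simp,
          div_le_iff₀ hR0]
        nlinarith
      have h5 : Real.cos θ * -Real.log ‖F z‖ ≤ Real.cos θ * (4 * n / (R * Real.cos θ)) :=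
        mul_le_mul_of_nonneg_left (by linarith) hcos.le
      have h6 : 0 ≤ (C + 2 / η) * n := by positivity
      nlinarith
  · rw [max_eq_left (neg_nonneg.mpr hcos.le)]
    set u := -Real.cos θ with hu
    have hu0 : 0 < u := neg_pos.mpr hcos
    have hu1 : u ≤ 1 := by linarith
    rw [show -(Real.cos θ * Real.log ‖F z‖) = u * Real.log ‖F z‖ by ring]
    rw [show Real.cos θ = -u by ring] at hre
    have hRu : R * u ≤ 1 := by nlinarith
    rcases le_or_gt z.re (1 + η) with hzr | hzr
    · have himT : |z.im| ≤ T + 1 := by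
        rw [him]
        refine (abs_add_le _ _).trans (add_le_add hT ?_)
        rw [abs_mul, abs_of_pos hR0]
        exact mul_le_one₀ hR1.le (abs_nonneg _) (Real.abs_sin_le_one θ)
      have h1 := (Real.log_le_iff_le_exp hz0).mpr (hconv z (by linarith) hzr himT)
      have h2 : ((1 + η - z.re) / 2 + δ) * l ≤ ((R * u + η) / 2 + δ) * l := by
        gcongr
        linarith
      have h3 : u * Real.log ‖F z‖ ≤ u * (((R * u + η) / 2 + δ) * l + C * n) :=
        mul_le_mul_of_nonneg_left (by linarith) hu0.le
      have h4 : u * (C * n) ≤ 1 * (C * n) := by gcongr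
      have h5 : 0 ≤ (5 + 2 / η) * n := by positivity
      nlinarith
    · have h1 := (Real.log_le_iff_le_exp hz0).mpr (hup z (by linarith))
      have h2 : 2 * n / (z.re - 1) ≤ 2 * n / η := by
        gcongr
        linarith
      have h3 : u * Real.log ‖F z‖ ≤ u * (2 * n / η) :=
        mul_le_mul_of_nonneg_left (by linarith) hu0.le
      have h4 : u * (2 * n / η) ≤ 1 * (2 * n / η) := by gcongr
      have h5 : 0 ≤ (5 + C) * n := by positivity
      have h6 : 0 ≤ R / 2 * l * u ^ 2 + (η / 2 + δ) * l * u := by positivity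
      have h7 : 2 * n / η = 2 / η * n := by ring
      nlinarith

end LogDerivBound

section LogDerivBound

open Metric

lemma logDeriv_re_le_of_bounds {F : ℂ → ℂ} {n e : ℝ} {c : ℂ} (he : 0 < e) (hn : 0 ≤ n)
    (hF : ∀ s : ℂ, 1 < s.re → DifferentiableAt ℂ F s)
    (hlow : ∀ s : ℂ, 1 < s.re → Real.exp (-(4 * n / (s.re - 1))) ≤ ‖F s‖)
    (hup : ∀ s : ℂ, 1 < s.re → ‖F s‖ ≤ Real.exp (2 * n / (s.re - 1)))
    (hc : c.re = 1 + e) : (logDeriv F c).re ≤ 64 / e ^ 2 * n := by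
  have hsub : ∀ z ∈ ball c (e / 2), e / 2 < z.re - 1 := by
    intro z hz
    have h1 := (abs_re_le_norm (z - c)).trans_lt (mem_ball_iff_norm.mp hz)
    rw [sub_re, hc] at h1
    linarith [(abs_lt.mp h1).1]
  have h0 : ∀ z ∈ ball c (e / 2), F z ≠ 0 := fun z hz => norm_pos_iff.mp
    ((Real.exp_pos _).trans_le (hlow z (by linarith [hsub z hz])))
  rw [logDeriv_re_eq_integral (R := e / 4) (r := e / 2) (by positivity) (by linarith)
    (fun z hz => (hF z (by linarith [hsub z hz])).differentiableWithinAt) h0]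
  have hpt : ∀ θ : ℝ, ‖Real.cos θ * Real.log ‖F (circleMap c (e / 4) θ)‖‖ ≤ 8 * n / e := by
    intro θ
    have hz : circleMap c (e / 4) θ ∈ ball c (e / 2) :=
      closedBall_subset_ball (by linarith) (circleMap_mem_closedBall c (by positivity) θ)
    set z := circleMap c (e / 4) θ
    have hre := hsub z hz
    have hz0 := norm_pos_iff.mpr (h0 z hz)
    have h1 := (Real.le_log_iff_exp_le hz0).mpr (hlow z (by linarith))
    have h2 := (Real.log_le_iff_le_exp hz0).mpr (hup z (by linarith))
    have h3 : 4 * n / (z.re - 1) ≤ 4 * n / (e / 2) := by gcongr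
    have h4 : 2 * n / (z.re - 1) ≤ 2 * n / (e / 2) := by gcongr
    have h5 : 4 * n / (e / 2) = 8 * n / e := by field_simp; ring
    have h6 : 2 * n / (e / 2) = 4 * n / e := by field_simp; ring
    have h7 : 4 * n / e ≤ 8 * n / e := by gcongr; norm_num
    rw [norm_mul, Real.norm_eq_abs, Real.norm_eq_abs]
    have h8 : |Real.log ‖F z‖| ≤ 8 * n / e := abs_le.mpr ⟨by linarith, by linarith⟩
    calc _ ≤ 1 * |Real.log ‖F z‖| := by
          gcongr
          exact Real.abs_cos_le_one θ
      _ ≤ _ := by rwa [one_mul]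
  have hintg := intervalIntegral.norm_integral_le_of_norm_le_const (a := 0) (b := 2 * Real.pi)
    fun θ _ => hpt θ
  have hpi := Real.pi_pos
  rw [sub_zero, abs_of_pos (by positivity : 0 < 2 * Real.pi)] at hintg
  calc _ ≤ (Real.pi * (e / 4))⁻¹ * (8 * n / e * (2 * Real.pi)) := by
        gcongr
        exact (le_abs_self _).trans hintg
    _ = _ := by field_simp; ring

/-- The regularised `L`-function, with bounds for its logarithmic derivative in terms of the
zeros close to the point of evaluation. -/
theorem exists_regular_logDeriv_bound {ε : ℝ} (hε : 0 < ε) (hε4 : ε < 1 / 4) :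
    ∃ C : ℝ, 0 < C ∧ ∀ (K : Type) [Field K] [NumberField K] (q : Ideal (𝓞 K)) (χ : HeckeChar K q)
      (L : ℂ → ℂ), IsLFun χ L → q ≠ ⊥ → ∃ F : ℂ → ℂ,
        (∀ s, s ≠ 1 → F s = L s * poleFactor (IsTrivialChar χ) s) ∧
        (∀ s : ℂ, 1 < s.re → F s ≠ 0) ∧
        (∀ s : ℂ, s.re = 1 + ε → (logDeriv F s).re ≤ C * nK K) ∧
        ∀ T : ℝ, 1 ≤ T → ∀ c : ℂ, 1 < c.re → |c.im| ≤ T → ∃ R : ℝ, 9 / 10 < R ∧ R < 1 ∧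
          ∀ (S : Finset ℂ) (m : ℂ → ℕ),
            (∀ ρ ∈ S, ρ ∈ ball c R ∧ F ρ = 0 ∧ ZeroOrderAtLeast F ρ (m ρ)) →
            -(logDeriv F c).re +
                ∑ ρ ∈ S, (m ρ : ℝ) * ((1 / (c - ρ)).re - (c - ρ).re / R ^ 2) ≤
              (1 / 4 + ε / Real.pi) * logCond K q T + C * nK K := by
  obtain ⟨C, hC, hconv⟩ := exists_convexity (η := ε / 4) (δ := ε / 8) (by positivity) (by linarith)
    (by positivity)
  refine ⟨64 / ε ^ 2 + 4 * (5 + C + 2 / (ε / 4)), by positivity, ?_⟩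
  intro K _ _ q χ L hL hq
  obtain ⟨F, hFd, hFL, hFb, hFc⟩ := hconv K q χ L hL hq
  have hF0 : ∀ s : ℂ, 1 < s.re → F s ≠ 0 := fun s hs =>
    norm_pos_iff.mp ((Real.exp_pos _).trans_le (hFb s hs).1)
  have hn : (0 : ℝ) ≤ nK K := Nat.cast_nonneg _
  refine ⟨F, hFL, hF0, fun s hs => ?_, fun T hT c hc hcT => ?_⟩
  · have h1 := logDeriv_re_le_of_bounds hε hn (fun s hs => hFd s (by linarith))
      (fun s hs => (hFb s hs).1) (fun s hs => (hFb s hs).2) hs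
    have h2 : 0 ≤ 4 * (5 + C + 2 / (ε / 4)) * (nK K : ℝ) := by positivity
    linarith
  · have hd : DifferentiableOn ℂ F (ball c 2) := by
      intro z hz
      refine (hFd z ?_).differentiableWithinAt
      have h1 := (abs_re_le_norm (z - c)).trans_lt (mem_ball_iff_norm.mp hz)
      rw [sub_re] at h1
      linarith [(abs_lt.mp h1).1]
    obtain ⟨R, hR, hR1, hsph⟩ := exists_radius (a := 9 / 10) (b := 1) (by norm_num) (by norm_num)
      hd (hF0 c hc)
    have hR0 : 0 < R := by linarith
    refine ⟨R, hR, hR1, fun S m hS => ?_⟩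
    refine (neg_logDeriv_add_sum_le hR0 (by linarith) hd (hF0 c hc) hsph ?_ S m hS).trans ?_
    · intro z _ hz
      by_contra! h
      exact hF0 z (hc.trans h) hz
    · have hl := logCond_nonneg (K := K) hq hT
      have hcont : Continuous fun θ : ℝ => Real.log ‖F (circleMap c R θ)‖ := by
        refine Continuous.log (Continuous.norm ?_) fun θ =>
          norm_ne_zero_iff.mpr (hsph _ (circleMap_mem_sphere c hR0.le θ))
        exact (hd.continuousOn.mono (closedBall_subset_ball (by linarith))).comp_continuous
          (continuous_circleMap c R) fun θ => circleMap_mem_closedBall c hR0.le θ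
      have h1 := boundary_integral_le hcont (boundary_pointwise (η := ε / 4) (δ := ε / 8)
        (by positivity) (by positivity) hC.le hl hn (fun s hs => (hFb s hs).1)
        (fun s hs => (hFb s hs).2) (hFc T hT) hc hcT hR hR1 hsph)
      set l := logCond K q T
      set n : ℝ := (nK K : ℝ)
      set D := 5 + C + 2 / (ε / 4) with hD
      have hD0 : 0 ≤ D := by positivity
      have hpi := Real.pi_pos
      rw [← mul_neg]
      calc _ ≤ (Real.pi * R)⁻¹ * (R / 2 * l * (Real.pi / 2) + (ε / 4 / 2 + ε / 8) * l * 2 +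
            D * n * (2 * Real.pi)) := by gcongr
        _ = l / 4 + (1 / (2 * R)) * (ε / Real.pi * l) + (2 / R) * (D * n) := by
            field_simp
            ring
        _ ≤ l / 4 + 1 * (ε / Real.pi * l) + 4 * (D * n) := by
            gcongr
            · rw [div_le_one (by positivity)]
              linarith
            · rw [div_le_iff₀ hR0]
              linarith
        _ ≤ _ := by
            have : 0 ≤ 64 / ε ^ 2 * n := by positivity
            linarith

end LogDerivBound

section FinalAssembly

open Metric

variable {K : Type*} [Field K] [NumberField K]

/-- The bottom ideal is never the modulus of a primitive character. -/
lemma IsPrimitiveChar.ne_bot {q : Ideal (𝓞 K)} {χ : HeckeChar K q} (h : IsPrimitiveChar χ) :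
    q ≠ ⊥ := by
  rintro rfl
  let ψ : HeckeChar K ⊤ :=
    { toFun := fun _ => 1
      map_mul' := by simp
      eq_zero' := by simp [← Ideal.one_eq_top, isCoprime_one_right]
      norm_one' := by simp
      ray_one' := by simp }
  have hψ : Induces ψ χ := by
    refine ⟨bot_le, fun a ha => ?_⟩
    have h1 : a = ⊤ := by
      rw [Ideal.isCoprime_iff_sup_eq, sup_bot_eq] at ha
      exact ha
    rw [h1, χ.map_top]
  have h1 : (⊤ : Ideal (𝓞 K)) ≤ ⊥ := h.2 ⊤ ⟨ψ, hψ⟩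
  exact top_ne_bot (le_bot_iff.mp h1)

lemma ZeroOrderAtLeast.mul_analytic {L F G : ℂ → ℂ} {ρ : ℂ} {m : ℕ} (h : ZeroOrderAtLeast L ρ m)
    (hG : AnalyticAt ℂ G ρ) (hF : ∀ᶠ z in 𝓝 ρ, F z = L z * G z) : ZeroOrderAtLeast F ρ m := by
  obtain ⟨g, hg, he⟩ := h
  refine ⟨fun z => g z * G z, hg.mul hG, ?_⟩
  filter_upwards [hF, he] with z h1 h2
  rw [h1, h2, mul_assoc]

lemma analyticAt_poleFactor (b : Prop) {s : ℂ} (hs : -1 < s.re) :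
    AnalyticAt ℂ (poleFactor b) s := by
  have ho : IsOpen {z : ℂ | -1 < z.re} := isOpen_lt continuous_const continuous_re
  exact DifferentiableOn.analyticAt
    (fun z hz => (differentiableAt_poleFactor b hz).differentiableWithinAt) (ho.mem_nhds hs)

lemma logDeriv_poleFactor_re_le {q : Ideal (𝓞 K)} (χ : HeckeChar K q) {s : ℂ} (hs : 1 < s.re) :
    (logDeriv (poleFactor (IsTrivialChar χ)) s).re ≤ delta χ * (1 / (s - 1)).re := by
  classical
  unfold delta
  by_cases h : IsTrivialChar χ
  · have h1 : poleFactor (IsTrivialChar χ) = fun z => (z - 1) / (z + 1) := by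
      funext z
      simp [poleFactor, h]
    have hm : s - 1 ≠ 0 := fun h0 => by
      have := congrArg re h0
      rw [sub_re, one_re, zero_re] at this
      linarith
    have hp : s + 1 ≠ 0 := add_one_ne_zero (by linarith)
    have h2 : 0 ≤ (1 / (s + 1)).re := by
      rw [one_div, inv_re]
      refine div_nonneg ?_ (normSq_nonneg _)
      rw [add_re, one_re]
      linarith
    have h3 : deriv (fun z : ℂ => z + 1) s = 1 := ((hasDerivAt_id s).add_const 1).deriv
    have h4 : deriv (fun z : ℂ => z - 1) s = 1 := ((hasDerivAt_id s).sub_const 1).deriv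
    rw [h1, logDeriv_div s hm hp (by fun_prop) (by fun_prop), if_pos h, sub_re]
    simp only [logDeriv_apply, h3, h4, one_mul]
    linarith
  · have h1 : poleFactor (IsTrivialChar χ) = fun _ => 1 := by
      funext z
      simp [poleFactor, h]
    rw [h1, if_neg h]
    simp [logDeriv_apply]

lemma neg_logDeriv_re_le {q : Ideal (𝓞 K)} {χ : HeckeChar K q} {L F : ℂ → ℂ} (hL : IsLFun χ L)
    (hFL : ∀ s, s ≠ 1 → F s = L s * poleFactor (IsTrivialChar χ) s) {s : ℂ} (hs : 1 < s.re)
    (hF0 : F s ≠ 0) :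
    -(logDeriv L s).re ≤ -(logDeriv F s).re + delta χ * (1 / (s - 1)).re := by
  have hs1 : s ≠ 1 := by
    rintro rfl
    simp at hs
  have he : F =ᶠ[𝓝 s] fun z => L z * poleFactor (IsTrivialChar χ) z := by
    filter_upwards [isOpen_ne.mem_nhds hs1] with z hz using hFL z hz
  have h0 := hF0
  rw [hFL s hs1] at h0
  have h1 : logDeriv F s = logDeriv L s + logDeriv (poleFactor (IsTrivialChar χ)) s := by
    rw [← logDeriv_mul s (left_ne_zero_of_mul h0) (right_ne_zero_of_mul h0) (hL.1 s hs1)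
      (differentiableAt_poleFactor _ (by linarith)), logDeriv_apply, logDeriv_apply, he.deriv_eq,
      he.self_of_nhds]
  rw [h1, add_re]
  linarith [logDeriv_poleFactor_re_le χ hs]

/-- Zeros close to `1 + it` contribute at least `1 / (2 ε)` at the point `1 + ε + it`. -/
lemma inv_re_ge {ε : ℝ} {w : ℂ} (hε : 0 < ε) (hw : ‖w - ε‖ < ε) :
    1 / (2 * ε) ≤ (1 / w).re ∧ 0 < w.re ∧ w.re < 2 * ε := by
  have h1 := (abs_re_le_norm (w - ε)).trans_lt hw
  rw [sub_re, ofReal_re] at h1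
  have h2 := abs_lt.mp h1
  have hre : 0 < w.re := by linarith
  refine ⟨?_, hre, by linarith⟩
  have h3 : normSq (w - ε) < ε ^ 2 := by
    rw [normSq_eq_norm_sq]
    gcongr
  rw [normSq_apply, sub_re, sub_im, ofReal_re, ofReal_im] at h3
  have h4 : 0 < normSq w := normSq_pos.mpr fun h => by simp [h] at hre
  rw [one_div w, inv_re, div_le_div_iff₀ (by positivity) h4, normSq_apply]
  nlinarith

/-- Bound for the number of zeros close to `1 + it`, as needed for the error terms. -/
lemma near_zeros_correction {ε A X R₁ R₂ N : ℝ} (hε : 0 < ε) (hε4 : ε < 1 / 4)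
    (hX : 0 ≤ X) (hR₁ : 9 / 10 < R₁) (hR₂ : 9 / 10 < R₂) (hA : A ≤ 1 / 2) (hN : 0 ≤ N)
    (h : N * (1 / (2 * ε) - 2 * ε / R₁ ^ 2) ≤ A * X) : N * (2 * ε / R₂ ^ 2) ≤ 4 * ε ^ 2 * X := by
  have hsq : ∀ {R : ℝ}, 9 / 10 < R → 2 * ε / R ^ 2 ≤ 5 / 2 * ε := by
    intro R hR
    have hR0 : 0 < R := by linarith
    have hR2 : 4 / 5 ≤ R ^ 2 := by nlinarith
    rw [div_le_iff₀ (by positivity)]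
    nlinarith
  have h1 : 2 * ε / R₁ ^ 2 ≤ 5 / 2 * ε := hsq hR₁
  have h2 : 2 * ε / R₂ ^ 2 ≤ 5 / 2 * ε := hsq hR₂
  have h3 : N * (1 / (2 * ε) - 5 / 2 * ε) ≤ 1 / 2 * X :=
    (mul_le_mul_of_nonneg_left (by linarith) hN).trans (h.trans (by gcongr))
  have h4 : N * (1 - 5 * ε ^ 2) ≤ ε * X := by
    have := mul_le_mul_of_nonneg_left h3 (by positivity : 0 ≤ 2 * ε)
    have h5 : 2 * ε * (N * (1 / (2 * ε) - 5 / 2 * ε)) = N * (1 - 5 * ε ^ 2) := by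
      field_simp
    nlinarith
  have h6 : N * (11 / 16) ≤ ε * X := (mul_le_mul_of_nonneg_left (by nlinarith) hN).trans h4
  calc N * (2 * ε / R₂ ^ 2) ≤ N * (5 / 2 * ε) := by gcongr
    _ ≤ 4 * ε ^ 2 * X := by nlinarith

end FinalAssembly

/-- **Explicit inequality for `L'/L` via convexity** (Proposition 2.6). Let `0 < ε < 1/4`,
`T ≥ 1`, `χ` primitive. For `0 < r < ε`, uniformly in `1 < σ ≤ 1+ε`, `|t| ≤ T`:
(i) `-Re{L'/L(s,χ)} ≤ (1/4 + ε/π) ℒ_χ + 4ε² ℒ_χ' + δ(χ) Re{1/(s-1)}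
      - Σ_{ρ ∈ 𝒵_{r,t}} Re{1/(s-ρ)} + O_ε(n_K)`, and
(ii) `-Re{L'/L(s,χ)} ≤ (1/4 + ε/π) ℒ_χ + δ(χ) Re{1/(s-1)} + O_ε(n_K)`,
where `ℒ_χ = log D_χ + n_K log(T+3)`, `ℒ_χ' = log D_K + ℒ_χ`, and the multiset `𝒵_{r,t}`
of zeros with `|1+it-ρ| < r` is encoded by admissible multiplicity functions. -/
theorem explicit_inequality_convexity :
    ∀ ε : ℝ, 0 < ε → ε < 1 / 4 →
    ∃ C : ℝ, 0 < C ∧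
      ∀ (K : Type) [Field K] [NumberField K] (𝔮 : Ideal (𝓞 K))
        (χ : HeckeChar K 𝔮) (L : ℂ → ℂ) (T r : ℝ) (s : ℂ),
        IsLFun χ L → IsPrimitiveChar χ → 1 ≤ T → 0 < r → r < ε →
        1 < s.re → s.re ≤ 1 + ε → |s.im| ≤ T →
        let Lchi : ℝ := Real.log ((DK K : ℝ) * (Ideal.absNorm 𝔮 : ℝ)) +
          (nK K : ℝ) * Real.log (T + 3);
        let Lchi' : ℝ := Real.log (DK K : ℝ) + Lchi;
        (∀ (S : Finset ℂ) (m : ℂ → ℕ),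
          (∀ ρ ∈ S, L ρ = 0 ∧ 0 < ρ.re ∧ ρ.re < 1 ∧
            ‖1 + Complex.I * (s.im : ℂ) - ρ‖ < r ∧ ZeroOrderAtLeast L ρ (m ρ)) →
          -(logDeriv L s).re ≤ (1 / 4 + ε / Real.pi) * Lchi + 4 * ε ^ 2 * Lchi' +
            delta χ * (1 / (s - 1)).re - (∑ ρ ∈ S, (m ρ : ℝ) * (1 / (s - ρ)).re) +
            C * (nK K : ℝ)) ∧
        -(logDeriv L s).re ≤ (1 / 4 + ε / Real.pi) * Lchi +
          delta χ * (1 / (s - 1)).re + C * (nK K : ℝ) := by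
  intro ε hε hε4
  obtain ⟨C, hC, hmain⟩ := exists_regular_logDeriv_bound hε hε4
  refine ⟨3 * C, by positivity, ?_⟩
  intro K _ _ q χ L T r s hL hχ hT hr hrε hs hsε hsT
  have hq := hχ.ne_bot
  obtain ⟨F, hFL, hF0, hFd, hFb⟩ := hmain K q χ L hL hq
  have hn : (0 : ℝ) ≤ nK K := Nat.cast_nonneg _
  have hl : 0 ≤ logCond K q T := logCond_nonneg hq hT
  have hLF := neg_logDeriv_re_le hL hFL hs (hF0 s hs)
  obtain ⟨R₂, hR₂, -, hb₂⟩ := hFb T hT s hs hsT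
  intro Lchi Lchi'
  change (∀ (S : Finset ℂ) (m : ℂ → ℕ), _ → -(logDeriv L s).re ≤ (1 / 4 + ε / Real.pi) *
    logCond K q T + 4 * ε ^ 2 * (Real.log (DK K : ℝ) + logCond K q T) + _ - _ + _) ∧
    -(logDeriv L s).re ≤ (1 / 4 + ε / Real.pi) * logCond K q T + _ + _
  have hpi := Real.pi_gt_three
  have hA : ε / Real.pi ≤ 1 / 4 := by
    rw [div_le_iff₀ (by linarith)]
    linarith
  have hA0 : 0 ≤ ε / Real.pi := by positivity
  set l := logCond K q T
  set n : ℝ := (nK K : ℝ)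
  have hCn : 0 ≤ C * n := by positivity
  refine ⟨fun S m hS => ?_, ?_⟩
  · let s₀ : ℂ := ((1 + ε : ℝ) : ℂ) + s.im * I
    have hs₀re : s₀.re = 1 + ε := by simp [s₀]
    have hs₀im : s₀.im = s.im := by simp [s₀]
    obtain ⟨R₁, hR₁, -, hb₁⟩ := hFb T hT s₀ (by linarith) (by rwa [hs₀im])
    have hdist : ∀ ρ ∈ S, ‖1 + I * (s.im : ℂ) - ρ‖ < ε := fun ρ hρ => (hS ρ hρ).2.2.2.1.trans hrε
    have hzero : ∀ c : ℂ, 1 < c.re → c.re ≤ 1 + ε → c.im = s.im → ∀ R, 9 / 10 < R → ∀ ρ ∈ S,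
        ρ ∈ Metric.ball c R ∧ F ρ = 0 ∧ ZeroOrderAtLeast F ρ (m ρ) := by
      intro c hc hcε hcim R hR ρ hρ
      obtain ⟨h1, h2, h3, -, h5⟩ := hS ρ hρ
      have hρ1 : ρ ≠ 1 := by
        rintro rfl
        simp at h3
      refine ⟨?_, by rw [hFL ρ hρ1, h1, zero_mul], ?_⟩
      · have h6 : c - (1 + I * (s.im : ℂ)) = ((c.re - 1 : ℝ) : ℂ) := by
          apply Complex.ext <;> simp [hcim]
        have h7 : ‖c - (1 + I * (s.im : ℂ))‖ ≤ ε := by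
          rw [h6, norm_real, Real.norm_of_nonneg (by linarith)]
          linarith
        rw [mem_ball_iff_norm']
        calc ‖c - ρ‖ = ‖(c - (1 + I * (s.im : ℂ))) + (1 + I * (s.im : ℂ) - ρ)‖ := by
              rw [sub_add_sub_cancel]
          _ < R := (norm_add_le _ _).trans_lt (by linarith [hdist ρ hρ])
      · refine h5.mul_analytic (analyticAt_poleFactor (IsTrivialChar χ) (by linarith)) ?_
        filter_upwards [isOpen_ne.mem_nhds hρ1] with z hz using hFL z hz
    have h₁ := hb₁ S m (hzero s₀ (by linarith) hs₀re.le hs₀im R₁ hR₁)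
    have h₂ := hb₂ S m (hzero s hs hsε rfl R₂ hR₂)
    set N : ℝ := ∑ ρ ∈ S, (m ρ : ℝ) with hN
    have hN0 : 0 ≤ N := Finset.sum_nonneg fun ρ _ => Nat.cast_nonneg _
    have hcount : N * (1 / (2 * ε) - 2 * ε / R₁ ^ 2) ≤
        ∑ ρ ∈ S, (m ρ : ℝ) * ((1 / (s₀ - ρ)).re - (s₀ - ρ).re / R₁ ^ 2) := by
      rw [hN, Finset.sum_mul]
      refine Finset.sum_le_sum fun ρ hρ => mul_le_mul_of_nonneg_left ?_ (Nat.cast_nonneg _)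
      have hw : ‖s₀ - ρ - ε‖ < ε := by
        have : s₀ - ρ - ε = 1 + I * (s.im : ℂ) - ρ := by
          simp only [s₀]
          push_cast
          ring
        rw [this]
        exact hdist ρ hρ
      obtain ⟨h3, -, h5⟩ := inv_re_ge hε hw
      have h6 : (s₀ - ρ).re / R₁ ^ 2 ≤ 2 * ε / R₁ ^ 2 := by gcongr
      linarith
    have hcorr : N * (2 * ε / R₂ ^ 2) ≤ 4 * ε ^ 2 * (l + 8 * (C * n)) := by
      refine near_zeros_correction (A := 1 / 4 + ε / Real.pi) hε hε4 (by positivity) hR₁ hR₂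
        (by linarith) hN0 (hcount.trans ?_)
      have h3 := hFd s₀ hs₀re
      have h4 : 0 ≤ ε / Real.pi * (8 * (C * n)) := by positivity
      linarith
    have hsum : (∑ ρ ∈ S, (m ρ : ℝ) * (1 / (s - ρ)).re) - N * (2 * ε / R₂ ^ 2) ≤
        ∑ ρ ∈ S, (m ρ : ℝ) * ((1 / (s - ρ)).re - (s - ρ).re / R₂ ^ 2) := by
      rw [hN, Finset.sum_mul, ← Finset.sum_sub_distrib]
      refine Finset.sum_le_sum fun ρ hρ => ?_
      rw [← mul_sub]
      refine mul_le_mul_of_nonneg_left ?_ (Nat.cast_nonneg _)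
      have h3 := (abs_re_le_norm _).trans_lt (hdist ρ hρ)
      have h4 : (s - ρ).re ≤ 2 * ε := by
        simp only [sub_re, add_re, one_re, mul_re, I_re, I_im, ofReal_re, ofReal_im, zero_mul,
          mul_zero, sub_zero, add_zero] at h3 ⊢
        linarith [(abs_lt.mp h3).2]
      gcongr
    have h5 : 0 ≤ 4 * ε ^ 2 * Real.log (DK K : ℝ) :=
      mul_nonneg (by positivity) (log_DK_nonneg K)
    have h6 : 4 * ε ^ 2 * (8 * (C * n)) ≤ 2 * (C * n) := by
      have : ε ^ 2 ≤ 1 / 16 := by nlinarith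
      nlinarith
    linarith
  · have h₂ := hb₂ ∅ (fun _ => 0) (by simp)
    rw [Finset.sum_empty] at h₂
    linarith

end RTZ
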